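/- Let Σ(x₁,x₂) = Σ₊·1{x₁>x₂} + Σ₋·1{x₁≤x₂} be any real square root of the covariance matrix 𝒜(x₁,x₂) = diag(ρ²·1{x₁>x₂} + σ²·1{x₁≤x₂}, ρ²·1{x₁≤x₂} + σ²·1{x₁>x₂}), so Σ₊Σ₊ᵀ = diag(ρ²,σ²) and Σ₋Σ₋ᵀ = diag(σ²,ρ²). Then the (unique-in-distribution) weak solution of the system dX(t) = Σ(X(t)) dU(t) + G(X(t)) dt, driven by a two-dimensional Brownian motion U(·), fails to be strong if and only if (e₁ − e₂)ᵀ Σ₋ = −(e₁ − e₂)ᵀ Σ₊, where e₁ = (1,0)ᵀ, e₂ = (0,1)ᵀ. -/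

import Mathlib

open MeasureTheory ProbabilityTheory Filter Set

noncomputable section

namespace SDEPaper

/-- The signum convention of the paper: `psgn y = 1` for `y > 0`, `= -1` for `y ≤ 0`. -/
def psgn (y : ℝ) : ℝ := if 0 < y then 1 else -1

variable {Ω : Type*} [m : MeasurableSpace Ω]

/-- The σ-algebra generated by the process `Ξ` on the time interval `[0, t]`. -/
def natSA {E : Type*} [MeasurableSpace E] (Ξ : ℝ → Ω → E) (t : ℝ) : MeasurableSpace Ω :=
  ⨆ s ∈ Icc (0 : ℝ) t, MeasurableSpace.comap (Ξ s) inferInstance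

/-- The `μ`-augmentation of a σ-algebra. -/
def augSA (μ : Measure Ω) (m' : MeasurableSpace Ω) : MeasurableSpace Ω :=
  m' ⊔ MeasurableSpace.generateFrom {A : Set Ω | μ A = 0}

/-- `𝔉^Ξ(t)`: the `μ`-augmented σ-algebra generated by the process `Ξ` up to time `t`. -/
def natFilt {E : Type*} [MeasurableSpace E] (μ : Measure Ω) (Ξ : ℝ → Ω → E) (t : ℝ) :
    MeasurableSpace Ω := augSA μ (natSA Ξ t)

/-- Dyadic left-point Riemann sum of `H` against `X` on `[0,t]`. -/
def rsum (H X : ℝ → Ω → ℝ) (t : ℝ) (n : ℕ) (ω : Ω) : ℝ :=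
  ∑ i ∈ Finset.range (2 ^ n),
    H (t * i / 2 ^ n) ω * (X (t * (i + 1) / 2 ^ n) ω - X (t * i / 2 ^ n) ω)

/-- `I = ∫₀^· H dX`: dyadic Riemann sums converge in probability, and `I 0 = 0` a.s. -/
def IsSI (μ : Measure Ω) (H X I : ℝ → Ω → ℝ) : Prop :=
  (∀ᵐ ω ∂μ, I 0 ω = 0) ∧
  ∀ t : ℝ, 0 ≤ t → TendstoInMeasure μ (fun n => rsum H X t n) atTop (I t)

/-- `I = ∫₀^· H₁ dX₁ + ∫₀^· H₂ dX₂` in the sense of convergence in probability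
of dyadic Riemann sums. -/
def IsSI2 (μ : Measure Ω) (H₁ X₁ H₂ X₂ I : ℝ → Ω → ℝ) : Prop :=
  (∀ᵐ ω ∂μ, I 0 ω = 0) ∧
  ∀ t : ℝ, 0 ≤ t →
    TendstoInMeasure μ (fun n ω => rsum H₁ X₁ t n ω + rsum H₂ X₂ t n ω) atTop (I t)

/-- Dyadic sums of products of increments. -/
def qsum (X Y : ℝ → Ω → ℝ) (t : ℝ) (n : ℕ) (ω : Ω) : ℝ :=
  ∑ i ∈ Finset.range (2 ^ n),
    (X (t * (i + 1) / 2 ^ n) ω - X (t * i / 2 ^ n) ω) *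
      (Y (t * (i + 1) / 2 ^ n) ω - Y (t * i / 2 ^ n) ω)

/-- `C = ⟨X,Y⟩`: the quadratic covariation, as a limit in probability of dyadic sums. -/
def IsQV (μ : Measure Ω) (X Y C : ℝ → Ω → ℝ) : Prop :=
  ∀ t : ℝ, 0 ≤ t → TendstoInMeasure μ (fun n => qsum X Y t n) atTop (C t)

/-- `W` is a standard one-dimensional Brownian motion with respect to the family of
σ-algebras `F` (a filtration contained in the ambient σ-algebra). -/
structure IsBM (μ : Measure Ω) (F : ℝ → MeasurableSpace Ω) (W : ℝ → Ω → ℝ) : Prop where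
  le : ∀ t : ℝ, F t ≤ m
  mono : Monotone F
  adapted : ∀ t : ℝ, 0 ≤ t → MeasurableSpace.comap (W t) inferInstance ≤ F t
  init : ∀ᵐ ω ∂μ, W 0 ω = 0
  cont : ∀ᵐ ω ∂μ, Continuous fun t => W t ω
  law : ∀ s t : ℝ, 0 ≤ s → s ≤ t →
    μ.map (fun ω => W t ω - W s ω) = gaussianReal 0 ((t - s).toNNReal)
  indep : ∀ s t : ℝ, 0 ≤ s → s ≤ t →
    Indep (MeasurableSpace.comap (fun ω => W t ω - W s ω) inferInstance) (F s) μ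

/-- `(B₁, B₂)` is a planar Brownian motion: two independent standard Brownian motions
with respect to the common filtration `F`. -/
def IsPlanarBM (μ : Measure Ω) (F : ℝ → MeasurableSpace Ω) (B₁ B₂ : ℝ → Ω → ℝ) : Prop :=
  IsBM μ F B₁ ∧ IsBM μ F B₂ ∧
    IndepFun (fun ω => (fun t => B₁ t ω)) (fun ω => (fun t => B₂ t ω)) μ

/-- `L` is the (right) local time at the origin of the process `Y`:
`L t = lim_{ε ↓ 0} (4ε)⁻¹ ∫₀ᵗ 1{|Y(s)| < ε} ds`. -/
def IsLocalTime (μ : Measure Ω) (Y L : ℝ → Ω → ℝ) : Prop :=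
  ∀ᵐ ω ∂μ, ∀ t : ℝ, 0 ≤ t →
    Tendsto (fun ε : ℝ =>
        (4 * ε)⁻¹ * ∫ s in (0:ℝ)..t, (if |Y s ω| < ε then (1:ℝ) else 0))
      (nhdsWithin 0 (Ioi 0)) (nhds (L t ω))

/-- A continuous local martingale with respect to the filtration `F`. -/
def IsContLocMart (μ : Measure Ω) (F : Filtration ℝ m) (M : ℝ → Ω → ℝ) : Prop :=
  (∀ᵐ ω ∂μ, Continuous fun t => M t ω) ∧ StronglyAdapted F M ∧
    ∃ τ : ℕ → Ω → ℝ, (∀ n, IsStoppingTime F (fun ω => (τ n ω : WithTop ℝ))) ∧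
      (∀ᵐ ω ∂μ, Tendsto (fun n => τ n ω) atTop atTop) ∧
      ∀ n, Martingale (fun t ω => M (min t (τ n ω)) ω) F μ

/-- Orthogonality: the cross-variation `⟨M,N⟩` vanishes identically. -/
def Orthogonal (μ : Measure Ω) (M N : ℝ → Ω → ℝ) : Prop :=
  IsQV μ M N fun _ _ => 0

/-- Domination: `⟨M⟩(t) = ∫₀ᵗ q(s) d⟨N⟩(s)` for a progressively measurable
process `q` with values in `[0,c]`. -/
def Dominated (μ : Measure Ω) (F : Filtration ℝ m) (M N : ℝ → Ω → ℝ) (c : ℝ) : Prop :=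
  ∃ QM QN q : ℝ → Ω → ℝ, IsQV μ M M QM ∧ IsQV μ N N QN ∧
    ProgMeasurable F q ∧ (∀ t ω, q t ω ∈ Icc (0:ℝ) c) ∧
    ∀ᵐ ω ∂μ, ∃ ν : Measure ℝ,
      (∀ a b : ℝ, 0 ≤ a → a ≤ b → ν (Ioc a b) = ENNReal.ofReal (QN b ω - QN a ω)) ∧
      ∀ t : ℝ, 0 ≤ t → QM t ω = ∫ s in Ioc (0:ℝ) t, q s ω ∂ν

/-- The law of the two-dimensional process `(X₁, X₂)` on path space. -/
def pathLaw (μ : Measure Ω) (X₁ X₂ : ℝ → Ω → ℝ) : Measure (ℝ → ℝ × ℝ) :=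
  μ.map fun ω => (fun t => (X₁ t ω, X₂ t ω))
/-- `(X₁, X₂)` solves the system (1.1)-(1.2) driven by `(B₁, B₂)`. -/
def Solves11 (μ : Measure Ω) (F : ℝ → MeasurableSpace Ω) (g h ρ σ x₁ x₂ : ℝ)
    (B₁ B₂ X₁ X₂ : ℝ → Ω → ℝ) : Prop :=
  (∀ t : ℝ, 0 ≤ t →
    MeasurableSpace.comap (fun ω => (X₁ t ω, X₂ t ω)) inferInstance ≤ F t) ∧
  (∀ᵐ ω ∂μ, Continuous (fun t => X₁ t ω) ∧ Continuous (fun t => X₂ t ω)) ∧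
  ∃ I₁ I₂ : ℝ → Ω → ℝ,
    IsSI μ (fun s ω => if X₁ s ω ≤ X₂ s ω then σ else ρ) B₁ I₁ ∧
    IsSI μ (fun s ω => if X₁ s ω ≤ X₂ s ω then ρ else σ) B₂ I₂ ∧
    ∀ᵐ ω ∂μ, ∀ t : ℝ, 0 ≤ t →
      X₁ t ω = x₁ + (∫ s in (0:ℝ)..t, (if X₁ s ω ≤ X₂ s ω then g else -h)) + I₁ t ω ∧
      X₂ t ω = x₂ + (∫ s in (0:ℝ)..t, (if X₁ s ω ≤ X₂ s ω then -h else g)) + I₂ t ω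

/-- `(X₁, X₂)` solves the system (4.7)-(4.8), driven by the single Brownian motion `W`. -/
def Solves47 (μ : Measure Ω) (F : ℝ → MeasurableSpace Ω) (g h x₁ x₂ : ℝ)
    (W X₁ X₂ : ℝ → Ω → ℝ) : Prop :=
  (∀ t : ℝ, 0 ≤ t →
    MeasurableSpace.comap (fun ω => (X₁ t ω, X₂ t ω)) inferInstance ≤ F t) ∧
  (∀ᵐ ω ∂μ, Continuous (fun t => X₁ t ω) ∧ Continuous (fun t => X₂ t ω)) ∧
  ∃ I₁ I₂ : ℝ → Ω → ℝ,
    IsSI μ (fun s ω => if X₁ s ω ≤ X₂ s ω then (0:ℝ) else 1) W I₁ ∧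
    IsSI μ (fun s ω => if X₁ s ω ≤ X₂ s ω then (-1:ℝ) else 0) W I₂ ∧
    ∀ᵐ ω ∂μ, ∀ t : ℝ, 0 ≤ t →
      X₁ t ω = x₁ + (∫ s in (0:ℝ)..t, (if X₁ s ω ≤ X₂ s ω then g else -h)) + I₁ t ω ∧
      X₂ t ω = x₂ + (∫ s in (0:ℝ)..t, (if X₁ s ω ≤ X₂ s ω then -h else g)) + I₂ t ω

/-- `(X₁, X₂)` solves the system (4.9)-(4.10), driven by the single Brownian motion `V`. -/
def Solves49 (μ : Measure Ω) (F : ℝ → MeasurableSpace Ω) (g h x₁ x₂ : ℝ)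
    (V X₁ X₂ : ℝ → Ω → ℝ) : Prop :=
  (∀ t : ℝ, 0 ≤ t →
    MeasurableSpace.comap (fun ω => (X₁ t ω, X₂ t ω)) inferInstance ≤ F t) ∧
  (∀ᵐ ω ∂μ, Continuous (fun t => X₁ t ω) ∧ Continuous (fun t => X₂ t ω)) ∧
  ∃ I₁ I₂ : ℝ → Ω → ℝ,
    IsSI μ (fun s ω => if X₁ s ω ≤ X₂ s ω then (0:ℝ) else 1) V I₁ ∧
    IsSI μ (fun s ω => if X₁ s ω ≤ X₂ s ω then (1:ℝ) else 0) V I₂ ∧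
    ∀ᵐ ω ∂μ, ∀ t : ℝ, 0 ≤ t →
      X₁ t ω = x₁ + (∫ s in (0:ℝ)..t, (if X₁ s ω ≤ X₂ s ω then g else -h)) + I₁ t ω ∧
      X₂ t ω = x₂ + (∫ s in (0:ℝ)..t, (if X₁ s ω ≤ X₂ s ω then -h else g)) + I₂ t ω

/-- `(X₁, X₂)` solves the system (2.12)-(2.13), driven by the planar BM `(W₁, W₂)`. -/
def Solves212 (μ : Measure Ω) (F : ℝ → MeasurableSpace Ω) (g h ρ σ x₁ x₂ : ℝ)
    (W₁ W₂ X₁ X₂ : ℝ → Ω → ℝ) : Prop :=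
  (∀ t : ℝ, 0 ≤ t →
    MeasurableSpace.comap (fun ω => (X₁ t ω, X₂ t ω)) inferInstance ≤ F t) ∧
  (∀ᵐ ω ∂μ, Continuous (fun t => X₁ t ω) ∧ Continuous (fun t => X₂ t ω)) ∧
  ∃ I₁ I₂ : ℝ → Ω → ℝ,
    IsSI2 μ (fun s ω => if X₁ s ω ≤ X₂ s ω then 0 else ρ) W₁
            (fun s ω => if X₁ s ω ≤ X₂ s ω then σ else 0) W₂ I₁ ∧
    IsSI2 μ (fun s ω => if X₁ s ω ≤ X₂ s ω then -ρ else 0) W₁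
            (fun s ω => if X₁ s ω ≤ X₂ s ω then 0 else -σ) W₂ I₂ ∧
    ∀ᵐ ω ∂μ, ∀ t : ℝ, 0 ≤ t →
      X₁ t ω = x₁ + (∫ s in (0:ℝ)..t, (if X₁ s ω ≤ X₂ s ω then g else -h)) + I₁ t ω ∧
      X₂ t ω = x₂ + (∫ s in (0:ℝ)..t, (if X₁ s ω ≤ X₂ s ω then -h else g)) + I₂ t ω

/-- `(X₁, X₂)` solves the system (2.14)-(2.15), driven by the planar BM `(V₁, V₂)`. -/
def Solves214 (μ : Measure Ω) (F : ℝ → MeasurableSpace Ω) (g h ρ σ x₁ x₂ : ℝ)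
    (V₁ V₂ X₁ X₂ : ℝ → Ω → ℝ) : Prop :=
  (∀ t : ℝ, 0 ≤ t →
    MeasurableSpace.comap (fun ω => (X₁ t ω, X₂ t ω)) inferInstance ≤ F t) ∧
  (∀ᵐ ω ∂μ, Continuous (fun t => X₁ t ω) ∧ Continuous (fun t => X₂ t ω)) ∧
  ∃ I₁ I₂ : ℝ → Ω → ℝ,
    IsSI2 μ (fun s ω => if X₁ s ω ≤ X₂ s ω then 0 else ρ) V₁
            (fun s ω => if X₁ s ω ≤ X₂ s ω then σ else 0) V₂ I₁ ∧
    IsSI2 μ (fun s ω => if X₁ s ω ≤ X₂ s ω then ρ else 0) V₁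
            (fun s ω => if X₁ s ω ≤ X₂ s ω then 0 else σ) V₂ I₂ ∧
    ∀ᵐ ω ∂μ, ∀ t : ℝ, 0 ≤ t →
      X₁ t ω = x₁ + (∫ s in (0:ℝ)..t, (if X₁ s ω ≤ X₂ s ω then g else -h)) + I₁ t ω ∧
      X₂ t ω = x₂ + (∫ s in (0:ℝ)..t, (if X₁ s ω ≤ X₂ s ω then -h else g)) + I₂ t ω

/-- `(X₁, X₂)` solves the system `dX = Σ(X) dU + G(X) dt` of (eq:xSigma), where
`Σ(x) = Σ₊ 1{x₁ > x₂} + Σ₋ 1{x₁ ≤ x₂}`. -/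
def SolvesGen (μ : Measure Ω) (F : ℝ → MeasurableSpace Ω) (g h : ℝ)
    (Sp Sm : Matrix (Fin 2) (Fin 2) ℝ) (x₁ x₂ : ℝ)
    (U₁ U₂ X₁ X₂ : ℝ → Ω → ℝ) : Prop :=
  (∀ t : ℝ, 0 ≤ t →
    MeasurableSpace.comap (fun ω => (X₁ t ω, X₂ t ω)) inferInstance ≤ F t) ∧
  (∀ᵐ ω ∂μ, Continuous (fun t => X₁ t ω) ∧ Continuous (fun t => X₂ t ω)) ∧
  ∃ I₁ I₂ : ℝ → Ω → ℝ,
    IsSI2 μ (fun s ω => if X₁ s ω ≤ X₂ s ω then Sm 0 0 else Sp 0 0) U₁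
            (fun s ω => if X₁ s ω ≤ X₂ s ω then Sm 0 1 else Sp 0 1) U₂ I₁ ∧
    IsSI2 μ (fun s ω => if X₁ s ω ≤ X₂ s ω then Sm 1 0 else Sp 1 0) U₁
            (fun s ω => if X₁ s ω ≤ X₂ s ω then Sm 1 1 else Sp 1 1) U₂ I₂ ∧
    ∀ᵐ ω ∂μ, ∀ t : ℝ, 0 ≤ t →
      X₁ t ω = x₁ + (∫ s in (0:ℝ)..t, (if X₁ s ω ≤ X₂ s ω then g else -h)) + I₁ t ω ∧
      X₂ t ω = x₂ + (∫ s in (0:ℝ)..t, (if X₁ s ω ≤ X₂ s ω then -h else g)) + I₂ t ω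

open scoped Topology

section
/-! ### Conditional laws -/

/-- `Z` is independent of `𝒢` with law `ν`. -/
structure CL {Ω : Type*} (𝒢 : MeasurableSpace Ω) [m : MeasurableSpace Ω] (μ : Measure Ω)
    {E : Type*} [MeasurableSpace E] (Z : Ω → E) (ν : Measure E) : Prop where
  meas : Measurable Z
  rect : ∀ A, MeasurableSet[𝒢] A → ∀ B, MeasurableSet B → μ (A ∩ Z ⁻¹' B) = μ A * ν B

section CL
variable {Ω : Type*} {𝒢 𝒢' : MeasurableSpace Ω} [m : MeasurableSpace Ω]
variable {μ : Measure Ω} [IsProbabilityMeasure μ]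
  {E : Type*} [MeasurableSpace E] {Z : Ω → E} {ν : Measure E}
  {E' : Type*} [MeasurableSpace E'] {E'' : Type*} [MeasurableSpace E'']

lemma CL.mono (h : CL 𝒢 μ Z ν) (hle : 𝒢' ≤ 𝒢) : CL 𝒢' μ Z ν :=
  ⟨h.meas, fun A hA B hB => h.rect A (hle A hA) B hB⟩

lemma CL.map_prod [SigmaFinite ν] (h : CL 𝒢 μ Z ν) (h𝒢 : 𝒢 ≤ m) {T : Ω → E'} (hT : Measurable[𝒢] T) :
    μ.map (fun ω => (T ω, Z ω)) = (μ.map T).prod ν := by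
  have hT' : Measurable T := hT.mono h𝒢 le_rfl
  have : IsProbabilityMeasure (μ.map T) := Measure.isProbabilityMeasure_map hT'.aemeasurable
  symm
  apply Measure.prod_eq
  intro s t hs ht
  rw [Measure.map_apply (hT'.prodMk h.meas) (hs.prod ht), Measure.map_apply hT' hs,
    ← h.rect _ (hT hs) t ht]
  rfl

lemma CL.law (h : CL 𝒢 μ Z ν) : μ.map Z = ν := by
  ext B hB
  rw [Measure.map_apply h.meas hB]
  have := h.rect univ MeasurableSet.univ B hB
  simpa using this

lemma CL.prob (h : CL 𝒢 μ Z ν) : IsProbabilityMeasure ν := by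
  rw [← h.law]; exact Measure.isProbabilityMeasure_map h.meas.aemeasurable

lemma CL.comp (h : CL 𝒢 μ Z ν) (h𝒢 : 𝒢 ≤ m) {T : Ω → E'} (hT : Measurable[𝒢] T)
    {f : E' × E → E''} (hf : Measurable f) {ν' : Measure E''}
    (hν : ∀ᵐ x ∂(μ.map T), ν.map (fun z => f (x, z)) = ν') :
    CL 𝒢 μ (fun ω => f (T ω, Z ω)) ν' := by
  have := h.prob
  have hT' : Measurable T := hT.mono h𝒢 le_rfl
  refine ⟨hf.comp (hT'.prodMk h.meas), fun A hA B hB => ?_⟩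
  classical
  let S : Ω → Bool × E' := fun ω => (decide (ω ∈ A), T ω)
  have hdec : Measurable[𝒢] (fun ω => decide (ω ∈ A)) := by
    apply measurable_to_bool
    convert hA using 1
    ext ω; simp
  have hS : Measurable[𝒢] S := hdec.prodMk hT
  have hS' : Measurable S := hS.mono h𝒢 le_rfl
  have hmap := h.map_prod h𝒢 hS
  have hC : MeasurableSet {p : (Bool × E') × E | p.1.1 = true ∧ f (p.1.2, p.2) ∈ B} := by
    apply MeasurableSet.inter
    · exact (measurable_fst.comp measurable_fst) (measurableSet_singleton true)
    · exact (hf.comp ((measurable_snd.comp measurable_fst).prodMk measurable_snd)) hB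
  have h1 : A ∩ (fun ω => f (T ω, Z ω)) ⁻¹' B =
      (fun ω => (S ω, Z ω)) ⁻¹' {p : (Bool × E') × E | p.1.1 = true ∧ f (p.1.2, p.2) ∈ B} := by
    ext ω; simp [S]
  rw [h1, ← Measure.map_apply (hS'.prodMk h.meas) hC, hmap, Measure.prod_apply hC]
  have h2 : ∀ᵐ x ∂(μ.map S), ν (Prod.mk x ⁻¹' {p : (Bool × E') × E | p.1.1 = true ∧ f (p.1.2, p.2) ∈ B})
      = ({b : Bool × E' | b.1 = true}).indicator (fun _ => ν' B) x := by
    have h3 : ∀ᵐ x ∂(μ.map S), ν.map (fun z => f (x.2, z)) = ν' := by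
      have : (μ.map T) = (μ.map S).map Prod.snd := by
        rw [Measure.map_map measurable_snd hS']; rfl
      rw [this] at hν
      exact ae_of_ae_map measurable_snd.aemeasurable hν
    filter_upwards [h3] with x hx
    by_cases hb : x.1 = true
    · rw [indicator_of_mem (by exact hb), ← hx, Measure.map_apply (f := fun z => f (x.2, z)) (hf.comp (measurable_const.prodMk measurable_id)) hB]
      congr 1
      ext z; simp [hb]
    · rw [indicator_of_notMem (by exact hb)]
      simp [hb]
  have hbm : MeasurableSet {b : Bool × E' | b.1 = true} :=
    measurable_fst (measurableSet_singleton true)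
  rw [lintegral_congr_ae h2, lintegral_indicator hbm]
  simp only [lintegral_const, MeasurableSet.univ, Measure.restrict_apply, univ_inter]
  rw [Measure.map_apply hS' hbm, mul_comm]
  congr 2
  ext ω; simp [S]

lemma CL.comp' (h : CL 𝒢 μ Z ν) (h𝒢 : 𝒢 ≤ m) {f : E → E''} (hf : Measurable f) :
    CL 𝒢 μ (fun ω => f (Z ω)) (ν.map f) := by
  refine ⟨hf.comp h.meas, fun A hA B hB => ?_⟩
  rw [Measure.map_apply hf hB, ← h.rect A hA _ (hf hB)]
  rfl

lemma CL.pair {Z' : Ω → E'} {ν' : Measure E'} (h : CL 𝒢 μ Z ν)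
    (h' : CL 𝒢' μ Z' ν') (hle : 𝒢 ≤ 𝒢') (hZ : Measurable[𝒢'] Z) (h𝒢' : 𝒢' ≤ m) :
    CL 𝒢 μ (fun ω => (Z ω, Z' ω)) (ν.prod ν') := by
  have := h.prob
  have := h'.prob
  refine ⟨h.meas.prodMk h'.meas, fun A hA B hB => ?_⟩
  have key : (μ.restrict A).map (fun ω => (Z ω, Z' ω)) = (μ A • ν).prod ν' := by
    have : IsFiniteMeasure (μ A • ν) := Measure.smul_finite _ (measure_ne_top _ _)
    symm
    apply Measure.prod_eq
    intro s t hs ht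
    rw [Measure.map_apply (h.meas.prodMk h'.meas) (hs.prod ht), Measure.restrict_apply
      ((h.meas.prodMk h'.meas) (hs.prod ht)), Measure.smul_apply, smul_eq_mul,
      ← h.rect A hA s hs, ← h'.rect _ ((hle A hA).inter (hZ hs)) t ht]
    congr 1
    ext ω; simp; tauto
  have hm : Measurable (fun ω => (Z ω, Z' ω)) := h.meas.prodMk h'.meas
  have : μ (A ∩ (fun ω => (Z ω, Z' ω)) ⁻¹' B) = (μ.restrict A).map (fun ω => (Z ω, Z' ω)) B := by
    rw [Measure.map_apply hm hB, Measure.restrict_apply (hm hB), inter_comm]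
  rw [this, key, Measure.prod_smul_left, Measure.smul_apply, smul_eq_mul]

lemma CL.integral (h : CL 𝒢 μ Z ν) (h𝒢 : 𝒢 ≤ m) {u : Ω → ℝ} (hu : Measurable[𝒢] u)
    {f : E → ℝ} (hf : Measurable f) :
    ∫ ω, u ω * f (Z ω) ∂μ = (∫ ω, u ω ∂μ) * ∫ z, f z ∂ν := by
  have := h.prob
  have hu' : Measurable u := hu.mono h𝒢 le_rfl
  have h1 := h.map_prod h𝒢 hu
  have h2 : ∫ ω, u ω * f (Z ω) ∂μ = ∫ p, p.1 * f p.2 ∂(μ.map (fun ω => (u ω, Z ω))) := by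
    rw [integral_map (hu'.prodMk h.meas).aemeasurable]
    exact (measurable_fst.mul (hf.comp measurable_snd)).aestronglyMeasurable
  rw [h2, h1, integral_prod_mul (f := fun x => x) (g := f),
    integral_map hu'.aemeasurable (by fun_prop)]

lemma CL.integrable (h : CL 𝒢 μ Z ν) (h𝒢 : 𝒢 ≤ m) {u : Ω → ℝ} (hu : Measurable[𝒢] u)
    (hui : Integrable u μ) {f : E → ℝ} (hf : Measurable f) (hfi : Integrable f ν) :
    Integrable (fun ω => u ω * f (Z ω)) μ := by
  have := h.prob
  have hu' : Measurable u := hu.mono h𝒢 le_rfl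
  have h1 := h.map_prod h𝒢 hu
  have h2 : Integrable (fun p : ℝ × E => p.1 * f p.2) (μ.map (fun ω => (u ω, Z ω))) := by
    rw [h1]
    apply Integrable.mul_prod (f := fun x : ℝ => x)
    · exact (integrable_map_measure (by fun_prop) hu'.aemeasurable).2 hui
    · exact hfi
  exact (integrable_map_measure
    (measurable_fst.mul (hf.comp measurable_snd)).aestronglyMeasurable
    (hu'.prodMk h.meas).aemeasurable).1 h2

lemma CL.integrable' (h : CL 𝒢 μ Z ν) {f : E → ℝ} (hf : Measurable f) (hfi : Integrable f ν) :
    Integrable (fun ω => f (Z ω)) μ := by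
  rw [← h.law] at hfi
  exact (integrable_map_measure hf.aestronglyMeasurable h.meas.aemeasurable).1 hfi

lemma CL.integral' (h : CL 𝒢 μ Z ν) {f : E → ℝ} (hf : Measurable f) :
    ∫ ω, f (Z ω) ∂μ = ∫ z, f z ∂ν := by
  rw [← h.law, integral_map h.meas.aemeasurable hf.aestronglyMeasurable]

/-- Two sequences with the same conditional laws have the same joint law. -/
lemma CL.seq_law {H : ℕ → MeasurableSpace Ω} (hH : Monotone H) (hle : ∀ k, H k ≤ m)
    {Z Z' : ℕ → Ω → E} {ν : Measure E} [Zero E] (N : ℕ)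
    (h : ∀ k < N, CL (H k) μ (Z k) ν) (h' : ∀ k < N, CL (H k) μ (Z' k) ν)
    (hm : ∀ k < N, Measurable[H (k+1)] (Z k)) (hm' : ∀ k < N, Measurable[H (k+1)] (Z' k)) :
    μ.map (fun ω => fun i : ℕ => if i < N then Z i ω else 0) =
    μ.map (fun ω => fun i : ℕ => if i < N then Z' i ω else 0) := by
  induction N with
  | zero => simp
  | succ N ih =>
    have ih := ih (fun k hk => h k (hk.trans N.lt_succ_self)) (fun k hk => h' k (hk.trans N.lt_succ_self))
      (fun k hk => hm k (hk.trans N.lt_succ_self)) (fun k hk => hm' k (hk.trans N.lt_succ_self))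
    have gen : ∀ Z : ℕ → Ω → E, (∀ k < N+1, CL (H k) μ (Z k) ν) → (∀ k < N+1, Measurable[H (k+1)] (Z k)) →
        μ.map (fun ω => fun i : ℕ => if i < N+1 then Z i ω else 0) =
        ((μ.map (fun ω => fun i : ℕ => if i < N then Z i ω else 0)).prod ν).map
          (fun p : (ℕ → E) × E => fun i => if i = N then p.2 else p.1 i) := by
      intro Z h hm
      have := (h N N.lt_succ_self).prob
      have hT : Measurable[H N] (fun ω => fun i : ℕ => if i < N then Z i ω else 0) := by
        refine @measurable_pi_lambda _ _ _ (H N) _ _ (fun i => ?_)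
        by_cases hi : i < N
        · simp only [hi, if_true]
          exact (hm i (hi.trans N.lt_succ_self)).mono (hH hi) le_rfl
        · simp only [hi, if_false]
          exact @measurable_const _ _ _ (H N) _
      have hf : Measurable (fun p : (ℕ → E) × E => fun i => if i = N then p.2 else p.1 i) := by
        refine measurable_pi_lambda _ (fun i => ?_)
        by_cases hi : i = N
        · simp only [hi, if_true]; exact measurable_snd
        · simp only [hi, if_false]; exact (measurable_pi_apply i).comp measurable_fst
      rw [← (h N N.lt_succ_self).map_prod (hle N) hT, Measure.map_map hf
        ((hT.mono (hle N) le_rfl).prodMk (h N N.lt_succ_self).meas)]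
      congr 1
      ext ω i
      simp only [Function.comp]
      by_cases hi : i = N
      · simp [hi]
      · simp only [hi, if_false]
        have : i < N + 1 ↔ i < N := by omega
        simp [this]
    rw [gen Z h hm, gen Z' h' hm', ih]

end CL

section CLlim
variable {Ω : Type*} {𝒢 : MeasurableSpace Ω} [m : MeasurableSpace Ω]
variable {μ : Measure Ω} [IsProbabilityMeasure μ]
  {E : Type*} [MeasurableSpace E] [PseudoEMetricSpace E] [BorelSpace E] [HasOuterApproxClosed E]

lemma CL.of_tendsto {Z : ℕ → Ω → E} {Y : Ω → E} {ν : Measure E} (h𝒢 : 𝒢 ≤ m)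
    (hZ : ∀ n, CL 𝒢 μ (Z n) ν) (hY : Measurable Y) (hlim : TendstoInMeasure μ Z atTop Y) :
    CL 𝒢 μ Y ν := by
  have := (hZ 0).prob
  refine ⟨hY, fun A hA B hB => ?_⟩
  have : IsFiniteMeasure (μ A • ν) := Measure.smul_finite _ (measure_ne_top _ _)
  have key : (μ.restrict A).map Y = μ A • ν := by
    apply ext_of_forall_integral_eq_of_IsFiniteMeasure
    intro f
    obtain ⟨ns, -, hns⟩ := hlim.exists_seq_tendsto_ae
    have h1 : ∀ n, ∫ x, f x ∂((μ.restrict A).map (Z n)) = ∫ x, f x ∂(μ A • ν) := by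
      intro n
      congr 1
      ext B hB
      rw [Measure.map_apply (hZ n).meas hB, Measure.restrict_apply ((hZ n).meas hB), inter_comm,
        (hZ n).rect A hA B hB]
      rfl
    rw [integral_map hY.aemeasurable f.continuous.measurable.aestronglyMeasurable]
    have h2 : Tendsto (fun k => ∫ ω, f (Z (ns k) ω) ∂(μ.restrict A)) atTop
        (nhds (∫ ω, f (Y ω) ∂(μ.restrict A))) := by
      apply tendsto_integral_of_dominated_convergence (fun _ => ‖f‖)
      · intro n
        exact (f.continuous.measurable.comp (hZ _).meas).aestronglyMeasurable
      · exact integrable_const _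
      · intro n; exact ae_of_all _ fun ω => f.norm_coe_le_norm _
      · filter_upwards [ae_restrict_of_ae hns] with ω hω
        exact (f.continuous.tendsto _).comp hω
    refine tendsto_nhds_unique h2 ?_
    apply Filter.Tendsto.congr (f₁ := fun _ => ∫ x, f x ∂(μ A • ν)) _ tendsto_const_nhds
    intro k
    rw [← h1 (ns k), integral_map (hZ _).meas.aemeasurable f.continuous.measurable.aestronglyMeasurable]
  have : μ (A ∩ Y ⁻¹' B) = (μ.restrict A).map Y B := by
    rw [Measure.map_apply hY hB, Measure.restrict_apply (hY hB), inter_comm]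
  rw [this, key]; rfl

end CLlim
end

section
/-! ### Gaussian facts -/

/-- centred Gaussian of variance `v` -/
def gam (v : ℝ) : Measure ℝ := gaussianReal 0 v.toNNReal
/-- product Gaussian -/
def gam2 (v : ℝ) : Measure (ℝ × ℝ) := (gam v).prod (gam v)

instance (v : ℝ) : IsProbabilityMeasure (gam v) := by unfold gam; infer_instance
instance (v : ℝ) : IsProbabilityMeasure (gam2 v) := by unfold gam2; infer_instance

lemma gam_memLp (v : ℝ) (p : NNReal) : MemLp (fun x : ℝ => x) p (gam v) := memLp_id_gaussianReal p

lemma gam_integrable_pow (v : ℝ) (k : ℕ) : Integrable (fun x : ℝ => x ^ k) (gam v) := by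
  have h := (gam_memLp v k).integrable_norm_pow'
  refine (integrable_norm_iff (by fun_prop)).1 ?_
  simpa using h

lemma gam_integral_id (v : ℝ) : ∫ x, x ∂(gam v) = 0 := integral_id_gaussianReal

lemma gam_integral_sq {v : ℝ} (hv : 0 ≤ v) : ∫ x, x ^ 2 ∂(gam v) = v := by
  have h := variance_fun_id_gaussianReal (μ := 0) (v := v.toNNReal)
  rw [variance_of_integral_eq_zero (by fun_prop) integral_id_gaussianReal] at h
  simpa [hv, gam] using h

/-- fourth moment of the standard Gaussian -/
def c4 : ℝ := ∫ x, x ^ 4 ∂(gam 1)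

lemma c4_nonneg : 0 ≤ c4 := integral_nonneg fun x => by positivity

lemma gam_integral_four {v : ℝ} (hv : 0 ≤ v) : ∫ x, x ^ 4 ∂(gam v) = c4 * v ^ 2 := by
  have h : gam v = (gam 1).map (fun x => Real.sqrt v * x) := by
    unfold gam
    rw [gaussianReal_map_const_mul]
    congr 1
    · simp
    · ext; simp [hv, Real.sq_sqrt]
  rw [h, integral_map (by fun_prop) (by fun_prop)]
  have : ∀ x : ℝ, (Real.sqrt v * x) ^ 4 = v ^ 2 * x ^ 4 := by
    intro x
    have := Real.sq_sqrt hv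
    calc (Real.sqrt v * x) ^ 4 = (Real.sqrt v ^ 2) ^ 2 * x ^ 4 := by ring
      _ = _ := by rw [this]
  simp_rw [this]
  rw [integral_const_mul, c4, mul_comm]

lemma gam_zero : gam 0 = Measure.dirac 0 := by simp [gam, gaussianReal_zero_var]

lemma ext2 {μ ν : Measure (ℝ × ℝ)} [IsFiniteMeasure μ] [IsFiniteMeasure ν]
    (h : ∀ s t : ℝ, ∫ p, Complex.exp (((s * p.1 + t * p.2 : ℝ) : ℂ) * Complex.I) ∂μ
      = ∫ p, Complex.exp (((s * p.1 + t * p.2 : ℝ) : ℂ) * Complex.I) ∂ν) : μ = ν := by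
  apply Measure.ext_of_charFunDual
  ext L
  rw [charFunDual_apply, charFunDual_apply]
  have hL : ∀ p : ℝ × ℝ, L p = L (1, 0) * p.1 + L (0, 1) * p.2 := by
    intro p
    have : p = p.1 • ((1 : ℝ), (0 : ℝ)) + p.2 • ((0 : ℝ), (1 : ℝ)) := by ext <;> simp
    conv_lhs => rw [this, map_add, map_smul, map_smul]
    simp [mul_comm]
  have h1 := h (L (1, 0)) (L (0, 1))
  have h2 : ∀ ρ : Measure (ℝ × ℝ), ∫ p, Complex.exp ((L p : ℂ) * Complex.I) ∂ρ =
      ∫ p, Complex.exp (((L (1, 0) * p.1 + L (0, 1) * p.2 : ℝ) : ℂ) * Complex.I) ∂ρ := by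
    intro ρ
    congr 1
    ext p
    rw [hL p]
  rw [h2, h2]
  exact h1

lemma gam_char (v s : ℝ) (hv : 0 ≤ v) :
    ∫ x, Complex.exp (((s * x : ℝ) : ℂ) * Complex.I) ∂(gam v) = Complex.exp (-(v * s ^ 2 / 2)) := by
  have h := charFun_gaussianReal (μ := 0) (v := v.toNNReal) s
  rw [charFun_apply_real] at h
  simp only [gam]
  push_cast
  rw [h]
  simp [hv]

lemma gam2_char (v s t : ℝ) (hv : 0 ≤ v) :
    ∫ p, Complex.exp (((s * p.1 + t * p.2 : ℝ) : ℂ) * Complex.I) ∂(gam2 v)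
      = Complex.exp (-(v * (s ^ 2 + t ^ 2) / 2)) := by
  have : ∀ p : ℝ × ℝ, Complex.exp (((s * p.1 + t * p.2 : ℝ) : ℂ) * Complex.I) =
      Complex.exp (((s * p.1 : ℝ) : ℂ) * Complex.I) * Complex.exp (((t * p.2 : ℝ) : ℂ) * Complex.I) := by
    intro p; rw [← Complex.exp_add]; push_cast; ring_nf
  simp_rw [this]
  rw [gam2, integral_prod_mul (f := fun x : ℝ => Complex.exp (((s * x : ℝ) : ℂ) * Complex.I))
    (g := fun x : ℝ => Complex.exp (((t * x : ℝ) : ℂ) * Complex.I)), gam_char v s hv, gam_char v t hv,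
    ← Complex.exp_add]
  ring_nf

/-- orthogonal maps preserve `gam2` -/
lemma gam2_orth {v : ℝ} (hv : 0 ≤ v) {a b c d : ℝ} (h1 : a ^ 2 + b ^ 2 = 1) (h2 : c ^ 2 + d ^ 2 = 1)
    (h3 : a * c + b * d = 0) :
    (gam2 v).map (fun p => (a * p.1 + b * p.2, c * p.1 + d * p.2)) = gam2 v := by
  have hm : Measurable (fun p : ℝ × ℝ => (a * p.1 + b * p.2, c * p.1 + d * p.2)) := by fun_prop
  have := Measure.isProbabilityMeasure_map (μ := gam2 v) hm.aemeasurable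
  apply ext2
  intro s t
  rw [integral_map hm.aemeasurable (by fun_prop), gam2_char v s t hv]
  have : ∀ p : ℝ × ℝ, s * (a * p.1 + b * p.2) + t * (c * p.1 + d * p.2) =
    (s * a + t * c) * p.1 + (s * b + t * d) * p.2 := fun p => by ring
  simp_rw [this]
  rw [gam2_char v _ _ hv]
  congr 1
  have : (s * a + t * c) ^ 2 + (s * b + t * d) ^ 2 = s ^ 2 + t ^ 2 := by
    linear_combination s ^ 2 * h1 + t ^ 2 * h2 + 2 * s * t * h3
  norm_cast
  rw [this]

lemma gam2_add {v w : ℝ} (hv : 0 ≤ v) (hw : 0 ≤ w) :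
    ((gam2 v).prod (gam2 w)).map (fun p => p.1 + p.2) = gam2 (v + w) := by
  have hm : Measurable (fun p : (ℝ × ℝ) × (ℝ × ℝ) => p.1 + p.2) := by fun_prop
  have := Measure.isProbabilityMeasure_map (μ := (gam2 v).prod (gam2 w)) hm.aemeasurable
  apply ext2
  intro s t
  rw [integral_map hm.aemeasurable (by fun_prop), gam2_char _ s t (by positivity)]
  have : ∀ p : (ℝ × ℝ) × (ℝ × ℝ), Complex.exp (((s * (p.1 + p.2).1 + t * (p.1 + p.2).2 : ℝ) : ℂ) * Complex.I) =
      Complex.exp (((s * p.1.1 + t * p.1.2 : ℝ) : ℂ) * Complex.I) *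
      Complex.exp (((s * p.2.1 + t * p.2.2 : ℝ) : ℂ) * Complex.I) := by
    intro p; rw [← Complex.exp_add]; simp only [Prod.fst_add, Prod.snd_add]; push_cast; ring_nf
  simp_rw [this]
  rw [integral_prod_mul (f := fun p : ℝ × ℝ => Complex.exp (((s * p.1 + t * p.2 : ℝ) : ℂ) * Complex.I))
    (g := fun p : ℝ × ℝ => Complex.exp (((s * p.1 + t * p.2 : ℝ) : ℂ) * Complex.I)),
    gam2_char v s t hv, gam2_char w s t hw, ← Complex.exp_add]
  push_cast
  ring_nf

lemma gam2_zero : gam2 0 = Measure.dirac 0 := by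
  rw [gam2, gam_zero, Measure.dirac_prod_dirac]; rfl

lemma gam2_fst (v : ℝ) : (gam2 v).map Prod.fst = gam v := by
  simp [gam2, Measure.map_fst_prod]

lemma gam2_snd (v : ℝ) : (gam2 v).map Prod.snd = gam v := by
  simp [gam2, Measure.map_snd_prod]

/-- small ball estimate -/
lemma gam_small {v : ℝ} (hv : 0 < v) (x r : ℝ) (hr : 0 ≤ r) :
    gam v (Icc (x - r) (x + r)) ≤ ENNReal.ofReal (r / Real.sqrt v) := by
  have hv' : v.toNNReal ≠ 0 := by simpa using hv
  rw [gam, gaussianReal_apply _ hv']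
  have hb : ∀ y, gaussianPDF 0 v.toNNReal y ≤ ENNReal.ofReal ((Real.sqrt (2 * Real.pi * v))⁻¹) := by
    intro y
    rw [gaussianPDF]
    apply ENNReal.ofReal_le_ofReal
    rw [gaussianPDFReal]
    rw [Real.coe_toNNReal v hv.le]
    have : Real.exp (-(y - 0) ^ 2 / (2 * v)) ≤ 1 := by
      apply Real.exp_le_one_iff.2
      apply div_nonpos_of_nonpos_of_nonneg
      · nlinarith [sq_nonneg (y-0)]
      · positivity
    calc _ ≤ (Real.sqrt (2 * Real.pi * v))⁻¹ * 1 := by gcongr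
      _ = _ := mul_one _
  calc ∫⁻ y in Icc (x - r) (x + r), gaussianPDF 0 v.toNNReal y
      ≤ ∫⁻ y in Icc (x - r) (x + r), ENNReal.ofReal ((Real.sqrt (2 * Real.pi * v))⁻¹) := by
        apply lintegral_mono; intro y; exact hb y
    _ = ENNReal.ofReal ((Real.sqrt (2 * Real.pi * v))⁻¹ * (2 * r)) := by
        rw [setLIntegral_const, Real.volume_Icc, ← ENNReal.ofReal_mul (by positivity)]
        congr 2; ring
    _ ≤ _ := by
        apply ENNReal.ofReal_le_ofReal
        have h4 : Real.sqrt (2 * Real.pi * v) ≥ 2 * Real.sqrt v := by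
          have : 2 * Real.sqrt v = Real.sqrt (4 * v) := by
            rw [Real.sqrt_mul (by norm_num), show (4:ℝ) = 2 ^ 2 by norm_num, Real.sqrt_sq (by norm_num)]
          rw [this]
          apply Real.sqrt_le_sqrt
          nlinarith [Real.pi_gt_three]
        have h5 : 0 < Real.sqrt v := Real.sqrt_pos.2 hv
        rw [inv_mul_eq_div, div_le_div_iff₀ (by linarith) h5]
        nlinarith

lemma gam_Ioi_pos {v : ℝ} (hv : 0 < v) (c : ℝ) : 0 < gam v (Ioi c) := by
  have hv' : v.toNNReal ≠ 0 := by simpa using hv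
  by_contra h
  have h0 : gam v (Ioi c) = 0 := by simpa using h
  have := gaussianReal_absolutelyContinuous' 0 hv' h0
  simp at this

lemma gam_Iio_pos {v : ℝ} (hv : 0 < v) (c : ℝ) : 0 < gam v (Iio c) := by
  have hv' : v.toNNReal ≠ 0 := by simpa using hv
  by_contra h
  have h0 : gam v (Iio c) = 0 := by simpa using h
  have := gaussianReal_absolutelyContinuous' 0 hv' h0
  simp at this

/-- Cameron–Martin in dimension one -/
lemma gam_shift {v : ℝ} (hv : 0 ≤ v) (l : ℝ) {f : ℝ → ENNReal} (hf : Measurable f) :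
    ∫⁻ x, f (x - l * v) * ENNReal.ofReal (Real.exp (l * x - l ^ 2 * v / 2)) ∂(gam v) =
    ∫⁻ x, f x ∂(gam v) := by
  rcases hv.eq_or_lt with rfl | hv
  · rw [gam_zero, lintegral_dirac' _ (by fun_prop), lintegral_dirac' _ hf]; simp
  have hv' : v.toNNReal ≠ 0 := by simpa using hv
  rw [gam, gaussianReal_of_var_ne_zero _ hv', lintegral_withDensity_eq_lintegral_mul _ (by fun_prop) (by fun_prop),
    lintegral_withDensity_eq_lintegral_mul _ (by fun_prop) hf]
  rw [← lintegral_add_right_eq_self _ (l * v)]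
  apply lintegral_congr
  intro x
  simp only [Pi.mul_apply, add_sub_cancel_right]
  rw [mul_comm (f x), ← mul_assoc]
  congr 1
  rw [gaussianPDF, gaussianPDF, ← ENNReal.ofReal_mul (gaussianPDFReal_nonneg _ _ _)]
  congr 1
  rw [gaussianPDFReal, gaussianPDFReal, Real.coe_toNNReal v hv.le, mul_assoc, ← Real.exp_add]
  congr 2
  field_simp
  ring
end

section
/-! ### Discrete Gaussian increments -/

lemma gam2_int_fst (v : ℝ) (f : ℝ → ℝ) (hf : Measurable f) : ∫ p, f p.1 ∂(gam2 v) = ∫ x, f x ∂(gam v) := by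
  rw [← gam2_fst v, integral_map (by fun_prop) hf.aestronglyMeasurable]

lemma gam2_int_snd (v : ℝ) (f : ℝ → ℝ) (hf : Measurable f) : ∫ p, f p.2 ∂(gam2 v) = ∫ x, f x ∂(gam v) := by
  rw [← gam2_snd v, integral_map (by fun_prop) hf.aestronglyMeasurable]

lemma gam2_integrable_fst (v : ℝ) (k : ℕ) : Integrable (fun p : ℝ × ℝ => p.1 ^ k) (gam2 v) := by
  have := gam_integrable_pow v k
  rw [← gam2_fst v] at this
  exact (integrable_map_measure (f := Prod.fst) (g := fun x : ℝ => x ^ k)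
    (measurable_id.pow_const k).aestronglyMeasurable (by fun_prop)).1 this

lemma gam2_integrable_snd (v : ℝ) (k : ℕ) : Integrable (fun p : ℝ × ℝ => p.2 ^ k) (gam2 v) := by
  have := gam_integrable_pow v k
  rw [← gam2_snd v] at this
  exact (integrable_map_measure (f := Prod.snd) (g := fun x : ℝ => x ^ k)
    (measurable_id.pow_const k).aestronglyMeasurable (by fun_prop)).1 this

lemma gam2_integrable_mul (v : ℝ) : Integrable (fun p : ℝ × ℝ => p.1 * p.2) (gam2 v) := by
  have h := gam_integrable_pow v 1
  simp only [pow_one] at h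
  exact Integrable.mul_prod h h

lemma gam2_int_mul (v : ℝ) : ∫ p : ℝ × ℝ, p.1 * p.2 ∂(gam2 v) = 0 := by
  rw [gam2, integral_prod_mul (f := fun x : ℝ => x) (g := fun x : ℝ => x), gam_integral_id]; simp

/-- Discrete planar Gaussian increments with respect to a discrete filtration. -/
structure Inc {Ω : Type*} [m : MeasurableSpace Ω] (H : ℕ → MeasurableSpace Ω) (μ : Measure Ω)
    (ξ η : ℕ → Ω → ℝ) (Δ : ℕ → ℝ) (N : ℕ) : Prop where
  le : ∀ k, H k ≤ m
  mono : Monotone H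
  pos : ∀ k, 0 ≤ Δ k
  m1 : ∀ k < N, Measurable[H (k+1)] (ξ k)
  m2 : ∀ k < N, Measurable[H (k+1)] (η k)
  cl : ∀ k < N, CL (H k) μ (fun ω => (ξ k ω, η k ω)) (gam2 (Δ k))

section Inc
variable {μ : Measure Ω} [IsProbabilityMeasure μ] {H : ℕ → MeasurableSpace Ω}
  {ξ η : ℕ → Ω → ℝ} {Δ : ℕ → ℝ} {N : ℕ}

lemma Inc.orth (h : Inc H μ ξ η Δ N) {a b c d : ℕ → Ω → ℝ}
    (ha : ∀ k < N, Measurable[H k] (a k)) (hb : ∀ k < N, Measurable[H k] (b k))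
    (hc : ∀ k < N, Measurable[H k] (c k)) (hd : ∀ k < N, Measurable[H k] (d k))
    (h1 : ∀ k < N, ∀ ω, a k ω ^ 2 + b k ω ^ 2 = 1) (h2 : ∀ k < N, ∀ ω, c k ω ^ 2 + d k ω ^ 2 = 1)
    (h3 : ∀ k < N, ∀ ω, a k ω * c k ω + b k ω * d k ω = 0) :
    Inc H μ (fun k ω => a k ω * ξ k ω + b k ω * η k ω) (fun k ω => c k ω * ξ k ω + d k ω * η k ω) Δ N := by
  refine ⟨h.le, h.mono, h.pos, fun k hk => ?_, fun k hk => ?_, fun k hk => ?_⟩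
  · have hH := h.mono (Nat.le_succ k)
    exact (((ha k hk).mono hH le_rfl).mul (h.m1 k hk)).add (((hb k hk).mono hH le_rfl).mul (h.m2 k hk))
  · have hH := h.mono (Nat.le_succ k)
    exact (((hc k hk).mono hH le_rfl).mul (h.m1 k hk)).add (((hd k hk).mono hH le_rfl).mul (h.m2 k hk))
  · have hT : Measurable[H k] (fun ω => ((a k ω, b k ω), (c k ω, d k ω))) :=
      ((ha k hk).prodMk (hb k hk)).prodMk ((hc k hk).prodMk (hd k hk))
    have hT' : Measurable (fun ω => ((a k ω, b k ω), (c k ω, d k ω))) := hT.mono (h.le k) le_rfl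
    refine (h.cl k hk).comp (h.le k) hT
      (f := fun p : ((ℝ × ℝ) × (ℝ × ℝ)) × (ℝ × ℝ) =>
        (p.1.1.1 * p.2.1 + p.1.1.2 * p.2.2, p.1.2.1 * p.2.1 + p.1.2.2 * p.2.2)) (by fun_prop) ?_
    have hS : MeasurableSet {x : (ℝ × ℝ) × (ℝ × ℝ) | x.1.1 ^ 2 + x.1.2 ^ 2 = 1 ∧ x.2.1 ^ 2 + x.2.2 ^ 2 = 1 ∧
        x.1.1 * x.2.1 + x.1.2 * x.2.2 = 0} :=
      (measurableSet_eq_fun (by fun_prop) (by fun_prop)).inter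
        ((measurableSet_eq_fun (by fun_prop) (by fun_prop)).inter
          (measurableSet_eq_fun (by fun_prop) (by fun_prop)))
    have : ∀ᵐ x ∂(μ.map (fun ω => ((a k ω, b k ω), (c k ω, d k ω)))),
      x.1.1 ^ 2 + x.1.2 ^ 2 = 1 ∧ x.2.1 ^ 2 + x.2.2 ^ 2 = 1 ∧ x.1.1 * x.2.1 + x.1.2 * x.2.2 = 0 := by
      rw [ae_map_iff hT'.aemeasurable hS]
      exact ae_of_all _ fun ω => ⟨h1 k hk ω, h2 k hk ω, h3 k hk ω⟩
    filter_upwards [this] with x hx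
    exact gam2_orth (h.pos k) hx.1 hx.2.1 hx.2.2

/-- multiply the first component by a predictable sign -/
lemma Inc.sign (h : Inc H μ ξ η Δ N) {a : ℕ → Ω → ℝ}
    (ha : ∀ k < N, Measurable[H k] (a k)) (h1 : ∀ k < N, ∀ ω, a k ω ^ 2 = 1) :
    Inc H μ (fun k ω => a k ω * ξ k ω) η Δ N := by
  have := h.orth (a := a) (b := fun _ _ => 0) (c := fun _ _ => 0) (d := fun _ _ => 1) ha
    (fun k _ => measurable_const) (fun k _ => measurable_const) (fun k _ => measurable_const)
    (fun k hk ω => by simp [h1 k hk ω]) (fun k hk ω => by simp) (fun k hk ω => by simp)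
  simpa using this

lemma Inc.measSum (h : Inc H μ ξ η Δ N) {a b : ℕ → Ω → ℝ}
    (ha : ∀ k < N, Measurable[H k] (a k)) (hb : ∀ k < N, Measurable[H k] (b k)) {K : ℕ} (hK : K ≤ N) :
    Measurable[H K] (fun ω => ∑ k ∈ Finset.range K, (a k ω * ξ k ω + b k ω * η k ω)) := by
  refine Finset.measurable_fun_sum _ fun k hk => ?_
  have hk' : k < K := Finset.mem_range.1 hk
  have hkN := hk'.trans_le hK
  exact (((ha k hkN).mono (h.mono hk'.le) le_rfl).mul ((h.m1 k hkN).mono (h.mono hk') le_rfl)).add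
    (((hb k hkN).mono (h.mono hk'.le) le_rfl).mul ((h.m2 k hkN).mono (h.mono hk') le_rfl))

/-- law of block sums -/
lemma Inc.sumLaw (h : Inc H μ ξ η Δ N) (j : ℕ) (l : ℕ) (hK : j + l ≤ N) :
    CL (H j) μ (fun ω => (∑ k ∈ Finset.range l, ξ (j + k) ω, ∑ k ∈ Finset.range l, η (j + k) ω))
      (gam2 (∑ k ∈ Finset.range l, Δ (j + k))) := by
  induction l with
  | zero =>
    simp only [Finset.range_zero, Finset.sum_empty, gam2_zero]
    refine ⟨measurable_const, fun A hA B hB => ?_⟩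
    rw [Measure.dirac_apply' _ hB]
    by_cases h0 : ((0 : ℝ), (0 : ℝ)) ∈ B
    · have h0' : (0 : ℝ × ℝ) ∈ B := h0
      have : (fun _ : Ω => ((0:ℝ), (0:ℝ))) ⁻¹' B = univ := by
        ext ω; simpa using h0
      rw [this]; simp [h0']
    · have h0' : (0 : ℝ × ℝ) ∉ B := h0
      have : (fun _ : Ω => ((0:ℝ), (0:ℝ))) ⁻¹' B = ∅ := by
        ext ω; simpa using h0
      rw [this]; simp [h0']
  | succ l ih =>
    have ih := ih (by omega)
    have hl : j + l < N := by omega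
    have hmeas : Measurable[H (j + l)] (fun ω => (∑ k ∈ Finset.range l, ξ (j + k) ω, ∑ k ∈ Finset.range l, η (j + k) ω)) := by
      refine Measurable.prodMk ?_ ?_
      · refine Finset.measurable_fun_sum _ fun k hk => ?_
        have hk' : k < l := Finset.mem_range.1 hk
        exact (h.m1 (j + k) (by omega)).mono (h.mono (by omega)) le_rfl
      · refine Finset.measurable_fun_sum _ fun k hk => ?_
        have hk' : k < l := Finset.mem_range.1 hk
        exact (h.m2 (j + k) (by omega)).mono (h.mono (by omega)) le_rfl
    have h1 := (ih.pair (h.cl (j + l) hl) (h.mono (by omega)) hmeas (h.le _)).comp' (h.le j)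
      (f := fun p : (ℝ × ℝ) × (ℝ × ℝ) => p.1 + p.2) (by fun_prop)
    rw [gam2_add (Finset.sum_nonneg fun k _ => h.pos _) (h.pos _)] at h1
    rw [Finset.sum_range_succ]
    convert h1 using 2 with ω
    simp [Finset.sum_range_succ]

/-- square-integrability of the elementary terms -/
lemma Inc.memLp (h : Inc H μ ξ η Δ N) {k : ℕ} (hk : k < N) : MemLp (ξ k) 2 μ ∧ MemLp (η k) 2 μ := by
  have hc := h.cl k hk
  have hm1 : Measurable (ξ k) := (h.m1 k hk).mono (h.le _) le_rfl
  have hm2 : Measurable (η k) := (h.m2 k hk).mono (h.le _) le_rfl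
  constructor
  · rw [memLp_two_iff_integrable_sq hm1.aestronglyMeasurable]
    exact hc.integrable' (f := fun p => p.1 ^ 2) (by fun_prop) (gam2_integrable_fst _ 2)
  · rw [memLp_two_iff_integrable_sq hm2.aestronglyMeasurable]
    exact hc.integrable' (f := fun p => p.2 ^ 2) (by fun_prop) (gam2_integrable_snd _ 2)

lemma memLp_bdd_mul {a f : Ω → ℝ} {C : ℝ} (ha : Measurable a) (hC : ∀ ω, |a ω| ≤ C) {p : ENNReal}
    (hf : MemLp f p μ) : MemLp (fun ω => a ω * f ω) p μ := by
  refine MemLp.of_le_mul (c := C) hf (ha.aestronglyMeasurable.mul hf.1) (ae_of_all _ fun ω => ?_)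
  rw [norm_mul]
  exact mul_le_mul_of_nonneg_right (hC ω) (norm_nonneg _)

lemma Inc.memLpSum (h : Inc H μ ξ η Δ N) {a b : ℕ → Ω → ℝ} {C : ℝ}
    (ha : ∀ k < N, Measurable[H k] (a k)) (hb : ∀ k < N, Measurable[H k] (b k))
    (haC : ∀ k < N, ∀ ω, |a k ω| ≤ C) (hbC : ∀ k < N, ∀ ω, |b k ω| ≤ C) {K : ℕ} (hK : K ≤ N) :
    MemLp (fun ω => ∑ k ∈ Finset.range K, (a k ω * ξ k ω + b k ω * η k ω)) 2 μ := by
  refine memLp_finset_sum _ fun k hk => ?_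
  have hkN := (Finset.mem_range.1 hk).trans_le hK
  exact (memLp_bdd_mul ((ha k hkN).mono (h.le _) le_rfl) (haC k hkN) (h.memLp hkN).1).add
    (memLp_bdd_mul ((hb k hkN).mono (h.le _) le_rfl) (hbC k hkN) (h.memLp hkN).2)

lemma Inc.mean (h : Inc H μ ξ η Δ N) {k : ℕ} (hk : k < N) {u : Ω → ℝ} (hu : Measurable[H k] u) :
    ∫ ω, u ω * ξ k ω ∂μ = 0 ∧ ∫ ω, u ω * η k ω ∂μ = 0 := by
  have hc := h.cl k hk
  constructor
  · have := hc.integral (h.le k) hu (f := fun p => p.1) (by fun_prop)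
    rw [this, gam2_int_fst _ (fun x => x) measurable_id, gam_integral_id, mul_zero]
  · have := hc.integral (h.le k) hu (f := fun p => p.2) (by fun_prop)
    rw [this, gam2_int_snd _ (fun x => x) measurable_id, gam_integral_id, mul_zero]

lemma Inc.var (h : Inc H μ ξ η Δ N) {k : ℕ} (hk : k < N) {u : Ω → ℝ} (hu : Measurable[H k] u) :
    ∫ ω, u ω * ξ k ω ^ 2 ∂μ = Δ k * ∫ ω, u ω ∂μ ∧ ∫ ω, u ω * η k ω ^ 2 ∂μ = Δ k * ∫ ω, u ω ∂μ ∧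
    ∫ ω, u ω * (ξ k ω * η k ω) ∂μ = 0 := by
  have hc := h.cl k hk
  refine ⟨?_, ?_, ?_⟩
  · have := hc.integral (h.le k) hu (f := fun p => p.1 ^ 2) (by fun_prop)
    rw [this, gam2_int_fst _ (fun x => x ^ 2) (by fun_prop), gam_integral_sq (h.pos k), mul_comm]
  · have := hc.integral (h.le k) hu (f := fun p => p.2 ^ 2) (by fun_prop)
    rw [this, gam2_int_snd _ (fun x => x ^ 2) (by fun_prop), gam_integral_sq (h.pos k), mul_comm]
  · have := hc.integral (h.le k) hu (f := fun p => p.1 * p.2) (by fun_prop)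
    rw [this, gam2_int_mul, mul_zero]

lemma Inc.ints (h : Inc H μ ξ η Δ N) {k : ℕ} (hk : k < N) {u : Ω → ℝ} (hu : Measurable[H k] u)
    (hui : Integrable u μ) :
    Integrable (fun ω => u ω * ξ k ω) μ ∧ Integrable (fun ω => u ω * η k ω) μ ∧
    Integrable (fun ω => u ω * ξ k ω ^ 2) μ ∧ Integrable (fun ω => u ω * η k ω ^ 2) μ ∧
    Integrable (fun ω => u ω * (ξ k ω * η k ω)) μ := by
  have hc := h.cl k hk
  refine ⟨?_, ?_, ?_, ?_, ?_⟩
  · have := gam2_integrable_fst (Δ k) 1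
    simp only [pow_one] at this
    exact hc.integrable (h.le k) hu hui (f := fun p => p.1) (by fun_prop) this
  · have := gam2_integrable_snd (Δ k) 1
    simp only [pow_one] at this
    exact hc.integrable (h.le k) hu hui (f := fun p => p.2) (by fun_prop) this
  · exact hc.integrable (h.le k) hu hui (f := fun p => p.1 ^ 2) (by fun_prop) (gam2_integrable_fst (Δ k) 2)
  · exact hc.integrable (h.le k) hu hui (f := fun p => p.2 ^ 2) (by fun_prop) (gam2_integrable_snd (Δ k) 2)
  · exact hc.integrable (h.le k) hu hui (f := fun p => p.1 * p.2) (by fun_prop) (gam2_integrable_mul (Δ k))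

lemma integrable_of_bdd {u : Ω → ℝ} {C : ℝ} (hu : Measurable u) (hC : ∀ ω, |u ω| ≤ C) : Integrable u μ :=
  Integrable.of_bound hu.aestronglyMeasurable C (ae_of_all _ hC)

/-- discrete Itô isometry -/
lemma Inc.isometry (h : Inc H μ ξ η Δ N) {a b : ℕ → Ω → ℝ} {C : ℝ}
    (ha : ∀ k < N, Measurable[H k] (a k)) (hb : ∀ k < N, Measurable[H k] (b k))
    (haC : ∀ k < N, ∀ ω, |a k ω| ≤ C) (hbC : ∀ k < N, ∀ ω, |b k ω| ≤ C) {K : ℕ} (hK : K ≤ N) :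
    ∫ ω, (∑ k ∈ Finset.range K, (a k ω * ξ k ω + b k ω * η k ω)) ^ 2 ∂μ =
      ∑ k ∈ Finset.range K, Δ k * ∫ ω, (a k ω ^ 2 + b k ω ^ 2) ∂μ := by
  induction K with
  | zero => simp
  | succ K ih =>
    have hKN : K < N := hK
    have ih := ih hKN.le
    set M : Ω → ℝ := fun ω => ∑ k ∈ Finset.range K, (a k ω * ξ k ω + b k ω * η k ω) with hM
    have hMm : Measurable[H K] M := h.measSum ha hb hKN.le
    have hML : MemLp M 2 μ := h.memLpSum ha hb haC hbC hKN.le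
    have hMi : Integrable M μ := hML.integrable (by norm_num)
    have haK := ha K hKN
    have hbK := hb K hKN
    have haK' : Measurable (a K) := haK.mono (h.le _) le_rfl
    have hbK' : Measurable (b K) := hbK.mono (h.le _) le_rfl
    have hC0 : ∀ ω, 0 ≤ C := fun ω => (abs_nonneg _).trans (haC K hKN ω)
    have hi1 : Integrable (fun ω => a K ω * M ω) μ :=
      hMi.bdd_mul haK'.aestronglyMeasurable (ae_of_all _ (haC K hKN))
    have hi2 : Integrable (fun ω => b K ω * M ω) μ :=
      hMi.bdd_mul hbK'.aestronglyMeasurable (ae_of_all _ (hbC K hKN))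
    have hia : Integrable (fun ω => a K ω ^ 2) μ := by
      refine integrable_of_bdd (C := C ^ 2) (haK'.pow_const 2) fun ω => ?_
      rw [abs_pow]; exact pow_le_pow_left₀ (abs_nonneg _) (haC K hKN ω) 2
    have hib : Integrable (fun ω => b K ω ^ 2) μ := by
      refine integrable_of_bdd (C := C ^ 2) (hbK'.pow_const 2) fun ω => ?_
      rw [abs_pow]; exact pow_le_pow_left₀ (abs_nonneg _) (hbC K hKN ω) 2
    have hiab : Integrable (fun ω => a K ω * b K ω) μ := by
      refine integrable_of_bdd (C := C * C) (haK'.mul hbK') fun ω => ?_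
      rw [abs_mul]; exact mul_le_mul (haC K hKN ω) (hbC K hKN ω) (abs_nonneg _) (hC0 ω)
    have e1 : ∀ ω, (∑ k ∈ Finset.range (K+1), (a k ω * ξ k ω + b k ω * η k ω)) ^ 2 =
        M ω ^ 2 + (2 * ((a K ω * M ω) * ξ K ω) + (2 * ((b K ω * M ω) * η K ω) + (a K ω ^ 2 * ξ K ω ^ 2 +
          (b K ω ^ 2 * η K ω ^ 2 + 2 * ((a K ω * b K ω) * (ξ K ω * η K ω)))))) := by
      intro ω
      rw [Finset.sum_range_succ]
      simp only [hM]
      ring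
    simp_rw [e1]
    have hm1 : Measurable[H K] (fun ω => a K ω * M ω) := haK.mul hMm
    have hm2 : Measurable[H K] (fun ω => b K ω * M ω) := hbK.mul hMm
    have hm3 : Measurable[H K] (fun ω => a K ω ^ 2) := haK.pow_const 2
    have hm4 : Measurable[H K] (fun ω => b K ω ^ 2) := hbK.pow_const 2
    have hm5 : Measurable[H K] (fun ω => a K ω * b K ω) := haK.mul hbK
    have j1 := (h.ints hKN hm1 hi1).1.const_mul 2
    have j2 := (h.ints hKN hm2 hi2).2.1.const_mul 2
    have j3 := (h.ints hKN hm3 hia).2.2.1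
    have j4 := (h.ints hKN hm4 hib).2.2.2.1
    have j5 := (h.ints hKN hm5 hiab).2.2.2.2.const_mul 2
    have j45 := j4.add j5
    have j345 := j3.add j45
    have j2345 := j2.add j345
    have j12345 := j1.add j2345
    simp only [Pi.add_def] at j45 j345 j2345 j12345
    rw [integral_add hML.integrable_sq j12345, integral_add j1 j2345, integral_add j2 j345,
      integral_add j3 j45, integral_add j4 j5, integral_const_mul, integral_const_mul, integral_const_mul,
      (h.mean hKN hm1).1, (h.mean hKN hm2).2, (h.var hKN hm3).1,
      (h.var hKN hm4).2.1, (h.var hKN hm5).2.2, ih, Finset.sum_range_succ,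
      integral_add hia hib]
    ring

end Inc
end

section
/-! ### The smooth approximation of the absolute value -/

def Fd (δ x : ℝ) : ℝ := √(x ^ 2 + δ ^ 2)
def Fd1 (δ x : ℝ) : ℝ := x / √(x ^ 2 + δ ^ 2)
def Fd2 (δ x : ℝ) : ℝ := δ ^ 2 / √(x ^ 2 + δ ^ 2) ^ 3
def Fd3 (δ x : ℝ) : ℝ := - (3 * δ ^ 2 * x) / √(x ^ 2 + δ ^ 2) ^ 5

section Fd
variable {δ : ℝ}

lemma Fd_pos (hδ : 0 < δ) (x : ℝ) : 0 < √(x ^ 2 + δ ^ 2) := Real.sqrt_pos.2 (by positivity)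

lemma Fd_sq (hδ : 0 < δ) (x : ℝ) : √(x ^ 2 + δ ^ 2) ^ 2 = x ^ 2 + δ ^ 2 := Real.sq_sqrt (by positivity)

lemma Fd_ge (hδ : 0 < δ) (x : ℝ) : δ ≤ √(x ^ 2 + δ ^ 2) := by
  apply Real.le_sqrt_of_sq_le; nlinarith [sq_nonneg x]

lemma Fd_abs_le (δ x : ℝ) : |x| ≤ √(x ^ 2 + δ ^ 2) := by
  apply Real.le_sqrt_of_sq_le; rw [sq_abs]; nlinarith [sq_nonneg δ]

lemma Fd_le (hδ : 0 < δ) (x : ℝ) : Fd δ x ≤ |x| + δ := by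
  unfold Fd
  rw [Real.sqrt_le_left (by positivity)]
  nlinarith [sq_abs x, abs_nonneg x]

lemma Fd_hasDeriv (hδ : 0 < δ) (x : ℝ) : HasDerivAt (Fd δ) (Fd1 δ x) x := by
  unfold Fd Fd1
  have h1 : HasDerivAt (fun x : ℝ => x ^ 2 + δ ^ 2) (2 * x) x := by
    simpa using (hasDerivAt_pow 2 x).add_const (δ ^ 2)
  have := h1.sqrt (by positivity)
  convert this using 1
  have := Fd_pos hδ x
  field_simp

lemma Fd1_hasDeriv (hδ : 0 < δ) (x : ℝ) : HasDerivAt (Fd1 δ) (Fd2 δ x) x := by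
  have h0 := Fd_pos hδ x
  have := (hasDerivAt_id x).div (Fd_hasDeriv hδ x) h0.ne'
  refine HasDerivAt.congr_deriv (f := Fd1 δ) this ?_
  unfold Fd2 Fd1 Fd
  have h2 := Fd_sq hδ x
  set s := √(x ^ 2 + δ ^ 2)
  have : δ ^ 2 = s ^ 2 - x ^ 2 := by linarith
  rw [this]
  simp only [id]
  field_simp

lemma Fd2_hasDeriv (hδ : 0 < δ) (x : ℝ) : HasDerivAt (Fd2 δ) (Fd3 δ x) x := by
  have h0 := Fd_pos hδ x
  have := (hasDerivAt_const x (δ ^ 2)).div ((Fd_hasDeriv hδ x).pow 3) (pow_ne_zero 3 h0.ne')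
  refine HasDerivAt.congr_deriv (f := Fd2 δ) this ?_
  unfold Fd3 Fd1 Fd
  simp only [Pi.pow_apply]
  set s := √(x ^ 2 + δ ^ 2)
  field_simp
  ring

lemma Fd1_abs (hδ : 0 < δ) (x : ℝ) : |Fd1 δ x| ≤ 1 := by
  unfold Fd1
  rw [abs_div, abs_of_pos (Fd_pos hδ x), div_le_one (Fd_pos hδ x)]
  exact Fd_abs_le δ x

lemma Fd2_nonneg (δ x : ℝ) : 0 ≤ Fd2 δ x := by unfold Fd2; positivity

lemma Fd2_le (hδ : 0 < δ) (x : ℝ) : Fd2 δ x ≤ 1 / δ := by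
  unfold Fd2
  have h := Fd_ge hδ x
  rw [div_le_div_iff₀ (pow_pos (Fd_pos hδ x) 3) hδ]
  calc δ ^ 2 * δ = δ ^ 3 := by ring
    _ ≤ 1 * √(x ^ 2 + δ ^ 2) ^ 3 := by rw [one_mul]; gcongr

lemma Fd2_abs (hδ : 0 < δ) (x : ℝ) : |Fd2 δ x| ≤ 1 / δ := by
  rw [abs_of_nonneg (Fd2_nonneg δ x)]; exact Fd2_le hδ x

lemma Fd3_abs (hδ : 0 < δ) (x : ℝ) : |Fd3 δ x| ≤ 3 / δ ^ 2 := by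
  unfold Fd3
  have h := Fd_ge hδ x
  have h' := Fd_abs_le δ x
  have h0 := Fd_pos hδ x
  set s := √(x ^ 2 + δ ^ 2)
  rw [abs_div, abs_neg, abs_mul, abs_of_pos (show 0 < 3 * δ ^ 2 by positivity), abs_of_pos (pow_pos h0 5),
    div_le_div_iff₀ (pow_pos h0 5) (by positivity)]
  calc 3 * δ ^ 2 * |x| * δ ^ 2 ≤ 3 * s ^ 2 * s * s ^ 2 := by gcongr
    _ = 3 * s ^ 5 := by ring

/-- third order Taylor estimate -/
lemma Fd_taylor (hδ : 0 < δ) (z h : ℝ) :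
    |Fd δ (z + h) - Fd δ z - Fd1 δ z * h - Fd2 δ z * h ^ 2 / 2| ≤ 3 / δ ^ 2 * |h| ^ 3 := by
  have hconv : Convex ℝ (uIcc 0 h) := convex_uIcc 0 h
  have habs : ∀ t ∈ uIcc 0 h, |t| ≤ |h| := by
    intro t ht
    have := abs_sub_left_of_mem_uIcc ht
    simpa using this
  have h0 : (0:ℝ) ∈ uIcc 0 h := left_mem_uIcc
  have d2 : ∀ t ∈ uIcc 0 h, |Fd2 δ (z + t) - Fd2 δ z| ≤ 3 / δ ^ 2 * |h| := by
    intro t ht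
    have := Convex.norm_image_sub_le_of_norm_hasDerivWithin_le (f := fun t => Fd2 δ (z + t)) (f' := fun t => Fd3 δ (z + t))
      (C := 3 / δ ^ 2) (s := univ) (x := 0) (y := t)
      (fun x _ => ((Fd2_hasDeriv hδ (z + x)).comp_const_add z x).hasDerivWithinAt)
      (fun x _ => Fd3_abs hδ _) convex_univ (mem_univ _) (mem_univ _)
    simp only [add_zero, sub_zero, Real.norm_eq_abs] at this
    exact this.trans (mul_le_mul_of_nonneg_left (habs t ht) (by positivity))
  have d1 : ∀ t ∈ uIcc 0 h, |Fd1 δ (z + t) - Fd1 δ z - Fd2 δ z * t| ≤ 3 / δ ^ 2 * |h| ^ 2 := by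
    intro t ht
    have := Convex.norm_image_sub_le_of_norm_hasDerivWithin_le (f := fun t => Fd1 δ (z + t) - Fd1 δ z - Fd2 δ z * t)
      (f' := fun t => Fd2 δ (z + t) - Fd2 δ z)
      (C := 3 / δ ^ 2 * |h|) (s := uIcc 0 h) (x := 0) (y := t)
      (fun x _ => by
        have a := (((Fd1_hasDeriv hδ (z + x)).comp_const_add z x).sub_const (Fd1 δ z)).sub
          ((hasDerivAt_id x).const_mul (Fd2 δ z))
        rw [mul_one] at a
        exact a.hasDerivWithinAt)
      (fun x hx => d2 x hx) hconv h0 ht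
    simp only [add_zero, sub_zero, Real.norm_eq_abs, mul_zero, sub_self] at this
    refine this.trans ?_
    have := mul_le_mul_of_nonneg_left (habs t ht) (show 0 ≤ 3 / δ ^ 2 * |h| by positivity)
    calc _ ≤ _ := this
      _ = _ := by ring
  have := Convex.norm_image_sub_le_of_norm_hasDerivWithin_le
      (f := fun t => Fd δ (z + t) - Fd δ z - Fd1 δ z * t - Fd2 δ z * t ^ 2 / 2)
      (f' := fun t => Fd1 δ (z + t) - Fd1 δ z - Fd2 δ z * t)
      (C := 3 / δ ^ 2 * |h| ^ 2) (s := uIcc 0 h) (x := 0) (y := h)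
      (fun x _ => by
        have a := ((((Fd_hasDeriv hδ (z + x)).comp_const_add z x).sub_const (Fd δ z)).sub
          ((hasDerivAt_id x).const_mul (Fd1 δ z))).sub (((hasDerivAt_pow 2 x).const_mul (Fd2 δ z)).div_const 2)
        have e : Fd1 δ (z + x) - Fd1 δ z * 1 - Fd2 δ z * (((2:ℕ):ℝ) * x ^ (2-1)) / 2 =
          Fd1 δ (z + x) - Fd1 δ z - Fd2 δ z * x := by norm_num; ring
        rw [e] at a
        exact a.hasDerivWithinAt)
      (fun x hx => d1 x hx) hconv h0 right_mem_uIcc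
  simp only [add_zero, sub_zero, Real.norm_eq_abs, mul_zero, sub_self] at this
  norm_num at this
  calc _ ≤ _ := this
    _ = _ := by rw [← sq_abs h]; ring

lemma Fd_cont (δ : ℝ) : Continuous (Fd δ) := by unfold Fd; fun_prop
lemma Fd1_cont (hδ : 0 < δ) : Continuous (Fd1 δ) :=
  continuous_iff_continuousAt.2 fun x => (Fd1_hasDeriv hδ x).continuousAt
lemma Fd2_cont (hδ : 0 < δ) : Continuous (Fd2 δ) :=
  continuous_iff_continuousAt.2 fun x => (Fd2_hasDeriv hδ x).continuousAt

/-- second derivative at least `1/(4δ)` on `|x| ≤ δ` -/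
lemma Fd2_ge (hδ : 0 < δ) {x : ℝ} (hx : |x| ≤ δ) : 1 / (4 * δ) ≤ Fd2 δ x := by
  unfold Fd2
  have h0 := Fd_pos hδ x
  have h2 : √(x ^ 2 + δ ^ 2) ≤ 3 / 2 * δ := by
    rw [Real.sqrt_le_left (by positivity)]
    nlinarith [sq_abs x, abs_nonneg x]
  rw [div_le_div_iff₀ (by positivity) (by positivity)]
  calc 1 * √(x ^ 2 + δ ^ 2) ^ 3 ≤ 1 * (3 / 2 * δ) ^ 3 := by gcongr
    _ ≤ δ ^ 2 * (4 * δ) := by nlinarith [pow_pos hδ 3]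

/-- difference quotient of `F'` -/
lemma Fd1_diff (hδ : 0 < δ) (z z' : ℝ) :
    (z - z') * ∫ θ in (0:ℝ)..1, Fd2 δ (z' + θ * (z - z')) = Fd1 δ z - Fd1 δ z' := by
  have := intervalIntegral.integral_eq_sub_of_hasDerivAt (a := 0) (b := 1)
    (f := fun θ => Fd1 δ (z' + θ * (z - z'))) (f' := fun θ => (z - z') * Fd2 δ (z' + θ * (z - z')))
    (fun θ _ => by
      have a := (Fd1_hasDeriv hδ (z' + θ * (z - z'))).comp θ
        (((hasDerivAt_id θ).mul_const (z - z')).const_add z')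
      simp only [one_mul] at a
      rw [mul_comm] at a
      exact a)
    (by
      apply Continuous.intervalIntegrable
      have := Fd2_cont hδ
      fun_prop)
  rw [intervalIntegral.integral_const_mul] at this
  rw [this]; simp

/-- if `z > 0 ≥ z'` (or conversely) and `|z| > δ`, then `1 ≤ 2 |z - z'| ∫ F''` -/
lemma Fd2_opp (hδ : 0 < δ) {z z' : ℝ} (hz : δ < |z|) (hopp : psgn z ≠ psgn z') :
    1 ≤ 2 * |z - z'| * ∫ θ in (0:ℝ)..1, Fd2 δ (z' + θ * (z - z')) := by
  have hnn : 0 ≤ ∫ θ in (0:ℝ)..1, Fd2 δ (z' + θ * (z - z')) :=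
    intervalIntegral.integral_nonneg zero_le_one fun _ _ => Fd2_nonneg _ _
  have e : |z - z'| * ∫ θ in (0:ℝ)..1, Fd2 δ (z' + θ * (z - z')) = |Fd1 δ z - Fd1 δ z'| := by
    rw [← Fd1_diff hδ, abs_mul, abs_of_nonneg hnn]
  rw [mul_assoc, e]
  have hb : 1 / 2 ≤ |Fd1 δ z| := by
    unfold Fd1
    rw [abs_div, abs_of_pos (Fd_pos hδ z), div_le_div_iff₀ (by norm_num) (Fd_pos hδ z)]
    have : √(z ^ 2 + δ ^ 2) ≤ |z| * 2 := by
      rw [Real.sqrt_le_left (by positivity)]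
      nlinarith [sq_abs z, abs_nonneg z]
    linarith
  have hs : ∀ x, 0 < x → 0 ≤ Fd1 δ x := fun x hx => by unfold Fd1; positivity
  have hs' : ∀ x, x ≤ 0 → Fd1 δ x ≤ 0 := fun x hx =>
    div_nonpos_of_nonpos_of_nonneg hx (Real.sqrt_nonneg _)
  unfold psgn at hopp
  by_cases h1 : 0 < z <;> by_cases h2 : 0 < z' <;> simp [h1, h2] at hopp
  · have := hs z h1
    have h3 := hs' z' (not_lt.1 h2)
    rw [abs_of_nonneg this] at hb
    rw [abs_of_nonneg (by linarith)]; linarith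
  · have := hs' z (not_lt.1 h1)
    have h3 := hs z' h2
    rw [abs_of_nonpos this] at hb
    rw [abs_of_nonpos (by linarith)]; linarith

/-- geometric scales: the sum of `F''` over dyadic scales is at most `C/|x|`. -/
lemma Fd2_scales (J : ℕ) (x : ℝ) (hx : x ≠ 0) :
    ∑ j ∈ Finset.range J, Fd2 ((1/2 : ℝ) ^ j) x ≤ 4 / |x| := by
  have hx0 : 0 < |x| := abs_pos.2 hx
  set g : ℕ → ℝ := fun j => (1/2 : ℝ) ^ j / (|x| + (1/2 : ℝ) ^ j) with hg
  have key : ∀ j, Fd2 ((1/2 : ℝ) ^ j) x ≤ 4 / |x| * (g j - g (j + 1)) := by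
    intro j
    simp only [hg, pow_succ]
    have hη : 0 < (1/2 : ℝ) ^ j := by positivity
    set η := (1/2 : ℝ) ^ j
    have h1 := Fd_pos hη x
    have h2 := Fd_sq hη x
    have h3 := Fd_ge hη x
    unfold Fd2
    set s := √(x ^ 2 + η ^ 2)
    have e : 4 / |x| * (η / (|x| + η) - η * (1/2) / (|x| + η * (1/2))) =
        2 * η / ((|x| + η) * (|x| + η * (1/2))) := by
      field_simp
      ring
    rw [e]
    have : 2 * η / ((|x| + η) * (|x| + η)) ≤ 2 * η / ((|x| + η) * (|x| + η * (1/2))) := by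
      gcongr; linarith
    refine le_trans ?_ this
    rw [div_le_div_iff₀ (by positivity) (by positivity)]
    have h4 : (|x| + η) * (|x| + η) ≤ 2 * s ^ 2 := by
      rw [h2]; nlinarith [sq_abs x, sq_nonneg (|x| - η)]
    calc η ^ 2 * ((|x| + η) * (|x| + η)) ≤ η * s * (2 * s ^ 2) := by
          rw [sq]; gcongr
      _ = 2 * η * s ^ 3 := by ring
  calc _ ≤ ∑ j ∈ Finset.range J, 4 / |x| * (g j - g (j + 1)) := Finset.sum_le_sum fun j _ => key j
    _ = 4 / |x| * (g 0 - g J) := by rw [← Finset.mul_sum, Finset.sum_range_sub']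
    _ ≤ 4 / |x| * 1 := by
        have h1 : 0 ≤ g J := by simp only [hg]; positivity
        have h2 : g 0 ≤ 1 := by
          simp only [hg, pow_zero]; rw [div_le_one (by positivity)]; linarith
        gcongr; linarith
    _ = _ := by ring
end Fd
end

section
/-! ### One-step expansion -/

def CT (B : ℝ) : ℝ := 3 / 2 * (9 * B ^ 2 + 27 * B ^ 4 * (1 + 2 * c4)) + B ^ 2

lemma CT_nonneg (B : ℝ) : 0 ≤ CT B := by
  have := c4_nonneg
  unfold CT; positivity

lemma intadd {Ω : Type*} [m : MeasurableSpace Ω] {μ : Measure Ω} {f g : Ω → ℝ} (hf : Integrable f μ) (hg : Integrable g μ) :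
    Integrable (fun ω => f ω + g ω) μ := hf.add hg

section Step
variable {μ : Measure Ω} [IsProbabilityMeasure μ] {H : ℕ → MeasurableSpace Ω}
  {ξ η : ℕ → Ω → ℝ} {Δ : ℕ → ℝ} {N : ℕ}

lemma cube_le {c : ℝ} (hc : 0 < c) (x : ℝ) : |x| ^ 3 ≤ (c * x ^ 2 + x ^ 4 / c) / 2 := by
  have e : (c * x ^ 2 + x ^ 4 / c) / 2 - |x| ^ 3 = |x| ^ 2 * (c - |x|) ^ 2 / (2 * c) := by
    rw [show x ^ 4 = (|x| ^ 2) ^ 2 by rw [sq_abs]; ring, ← sq_abs x]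
    field_simp
    ring
  have : 0 ≤ |x| ^ 2 * (c - |x|) ^ 2 / (2 * c) := by positivity
  linarith

lemma Inc.moments (h : Inc H μ ξ η Δ N) {k : ℕ} (hk : k < N) (hΔ1 : Δ k ≤ 1)
    {b r₁ r₂ : Ω → ℝ} {B : ℝ} (hb : Measurable b) (h1 : Measurable r₁)
    (h2 : Measurable r₂) (hbB : ∀ ω, |b ω| ≤ B) (h1B : ∀ ω, |r₁ ω| ≤ B) (h2B : ∀ ω, |r₂ ω| ≤ B) :
    (Integrable (fun ω => (b ω * Δ k + (r₁ ω * ξ k ω + r₂ ω * η k ω)) ^ 2) μ ∧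
      ∫ ω, (b ω * Δ k + (r₁ ω * ξ k ω + r₂ ω * η k ω)) ^ 2 ∂μ ≤ 9 * B ^ 2 * Δ k) ∧
    (Integrable (fun ω => (b ω * Δ k + (r₁ ω * ξ k ω + r₂ ω * η k ω)) ^ 4) μ ∧
      ∫ ω, (b ω * Δ k + (r₁ ω * ξ k ω + r₂ ω * η k ω)) ^ 4 ∂μ ≤ 27 * B ^ 4 * (1 + 2 * c4) * Δ k ^ 2) := by
  have hc := h.cl k hk
  have hΔ0 := h.pos k
  have hm1 : Measurable (ξ k) := (h.m1 k hk).mono (h.le _) le_rfl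
  have hm2 : Measurable (η k) := (h.m2 k hk).mono (h.le _) le_rfl
  have mm : Measurable (fun ω => b ω * Δ k + (r₁ ω * ξ k ω + r₂ ω * η k ω)) := by fun_prop
  have i1 : Integrable (fun ω => ξ k ω ^ 2) μ := hc.integrable' (f := fun p => p.1 ^ 2) (by fun_prop) (gam2_integrable_fst _ 2)
  have i2 : Integrable (fun ω => η k ω ^ 2) μ := hc.integrable' (f := fun p => p.2 ^ 2) (by fun_prop) (gam2_integrable_snd _ 2)
  have i3 : Integrable (fun ω => ξ k ω ^ 4) μ := hc.integrable' (f := fun p => p.1 ^ 4) (by fun_prop) (gam2_integrable_fst _ 4)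
  have i4 : Integrable (fun ω => η k ω ^ 4) μ := hc.integrable' (f := fun p => p.2 ^ 4) (by fun_prop) (gam2_integrable_snd _ 4)
  have v1 : ∫ ω, ξ k ω ^ 2 ∂μ = Δ k := by
    rw [hc.integral' (f := fun p => p.1 ^ 2) (by fun_prop), gam2_int_fst _ (fun x => x ^ 2) (by fun_prop), gam_integral_sq hΔ0]
  have v2 : ∫ ω, η k ω ^ 2 ∂μ = Δ k := by
    rw [hc.integral' (f := fun p => p.2 ^ 2) (by fun_prop), gam2_int_snd _ (fun x => x ^ 2) (by fun_prop), gam_integral_sq hΔ0]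
  have v3 : ∫ ω, ξ k ω ^ 4 ∂μ = c4 * Δ k ^ 2 := by
    rw [hc.integral' (f := fun p => p.1 ^ 4) (by fun_prop), gam2_int_fst _ (fun x => x ^ 4) (by fun_prop), gam_integral_four hΔ0]
  have v4 : ∫ ω, η k ω ^ 4 ∂μ = c4 * Δ k ^ 2 := by
    rw [hc.integral' (f := fun p => p.2 ^ 4) (by fun_prop), gam2_int_snd _ (fun x => x ^ 4) (by fun_prop), gam_integral_four hΔ0]
  have sqb : ∀ x : ℝ, |x| ≤ B → x ^ 2 ≤ B ^ 2 := fun x hx => by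
    rw [← sq_abs]; exact pow_le_pow_left₀ (abs_nonneg _) hx 2
  have pt2 : ∀ ω, (b ω * Δ k + (r₁ ω * ξ k ω + r₂ ω * η k ω)) ^ 2 ≤
      3 * B ^ 2 * (Δ k ^ 2 + (ξ k ω ^ 2 + η k ω ^ 2)) := by
    intro ω
    have a1 := mul_le_mul_of_nonneg_right (sqb _ (hbB ω)) (sq_nonneg (Δ k))
    have a2 := mul_le_mul_of_nonneg_right (sqb _ (h1B ω)) (sq_nonneg (ξ k ω))
    have a3 := mul_le_mul_of_nonneg_right (sqb _ (h2B ω)) (sq_nonneg (η k ω))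
    nlinarith [sq_nonneg (b ω * Δ k - r₁ ω * ξ k ω), sq_nonneg (b ω * Δ k - r₂ ω * η k ω),
      sq_nonneg (r₁ ω * ξ k ω - r₂ ω * η k ω)]
  have pt4 : ∀ ω, (b ω * Δ k + (r₁ ω * ξ k ω + r₂ ω * η k ω)) ^ 4 ≤
      27 * B ^ 4 * (Δ k ^ 4 + (ξ k ω ^ 4 + η k ω ^ 4)) := by
    intro ω
    have a := pow_le_pow_left₀ (sq_nonneg _) (pt2 ω) 2
    have : (Δ k ^ 2 + (ξ k ω ^ 2 + η k ω ^ 2)) ^ 2 ≤ 3 * (Δ k ^ 4 + (ξ k ω ^ 4 + η k ω ^ 4)) := by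
      nlinarith [sq_nonneg (Δ k ^ 2 - ξ k ω ^ 2), sq_nonneg (Δ k ^ 2 - η k ω ^ 2), sq_nonneg (ξ k ω ^ 2 - η k ω ^ 2)]
    calc _ = ((b ω * Δ k + (r₁ ω * ξ k ω + r₂ ω * η k ω)) ^ 2) ^ 2 := by ring
      _ ≤ _ := a
      _ = 9 * B ^ 4 * (Δ k ^ 2 + (ξ k ω ^ 2 + η k ω ^ 2)) ^ 2 := by ring
      _ ≤ 9 * B ^ 4 * (3 * (Δ k ^ 4 + (ξ k ω ^ 4 + η k ω ^ 4))) := by gcongr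
      _ = _ := by ring
  have g2 : Integrable (fun ω => 3 * B ^ 2 * (Δ k ^ 2 + (ξ k ω ^ 2 + η k ω ^ 2))) μ :=
    ((integrable_const _).add (i1.add i2)).const_mul _
  have g4 : Integrable (fun ω => 27 * B ^ 4 * (Δ k ^ 4 + (ξ k ω ^ 4 + η k ω ^ 4))) μ :=
    ((integrable_const _).add (i3.add i4)).const_mul _
  have f2 : Integrable (fun ω => (b ω * Δ k + (r₁ ω * ξ k ω + r₂ ω * η k ω)) ^ 2) μ :=
    g2.mono' (mm.pow_const 2).aestronglyMeasurable (ae_of_all _ fun ω => by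
      rw [Real.norm_eq_abs, abs_of_nonneg (by positivity)]; exact pt2 ω)
  have f4 : Integrable (fun ω => (b ω * Δ k + (r₁ ω * ξ k ω + r₂ ω * η k ω)) ^ 4) μ :=
    g4.mono' (mm.pow_const 4).aestronglyMeasurable (ae_of_all _ fun ω => by
      rw [Real.norm_eq_abs, abs_of_nonneg (by positivity)]; exact pt4 ω)
  refine ⟨⟨f2, ?_⟩, ⟨f4, ?_⟩⟩
  · refine (integral_mono f2 g2 pt2).trans ?_
    rw [integral_const_mul, integral_add (integrable_const _) (intadd i1 i2), integral_add i1 i2, v1, v2]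
    simp only [integral_const, probReal_univ, one_smul]
    have : Δ k ^ 2 ≤ Δ k := by nlinarith
    nlinarith [sq_nonneg B]
  · refine (integral_mono f4 g4 pt4).trans ?_
    rw [integral_const_mul, integral_add (integrable_const _) (intadd i3 i4), integral_add i3 i4, v3, v4]
    simp only [integral_const, probReal_univ, one_smul]
    have : Δ k ^ 4 ≤ Δ k ^ 2 := pow_le_pow_of_le_one hΔ0 hΔ1 (by norm_num)
    have hB : 0 ≤ 27 * B ^ 4 := by positivity
    calc _ ≤ 27 * B ^ 4 * (Δ k ^ 2 + (c4 * Δ k ^ 2 + c4 * Δ k ^ 2)) := by gcongr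
      _ = _ := by ring

lemma Inc.step (h : Inc H μ ξ η Δ N) {k : ℕ} (hk : k < N) (hΔ : 0 < Δ k) (hΔ1 : Δ k ≤ 1)
    {Z b r₁ r₂ : Ω → ℝ} {B : ℝ} (hZ : Measurable[H k] Z) (hZi : Integrable Z μ)
    (hb : Measurable[H k] b) (h1 : Measurable[H k] r₁) (h2 : Measurable[H k] r₂)
    (hbB : ∀ ω, |b ω| ≤ B) (h1B : ∀ ω, |r₁ ω| ≤ B) (h2B : ∀ ω, |r₂ ω| ≤ B) {δ : ℝ} (hδ : 0 < δ) (hδ1 : δ ≤ 1) :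
    |∫ ω, Fd δ (Z ω + (b ω * Δ k + (r₁ ω * ξ k ω + r₂ ω * η k ω))) ∂μ - ∫ ω, Fd δ (Z ω) ∂μ
      - Δ k * ∫ ω, Fd1 δ (Z ω) * b ω ∂μ - Δ k / 2 * ∫ ω, Fd2 δ (Z ω) * (r₁ ω ^ 2 + r₂ ω ^ 2) ∂μ|
    ≤ CT B * (Δ k * √(Δ k)) / δ ^ 2 := by
  have hm1 : Measurable (ξ k) := (h.m1 k hk).mono (h.le _) le_rfl
  have hm2 : Measurable (η k) := (h.m2 k hk).mono (h.le _) le_rfl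
  have hZ' : Measurable Z := hZ.mono (h.le _) le_rfl
  have hb' : Measurable b := hb.mono (h.le _) le_rfl
  have h1' : Measurable r₁ := h1.mono (h.le _) le_rfl
  have h2' : Measurable r₂ := h2.mono (h.le _) le_rfl
  obtain ⟨⟨q2, q2'⟩, ⟨q4, q4'⟩⟩ := h.moments hk hΔ1 hb' h1' h2' hbB h1B h2B
  set hh : Ω → ℝ := fun ω => b ω * Δ k + (r₁ ω * ξ k ω + r₂ ω * η k ω) with hhd
  have hhm : Measurable hh := by fun_prop
  have hF1m : Measurable[H k] (fun ω => Fd1 δ (Z ω)) := (Fd1_cont hδ).measurable.comp hZ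
  have hF2m : Measurable[H k] (fun ω => Fd2 δ (Z ω)) := (Fd2_cont hδ).measurable.comp hZ
  have hF1m' : Measurable (fun ω => Fd1 δ (Z ω)) := hF1m.mono (h.le _) le_rfl
  have hF2m' : Measurable (fun ω => Fd2 δ (Z ω)) := hF2m.mono (h.le _) le_rfl
  have hΩ : Nonempty Ω := by
    by_contra hne
    rw [not_nonempty_iff] at hne
    have := measure_univ (μ := μ)
    rw [univ_eq_empty_iff.2 hne] at this; simp at this
  have hB0 : 0 ≤ B := (abs_nonneg _).trans (hbB hΩ.some)
  have bdd : ∀ {u v : Ω → ℝ} {C D : ℝ}, Measurable u → Measurable v → (∀ ω, |u ω| ≤ C) → (∀ ω, |v ω| ≤ D) →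
      Integrable (fun ω => u ω * v ω) μ := fun {u v C D} hu hv hC hD =>
    integrable_of_bdd (C := C * D) (hu.mul hv) fun ω => by
      rw [abs_mul]; exact mul_le_mul (hC ω) (hD ω) (abs_nonneg _) ((abs_nonneg _).trans (hC ω))
  have sqb : ∀ x : ℝ, |x| ≤ B → |x ^ 2| ≤ B ^ 2 := fun x hx => by
    rw [abs_pow]; exact pow_le_pow_left₀ (abs_nonneg _) hx 2
  -- first order term
  have iF1b := bdd hF1m' hb' (fun ω => Fd1_abs hδ _) hbB
  have iF1r1 := bdd hF1m' h1' (fun ω => Fd1_abs hδ _) h1B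
  have iF1r2 := bdd hF1m' h2' (fun ω => Fd1_abs hδ _) h2B
  have m11 : Measurable[H k] (fun ω => Fd1 δ (Z ω) * r₁ ω) := hF1m.mul h1
  have m12 : Measurable[H k] (fun ω => Fd1 δ (Z ω) * r₂ ω) := hF1m.mul h2
  have t11 := (h.ints hk m11 iF1r1).1
  have t12 := (h.ints hk m12 iF1r2).2.1
  have e1 : ∫ ω, Fd1 δ (Z ω) * hh ω ∂μ = Δ k * ∫ ω, Fd1 δ (Z ω) * b ω ∂μ := by
    have : ∀ ω, Fd1 δ (Z ω) * hh ω = Δ k * (Fd1 δ (Z ω) * b ω) + (Fd1 δ (Z ω) * r₁ ω * ξ k ω +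
        Fd1 δ (Z ω) * r₂ ω * η k ω) := fun ω => by simp only [hhd]; ring
    simp_rw [this]
    rw [integral_add (iF1b.const_mul _) (intadd t11 t12), integral_add t11 t12, integral_const_mul,
      (h.mean hk m11).1, (h.mean hk m12).2]
    ring
  -- second order term
  have hF2B : ∀ ω, |Fd2 δ (Z ω)| ≤ 1 / δ := fun ω => Fd2_abs hδ _
  have b2 : ∀ {u v : Ω → ℝ}, Measurable u → Measurable v → (∀ ω, |u ω| ≤ B) → (∀ ω, |v ω| ≤ B) →
      Integrable (fun ω => Fd2 δ (Z ω) * (u ω * v ω)) μ := fun {u v} hu hv hC hD =>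
    bdd (C := 1 / δ) (D := B * B) hF2m' (hu.mul hv) hF2B fun ω => by
      rw [abs_mul]; exact mul_le_mul (hC ω) (hD ω) (abs_nonneg _) hB0
  have nbb : Measurable[H k] (fun ω => Fd2 δ (Z ω) * (b ω * r₁ ω)) := hF2m.mul (hb.mul h1)
  have nb2 : Measurable[H k] (fun ω => Fd2 δ (Z ω) * (b ω * r₂ ω)) := hF2m.mul (hb.mul h2)
  have n11 : Measurable[H k] (fun ω => Fd2 δ (Z ω) * (r₁ ω * r₁ ω)) := hF2m.mul (h1.mul h1)
  have n22 : Measurable[H k] (fun ω => Fd2 δ (Z ω) * (r₂ ω * r₂ ω)) := hF2m.mul (h2.mul h2)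
  have n12 : Measurable[H k] (fun ω => Fd2 δ (Z ω) * (r₁ ω * r₂ ω)) := hF2m.mul (h1.mul h2)
  have s0 := (b2 hb' hb' hbB hbB).const_mul (Δ k ^ 2)
  have s1 := (h.ints hk nbb (b2 hb' h1' hbB h1B)).1.const_mul (2 * Δ k)
  have s2 := (h.ints hk nb2 (b2 hb' h2' hbB h2B)).2.1.const_mul (2 * Δ k)
  have s3 := (h.ints hk n11 (b2 h1' h1' h1B h1B)).2.2.1
  have s4 := (h.ints hk n22 (b2 h2' h2' h2B h2B)).2.2.2.1
  have s5 := (h.ints hk n12 (b2 h1' h2' h1B h2B)).2.2.2.2.const_mul 2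
  have s45 := s4.add s5
  have s345 := s3.add s45
  have s2345 := s2.add s345
  have s12345 := s1.add s2345
  have s012345 := s0.add s12345
  simp only [Pi.add_def] at s45 s345 s2345 s12345 s012345
  have e2' : ∀ ω, Fd2 δ (Z ω) * hh ω ^ 2 = Δ k ^ 2 * (Fd2 δ (Z ω) * (b ω * b ω)) +
      (2 * Δ k * (Fd2 δ (Z ω) * (b ω * r₁ ω) * ξ k ω) + (2 * Δ k * (Fd2 δ (Z ω) * (b ω * r₂ ω) * η k ω) +
      (Fd2 δ (Z ω) * (r₁ ω * r₁ ω) * ξ k ω ^ 2 + (Fd2 δ (Z ω) * (r₂ ω * r₂ ω) * η k ω ^ 2 +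
      2 * (Fd2 δ (Z ω) * (r₁ ω * r₂ ω) * (ξ k ω * η k ω)))))) := fun ω => by simp only [hhd]; ring
  have iF2h : Integrable (fun ω => Fd2 δ (Z ω) * hh ω ^ 2) μ := by simp_rw [e2']; exact s012345
  have e2 : ∫ ω, Fd2 δ (Z ω) * hh ω ^ 2 ∂μ = Δ k ^ 2 * (∫ ω, Fd2 δ (Z ω) * (b ω * b ω) ∂μ) +
      Δ k * ∫ ω, Fd2 δ (Z ω) * (r₁ ω ^ 2 + r₂ ω ^ 2) ∂μ := by
    have e3 : ∫ ω, Fd2 δ (Z ω) * (r₁ ω ^ 2 + r₂ ω ^ 2) ∂μ =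
        ∫ ω, Fd2 δ (Z ω) * (r₁ ω * r₁ ω) ∂μ + ∫ ω, Fd2 δ (Z ω) * (r₂ ω * r₂ ω) ∂μ := by
      rw [← integral_add (b2 h1' h1' h1B h1B) (b2 h2' h2' h2B h2B)]
      congr 1; ext ω; ring
    simp_rw [e2']
    rw [e3, integral_add s0 s12345, integral_add s1 s2345, integral_add s2 s345, integral_add s3 s45,
      integral_add s4 s5, integral_const_mul, integral_const_mul, integral_const_mul, integral_const_mul,
      (h.mean hk nbb).1, (h.mean hk nb2).2, (h.var hk n11).1, (h.var hk n22).2.1, (h.var hk n12).2.2]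
    ring
  -- integrability of the main terms
  have ihh : Integrable hh μ := ((memLp_two_iff_integrable_sq hhm.aestronglyMeasurable).2 q2).integrable (by norm_num)
  have iF : ∀ {V : Ω → ℝ}, Measurable V → Integrable V μ → Integrable (fun ω => Fd δ (V ω)) μ := fun {V} hV hVi => by
    refine (hVi.abs.add (integrable_const δ)).mono' ((Fd_cont δ).measurable.comp hV).aestronglyMeasurable
      (ae_of_all _ fun ω => ?_)
    rw [Real.norm_eq_abs, abs_of_nonneg (show 0 ≤ Fd δ (V ω) from Real.sqrt_nonneg _)]
    exact Fd_le hδ _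
  have iA := iF (hZ'.add hhm) (hZi.add ihh)
  have iB := iF hZ' hZi
  have iC : Integrable (fun ω => Fd1 δ (Z ω) * hh ω) μ :=
    ihh.bdd_mul hF1m'.aestronglyMeasurable (ae_of_all _ fun ω => Fd1_abs hδ _)
  simp only [Pi.add_apply] at iA
  have iAB := iA.sub iB
  have iABC := iAB.sub iC
  have iD := iF2h.div_const 2
  simp only [Pi.sub_def] at iAB iABC
  have hT : |∫ ω, (Fd δ (Z ω + hh ω) - Fd δ (Z ω) - Fd1 δ (Z ω) * hh ω - Fd2 δ (Z ω) * hh ω ^ 2 / 2) ∂μ| ≤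
      3 / δ ^ 2 * ((√(Δ k) * (9 * B ^ 2 * Δ k) + (27 * B ^ 4 * (1 + 2 * c4) * Δ k ^ 2) / √(Δ k)) / 2) := by
    have hs : 0 < √(Δ k) := Real.sqrt_pos.2 hΔ
    have ir := ((q2.const_mul (√(Δ k))).add (q4.div_const (√(Δ k)))).div_const 2
    simp only [Pi.add_def] at ir
    have ir' := ir.const_mul (3 / δ ^ 2)
    rw [← Real.norm_eq_abs]
    refine (norm_integral_le_of_norm_le ir' (ae_of_all _ fun ω => ?_)).trans ?_
    · rw [Real.norm_eq_abs]
      exact (Fd_taylor hδ _ _).trans (mul_le_mul_of_nonneg_left (cube_le hs _) (by positivity))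
    · rw [integral_const_mul, integral_div, integral_add (q2.const_mul _) (q4.div_const _), integral_const_mul,
        integral_div]
      gcongr
  have hsplit : ∫ ω, (Fd δ (Z ω + hh ω) - Fd δ (Z ω) - Fd1 δ (Z ω) * hh ω - Fd2 δ (Z ω) * hh ω ^ 2 / 2) ∂μ =
      ∫ ω, Fd δ (Z ω + hh ω) ∂μ - ∫ ω, Fd δ (Z ω) ∂μ - Δ k * ∫ ω, Fd1 δ (Z ω) * b ω ∂μ -
      (Δ k ^ 2 * (∫ ω, Fd2 δ (Z ω) * (b ω * b ω) ∂μ) +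
      Δ k * ∫ ω, Fd2 δ (Z ω) * (r₁ ω ^ 2 + r₂ ω ^ 2) ∂μ) / 2 := by
    rw [integral_sub iABC iD, integral_sub iAB iC, integral_sub iA iB, integral_div, e1, e2]
  rw [hsplit] at hT
  have hbb : |∫ ω, Fd2 δ (Z ω) * (b ω * b ω) ∂μ| ≤ 1 / δ * B ^ 2 := by
    have := norm_integral_le_of_norm_le_const (μ := μ) (f := fun ω => Fd2 δ (Z ω) * (b ω * b ω)) (C := 1 / δ * B ^ 2)
      (ae_of_all _ fun ω => by
        rw [norm_mul, ← sq]
        exact mul_le_mul (hF2B ω) (sqb _ (hbB ω)) (norm_nonneg _) (by positivity))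
    simpa using this
  have hs : 0 < √(Δ k) := Real.sqrt_pos.2 hΔ
  have hss : √(Δ k) ^ 2 = Δ k := Real.sq_sqrt hΔ.le
  have hs1 : √(Δ k) ≤ 1 := Real.sqrt_le_one.2 hΔ1
  have hfin : 3 / δ ^ 2 * ((√(Δ k) * (9 * B ^ 2 * Δ k) + (27 * B ^ 4 * (1 + 2 * c4) * Δ k ^ 2) / √(Δ k)) / 2) =
      3 / 2 * (9 * B ^ 2 + 27 * B ^ 4 * (1 + 2 * c4)) * (Δ k * √(Δ k)) / δ ^ 2 := by
    have : Δ k ^ 2 / √(Δ k) = Δ k * √(Δ k) := by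
      rw [div_eq_iff hs.ne', mul_assoc, ← sq, hss, sq]
    rw [mul_div_assoc (27 * B ^ 4 * (1 + 2 * c4)), this]
    ring
  rw [hfin] at hT
  have hlast : |Δ k ^ 2 * (∫ ω, Fd2 δ (Z ω) * (b ω * b ω) ∂μ) / 2| ≤ B ^ 2 * (Δ k * √(Δ k)) / δ ^ 2 := by
    rw [abs_div, abs_mul, abs_of_pos (show (0:ℝ) < Δ k ^ 2 by positivity), abs_two]
    have a1 : Δ k ^ 2 ≤ Δ k * √(Δ k) := by
      rw [sq]; gcongr; nlinarith
    have a2 : 1 / δ ≤ 1 / δ ^ 2 := by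
      apply one_div_le_one_div_of_le (by positivity); nlinarith
    calc _ ≤ Δ k * √(Δ k) * (1 / δ ^ 2 * B ^ 2) / 2 := by
          gcongr
          exact hbb.trans (by gcongr)
      _ ≤ Δ k * √(Δ k) * (1 / δ ^ 2 * B ^ 2) := half_le_self (by positivity)
      _ = _ := by ring
  have hCT : CT B * (Δ k * √(Δ k)) / δ ^ 2 = 3 / 2 * (9 * B ^ 2 + 27 * B ^ 4 * (1 + 2 * c4)) * (Δ k * √(Δ k)) / δ ^ 2 +
      B ^ 2 * (Δ k * √(Δ k)) / δ ^ 2 := by unfold CT; ring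
  rw [hCT]
  have := abs_add_le (∫ ω, Fd δ (Z ω + hh ω) ∂μ - ∫ ω, Fd δ (Z ω) ∂μ - Δ k * ∫ ω, Fd1 δ (Z ω) * b ω ∂μ -
      (Δ k ^ 2 * (∫ ω, Fd2 δ (Z ω) * (b ω * b ω) ∂μ) +
      Δ k * ∫ ω, Fd2 δ (Z ω) * (r₁ ω ^ 2 + r₂ ω ^ 2) ∂μ) / 2) (Δ k ^ 2 * (∫ ω, Fd2 δ (Z ω) * (b ω * b ω) ∂μ) / 2)
  refine le_trans (le_of_eq ?_) (this.trans (add_le_add hT hlast))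
  congr 1
  ring

end Step
end

section
/-! ### Walks, Dynkin formula and occupation estimate -/

def walk {Ω : Type*} (z0 : ℝ) (b r₁ r₂ ξ η : ℕ → Ω → ℝ) (Δ : ℕ → ℝ) (k : ℕ) (ω : Ω) : ℝ :=
  z0 + ∑ i ∈ Finset.range k, (b i ω * Δ i + (r₁ i ω * ξ i ω + r₂ i ω * η i ω))

def CW (B T : ℝ) : ℝ := 2 * B ^ 2 * T ^ 2 + 4 * B ^ 2 * T
def Cocc (B T c : ℝ) : ℝ := 2 / c ^ 2 * (CW B T + 2 + B * T + CT B * T)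

/-- hypotheses on the coefficients of a walk -/
structure Coef {Ω : Type*} (H : ℕ → MeasurableSpace Ω) (b r₁ r₂ : ℕ → Ω → ℝ) (B : ℝ) (N : ℕ) : Prop where
  nn : 0 ≤ B
  mb : ∀ k < N, Measurable[H k] (b k)
  m1 : ∀ k < N, Measurable[H k] (r₁ k)
  m2 : ∀ k < N, Measurable[H k] (r₂ k)
  bb : ∀ k < N, ∀ ω, |b k ω| ≤ B
  b1 : ∀ k < N, ∀ ω, |r₁ k ω| ≤ B
  b2 : ∀ k < N, ∀ ω, |r₂ k ω| ≤ B

section Walk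
variable {μ : Measure Ω} [IsProbabilityMeasure μ] {H : ℕ → MeasurableSpace Ω}
  {ξ η : ℕ → Ω → ℝ} {Δ : ℕ → ℝ} {N : ℕ} {b r₁ r₂ : ℕ → Ω → ℝ} {B z0 : ℝ}

lemma walk_succ (k : ℕ) (ω : Ω) : walk z0 b r₁ r₂ ξ η Δ (k + 1) ω =
    walk z0 b r₁ r₂ ξ η Δ k ω + (b k ω * Δ k + (r₁ k ω * ξ k ω + r₂ k ω * η k ω)) := by
  unfold walk; rw [Finset.sum_range_succ]; ring

lemma walk_meas (h : Inc H μ ξ η Δ N) (hc : Coef H b r₁ r₂ B N) {K : ℕ} (hK : K ≤ N) :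
    Measurable[H K] (walk z0 b r₁ r₂ ξ η Δ K) := by
  unfold walk
  refine measurable_const.add (Finset.measurable_fun_sum _ fun k hk => ?_)
  have hk' : k < K := Finset.mem_range.1 hk
  have hkN := hk'.trans_le hK
  exact (((hc.mb k hkN).mono (h.mono hk'.le) le_rfl).mul measurable_const).add
    ((((hc.m1 k hkN).mono (h.mono hk'.le) le_rfl).mul ((h.m1 k hkN).mono (h.mono hk') le_rfl)).add
    (((hc.m2 k hkN).mono (h.mono hk'.le) le_rfl).mul ((h.m2 k hkN).mono (h.mono hk') le_rfl)))

lemma walk_meas' (h : Inc H μ ξ η Δ N) (hc : Coef H b r₁ r₂ B N) {K : ℕ} (hK : K ≤ N) :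
    Measurable (walk z0 b r₁ r₂ ξ η Δ K) := (walk_meas h hc hK).mono (h.le _) le_rfl

/-- second moment of increments of walks -/
lemma walk_incr (h : Inc H μ ξ η Δ N) (hc : Coef H b r₁ r₂ B N) {j K : ℕ} (hj : j ≤ K) (hK : K ≤ N)
    {T : ℝ} (hT : ∑ k ∈ Finset.Ico j K, Δ k ≤ T) :
    MemLp (fun ω => walk z0 b r₁ r₂ ξ η Δ K ω - walk z0 b r₁ r₂ ξ η Δ j ω) 2 μ ∧
    ∫ ω, (walk z0 b r₁ r₂ ξ η Δ K ω - walk z0 b r₁ r₂ ξ η Δ j ω) ^ 2 ∂μ ≤ CW B T := by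
  have hB := hc.nn
  have hT0 : 0 ≤ T := (Finset.sum_nonneg fun k _ => h.pos k).trans hT
  set a₁ : ℕ → Ω → ℝ := fun k ω => if j ≤ k then r₁ k ω else 0
  set a₂ : ℕ → Ω → ℝ := fun k ω => if j ≤ k then r₂ k ω else 0
  have ha1 : ∀ k < N, Measurable[H k] (a₁ k) := fun k hk => by
    by_cases hjk : j ≤ k
    · simpa [a₁, hjk] using hc.m1 k hk
    · simp only [a₁, hjk, if_false]; exact measurable_const
  have ha2 : ∀ k < N, Measurable[H k] (a₂ k) := fun k hk => by
    by_cases hjk : j ≤ k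
    · simpa [a₂, hjk] using hc.m2 k hk
    · simp only [a₂, hjk, if_false]; exact measurable_const
  have hb1 : ∀ k < N, ∀ ω, |a₁ k ω| ≤ B := fun k hk ω => by
    by_cases hjk : j ≤ k
    · simpa [a₁, hjk] using hc.b1 k hk ω
    · simpa [a₁, hjk] using hB
  have hb2 : ∀ k < N, ∀ ω, |a₂ k ω| ≤ B := fun k hk ω => by
    by_cases hjk : j ≤ k
    · simpa [a₂, hjk] using hc.b2 k hk ω
    · simpa [a₂, hjk] using hB
  have hL := h.memLpSum ha1 ha2 hb1 hb2 hK
  have hI := h.isometry ha1 ha2 hb1 hb2 hK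
  set M : Ω → ℝ := fun ω => ∑ k ∈ Finset.range K, (a₁ k ω * ξ k ω + a₂ k ω * η k ω) with hM
  set D : Ω → ℝ := fun ω => ∑ k ∈ Finset.Ico j K, b k ω * Δ k with hD
  have e : ∀ ω, walk z0 b r₁ r₂ ξ η Δ K ω - walk z0 b r₁ r₂ ξ η Δ j ω = D ω + M ω := by
    intro ω
    have e1 : M ω = ∑ k ∈ Finset.Ico j K, (r₁ k ω * ξ k ω + r₂ k ω * η k ω) := by
      simp only [hM]
      rw [← Finset.sum_range_add_sum_Ico _ hj, Finset.sum_eq_zero, zero_add]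
      · refine Finset.sum_congr rfl fun k hk => ?_
        have := (Finset.mem_Ico.1 hk).1
        simp [a₁, a₂, this]
      · intro k hk
        have := Finset.mem_range.1 hk
        simp [a₁, a₂, not_le.2 this]
    rw [e1]
    simp only [hD, walk]
    rw [← Finset.sum_add_distrib, ← Finset.sum_range_add_sum_Ico _ hj]
    ring
  have hDm : Measurable D := by
    refine Finset.measurable_fun_sum _ fun k hk => ?_
    have := (Finset.mem_Ico.1 hk).2
    exact ((hc.mb k (by omega)).mono (h.le _) le_rfl).mul measurable_const
  have hDb : ∀ ω, |D ω| ≤ B * T := by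
    intro ω
    refine (Finset.abs_sum_le_sum_abs _ _).trans ?_
    calc _ ≤ ∑ k ∈ Finset.Ico j K, B * Δ k := by
          refine Finset.sum_le_sum fun k hk => ?_
          have := (Finset.mem_Ico.1 hk).2
          rw [abs_mul, abs_of_nonneg (h.pos k)]
          exact mul_le_mul_of_nonneg_right (hc.bb k (by omega) ω) (h.pos k)
      _ = B * ∑ k ∈ Finset.Ico j K, Δ k := by rw [Finset.mul_sum]
      _ ≤ _ := by gcongr
  have hDL : MemLp D 2 μ := MemLp.of_bound hDm.aestronglyMeasurable (B * T) (ae_of_all _ hDb)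
  simp_rw [e]
  have hS : MemLp (fun ω => D ω + M ω) 2 μ := hDL.add hL
  refine ⟨hS, ?_⟩
  have hMs := hL.integrable_sq
  have hM2 : ∫ ω, M ω ^ 2 ∂μ ≤ 2 * B ^ 2 * T := by
    simp only [hM]
    rw [hI]
    calc _ ≤ ∑ k ∈ Finset.range K, (if j ≤ k then Δ k * (2 * B ^ 2) else 0) := by
          refine Finset.sum_le_sum fun k hk => ?_
          have hkN : k < N := (Finset.mem_range.1 hk).trans_le hK
          by_cases hjk : j ≤ k
          · simp only [hjk, if_true]
            refine mul_le_mul_of_nonneg_left ?_ (h.pos k)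
            have := norm_integral_le_of_norm_le_const (μ := μ) (f := fun ω => a₁ k ω ^ 2 + a₂ k ω ^ 2) (C := 2 * B ^ 2)
              (ae_of_all _ fun ω => by
                rw [Real.norm_eq_abs, abs_of_nonneg (by positivity)]
                have u1 := pow_le_pow_left₀ (abs_nonneg _) (hb1 k hkN ω) 2
                have u2 := pow_le_pow_left₀ (abs_nonneg _) (hb2 k hkN ω) 2
                rw [sq_abs] at u1 u2
                linarith)
            simp only [probReal_univ, mul_one] at this
            exact (le_abs_self _).trans this
          · simp [a₁, a₂, hjk]
      _ = ∑ k ∈ Finset.Ico j K, Δ k * (2 * B ^ 2) := by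
          rw [← Finset.sum_filter]
          congr 1; ext k; simp [and_comm]
      _ = 2 * B ^ 2 * ∑ k ∈ Finset.Ico j K, Δ k := by rw [Finset.mul_sum]; simp_rw [mul_comm]
      _ ≤ _ := by gcongr
  have hpt : ∀ ω, (D ω + M ω) ^ 2 ≤ 2 * (B * T) ^ 2 + 2 * M ω ^ 2 := by
    intro ω
    have := pow_le_pow_left₀ (abs_nonneg _) (hDb ω) 2
    rw [sq_abs] at this
    nlinarith [sq_nonneg (D ω - M ω)]
  refine (integral_mono hS.integrable_sq (intadd (integrable_const _) (hMs.const_mul 2)) hpt).trans ?_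
  have e2 : ∫ ω, 2 * M ω ^ 2 ∂μ = 2 * ∫ ω, M ω ^ 2 ∂μ := integral_const_mul _ _
  rw [integral_add (integrable_const _) (hMs.const_mul 2), e2]
  simp only [integral_const, probReal_univ, one_smul]
  unfold CW
  nlinarith

lemma walk_incr0 (h : Inc H μ ξ η Δ N) (hc : Coef H b r₁ r₂ B N) {K : ℕ} (hK : K ≤ N)
    {T : ℝ} (hT : ∑ k ∈ Finset.range N, Δ k ≤ T) :
    MemLp (fun ω => walk z0 b r₁ r₂ ξ η Δ K ω - z0) 2 μ ∧
    ∫ ω, (walk z0 b r₁ r₂ ξ η Δ K ω - z0) ^ 2 ∂μ ≤ CW B T := by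
  have := walk_incr (z0 := z0) h hc (Nat.zero_le K) hK (T := T) (by
    refine le_trans ?_ hT
    rw [Finset.range_eq_Ico]
    exact Finset.sum_le_sum_of_subset_of_nonneg (Finset.Ico_subset_Ico le_rfl hK) fun k _ _ => h.pos k)
  simpa [walk] using this

lemma walk_integrable (h : Inc H μ ξ η Δ N) (hc : Coef H b r₁ r₂ B N) {K : ℕ} (hK : K ≤ N) :
    Integrable (walk z0 b r₁ r₂ ξ η Δ K) μ := by
  have := ((walk_incr0 (z0 := z0) h hc hK le_rfl).1.integrable (by norm_num)).add (integrable_const z0)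
  simpa [Pi.add_def] using this

lemma abs_le_one_sq (x : ℝ) : |x| ≤ 1 + x ^ 2 := by
  rw [← sq_abs]; nlinarith [sq_nonneg (|x| - 1), abs_nonneg x]

lemma Fd_integrable {δ : ℝ} (hδ : 0 < δ) {V : Ω → ℝ} (hV : Measurable V) (hVi : Integrable V μ) :
    Integrable (fun ω => Fd δ (V ω)) μ := by
  refine (hVi.abs.add (integrable_const δ)).mono' ((Fd_cont δ).measurable.comp hV).aestronglyMeasurable
    (ae_of_all _ fun ω => ?_)
  rw [Real.norm_eq_abs, abs_of_nonneg (show 0 ≤ Fd δ (V ω) from Real.sqrt_nonneg _)]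
  exact Fd_le hδ _

/-- summed one step expansion -/
lemma walk_dynkin (h : Inc H μ ξ η Δ N) (hc : Coef H b r₁ r₂ B N) {K : ℕ} (hK : K ≤ N) {d δ : ℝ} (hd : d ≤ 1)
    (hΔ : ∀ k < N, 0 < Δ k) (hΔd : ∀ k < N, Δ k ≤ d) (hδ : 0 < δ) (hδ1 : δ ≤ 1) :
    |∫ ω, Fd δ (walk z0 b r₁ r₂ ξ η Δ K ω) ∂μ - Fd δ z0 - ∑ k ∈ Finset.range K,
      (Δ k * ∫ ω, Fd1 δ (walk z0 b r₁ r₂ ξ η Δ k ω) * b k ω ∂μ +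
        Δ k / 2 * ∫ ω, Fd2 δ (walk z0 b r₁ r₂ ξ η Δ k ω) * (r₁ k ω ^ 2 + r₂ k ω ^ 2) ∂μ)|
      ≤ CT B * (∑ k ∈ Finset.range K, Δ k) * √d / δ ^ 2 := by
  induction K with
  | zero => simp [walk]
  | succ K ih =>
    have hKN : K < N := hK
    have ih := ih hKN.le
    have st := h.step hKN (hΔ K hKN) ((hΔd K hKN).trans hd) (walk_meas (z0 := z0) h hc hKN.le) (walk_integrable h hc hKN.le)
      (hc.mb K hKN) (hc.m1 K hKN) (hc.m2 K hKN) (hc.bb K hKN) (hc.b1 K hKN) (hc.b2 K hKN) hδ hδ1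
    simp_rw [← walk_succ] at st
    rw [Finset.sum_range_succ, Finset.sum_range_succ]
    have st' : CT B * (Δ K * √(Δ K)) / δ ^ 2 ≤ CT B * (Δ K * √d) / δ ^ 2 := by
      have := CT_nonneg B
      have := h.pos K
      have := Real.sqrt_le_sqrt (hΔd K hKN)
      gcongr
    have := (abs_add_le _ _).trans (add_le_add ih (st.trans st'))
    refine le_trans (le_of_eq ?_) (this.trans (le_of_eq ?_))
    · congr 1; ring
    · ring

/-- occupation time estimate -/
lemma walk_occ (h : Inc H μ ξ η Δ N) (hc : Coef H b r₁ r₂ B N) {d δ c T : ℝ} (hd : d ≤ 1)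
    (hΔ : ∀ k < N, 0 < Δ k) (hΔd : ∀ k < N, Δ k ≤ d) (hδ : 0 < δ) (hδ1 : δ ≤ 1)
    (hT : ∑ k ∈ Finset.range N, Δ k ≤ T) (hc0 : 0 < c)
    (hcr : ∀ k < N, ∀ ω, c ^ 2 ≤ r₁ k ω ^ 2 + r₂ k ω ^ 2) :
    ∑ k ∈ Finset.range N, Δ k * ∫ ω, Fd2 δ (walk z0 b r₁ r₂ ξ η Δ k ω) ∂μ ≤ Cocc B T c * (1 + √d / δ ^ 2) := by
  have hB := hc.nn
  have hT0 : 0 ≤ T := (Finset.sum_nonneg fun k _ => h.pos k).trans hT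
  have hCT := CT_nonneg B
  have dy := (abs_le.1 (walk_dynkin (z0 := z0) h hc le_rfl hd hΔ hΔd hδ hδ1)).1
  -- upper bound for the terminal value
  have hterm : ∫ ω, Fd δ (walk z0 b r₁ r₂ ξ η Δ N ω) ∂μ - Fd δ z0 ≤ CW B T + 2 := by
    have w := walk_incr0 (z0 := z0) h hc le_rfl hT
    have iw := w.1.integrable_sq
    have hpt : ∀ ω, Fd δ (walk z0 b r₁ r₂ ξ η Δ N ω) ≤ (Fd δ z0 + 2) + (walk z0 b r₁ r₂ ξ η Δ N ω - z0) ^ 2 := by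
      intro ω
      have a1 := Fd_le hδ (walk z0 b r₁ r₂ ξ η Δ N ω)
      have a2 : |z0| ≤ Fd δ z0 := Fd_abs_le δ z0
      have a3 := abs_le_one_sq (walk z0 b r₁ r₂ ξ η Δ N ω - z0)
      have a4 := abs_sub_abs_le_abs_sub (walk z0 b r₁ r₂ ξ η Δ N ω) z0
      linarith
    have := integral_mono (Fd_integrable hδ (walk_meas' (z0 := z0) h hc le_rfl) (walk_integrable h hc le_rfl))
      (intadd (integrable_const _) iw) hpt
    rw [integral_add (integrable_const _) iw] at this
    simp only [integral_const, probReal_univ, one_smul] at this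
    linarith [w.2]
  have hlow : ∀ k ∈ Finset.range N, -(B * Δ k) + c ^ 2 / 2 * (Δ k * ∫ ω, Fd2 δ (walk z0 b r₁ r₂ ξ η Δ k ω) ∂μ) ≤
      (Δ k * ∫ ω, Fd1 δ (walk z0 b r₁ r₂ ξ η Δ k ω) * b k ω ∂μ +
        Δ k / 2 * ∫ ω, Fd2 δ (walk z0 b r₁ r₂ ξ η Δ k ω) * (r₁ k ω ^ 2 + r₂ k ω ^ 2) ∂μ) := by
    intro k hk
    have hkN := Finset.mem_range.1 hk
    have hwm := walk_meas' (z0 := z0) h hc hkN.le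
    have hmF2 : Measurable (fun ω => Fd2 δ (walk z0 b r₁ r₂ ξ η Δ k ω)) := (Fd2_cont hδ).measurable.comp hwm
    have hm1 := (hc.m1 k hkN).mono (h.le _) le_rfl
    have hm2 := (hc.m2 k hkN).mono (h.le _) le_rfl
    have p1 : -B ≤ ∫ ω, Fd1 δ (walk z0 b r₁ r₂ ξ η Δ k ω) * b k ω ∂μ := by
      have := norm_integral_le_of_norm_le_const (μ := μ)
        (f := fun ω => Fd1 δ (walk z0 b r₁ r₂ ξ η Δ k ω) * b k ω) (C := B) (ae_of_all _ fun ω => by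
          rw [norm_mul]
          calc _ ≤ 1 * B := mul_le_mul (Fd1_abs hδ _) (hc.bb k hkN ω) (abs_nonneg _) zero_le_one
            _ = B := one_mul B)
      simp only [probReal_univ, mul_one] at this
      exact (abs_le.1 this).1
    have p2 : c ^ 2 * ∫ ω, Fd2 δ (walk z0 b r₁ r₂ ξ η Δ k ω) ∂μ ≤
        ∫ ω, Fd2 δ (walk z0 b r₁ r₂ ξ η Δ k ω) * (r₁ k ω ^ 2 + r₂ k ω ^ 2) ∂μ := by
      rw [← integral_const_mul]
      refine integral_mono ((integrable_of_bdd hmF2 fun ω => Fd2_abs hδ _).const_mul _) ?_ fun ω => ?_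
      · refine integrable_of_bdd (C := 1 / δ * (B ^ 2 + B ^ 2)) (hmF2.mul ((hm1.pow_const 2).add (hm2.pow_const 2))) fun ω => ?_
        have u1 := pow_le_pow_left₀ (abs_nonneg _) (hc.b1 k hkN ω) 2
        have u2 := pow_le_pow_left₀ (abs_nonneg _) (hc.b2 k hkN ω) 2
        rw [sq_abs] at u1 u2
        rw [abs_mul, abs_of_nonneg (show 0 ≤ r₁ k ω ^ 2 + r₂ k ω ^ 2 by positivity)]
        exact mul_le_mul (Fd2_abs hδ _) (by linarith) (by positivity) (by positivity)
      · show c ^ 2 * _ ≤ _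
        rw [mul_comm]
        exact mul_le_mul_of_nonneg_left (hcr k hkN ω) (Fd2_nonneg _ _)
    have p1' := mul_le_mul_of_nonneg_left p1 (h.pos k)
    have p2' := mul_le_mul_of_nonneg_left p2 (half_pos (hΔ k hkN)).le
    linarith
  have hsum := Finset.sum_le_sum hlow
  rw [Finset.sum_add_distrib, Finset.sum_neg_distrib, ← Finset.mul_sum, ← Finset.mul_sum] at hsum
  set S := ∑ k ∈ Finset.range N, Δ k * ∫ ω, Fd2 δ (walk z0 b r₁ r₂ ξ η Δ k ω) ∂μ
  have hBT : B * ∑ k ∈ Finset.range N, Δ k ≤ B * T := by gcongr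
  have hE : CT B * (∑ k ∈ Finset.range N, Δ k) * √d / δ ^ 2 ≤ CT B * T * (√d / δ ^ 2) := by
    rw [mul_div_assoc]; gcongr
  have hmain : c ^ 2 / 2 * S ≤ CW B T + 2 + B * T + CT B * T * (√d / δ ^ 2) := by linarith
  have hq : 0 ≤ √d / δ ^ 2 := by positivity
  have hCW : 0 ≤ CW B T := by unfold CW; positivity
  have hmain2 : c ^ 2 / 2 * S ≤ (CW B T + 2 + B * T + CT B * T) * (1 + √d / δ ^ 2) := by
    have h1 : 0 ≤ (CW B T + 2 + B * T) * (√d / δ ^ 2) := by positivity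
    have h2 : 0 ≤ CT B * T := by positivity
    nlinarith
  unfold Cocc
  calc S = 2 / c ^ 2 * (c ^ 2 / 2 * S) := by field_simp
    _ ≤ 2 / c ^ 2 * ((CW B T + 2 + B * T + CT B * T) * (1 + √d / δ ^ 2)) := by gcongr
    _ = _ := by ring

lemma Cocc_nonneg {T : ℝ} (hB : 0 ≤ B) (hT : 0 ≤ T) (c : ℝ) : 0 ≤ Cocc B T c := by
  have := CT_nonneg B
  unfold Cocc CW; positivity

lemma walk_occ' (h : Inc H μ ξ η Δ N) (hc : Coef H b r₁ r₂ B N) {d δ c T : ℝ} (hd : d ≤ 1)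
    (hΔ : ∀ k < N, 0 < Δ k) (hΔd : ∀ k < N, Δ k ≤ d) (hδ : 0 < δ) (hδ1 : δ ≤ 1)
    (hT : ∑ k ∈ Finset.range N, Δ k ≤ T) (hc0 : 0 < c)
    (hcr : ∀ k < N, ∀ ω, c ^ 2 ≤ r₁ k ω ^ 2 + r₂ k ω ^ 2) :
    ∑ k ∈ Finset.range N, Δ k * μ.real {ω | |walk z0 b r₁ r₂ ξ η Δ k ω| ≤ δ} ≤
      4 * Cocc B T c * (δ + √d / δ) := by
  have := walk_occ (z0 := z0) h hc hd hΔ hΔd hδ hδ1 hT hc0 hcr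
  have key : ∀ k ∈ Finset.range N, Δ k * μ.real {ω | |walk z0 b r₁ r₂ ξ η Δ k ω| ≤ δ} ≤
      4 * δ * (Δ k * ∫ ω, Fd2 δ (walk z0 b r₁ r₂ ξ η Δ k ω) ∂μ) := by
    intro k hk
    have hkN := Finset.mem_range.1 hk
    have hwm := walk_meas' (z0 := z0) h hc hkN.le
    have hS : MeasurableSet {ω | |walk z0 b r₁ r₂ ξ η Δ k ω| ≤ δ} := measurableSet_le hwm.abs measurable_const
    have p : μ.real {ω | |walk z0 b r₁ r₂ ξ η Δ k ω| ≤ δ} ≤ 4 * δ * ∫ ω, Fd2 δ (walk z0 b r₁ r₂ ξ η Δ k ω) ∂μ := by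
      rw [← integral_indicator_one hS, ← integral_const_mul]
      have hmF2 : Measurable (fun ω => Fd2 δ (walk z0 b r₁ r₂ ξ η Δ k ω)) := (Fd2_cont hδ).measurable.comp hwm
      refine integral_mono ((integrable_const (1:ℝ)).indicator hS) ((integrable_of_bdd hmF2 fun ω => Fd2_abs hδ _).const_mul _)
        fun ω => ?_
      by_cases hω : |walk z0 b r₁ r₂ ξ η Δ k ω| ≤ δ
      · rw [indicator_of_mem (by exact hω)]
        have := Fd2_ge hδ hω
        rw [div_le_iff₀ (by positivity)] at this
        simp only [Pi.one_apply]; linarith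
      · rw [indicator_of_notMem (by exact hω)]
        have := Fd2_nonneg δ (walk z0 b r₁ r₂ ξ η Δ k ω)
        positivity
    have := mul_le_mul_of_nonneg_left p (h.pos k)
    linarith
  refine (Finset.sum_le_sum key).trans ?_
  rw [← Finset.mul_sum]
  calc _ ≤ 4 * δ * (Cocc B T c * (1 + √d / δ ^ 2)) := by gcongr
    _ = _ := by field_simp

end Walk
end

section
/-! ### Comparison of two schemes -/

/-- parameters of the equation for the difference process -/
structure Par (lam α1 α2 β1 β2 : ℝ) : Prop where
  lam0 : 0 ≤ lam
  ab : α1 * β1 + α2 * β2 = 0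
  nrm : α1 ^ 2 + α2 ^ 2 + (β1 ^ 2 + β2 ^ 2) = 1
  apos : 0 < α1 ^ 2 + α2 ^ 2

def zw {Ω : Type*} (y lam α1 α2 β1 β2 : ℝ) (p ξ η : ℕ → Ω → ℝ) (Δ : ℕ → ℝ) (k : ℕ) (ω : Ω) : ℝ :=
  walk y (fun k ω => -lam * p k ω) (fun k ω => α1 + β1 * p k ω) (fun k ω => α2 + β2 * p k ω) ξ η Δ k ω

/-- admissible predictable coefficient processes -/
structure Adm {Ω : Type*} (H : ℕ → MeasurableSpace Ω) (p : ℕ → Ω → ℝ) (N : ℕ) : Prop where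
  meas : ∀ k < N, Measurable[H k] (p k)
  bd : ∀ k < N, ∀ ω, |p k ω| ≤ 1

/-- sign processes -/
structure Sgn {Ω : Type*} (H : ℕ → MeasurableSpace Ω) (p : ℕ → Ω → ℝ) (N : ℕ) : Prop where
  meas : ∀ k < N, Measurable[H k] (p k)
  pm : ∀ k < N, ∀ ω, p k ω = 1 ∨ p k ω = -1

lemma Sgn.adm {Ω : Type*} {H : ℕ → MeasurableSpace Ω} {p : ℕ → Ω → ℝ} {N : ℕ} (h : Sgn H p N) : Adm H p N :=
  ⟨h.meas, fun k hk ω => by rcases h.pm k hk ω with e | e <;> simp [e]⟩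

lemma psgn_pm (x : ℝ) : psgn x = 1 ∨ psgn x = -1 := by unfold psgn; split_ifs <;> simp

lemma psgn_meas : Measurable psgn := by
  unfold psgn; exact Measurable.ite measurableSet_Ioi measurable_const measurable_const

section Pair
variable {μ : Measure Ω} [IsProbabilityMeasure μ] {H : ℕ → MeasurableSpace Ω}
  {ξ η p p' : ℕ → Ω → ℝ} {Δ : ℕ → ℝ} {N : ℕ} {y lam α1 α2 β1 β2 : ℝ}

lemma Par.b1 (P : Par lam α1 α2 β1 β2) : |α1| ≤ 1 ∧ |α2| ≤ 1 ∧ |β1| ≤ 1 ∧ |β2| ≤ 1 := by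
  have := P.nrm
  refine ⟨?_, ?_, ?_, ?_⟩ <;> rw [abs_le_one_iff_mul_self_le_one] <;>
    nlinarith [sq_nonneg α1, sq_nonneg α2, sq_nonneg β1, sq_nonneg β2]

lemma Par.coef (P : Par lam α1 α2 β1 β2) (hp : Adm H p N) :
    Coef H (fun k ω => -lam * p k ω) (fun k ω => α1 + β1 * p k ω) (fun k ω => α2 + β2 * p k ω) (2 * lam + 2) N := by
  obtain ⟨h1, h2, h3, h4⟩ := P.b1
  have hl := P.lam0
  have aux : ∀ a b q : ℝ, |a| ≤ 1 → |b| ≤ 1 → |q| ≤ 1 → |a + b * q| ≤ 2 * lam + 2 := by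
    intro a b q ha hb hq
    calc |a + b * q| ≤ |a| + |b| * |q| := by rw [← abs_mul]; exact abs_add_le _ _
      _ ≤ 1 + 1 * 1 := by gcongr
      _ ≤ _ := by linarith
  refine ⟨by linarith, fun k hk => (hp.meas k hk).const_mul _, fun k hk => ((hp.meas k hk).const_mul _).const_add _,
    fun k hk => ((hp.meas k hk).const_mul _).const_add _, fun k hk ω => ?_,
    fun k hk ω => aux _ _ _ h1 h3 (hp.bd k hk ω), fun k hk ω => aux _ _ _ h2 h4 (hp.bd k hk ω)⟩
  rw [abs_mul, abs_neg, abs_of_nonneg hl]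
  nlinarith [hp.bd k hk ω]

lemma Par.ell (P : Par lam α1 α2 β1 β2) (q : ℝ) :
    √(α1 ^ 2 + α2 ^ 2) ^ 2 ≤ (α1 + β1 * q) ^ 2 + (α2 + β2 * q) ^ 2 := by
  rw [Real.sq_sqrt P.apos.le]
  have := P.ab
  have : (α1 + β1 * q) ^ 2 + (α2 + β2 * q) ^ 2 = α1 ^ 2 + α2 ^ 2 + q ^ 2 * (β1 ^ 2 + β2 ^ 2) + 2 * q * (α1 * β1 + α2 * β2) := by ring
  rw [this, P.ab]; nlinarith [sq_nonneg q, sq_nonneg β1, sq_nonneg β2, mul_nonneg (sq_nonneg q) (add_nonneg (sq_nonneg β1) (sq_nonneg β2))]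

lemma Par.ca (P : Par lam α1 α2 β1 β2) : 0 < √(α1 ^ 2 + α2 ^ 2) := Real.sqrt_pos.2 P.apos

def Czw (lam α1 α2 T : ℝ) : ℝ := Cocc (2 * lam + 2) T (√(α1 ^ 2 + α2 ^ 2))

lemma zw_meas (P : Par lam α1 α2 β1 β2) (h : Inc H μ ξ η Δ N) (hp : Adm H p N) {K : ℕ} (hK : K ≤ N) :
    Measurable (zw y lam α1 α2 β1 β2 p ξ η Δ K) := walk_meas' h (P.coef hp) hK

lemma zw_occ (P : Par lam α1 α2 β1 β2) (h : Inc H μ ξ η Δ N) (hp : Adm H p N) {d δ T : ℝ} (hd : d ≤ 1)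
    (hΔ : ∀ k < N, 0 < Δ k) (hΔd : ∀ k < N, Δ k ≤ d) (hδ : 0 < δ) (hδ1 : δ ≤ 1)
    (hT : ∑ k ∈ Finset.range N, Δ k ≤ T) :
    ∑ k ∈ Finset.range N, Δ k * ∫ ω, Fd2 δ (zw y lam α1 α2 β1 β2 p ξ η Δ k ω) ∂μ ≤
      Czw lam α1 α2 T * (1 + √d / δ ^ 2) :=
  walk_occ h (P.coef hp) hd hΔ hΔd hδ hδ1 hT P.ca fun _ _ _ => P.ell _

lemma zw_occ' (P : Par lam α1 α2 β1 β2) (h : Inc H μ ξ η Δ N) (hp : Adm H p N) {d δ T : ℝ} (hd : d ≤ 1)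
    (hΔ : ∀ k < N, 0 < Δ k) (hΔd : ∀ k < N, Δ k ≤ d) (hδ : 0 < δ) (hδ1 : δ ≤ 1)
    (hT : ∑ k ∈ Finset.range N, Δ k ≤ T) :
    ∑ k ∈ Finset.range N, Δ k * μ.real {ω | |zw y lam α1 α2 β1 β2 p ξ η Δ k ω| ≤ δ} ≤
      4 * Czw lam α1 α2 T * (δ + √d / δ) :=
  walk_occ' h (P.coef hp) hd hΔ hΔd hδ hδ1 hT P.ca fun _ _ _ => P.ell _

lemma zw_mix (θ : ℝ) (k : ℕ) (ω : Ω) :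
    zw y lam α1 α2 β1 β2 (fun k ω => p' k ω + θ * (p k ω - p' k ω)) ξ η Δ k ω =
    zw y lam α1 α2 β1 β2 p' ξ η Δ k ω + θ * (zw y lam α1 α2 β1 β2 p ξ η Δ k ω - zw y lam α1 α2 β1 β2 p' ξ η Δ k ω) := by
  unfold zw walk
  rw [add_sub_add_left_eq_sub, ← Finset.sum_sub_distrib, Finset.mul_sum, add_assoc, ← Finset.sum_add_distrib]
  congr 1
  exact Finset.sum_congr rfl fun i _ => by ring

lemma zw_diff (k : ℕ) (ω : Ω) :
    zw y lam α1 α2 β1 β2 p ξ η Δ k ω - zw y lam α1 α2 β1 β2 p' ξ η Δ k ω =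
    walk 0 (fun k ω => -lam * (p k ω - p' k ω)) (fun k ω => β1 * (p k ω - p' k ω))
      (fun k ω => β2 * (p k ω - p' k ω)) ξ η Δ k ω := by
  unfold zw walk
  rw [add_sub_add_left_eq_sub, ← Finset.sum_sub_distrib, zero_add]
  exact Finset.sum_congr rfl fun i _ => by ring

lemma Par.coefD (P : Par lam α1 α2 β1 β2) (hp : Adm H p N) (hp' : Adm H p' N) :
    Coef H (fun k ω => -lam * (p k ω - p' k ω)) (fun k ω => β1 * (p k ω - p' k ω))
      (fun k ω => β2 * (p k ω - p' k ω)) (2 * lam + 2) N := by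
  obtain ⟨h1, h2, h3, h4⟩ := P.b1
  have hl := P.lam0
  have hm : ∀ k < N, Measurable[H k] (fun ω => p k ω - p' k ω) := fun k hk => (hp.meas k hk).sub (hp'.meas k hk)
  have hb : ∀ k < N, ∀ ω, |p k ω - p' k ω| ≤ 2 := fun k hk ω => by
    have := abs_sub (p k ω) (p' k ω)
    linarith [hp.bd k hk ω, hp'.bd k hk ω]
  refine ⟨by linarith, fun k hk => (hm k hk).const_mul _, fun k hk => (hm k hk).const_mul _,
    fun k hk => (hm k hk).const_mul _, fun k hk ω => ?_, fun k hk ω => ?_, fun k hk ω => ?_⟩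
  · rw [abs_mul, abs_neg, abs_of_nonneg hl]; nlinarith [hb k hk ω]
  · rw [abs_mul]; nlinarith [hb k hk ω, abs_nonneg β1, abs_nonneg (p k ω - p' k ω)]
  · rw [abs_mul]; nlinarith [hb k hk ω, abs_nonneg β2, abs_nonneg (p k ω - p' k ω)]

lemma Adm.mix (hp : Adm H p N) (hp' : Adm H p' N) {θ : ℝ} (h0 : 0 ≤ θ) (h1 : θ ≤ 1) :
    Adm H (fun k ω => p' k ω + θ * (p k ω - p' k ω)) N := by
  refine ⟨fun k hk => (hp'.meas k hk).add (((hp.meas k hk).sub (hp'.meas k hk)).const_mul θ), fun k hk ω => ?_⟩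
  have e : p' k ω + θ * (p k ω - p' k ω) = (1 - θ) * p' k ω + θ * p k ω := by ring
  have := hp.bd k hk ω; have := hp'.bd k hk ω
  rw [e]; rw [abs_le] at *
  constructor <;> nlinarith

/-- Fubini for the mixture walks -/
lemma mix_occ (P : Par lam α1 α2 β1 β2) (h : Inc H μ ξ η Δ N) (hp : Adm H p N) (hp' : Adm H p' N)
    {d δ T : ℝ} (hd : d ≤ 1)
    (hΔ : ∀ k < N, 0 < Δ k) (hΔd : ∀ k < N, Δ k ≤ d) (hδ : 0 < δ) (hδ1 : δ ≤ 1)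
    (hT : ∑ k ∈ Finset.range N, Δ k ≤ T) :
    (∀ k < N, Integrable (fun ω => ∫ θ in (0:ℝ)..1, Fd2 δ (zw y lam α1 α2 β1 β2 p' ξ η Δ k ω + θ *
        (zw y lam α1 α2 β1 β2 p ξ η Δ k ω - zw y lam α1 α2 β1 β2 p' ξ η Δ k ω))) μ) ∧
    ∑ k ∈ Finset.range N, Δ k * ∫ ω, (∫ θ in (0:ℝ)..1, Fd2 δ (zw y lam α1 α2 β1 β2 p' ξ η Δ k ω + θ *
        (zw y lam α1 α2 β1 β2 p ξ η Δ k ω - zw y lam α1 α2 β1 β2 p' ξ η Δ k ω))) ∂μ ≤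
      Czw lam α1 α2 T * (1 + √d / δ ^ 2) := by
  set Z := zw y lam α1 α2 β1 β2 p ξ η Δ with hZ
  set Z' := zw y lam α1 α2 β1 β2 p' ξ η Δ with hZ'
  have hI : ∀ k < N, Integrable (Function.uncurry fun (ω : Ω) (θ : ℝ) => Fd2 δ (Z' k ω + θ * (Z k ω - Z' k ω)))
      (μ.prod (volume.restrict (Ioc (0:ℝ) 1))) := by
    intro k hk
    have m1 : Measurable (Z k) := zw_meas P h hp hk.le
    have m2 : Measurable (Z' k) := zw_meas P h hp' hk.le
    refine Integrable.of_bound (C := 1 / δ) ?_ (ae_of_all _ fun x => Fd2_abs hδ _)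
    refine Measurable.aestronglyMeasurable ((Fd2_cont hδ).measurable.comp ?_)
    exact (m2.comp measurable_fst).add (measurable_snd.mul ((m1.comp measurable_fst).sub (m2.comp measurable_fst)))
  simp only [intervalIntegral.integral_of_le zero_le_one]
  refine ⟨fun k hk => (hI k hk).integral_prod_left, ?_⟩
  have e1 : ∀ k ∈ Finset.range N, Δ k * ∫ ω, (∫ θ in Ioc (0:ℝ) 1, Fd2 δ (Z' k ω + θ * (Z k ω - Z' k ω))) ∂μ =
      ∫ θ in Ioc (0:ℝ) 1, (Δ k * ∫ ω, Fd2 δ (Z' k ω + θ * (Z k ω - Z' k ω)) ∂μ) := by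
    intro k hk
    rw [integral_integral_swap (hI k (Finset.mem_range.1 hk)), integral_const_mul]
  have hI2 : ∀ k ∈ Finset.range N, Integrable (fun θ : ℝ => Δ k * ∫ ω, Fd2 δ (Z' k ω + θ * (Z k ω - Z' k ω)) ∂μ)
      (volume.restrict (Ioc (0:ℝ) 1)) := fun k hk =>
    ((hI k (Finset.mem_range.1 hk)).integral_prod_right).const_mul (Δ k)
  rw [Finset.sum_congr rfl e1, ← integral_finset_sum _ hI2]
  have : ∀ᵐ θ ∂(volume.restrict (Ioc (0:ℝ) 1)), ‖∑ k ∈ Finset.range N, Δ k * ∫ ω, Fd2 δ (Z' k ω + θ * (Z k ω - Z' k ω)) ∂μ‖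
      ≤ Czw lam α1 α2 T * (1 + √d / δ ^ 2) := by
    refine (ae_restrict_iff' measurableSet_Ioc).2 (ae_of_all _ fun θ hθ => ?_)
    have := zw_occ (y := y) P h (hp.mix hp' hθ.1.le hθ.2) hd hΔ hΔd hδ hδ1 hT
    simp_rw [zw_mix] at this
    rw [Real.norm_eq_abs, abs_of_nonneg]
    · exact this
    · exact Finset.sum_nonneg fun k hk => mul_nonneg (h.pos k) (integral_nonneg fun ω => Fd2_nonneg _ _)
  have := norm_integral_le_of_norm_le_const this
  simp only [measureReal_restrict_apply_univ, Real.volume_real_Ioc, sub_zero] at this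
  norm_num at this
  exact (le_abs_self _).trans this

end Pair
end

section
/-! ### The pair lemma -/
section Pair
variable {μ : Measure Ω} [IsProbabilityMeasure μ] {H : ℕ → MeasurableSpace Ω}
  {ξ η p p' : ℕ → Ω → ℝ} {Δ : ℕ → ℝ} {N : ℕ} {y lam α1 α2 β1 β2 : ℝ}

lemma psgn_mono_ne {z z' : ℝ} : 0 ≤ (z - z') * (psgn z - psgn z') := by
  unfold psgn
  split_ifs <;> nlinarith

lemma Fd1_mul_nonneg {δ x s : ℝ} (h : 0 ≤ x * s) : 0 ≤ Fd1 δ x * s := by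
  unfold Fd1
  rw [div_mul_eq_mul_div]; positivity

lemma scale_pt {J : ℕ} {δ : ℝ} (hδ : 0 < δ) {z z' q q' : ℝ} (hq : q = 1 ∨ q = -1) (hq' : q' = 1 ∨ q' = -1) :
    (∑ j ∈ Finset.range J, Fd2 ((1/2 : ℝ) ^ j) (z - z')) * (q - q') ^ 2 ≤
      32 * (∫ θ in (0:ℝ)..1, Fd2 δ (z' + θ * (z - z'))) + 4 * 2 ^ J *
        ((if q ≠ psgn z then (1:ℝ) else 0) + (if q' ≠ psgn z' then (1:ℝ) else 0) + (if |z| ≤ δ then (1:ℝ) else 0)) := by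
  have hnn : 0 ≤ ∫ θ in (0:ℝ)..1, Fd2 δ (z' + θ * (z - z')) :=
    intervalIntegral.integral_nonneg zero_le_one fun θ _ => Fd2_nonneg _ _
  have hS0 : 0 ≤ ∑ j ∈ Finset.range J, Fd2 ((1/2 : ℝ) ^ j) (z - z') := Finset.sum_nonneg fun j _ => Fd2_nonneg _ _
  have hS : ∑ j ∈ Finset.range J, Fd2 ((1/2 : ℝ) ^ j) (z - z') ≤ 2 ^ J := by
    calc _ ≤ ∑ j ∈ Finset.range J, (2:ℝ) ^ j := Finset.sum_le_sum fun j _ => by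
          refine (Fd2_le (by positivity) _).trans (le_of_eq ?_)
          rw [one_div, one_div, ← inv_pow, inv_inv]
      _ ≤ _ := by
        rw [geom_sum_eq (by norm_num)]; norm_num
  have hq2 : (q - q') ^ 2 ≤ 4 := by
    rcases hq with rfl | rfl <;> rcases hq' with rfl | rfl <;> norm_num
  have hcrude : (∑ j ∈ Finset.range J, Fd2 ((1/2 : ℝ) ^ j) (z - z')) * (q - q') ^ 2 ≤ 4 * 2 ^ J := by
    calc _ ≤ (2:ℝ) ^ J * 4 := mul_le_mul hS hq2 (sq_nonneg _) (by positivity)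
      _ = _ := by ring
  have h2J : (0:ℝ) < 2 ^ J := by positivity
  by_cases hbad : q ≠ psgn z ∨ q' ≠ psgn z' ∨ |z| ≤ δ
  · have : (1:ℝ) ≤ ((if q ≠ psgn z then (1:ℝ) else 0) + (if q' ≠ psgn z' then (1:ℝ) else 0) + (if |z| ≤ δ then (1:ℝ) else 0)) := by
      rcases hbad with hb | hb | hb <;> rw [if_pos hb] <;> split_ifs <;> norm_num
    nlinarith
  · push Not at hbad
    obtain ⟨h1, h2, h3⟩ := hbad
    have hr : 0 ≤ 4 * (2:ℝ) ^ J * ((if q ≠ psgn z then (1:ℝ) else 0) + (if q' ≠ psgn z' then (1:ℝ) else 0) + (if |z| ≤ δ then (1:ℝ) else 0)) := by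
      have : ∀ P : Prop, ∀ [Decidable P], (0:ℝ) ≤ if P then (1:ℝ) else 0 := fun P _ => by split_ifs <;> norm_num
      have a1 := this (q ≠ psgn z); have a2 := this (q' ≠ psgn z'); have a3 := this (|z| ≤ δ)
      positivity
    refine le_trans ?_ (le_add_of_nonneg_right hr)
    by_cases hqq : q = q'
    · rw [hqq]; simp; exact hnn
    have hopp := Fd2_opp hδ h3 (z' := z') (by rw [← h1, ← h2]; exact hqq)
    have hne : z - z' ≠ 0 := by
      intro h0
      have : z = z' := by linarith
      rw [h1, h2, this] at hqq; exact hqq rfl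
    have hpos : 0 < |z - z'| := abs_pos.2 hne
    have h4 := Fd2_scales J (z - z') hne
    have h5 : 4 / |z - z'| ≤ 8 * ∫ θ in (0:ℝ)..1, Fd2 δ (z' + θ * (z - z')) := by
      rw [div_le_iff₀ hpos]; nlinarith
    calc _ ≤ (8 * ∫ θ in (0:ℝ)..1, Fd2 δ (z' + θ * (z - z'))) * 4 :=
          mul_le_mul (h4.trans h5) hq2 (sq_nonneg _) (by positivity)
      _ = _ := by ring

lemma meas_ne {f g : Ω → ℝ} (hf : Measurable f) (hg : Measurable g) : MeasurableSet {ω | f ω ≠ g ω} :=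
  (measurableSet_eq_fun hf hg).compl

lemma ite_ind_int {S : Set Ω} (hS : MeasurableSet S) [∀ ω, Decidable (ω ∈ S)] :
    Integrable (fun ω => if ω ∈ S then (1:ℝ) else 0) μ ∧ ∫ ω, (if ω ∈ S then (1:ℝ) else 0) ∂μ = μ.real S := by
  have e : (fun ω => if ω ∈ S then (1:ℝ) else 0) = S.indicator 1 := by
    ext ω; simp [Set.indicator]
  rw [e]
  exact ⟨(integrable_const (1:ℝ)).indicator hS, integral_indicator_one hS⟩

/-- wrong sign mass -/
def wrong {Ω : Type*} [MeasurableSpace Ω] (μ : Measure Ω) (p Z : ℕ → Ω → ℝ) (Δ : ℕ → ℝ) (N : ℕ) : ℝ :=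
  ∑ k ∈ Finset.range N, Δ k * μ.real {ω | p k ω ≠ psgn (Z k ω)}

lemma pair_one (P : Par lam α1 α2 β1 β2) (h : Inc H μ ξ η Δ N) (hp : Sgn H p N) (hp' : Sgn H p' N)
    {d δ T : ℝ} (hd : d ≤ 1)
    (hΔ : ∀ k < N, 0 < Δ k) (hΔd : ∀ k < N, Δ k ≤ d) (hδ : 0 < δ) (hδ1 : δ ≤ 1)
    (hT : ∑ k ∈ Finset.range N, Δ k ≤ T) {K : ℕ} (hK : K ≤ N) :
    ∫ ω, |zw y lam α1 α2 β1 β2 p ξ η Δ K ω - zw y lam α1 α2 β1 β2 p' ξ η Δ K ω| ∂μ ≤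
      δ + 2 * lam * (wrong μ p (zw y lam α1 α2 β1 β2 p ξ η Δ) Δ N + wrong μ p' (zw y lam α1 α2 β1 β2 p' ξ η Δ) Δ N)
      + (∑ k ∈ Finset.range N, Δ k / 2 * ∫ ω, Fd2 δ (zw y lam α1 α2 β1 β2 p ξ η Δ k ω -
          zw y lam α1 α2 β1 β2 p' ξ η Δ k ω) * (p k ω - p' k ω) ^ 2 ∂μ)
      + CT (2 * lam + 2) * T * √d / δ ^ 2 := by
  have hcD := P.coefD hp.adm hp'.adm
  have hl := P.lam0
  set Z := zw y lam α1 α2 β1 β2 p ξ η Δ with hZ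
  set Z' := zw y lam α1 α2 β1 β2 p' ξ η Δ with hZ'
  have hD : ∀ k ω, walk 0 (fun k ω => -lam * (p k ω - p' k ω)) (fun k ω => β1 * (p k ω - p' k ω))
      (fun k ω => β2 * (p k ω - p' k ω)) ξ η Δ k ω = Z k ω - Z' k ω := fun k ω => (zw_diff k ω).symm
  have hdyn := walk_dynkin (z0 := 0) h hcD hK hd hΔ hΔd hδ hδ1
  simp only [hD] at hdyn
  have hmZ : ∀ k ≤ N, Measurable (Z k) := fun k hk => zw_meas P h hp.adm hk
  have hmZ' : ∀ k ≤ N, Measurable (Z' k) := fun k hk => zw_meas P h hp'.adm hk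
  have hmp : ∀ k < N, Measurable (p k) := fun k hk => (hp.meas k hk).mono (h.le k) le_rfl
  have hmp' : ∀ k < N, Measurable (p' k) := fun k hk => (hp'.meas k hk).mono (h.le k) le_rfl
  have hDi : Integrable (fun ω => Z K ω - Z' K ω) μ := by
    have := walk_integrable (z0 := 0) h hcD hK
    exact this.congr (ae_of_all _ fun ω => hD K ω)
  have h1 : ∫ ω, |Z K ω - Z' K ω| ∂μ ≤ ∫ ω, Fd δ (Z K ω - Z' K ω) ∂μ :=
    integral_mono hDi.abs (Fd_integrable hδ ((hmZ K hK).sub (hmZ' K hK)) hDi) fun ω => Fd_abs_le δ _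
  have h0 : Fd δ 0 = δ := by unfold Fd; simp [Real.sqrt_sq hδ.le]
  have hterm : ∀ k ∈ Finset.range K,
      (Δ k * ∫ ω, Fd1 δ (Z k ω - Z' k ω) * (-lam * (p k ω - p' k ω)) ∂μ +
        Δ k / 2 * ∫ ω, Fd2 δ (Z k ω - Z' k ω) * ((β1 * (p k ω - p' k ω)) ^ 2 + (β2 * (p k ω - p' k ω)) ^ 2) ∂μ) ≤
      2 * lam * (Δ k * μ.real {ω | p k ω ≠ psgn (Z k ω)} + Δ k * μ.real {ω | p' k ω ≠ psgn (Z' k ω)}) +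
      Δ k / 2 * ∫ ω, Fd2 δ (Z k ω - Z' k ω) * (p k ω - p' k ω) ^ 2 ∂μ := by
    intro k hk
    have hkN : k < N := (Finset.mem_range.1 hk).trans_le hK
    have mZ := hmZ k hkN.le; have mZ' := hmZ' k hkN.le
    have mp := hmp k hkN; have mp' := hmp' k hkN
    have mF1 : Measurable (fun ω => Fd1 δ (Z k ω - Z' k ω)) := (Fd1_cont hδ).measurable.comp (mZ.sub mZ')
    have mF2 : Measurable (fun ω => Fd2 δ (Z k ω - Z' k ω)) := (Fd2_cont hδ).measurable.comp (mZ.sub mZ')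
    have hbd : ∀ ω, |p k ω - p' k ω| ≤ 2 := fun ω => by
      rcases hp.pm k hkN ω with e | e <;> rcases hp'.pm k hkN ω with e' | e' <;> rw [e, e'] <;> norm_num
    have S1 := meas_ne mp (psgn_meas.comp mZ)
    have S2 := meas_ne mp' (psgn_meas.comp mZ')
    classical
    have I1 := ite_ind_int (μ := μ) S1
    have I2 := ite_ind_int (μ := μ) S2
    have a1 : ∫ ω, Fd1 δ (Z k ω - Z' k ω) * (-lam * (p k ω - p' k ω)) ∂μ ≤
        2 * lam * (μ.real {ω | p k ω ≠ psgn (Z k ω)} + μ.real {ω | p' k ω ≠ psgn (Z' k ω)}) := by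
      have e : 2 * lam * (μ.real {ω | p k ω ≠ psgn (Z k ω)} + μ.real {ω | p' k ω ≠ psgn (Z' k ω)}) =
        ∫ ω, 2 * lam * ((if ω ∈ {ω | p k ω ≠ (psgn ∘ Z k) ω} then (1:ℝ) else 0) + (if ω ∈ {ω | p' k ω ≠ (psgn ∘ Z' k) ω} then (1:ℝ) else 0)) ∂μ := by
        rw [integral_const_mul, integral_add I1.1 I2.1, I1.2, I2.2]; rfl
      rw [e]
      refine integral_mono ?_ ((intadd I1.1 I2.1).const_mul _) fun ω => ?_
      · refine integrable_of_bdd (C := 1 * (lam * 2)) (mF1.mul ((mp.sub mp').const_mul _)) fun ω => ?_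
        rw [abs_mul, abs_mul, abs_neg, abs_of_nonneg hl]
        exact mul_le_mul (Fd1_abs hδ _) (mul_le_mul_of_nonneg_left (hbd ω) hl) (by positivity) zero_le_one
      · simp only [mem_setOf_eq, Function.comp]
        by_cases hb : p k ω = psgn (Z k ω) ∧ p' k ω = psgn (Z' k ω)
        · have : 0 ≤ Fd1 δ (Z k ω - Z' k ω) * (p k ω - p' k ω) := by
            rw [hb.1, hb.2]; exact Fd1_mul_nonneg psgn_mono_ne
          simp only [hb.1, hb.2, ne_eq, not_true_eq_false, if_false]
          rw [hb.1, hb.2] at this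
          nlinarith
        · have i1 : (1:ℝ) ≤ (if p k ω ≠ psgn (Z k ω) then (1:ℝ) else 0) + (if p' k ω ≠ psgn (Z' k ω) then (1:ℝ) else 0) := by
            by_cases hb1 : p k ω = psgn (Z k ω)
            · have hb2 : p' k ω ≠ psgn (Z' k ω) := fun h => hb ⟨hb1, h⟩
              rw [if_pos hb2]; split_ifs <;> norm_num
            · rw [if_pos hb1]; split_ifs <;> norm_num
          have i2 : Fd1 δ (Z k ω - Z' k ω) * (-lam * (p k ω - p' k ω)) ≤ 2 * lam := by
            refine (le_abs_self _).trans ?_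
            rw [abs_mul, abs_mul, abs_neg, abs_of_nonneg hl]
            have := mul_le_mul (Fd1_abs hδ (Z k ω - Z' k ω)) (mul_le_mul_of_nonneg_left (hbd ω) hl) (by positivity) zero_le_one
            linarith
          nlinarith
    have a2 : ∫ ω, Fd2 δ (Z k ω - Z' k ω) * ((β1 * (p k ω - p' k ω)) ^ 2 + (β2 * (p k ω - p' k ω)) ^ 2) ∂μ ≤
        ∫ ω, Fd2 δ (Z k ω - Z' k ω) * (p k ω - p' k ω) ^ 2 ∂μ := by
      have hb4 : ∀ ω, (p k ω - p' k ω) ^ 2 ≤ 4 := fun ω => by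
        have := pow_le_pow_left₀ (abs_nonneg _) (hbd ω) 2
        rw [sq_abs] at this; linarith
      have hβ : β1 ^ 2 + β2 ^ 2 ≤ 1 := by linarith [P.nrm, P.apos]
      have hpt : ∀ ω, Fd2 δ (Z k ω - Z' k ω) * ((β1 * (p k ω - p' k ω)) ^ 2 + (β2 * (p k ω - p' k ω)) ^ 2) ≤
          Fd2 δ (Z k ω - Z' k ω) * (p k ω - p' k ω) ^ 2 := fun ω => by
        refine mul_le_mul_of_nonneg_left ?_ (Fd2_nonneg _ _)
        nlinarith [sq_nonneg (p k ω - p' k ω)]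
      have hi : Integrable (fun ω => Fd2 δ (Z k ω - Z' k ω) * (p k ω - p' k ω) ^ 2) μ := by
        refine integrable_of_bdd (C := 1 / δ * 4) (mF2.mul ((mp.sub mp').pow_const 2)) fun ω => ?_
        rw [abs_mul, abs_of_nonneg (sq_nonneg (p k ω - p' k ω))]
        exact mul_le_mul (Fd2_abs hδ _) (hb4 ω) (sq_nonneg _) (by positivity)
      refine integral_mono_of_nonneg (ae_of_all _ fun ω => mul_nonneg (Fd2_nonneg _ _) (by positivity)) hi (ae_of_all _ hpt)
    have hk0 := h.pos k
    nlinarith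
  have hs := (Finset.sum_le_sum hterm).trans_eq Finset.sum_add_distrib
  rw [← Finset.mul_sum (Finset.range K) (fun k => Δ k * μ.real {ω | p k ω ≠ psgn (Z k ω)} + Δ k * μ.real {ω | p' k ω ≠ psgn (Z' k ω)}),
    Finset.sum_add_distrib (f := fun k => Δ k * μ.real {ω | p k ω ≠ psgn (Z k ω)})] at hs
  have mono : ∀ f : ℕ → ℝ, (∀ k, 0 ≤ f k) → ∑ k ∈ Finset.range K, f k ≤ ∑ k ∈ Finset.range N, f k := fun f hf =>
    Finset.sum_le_sum_of_subset_of_nonneg (Finset.range_mono hK) fun k _ _ => hf k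
  have w1 := mono (fun k => Δ k * μ.real {ω | p k ω ≠ psgn (Z k ω)}) fun k => mul_nonneg (h.pos k) measureReal_nonneg
  have w2 := mono (fun k => Δ k * μ.real {ω | p' k ω ≠ psgn (Z' k ω)}) fun k => mul_nonneg (h.pos k) measureReal_nonneg
  have w3 := mono (fun k => Δ k / 2 * ∫ ω, Fd2 δ (Z k ω - Z' k ω) * (p k ω - p' k ω) ^ 2 ∂μ) fun k =>
    mul_nonneg (by have := h.pos k; positivity) (integral_nonneg fun ω => mul_nonneg (Fd2_nonneg _ _) (sq_nonneg _))
  have w4 := (mono Δ h.pos).trans hT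
  have w5 : CT (2 * lam + 2) * (∑ k ∈ Finset.range K, Δ k) * √d / δ ^ 2 ≤ CT (2 * lam + 2) * T * √d / δ ^ 2 := by
    have := CT_nonneg (2 * lam + 2)
    gcongr
  have := (abs_le.1 hdyn).2
  unfold wrong
  rw [h0] at this
  have w6 := mul_le_mul_of_nonneg_left (add_le_add w1 w2) (show 0 ≤ 2 * lam by positivity)
  linarith

lemma sum_half_pow (J : ℕ) : ∑ j ∈ Finset.range J, (1/2 : ℝ) ^ j ≤ 2 := by
  rw [geom_sum_eq (by norm_num)]
  have : (0:ℝ) ≤ (1/2) ^ J := by positivity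
  rw [div_le_iff_of_neg (by norm_num)]; linarith

/-- averaged estimate -/
lemma pair_avg (P : Par lam α1 α2 β1 β2) (h : Inc H μ ξ η Δ N) (hp : Sgn H p N) (hp' : Sgn H p' N)
    {d δ T : ℝ} (hd : d ≤ 1)
    (hΔ : ∀ k < N, 0 < Δ k) (hΔd : ∀ k < N, Δ k ≤ d) (hδ : 0 < δ) (hδ1 : δ ≤ 1)
    (hT : ∑ k ∈ Finset.range N, Δ k ≤ T) {K : ℕ} (hK : K ≤ N) (J : ℕ) {E : ℝ}
    (hE : wrong μ p (zw y lam α1 α2 β1 β2 p ξ η Δ) Δ N + wrong μ p' (zw y lam α1 α2 β1 β2 p' ξ η Δ) Δ N ≤ E) :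
    J * ∫ ω, |zw y lam α1 α2 β1 β2 p ξ η Δ K ω - zw y lam α1 α2 β1 β2 p' ξ η Δ K ω| ∂μ ≤
      2 + 2 * lam * J * E + 16 * (Czw lam α1 α2 T * (1 + √d / δ ^ 2)) +
      2 * 2 ^ J * (E + 4 * Czw lam α1 α2 T * (δ + √d / δ)) + J * (CT (2 * lam + 2) * T * √d * 4 ^ J) := by
  have hl := P.lam0
  set Z := zw y lam α1 α2 β1 β2 p ξ η Δ with hZ
  set Z' := zw y lam α1 α2 β1 β2 p' ξ η Δ with hZ'
  have hT0 : 0 ≤ T := (Finset.sum_nonneg fun k _ => h.pos k).trans hT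
  have hmZ : ∀ k ≤ N, Measurable (Z k) := fun k hk => zw_meas P h hp.adm hk
  have hmZ' : ∀ k ≤ N, Measurable (Z' k) := fun k hk => zw_meas P h hp'.adm hk
  have hmp : ∀ k < N, Measurable (p k) := fun k hk => (hp.meas k hk).mono (h.le k) le_rfl
  have hmp' : ∀ k < N, Measurable (p' k) := fun k hk => (hp'.meas k hk).mono (h.le k) le_rfl
  have hpow : ∀ j : ℕ, (0:ℝ) < (1/2) ^ j ∧ (1/2 : ℝ) ^ j ≤ 1 := fun j => ⟨by positivity, pow_le_one₀ (by norm_num) (by norm_num)⟩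
  have hone := fun j (_ : j ∈ Finset.range J) => pair_one (y := y) P h hp hp' hd hΔ hΔd (hpow j).1 (hpow j).2 hT hK
  have hsum := Finset.sum_le_sum hone
  rw [Finset.sum_const, Finset.card_range, nsmul_eq_mul] at hsum
  refine hsum.trans ?_
  rw [Finset.sum_add_distrib, Finset.sum_add_distrib, Finset.sum_add_distrib, Finset.sum_const, Finset.card_range, nsmul_eq_mul]
  have A1 := sum_half_pow J
  have A2 : (J:ℝ) * (2 * lam * (wrong μ p Z Δ N + wrong μ p' Z' Δ N)) ≤ 2 * lam * J * E := by
    calc _ ≤ (J:ℝ) * (2 * lam * E) := by gcongr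
      _ = _ := by ring
  have A4 : ∑ j ∈ Finset.range J, CT (2 * lam + 2) * T * √d / ((1/2 : ℝ) ^ j) ^ 2 ≤ J * (CT (2 * lam + 2) * T * √d * 4 ^ J) := by
    have hC := CT_nonneg (2 * lam + 2)
    calc _ ≤ ∑ j ∈ Finset.range J, CT (2 * lam + 2) * T * √d * 4 ^ J := Finset.sum_le_sum fun j hj => by
          rw [div_eq_mul_inv]
          refine mul_le_mul_of_nonneg_left ?_ (by positivity)
          rw [one_div, ← inv_pow, ← inv_pow, inv_inv, ← pow_mul, mul_comm, pow_mul]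
          norm_num
          exact pow_le_pow_right₀ (by norm_num) (Finset.mem_range.1 hj).le
      _ = _ := by rw [Finset.sum_const, Finset.card_range, nsmul_eq_mul]
  have A3 : ∑ j ∈ Finset.range J, ∑ k ∈ Finset.range N, Δ k / 2 * ∫ ω, Fd2 ((1/2 : ℝ) ^ j) (Z k ω - Z' k ω) * (p k ω - p' k ω) ^ 2 ∂μ
      ≤ 16 * (Czw lam α1 α2 T * (1 + √d / δ ^ 2)) + 2 * 2 ^ J * (E + 4 * Czw lam α1 α2 T * (δ + √d / δ)) := by
    rw [Finset.sum_comm]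
    have hmix := mix_occ (y := y) P h hp.adm hp'.adm hd hΔ hΔd hδ hδ1 hT
    rw [← hZ, ← hZ'] at hmix
    have hocc := zw_occ' (y := y) P h hp.adm hd hΔ hΔd hδ hδ1 hT
    rw [← hZ] at hocc
    have step : ∀ k ∈ Finset.range N, ∑ j ∈ Finset.range J, Δ k / 2 * ∫ ω, Fd2 ((1/2 : ℝ) ^ j) (Z k ω - Z' k ω) * (p k ω - p' k ω) ^ 2 ∂μ ≤
        16 * (Δ k * ∫ ω, (∫ θ in (0:ℝ)..1, Fd2 δ (Z' k ω + θ * (Z k ω - Z' k ω))) ∂μ) + 2 * 2 ^ J * (Δ k * μ.real {ω | p k ω ≠ psgn (Z k ω)} +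
          Δ k * μ.real {ω | p' k ω ≠ psgn (Z' k ω)} + Δ k * μ.real {ω | |Z k ω| ≤ δ}) := by
      intro k hk
      have hkN : k < N := Finset.mem_range.1 hk
      have mZ := hmZ k hkN.le; have mZ' := hmZ' k hkN.le
      have mp := hmp k hkN; have mp' := hmp' k hkN
      have S1 : MeasurableSet {ω | p k ω ≠ psgn (Z k ω)} := meas_ne mp (psgn_meas.comp mZ)
      have S2 : MeasurableSet {ω | p' k ω ≠ psgn (Z' k ω)} := meas_ne mp' (psgn_meas.comp mZ')
      have S3 : MeasurableSet {ω | |Z k ω| ≤ δ} := measurableSet_le mZ.abs measurable_const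
      classical
      have I1 := ite_ind_int (μ := μ) S1
      have I2 := ite_ind_int (μ := μ) S2
      have I3 := ite_ind_int (μ := μ) S3
      have I0 := hmix.1 k hkN
      have hi : ∀ j ∈ Finset.range J, Integrable (fun ω => Fd2 ((1/2 : ℝ) ^ j) (Z k ω - Z' k ω) * (p k ω - p' k ω) ^ 2) μ := fun j _ => by
        refine integrable_of_bdd (C := 1 / (1/2 : ℝ) ^ j * 4) (((Fd2_cont (hpow j).1).measurable.comp (mZ.sub mZ')).mul ((mp.sub mp').pow_const 2)) fun ω => ?_
        rw [abs_mul, abs_of_nonneg (sq_nonneg (p k ω - p' k ω))]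
        refine mul_le_mul (Fd2_abs (hpow j).1 _) ?_ (sq_nonneg _) (by positivity)
        rcases hp.pm k hkN ω with e | e <;> rcases hp'.pm k hkN ω with e' | e' <;> rw [e, e'] <;> norm_num
      rw [← Finset.mul_sum, ← integral_finset_sum _ hi]
      have hle : ∫ ω, ∑ j ∈ Finset.range J, Fd2 ((1/2 : ℝ) ^ j) (Z k ω - Z' k ω) * (p k ω - p' k ω) ^ 2 ∂μ ≤
          32 * (∫ ω, (∫ θ in (0:ℝ)..1, Fd2 δ (Z' k ω + θ * (Z k ω - Z' k ω))) ∂μ) + 4 * 2 ^ J *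
          (μ.real {ω | p k ω ≠ psgn (Z k ω)} + μ.real {ω | p' k ω ≠ psgn (Z' k ω)} + μ.real {ω | |Z k ω| ≤ δ}) := by
        have I12 := intadd I1.1 I2.1
        have I123 := intadd I12 I3.1
        rw [← I1.2, ← I2.2, ← I3.2, ← integral_add I1.1 I2.1, ← integral_add I12 I3.1, ← integral_const_mul, ← integral_const_mul,
          ← integral_add (I0.const_mul _) (I123.const_mul _)]
        refine integral_mono (integrable_finset_sum _ hi) (intadd (I0.const_mul _) (I123.const_mul _)) fun ω => ?_
        have := scale_pt (J := J) hδ (z := Z k ω) (z' := Z' k ω) (hp.pm k hkN ω) (hp'.pm k hkN ω)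
        rw [Finset.sum_mul] at this
        simpa only [mem_setOf_eq] using this
      have := mul_le_mul_of_nonneg_left hle (show 0 ≤ Δ k / 2 by have := h.pos k; positivity)
      refine this.trans (le_of_eq ?_)
      ring
    have hs := Finset.sum_le_sum step
    refine hs.trans ?_
    rw [Finset.sum_add_distrib, ← Finset.mul_sum, ← Finset.mul_sum, Finset.sum_add_distrib, Finset.sum_add_distrib]
    have e1 : (∑ k ∈ Finset.range N, Δ k * μ.real {ω | p k ω ≠ psgn (Z k ω)}) = wrong μ p Z Δ N := rfl
    have e2 : (∑ k ∈ Finset.range N, Δ k * μ.real {ω | p' k ω ≠ psgn (Z' k ω)}) = wrong μ p' Z' Δ N := rfl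
    rw [e1, e2]
    gcongr
    exact hmix.2
  linarith

lemma wrong_opp (P : Par lam α1 α2 β1 β2) (h : Inc H μ ξ η Δ N) (hp : Sgn H p N) (hp' : Sgn H p' N)
    {d δ T : ℝ} (hd : d ≤ 1)
    (hΔ : ∀ k < N, 0 < Δ k) (hΔd : ∀ k < N, Δ k ≤ d) (hδ : 0 < δ) (hδ1 : δ ≤ 1)
    (hT : ∑ k ∈ Finset.range N, Δ k ≤ T) {E R : ℝ}
    (hE : wrong μ p (zw y lam α1 α2 β1 β2 p ξ η Δ) Δ N + wrong μ p' (zw y lam α1 α2 β1 β2 p' ξ η Δ) Δ N ≤ E)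
    (hR : ∀ K ≤ N, ∫ ω, |zw y lam α1 α2 β1 β2 p ξ η Δ K ω - zw y lam α1 α2 β1 β2 p' ξ η Δ K ω| ∂μ ≤ R) :
    ∑ k ∈ Finset.range N, Δ k * μ.real {ω | p k ω ≠ p' k ω} ≤ E + 4 * Czw lam α1 α2 T * (δ + √d / δ) + T * (R / δ) := by
  set Z := zw y lam α1 α2 β1 β2 p ξ η Δ with hZ
  set Z' := zw y lam α1 α2 β1 β2 p' ξ η Δ with hZ'
  have hR0 : 0 ≤ R := (integral_nonneg fun ω => abs_nonneg _).trans (hR 0 (Nat.zero_le _))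
  have hocc := zw_occ' (y := y) P h hp.adm hd hΔ hΔd hδ hδ1 hT
  rw [← hZ] at hocc
  have step : ∀ k ∈ Finset.range N, Δ k * μ.real {ω | p k ω ≠ p' k ω} ≤ Δ k * μ.real {ω | p k ω ≠ psgn (Z k ω)} +
          Δ k * μ.real {ω | p' k ω ≠ psgn (Z' k ω)} + Δ k * μ.real {ω | |Z k ω| ≤ δ} + Δ k * (R / δ) := by
    intro k hk
    have hkN : k < N := Finset.mem_range.1 hk
    have hDi : Integrable (fun ω => Z k ω - Z' k ω) μ :=
      (walk_integrable (z0 := 0) h (P.coefD hp.adm hp'.adm) hkN.le).congr (ae_of_all _ fun ω => (zw_diff k ω).symm)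
    have hmk : μ.real {ω | δ ≤ |Z k ω - Z' k ω|} ≤ R / δ := by
      rw [le_div_iff₀ hδ, mul_comm]
      exact (mul_meas_ge_le_integral_of_nonneg (ae_of_all _ fun ω => abs_nonneg _) hDi.abs δ).trans (hR k hkN.le)
    have hsub : {ω | p k ω ≠ p' k ω} ⊆ ({ω | p k ω ≠ psgn (Z k ω)} ∪ {ω | p' k ω ≠ psgn (Z' k ω)} ∪ {ω | |Z k ω| ≤ δ}) ∪
        {ω | δ ≤ |Z k ω - Z' k ω|} := by
      intro ω hω
      by_contra hcon
      simp only [mem_union, mem_setOf_eq, not_or, not_le, ne_eq, not_not] at hcon hω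
      obtain ⟨⟨⟨h1, h2⟩, h3⟩, h4⟩ := hcon
      rw [h1, h2] at hω
      apply hω
      unfold psgn
      rw [abs_lt] at h4
      rcases lt_abs.1 h3 with h5 | h5 <;> split_ifs <;> linarith
    have u := (measureReal_mono (μ := μ) hsub).trans (measureReal_union_le _ _)
    have u2 := measureReal_union_le (μ := μ) ({ω | p k ω ≠ psgn (Z k ω)} ∪ {ω | p' k ω ≠ psgn (Z' k ω)}) {ω | |Z k ω| ≤ δ}
    have u3 := measureReal_union_le (μ := μ) {ω | p k ω ≠ psgn (Z k ω)} {ω | p' k ω ≠ psgn (Z' k ω)}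
    have := mul_le_mul_of_nonneg_left (show μ.real {ω | p k ω ≠ p' k ω} ≤ μ.real {ω | p k ω ≠ psgn (Z k ω)} +
          μ.real {ω | p' k ω ≠ psgn (Z' k ω)} + μ.real {ω | |Z k ω| ≤ δ} + R / δ by linarith) (h.pos k)
    linarith
  refine (Finset.sum_le_sum step).trans ?_
  rw [Finset.sum_add_distrib, Finset.sum_add_distrib, Finset.sum_add_distrib, ← Finset.sum_mul]
  have e1 : (∑ k ∈ Finset.range N, Δ k * μ.real {ω | p k ω ≠ psgn (Z k ω)}) = wrong μ p Z Δ N := rfl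
  have e2 : (∑ k ∈ Finset.range N, Δ k * μ.real {ω | p' k ω ≠ psgn (Z' k ω)}) = wrong μ p' Z' Δ N := rfl
  rw [e1, e2]
  gcongr

/-- Euler type sign processes -/
def Eul {Ω : Type*} (p Z : ℕ → Ω → ℝ) (Δ : ℕ → ℝ) (N : ℕ) (d : ℝ) : Prop :=
  ∃ κ : ℕ → ℕ, ∀ k < N, κ k ≤ k ∧ ∑ i ∈ Finset.Ico (κ k) k, Δ i ≤ d ∧ ∀ ω, p k ω = psgn (Z (κ k) ω)

lemma wrong_eul (P : Par lam α1 α2 β1 β2) (h : Inc H μ ξ η Δ N) (hp : Adm H p N)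
    {d δ T : ℝ} (hd0 : 0 ≤ d) (hd : d ≤ 1)
    (hΔ : ∀ k < N, 0 < Δ k) (hΔd : ∀ k < N, Δ k ≤ d) (hδ : 0 < δ) (hδ1 : δ ≤ 1)
    (hT : ∑ k ∈ Finset.range N, Δ k ≤ T) (he : Eul p (zw y lam α1 α2 β1 β2 p ξ η Δ) Δ N d) :
    wrong μ p (zw y lam α1 α2 β1 β2 p ξ η Δ) Δ N ≤ 4 * Czw lam α1 α2 T * (δ + √d / δ) + T * (CW (2 * lam + 2) d / δ ^ 2) := by
  obtain ⟨κ, hκ⟩ := he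
  set Z := zw y lam α1 α2 β1 β2 p ξ η Δ with hZ
  have hocc := zw_occ' (y := y) P h hp hd hΔ hΔd hδ hδ1 hT
  rw [← hZ] at hocc
  have step : ∀ k ∈ Finset.range N, Δ k * μ.real {ω | p k ω ≠ psgn (Z k ω)} ≤
      Δ k * μ.real {ω | |Z k ω| ≤ δ} + Δ k * (CW (2 * lam + 2) d / δ ^ 2) := by
    intro k hk
    have hkN : k < N := Finset.mem_range.1 hk
    obtain ⟨k1, k2, k3⟩ := hκ k hkN
    have hinc := walk_incr (z0 := y) h (P.coef hp) k1 hkN.le k2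
    have hmk : μ.real {ω | δ ^ 2 ≤ (Z k ω - Z (κ k) ω) ^ 2} ≤ CW (2 * lam + 2) d / δ ^ 2 := by
      rw [le_div_iff₀ (by positivity), mul_comm]
      exact (mul_meas_ge_le_integral_of_nonneg (ae_of_all _ fun ω => sq_nonneg _) hinc.1.integrable_sq _).trans hinc.2
    have hsub : {ω | p k ω ≠ psgn (Z k ω)} ⊆ {ω | |Z k ω| ≤ δ} ∪ {ω | δ ^ 2 ≤ (Z k ω - Z (κ k) ω) ^ 2} := by
      intro ω hω
      by_contra hcon
      simp only [mem_union, mem_setOf_eq, not_or, not_le, ne_eq] at hcon hω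
      obtain ⟨h3, h4⟩ := hcon
      rw [k3] at hω
      apply hω
      have h4' := abs_lt_of_sq_lt_sq h4 hδ.le
      unfold psgn
      rw [abs_lt] at h4'
      rcases lt_abs.1 h3 with h5 | h5 <;> split_ifs <;> linarith
    have u := (measureReal_mono (μ := μ) hsub).trans (measureReal_union_le _ _)
    rw [← mul_add]
    exact mul_le_mul_of_nonneg_left (u.trans (by linarith)) (h.pos k)
  refine (Finset.sum_le_sum step).trans ?_
  rw [Finset.sum_add_distrib, ← Finset.sum_mul]
  have : 0 ≤ CW (2 * lam + 2) d / δ ^ 2 := by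
    unfold CW; positivity
  gcongr

end Pair
end

section
/-! ### The pair lemma, final form -/

/-- an Euler type scheme of mesh at most `d` on a grid -/
structure Es {Ω : Type*} [m : MeasurableSpace Ω] (μ : Measure Ω) (H : ℕ → MeasurableSpace Ω) (ξ η : ℕ → Ω → ℝ)
    (Δ : ℕ → ℝ) (N : ℕ) (p : ℕ → Ω → ℝ) (y lam α1 α2 β1 β2 d T : ℝ) : Prop where
  inc : Inc H μ ξ η Δ N
  sgn : Sgn H p N
  pos : ∀ k < N, 0 < Δ k
  mesh : ∀ k < N, Δ k ≤ d
  tot : ∑ k ∈ Finset.range N, Δ k ≤ T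
  eul : Eul p (zw y lam α1 α2 β1 β2 p ξ η Δ) Δ N d

lemma Es.mono {Ω : Type*} [m : MeasurableSpace Ω] {μ : Measure Ω} {H : ℕ → MeasurableSpace Ω} {ξ η : ℕ → Ω → ℝ}
    {Δ : ℕ → ℝ} {N : ℕ} {p : ℕ → Ω → ℝ} {y lam α1 α2 β1 β2 d d' T : ℝ}
    (h : Es μ H ξ η Δ N p y lam α1 α2 β1 β2 d T) (hd : d ≤ d') : Es μ H ξ η Δ N p y lam α1 α2 β1 β2 d' T := by
  refine ⟨h.inc, h.sgn, h.pos, fun k hk => (h.mesh k hk).trans hd, h.tot, ?_⟩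
  obtain ⟨κ, hκ⟩ := h.eul
  exact ⟨κ, fun k hk => ⟨(hκ k hk).1, (hκ k hk).2.1.trans hd, (hκ k hk).2.2⟩⟩

lemma small_of_cont {f : ℝ → ℝ} (hf : Continuous f) {ε : ℝ} (h0 : f 0 < ε) {b : ℝ} (hb : 0 < b) : ∃ d : ℝ, 0 < d ∧ d ≤ b ∧ f d < ε := by
  have h1 : ∀ᶠ x in nhdsWithin (0:ℝ) (Ioi 0), f x < ε :=
    (hf.tendsto 0).mono_left nhdsWithin_le_nhds |>.eventually (gt_mem_nhds h0)
  have h2 : ∀ᶠ x in nhdsWithin (0:ℝ) (Ioi 0), x ∈ Ioc (0:ℝ) b := Ioc_mem_nhdsGT hb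
  obtain ⟨d, hd⟩ := (h1.and h2).exists
  exact ⟨d, hd.2.1, hd.2.2, hd.1⟩

def EE (lam α1 α2 T δ d : ℝ) : ℝ := 4 * Czw lam α1 α2 T * (δ + √d / δ) + T * (CW (2 * lam + 2) d / δ ^ 2)

lemma EE_cont (lam α1 α2 T δ : ℝ) : Continuous (EE lam α1 α2 T δ) := by unfold EE CW; fun_prop

lemma EE_zero (lam α1 α2 T δ : ℝ) : EE lam α1 α2 T δ 0 = 4 * Czw lam α1 α2 T * δ := by simp [EE, CW]

lemma Es.wrong {Ω : Type*} [m : MeasurableSpace Ω] {μ : Measure Ω} [IsProbabilityMeasure μ] {H : ℕ → MeasurableSpace Ω} {ξ η : ℕ → Ω → ℝ}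
    {Δ : ℕ → ℝ} {N : ℕ} {p : ℕ → Ω → ℝ} {y lam α1 α2 β1 β2 d T : ℝ} (P : Par lam α1 α2 β1 β2)
    (h : Es μ H ξ η Δ N p y lam α1 α2 β1 β2 d T) (hd0 : 0 ≤ d) (hd : d ≤ 1) {δ : ℝ} (hδ : 0 < δ) (hδ1 : δ ≤ 1) :
    wrong μ p (zw y lam α1 α2 β1 β2 p ξ η Δ) Δ N ≤ EE lam α1 α2 T δ d :=
  wrong_eul P h.inc h.sgn.adm hd0 hd h.pos h.mesh hδ hδ1 h.tot h.eul

lemma exists_small {C ε : ℝ} (hC : 0 ≤ C) (hε : 0 < ε) : ∃ δ : ℝ, 0 < δ ∧ δ ≤ 1 ∧ C * δ < ε := by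
  refine small_of_cont (f := fun δ => C * δ) (by fun_prop) (by simpa using hε) one_pos

universe u

lemma pair_E1 {y lam α1 α2 β1 β2 : ℝ} (P : Par lam α1 α2 β1 β2) {T : ℝ} (hT : 0 ≤ T) {ε : ℝ} (hε : 0 < ε) :
    ∃ d : ℝ, 0 < d ∧ d ≤ 1 ∧ ∀ {Ω : Type u} [m : MeasurableSpace Ω] {μ : Measure Ω} [IsProbabilityMeasure μ]
      {H : ℕ → MeasurableSpace Ω} {ξ η : ℕ → Ω → ℝ} {Δ : ℕ → ℝ} {N : ℕ} {p p' : ℕ → Ω → ℝ},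
      Es μ H ξ η Δ N p y lam α1 α2 β1 β2 d T → Es μ H ξ η Δ N p' y lam α1 α2 β1 β2 d T →
      ∀ K ≤ N, ∫ ω, |zw y lam α1 α2 β1 β2 p ξ η Δ K ω - zw y lam α1 α2 β1 β2 p' ξ η Δ K ω| ∂μ ≤ ε := by
  have hl := P.lam0
  set C := Czw lam α1 α2 T with hC
  have hC0 : 0 ≤ C := Cocc_nonneg (by linarith) hT _
  obtain ⟨J, hJ⟩ := exists_nat_gt ((2 + 16 * C) / (ε / 2))
  have hJ0 : (0:ℝ) < J := lt_of_le_of_lt (by positivity) hJ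
  have hJ2 : 2 + 16 * C < J * (ε / 2) := by rwa [div_lt_iff₀ (by positivity)] at hJ
  obtain ⟨δ, hδ, hδ1, hδs⟩ := exists_small (C := 2 * lam * J * (8 * C) + 2 * 2 ^ J * (12 * C)) (ε := J * (ε / 2))
    (by positivity) (by positivity)
  obtain ⟨d, hd, hd1, hds⟩ := small_of_cont (f := fun d => 2 + 2 * lam * J * (EE lam α1 α2 T δ d + EE lam α1 α2 T δ d) + 16 * (C * (1 + √d / δ ^ 2)) +
      2 * 2 ^ J * ((EE lam α1 α2 T δ d + EE lam α1 α2 T δ d) + 4 * C * (δ + √d / δ)) + J * (CT (2 * lam + 2) * T * √d * 4 ^ J))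
      (ε := J * ε) (by have := EE_cont lam α1 α2 T δ; fun_prop) (by
        simp only [EE_zero, Real.sqrt_zero, zero_div, add_zero, mul_zero, zero_mul, mul_one]
        rw [← hC]
        nlinarith) one_pos
  refine ⟨d, hd, hd1, ?_⟩
  intro Ω m μ _ H ξ η Δ N p p' h h' K hK
  have := pair_avg (y := y) P h.inc h.sgn h'.sgn hd1 h.pos h.mesh hδ hδ1 h.tot hK J (add_le_add (h.wrong P hd.le hd1 hδ hδ1) (h'.wrong P hd.le hd1 hδ hδ1))
  have := this.trans hds.le
  exact le_of_mul_le_mul_left this hJ0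

lemma pair_final {y lam α1 α2 β1 β2 : ℝ} (P : Par lam α1 α2 β1 β2) {T : ℝ} (hT : 0 ≤ T) {ε : ℝ} (hε : 0 < ε) :
    ∃ d : ℝ, 0 < d ∧ d ≤ 1 ∧ ∀ {Ω : Type u} [m : MeasurableSpace Ω] {μ : Measure Ω} [IsProbabilityMeasure μ]
      {H : ℕ → MeasurableSpace Ω} {ξ η : ℕ → Ω → ℝ} {Δ : ℕ → ℝ} {N : ℕ} {p p' : ℕ → Ω → ℝ},
      Es μ H ξ η Δ N p y lam α1 α2 β1 β2 d T → Es μ H ξ η Δ N p' y lam α1 α2 β1 β2 d T →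
      (∀ K ≤ N, ∫ ω, |zw y lam α1 α2 β1 β2 p ξ η Δ K ω - zw y lam α1 α2 β1 β2 p' ξ η Δ K ω| ∂μ ≤ ε) ∧
      ∑ k ∈ Finset.range N, Δ k * μ.real {ω | p k ω ≠ p' k ω} ≤ ε := by
  have hl := P.lam0
  set C := Czw lam α1 α2 T with hC
  have hC0 : 0 ≤ C := Cocc_nonneg (by linarith) hT _
  obtain ⟨δ, hδ, hδ1, hδs⟩ := exists_small (C := 12 * C) (ε := ε / 2) (by positivity) (by positivity)
  obtain ⟨R, hR, -, hRs⟩ := exists_small (C := T * (1 / δ)) (ε := ε / 2) (by positivity) (by positivity)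
  obtain ⟨d1, hd1, hd11, h1⟩ := pair_E1.{u} (y := y) P hT (lt_min hR hε)
  obtain ⟨d, hd, hd', hds⟩ := small_of_cont (f := fun d => (EE lam α1 α2 T δ d + EE lam α1 α2 T δ d) + 4 * C * (δ + √d / δ) + T * (R / δ))
      (ε := ε) (by have := EE_cont lam α1 α2 T δ; fun_prop) (by
        simp only [EE_zero, Real.sqrt_zero, zero_div, add_zero, mul_zero, zero_mul, mul_one]
        rw [← hC]
        have : T * (R / δ) = T * (1 / δ) * R := by ring
        rw [this]; linarith) hd1
  refine ⟨d, hd, hd'.trans hd11, ?_⟩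
  intro Ω m μ _ H ξ η Δ N p p' h h'
  have k1 := h1 (h.mono hd') (h'.mono hd')
  have hdd := hd'.trans hd11
  refine ⟨fun K hK => (k1 K hK).trans (min_le_right _ _), ?_⟩
  exact (wrong_opp (y := y) P h.inc h.sgn h'.sgn hdd h.pos h.mesh hδ hδ1 h.tot
    (add_le_add (h.wrong P hd.le hdd hδ hδ1) (h'.wrong P hd.le hdd hδ hδ1)) fun K hK => (k1 K hK).trans (min_le_left _ _)).trans hds.le
end

section
/-! ### Filtrations and grids -/

lemma CL.sup_indep {Ω : Type*} {𝒢0 𝒢1 𝒢2 : MeasurableSpace Ω} [m : MeasurableSpace Ω] {μ : Measure Ω}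
    [IsProbabilityMeasure μ] {E : Type*} [MeasurableSpace E] {Z : Ω → E} {ν : Measure E}
    (h : CL 𝒢0 μ Z ν) (hA : 𝒢0 ≤ 𝒢1) (hZ : Measurable[𝒢1] Z) (hind : Indep 𝒢1 𝒢2 μ) (hAm : 𝒢0 ≤ m) (hQ : 𝒢2 ≤ m) :
    CL (𝒢0 ⊔ 𝒢2) μ Z ν := by
  have := h.prob
  refine ⟨h.meas, fun A hA' B hB => ?_⟩
  set C : Set (Set Ω) := {s | ∃ a c, MeasurableSet[𝒢0] a ∧ MeasurableSet[𝒢2] c ∧ s = a ∩ c} with hC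
  have hgen : 𝒢0 ⊔ 𝒢2 = MeasurableSpace.generateFrom C := by
    apply le_antisymm
    · refine sup_le (fun a ha => ?_) (fun c hc => ?_)
      · exact MeasurableSpace.measurableSet_generateFrom ⟨a, univ, ha, MeasurableSet.univ, by simp⟩
      · exact MeasurableSpace.measurableSet_generateFrom ⟨univ, c, MeasurableSet.univ, hc, by simp⟩
    · apply MeasurableSpace.generateFrom_le
      rintro s ⟨a, c, ha, hc, rfl⟩
      exact MeasurableSet.inter ((le_sup_left : 𝒢0 ≤ 𝒢0 ⊔ 𝒢2) a ha) ((le_sup_right : 𝒢2 ≤ 𝒢0 ⊔ 𝒢2) c hc)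
  have hpi : IsPiSystem C := by
    rintro s ⟨a, c, ha, hc, rfl⟩ s' ⟨a', c', ha', hc', rfl⟩ -
    exact ⟨a ∩ a', c ∩ c', MeasurableSet.inter ha ha', MeasurableSet.inter hc hc', by
      ext x; simp only [mem_inter_iff]; tauto⟩
  have hsup : 𝒢0 ⊔ 𝒢2 ≤ m := sup_le hAm hQ
  have hZB : MeasurableSet (Z ⁻¹' B) := h.meas hB
  refine MeasurableSpace.induction_on_inter (m := 𝒢0 ⊔ 𝒢2) (C := fun A _ => μ (A ∩ Z ⁻¹' B) = μ A * ν B) hgen hpi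
    (by simp) ?_ ?_ ?_ A hA'
  · rintro s ⟨a, c, ha, hc, rfl⟩
    have h1 := (Indep_iff _ _ μ).1 hind (a ∩ Z ⁻¹' B) c (MeasurableSet.inter (hA a ha) (hZ hB)) hc
    have h2 := (Indep_iff _ _ μ).1 hind a c (hA a ha) hc
    rw [h.rect a ha B hB] at h1
    rw [h2, mul_right_comm, ← h1]
    congr 1; ext x; simp only [mem_inter_iff]; tauto
  · intro t ht iht
    have ht' := hsup t ht
    have e1 : μ (tᶜ ∩ Z ⁻¹' B) = μ (Z ⁻¹' B) - μ (t ∩ Z ⁻¹' B) := by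
      rw [← measure_diff inter_subset_right ((ht'.inter hZB).nullMeasurableSet) (measure_ne_top _ _)]
      congr 1; ext x; simp only [mem_inter_iff, mem_compl_iff, Set.mem_diff]; tauto
    rw [e1, iht, prob_compl_eq_one_sub ht', ENNReal.sub_mul (fun _ _ => measure_ne_top _ _), one_mul, ← h.law,
      Measure.map_apply h.meas hB]
  · intro f hd hf ih
    rw [iUnion_inter, measure_iUnion, measure_iUnion hd (fun i => hsup _ (hf i)), ← ENNReal.tsum_mul_right]
    · exact tsum_congr ih
    · intro i j hij
      exact (hd hij).mono inter_subset_left inter_subset_left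
    · exact fun i => (hsup _ (hf i)).inter hZB

/-- augmentation changes sets only by null sets -/
lemma augSA_ae {μ : Measure Ω} {𝒢 : Unit → MeasurableSpace Ω} {A : Set Ω} (hA : MeasurableSet[augSA μ (𝒢 ())] A) :
    ∃ A', MeasurableSet[𝒢 ()] A' ∧ A =ᵐ[μ] A' := by
  have hle : augSA μ (𝒢 ()) ≤ @eventuallyMeasurableSpace Ω (𝒢 ()) (ae μ) _ := by
    refine sup_le (fun a ha => ⟨a, ha, EventuallyEq.refl _ _⟩) ?_
    apply MeasurableSpace.generateFrom_le
    intro a ha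
    refine ⟨∅, @MeasurableSet.empty Ω (𝒢 ()), ?_⟩
    exact ae_eq_empty.2 ha
  obtain ⟨A', h, h'⟩ := hle A hA
  exact ⟨A', h, h'⟩

/-- the augmented filtration of the planar process, intersected with the ambient σ-algebra -/
def GG (μ : Measure Ω) (U1 U2 : ℝ → Ω → ℝ) (t : ℝ) : MeasurableSpace Ω :=
  natFilt μ (fun s ω => (U1 s ω, U2 s ω)) t ⊓ m

lemma GG_le (μ : Measure Ω) (U1 U2 : ℝ → Ω → ℝ) (t : ℝ) : GG μ U1 U2 t ≤ m := inf_le_right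

lemma natSA_mono {E : Type*} [MeasurableSpace E] (Ξ : ℝ → Ω → E) : Monotone (natSA Ξ) := by
  intro s t hst
  exact iSup₂_le fun r hr => le_iSup₂_of_le r ⟨hr.1, hr.2.trans hst⟩ le_rfl

lemma natSA_meas {E : Type*} [MeasurableSpace E] (Ξ : ℝ → Ω → E) {s t : ℝ} (hs : 0 ≤ s) (hst : s ≤ t) :
    Measurable[natSA Ξ t] (Ξ s) := by
  have : MeasurableSpace.comap (Ξ s) inferInstance ≤ natSA Ξ t :=
    le_iSup₂_of_le (f := fun r (_ : r ∈ Icc (0:ℝ) t) => MeasurableSpace.comap (Ξ r) inferInstance) s ⟨hs, hst⟩ le_rfl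
  exact measurable_iff_comap_le.2 this

lemma GG_mono (μ : Measure Ω) (U1 U2 : ℝ → Ω → ℝ) : Monotone (GG μ U1 U2) := by
  intro s t hst
  exact inf_le_inf_right _ (sup_le_sup_right (natSA_mono _ hst) _)

lemma GG_null (μ : Measure Ω) (U1 U2 : ℝ → Ω → ℝ) (t : ℝ) {A : Set Ω} (hA : MeasurableSet A) (h0 : μ A = 0) :
    MeasurableSet[GG μ U1 U2 t] A := by
  refine ⟨?_, hA⟩
  exact (le_sup_right : _ ≤ augSA μ _) A (MeasurableSpace.measurableSet_generateFrom h0)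

lemma GG_congr {μ : Measure Ω} {U1 U2 : ℝ → Ω → ℝ} {t : ℝ} {f g : Ω → ℝ} (hf : Measurable[GG μ U1 U2 t] f)
    (hg : Measurable g) (hfg : f =ᵐ[μ] g) : Measurable[GG μ U1 U2 t] g := by
  have hf' : Measurable f := hf.mono (GG_le μ U1 U2 t) le_rfl
  have hne : MeasurableSet {ω | f ω ≠ g ω} := (measurableSet_eq_fun hf' hg).compl
  have h0 : μ {ω | f ω ≠ g ω} = 0 := hfg
  intro B hB
  have e : g ⁻¹' B = (f ⁻¹' B \ {ω | f ω ≠ g ω}) ∪ (g ⁻¹' B ∩ {ω | f ω ≠ g ω}) := by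
    ext x
    by_cases hx : f x = g x <;> simp [hx]
  rw [e]
  refine MeasurableSet.union (MeasurableSet.diff (hf hB) (GG_null μ U1 U2 t hne h0)) ?_
  exact GG_null μ U1 U2 t ((hg hB).inter hne) (measure_mono_null inter_subset_right h0)

lemma GG_meas {μ : Measure Ω} {U1 U2 : ℝ → Ω → ℝ} {s t : ℝ} (hs : 0 ≤ s) (hst : s ≤ t)
    (h1 : Measurable (U1 s)) (h2 : Measurable (U2 s)) :
    Measurable[GG μ U1 U2 t] (U1 s) ∧ Measurable[GG μ U1 U2 t] (U2 s) := by
  have h : Measurable[GG μ U1 U2 t] (fun ω => (U1 s ω, U2 s ω)) := by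
    intro B hB
    refine ⟨?_, (h1.prodMk h2) hB⟩
    exact (le_sup_left : natSA _ t ≤ augSA μ _) _ (natSA_meas (fun s ω => (U1 s ω, U2 s ω)) hs hst hB)
  exact ⟨measurable_fst.comp h, measurable_snd.comp h⟩

/-- planar Brownian motion on `[0,T]` relative to a filtration -/
structure PBM {Ω : Type*} [m : MeasurableSpace Ω] (μ : Measure Ω) (G : ℝ → MeasurableSpace Ω)
    (U1 U2 : ℝ → Ω → ℝ) (T : ℝ) : Prop where
  le : ∀ t, G t ≤ m
  mono : Monotone G
  m1 : ∀ t, 0 ≤ t → t ≤ T → Measurable[G t] (U1 t)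
  m2 : ∀ t, 0 ≤ t → t ≤ T → Measurable[G t] (U2 t)
  cl : ∀ s t, 0 ≤ s → s ≤ t → t ≤ T →
    CL (G s) μ (fun ω => (U1 t ω - U1 s ω, U2 t ω - U2 s ω)) (gam2 (t - s))

lemma natSA_pair_le (U1 U2 : ℝ → Ω → ℝ) (t : ℝ) :
    natSA (fun s ω => (U1 s ω, U2 s ω)) t ≤ natSA U1 t ⊔ natSA U2 t := by
  refine iSup₂_le fun r hr => ?_
  rw [← measurable_iff_comap_le]
  exact Measurable.prodMk ((natSA_meas U1 hr.1 hr.2).mono le_sup_left le_rfl)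
    ((natSA_meas U2 hr.1 hr.2).mono le_sup_right le_rfl)

lemma path_meas (U1 : ℝ → Ω → ℝ) (s : ℝ) :
    Measurable[MeasurableSpace.comap (fun ω => (fun t => U1 t ω)) inferInstance] (U1 s) := by
  have : U1 s = (fun f : ℝ → ℝ => f s) ∘ (fun ω => (fun t => U1 t ω)) := rfl
  rw [this]
  exact (measurable_pi_apply s).comp (comap_measurable _)

lemma natSA_le_path (U1 : ℝ → Ω → ℝ) (t : ℝ) :
    natSA U1 t ≤ MeasurableSpace.comap (fun ω => (fun t => U1 t ω)) inferInstance :=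
  iSup₂_le fun r _ => measurable_iff_comap_le.1 (path_meas U1 r)

lemma pbm_of_indep {μ : Measure Ω} [IsProbabilityMeasure μ] {U1 U2 : ℝ → Ω → ℝ}
    (h1 : ∀ t, 0 ≤ t → Measurable (U1 t)) (h2 : ∀ t, 0 ≤ t → Measurable (U2 t))
    (hind : IndepFun (fun ω => (fun t => U1 t ω)) (fun ω => (fun t => U2 t ω)) μ)
    (c1 : ∀ s t, 0 ≤ s → s ≤ t → CL (natSA U1 s) μ (fun ω => U1 t ω - U1 s ω) (gam (t - s)))
    (c2 : ∀ s t, 0 ≤ s → s ≤ t → CL (natSA U2 s) μ (fun ω => U2 t ω - U2 s ω) (gam (t - s))) (T : ℝ) :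
    PBM μ (GG μ U1 U2) U1 U2 T := by
  refine ⟨GG_le μ U1 U2, GG_mono μ U1 U2, fun t ht _ => (GG_meas ht le_rfl (h1 t ht) (h2 t ht)).1,
    fun t ht _ => (GG_meas ht le_rfl (h1 t ht) (h2 t ht)).2, fun s t hs hst _ => ?_⟩
  have ht := hs.trans hst
  have hle : ∀ (V : ℝ → Ω → ℝ), (∀ t, 0 ≤ t → Measurable (V t)) → ∀ r, natSA V r ≤ m := fun V hV r =>
    iSup₂_le fun q hq => measurable_iff_comap_le.1 (hV q hq.1)
  have i0 : Indep (MeasurableSpace.comap (fun ω => (fun t => U1 t ω)) inferInstance)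
    (MeasurableSpace.comap (fun ω => (fun t => U2 t ω)) inferInstance) μ := hind
  have d1 := (c1 s t hs hst).sup_indep (𝒢2 := natSA U2 t) (natSA_le_path U1 s)
    ((path_meas U1 t).sub (path_meas U1 s)) (indep_of_indep_of_le_right i0 (natSA_le_path U2 t))
    (hle U1 h1 s) (hle U2 h2 t)
  have d2 := (c2 s t hs hst).sup_indep (𝒢2 := natSA U1 t) (natSA_le_path U2 s)
    ((path_meas U2 t).sub (path_meas U2 s)) (indep_of_indep_of_le_right i0.symm (natSA_le_path U1 t))
    (hle U2 h2 s) (hle U1 h1 t)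
  have d3 : CL (natSA U1 s ⊔ natSA U2 s) μ (fun ω => (U1 t ω - U1 s ω, U2 t ω - U2 s ω)) (gam2 (t - s)) := by
    refine CL.pair (d1.mono (sup_le_sup_left (natSA_mono U2 hst) _)) d2 ?_ ?_ (sup_le (hle U2 h2 s) (hle U1 h1 t))
    · rw [sup_comm]; exact sup_le_sup_left (natSA_mono U1 hst) _
    · exact Measurable.mono (Measurable.sub (natSA_meas U1 ht le_rfl) (natSA_meas U1 hs hst)) le_sup_right le_rfl
  have d4 := d3.mono (natSA_pair_le U1 U2 s)
  refine ⟨d4.meas, fun A hA B hB => ?_⟩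
  obtain ⟨A', hA', hAA⟩ := augSA_ae (𝒢 := fun _ => natSA (fun s ω => (U1 s ω, U2 s ω)) s) hA.1
  rw [measure_congr hAA, ← d4.rect A' hA' B hB]
  exact measure_congr (hAA.inter (EventuallyEq.refl _ _))

lemma PBM.inc {μ : Measure Ω} [IsProbabilityMeasure μ] {G : ℝ → MeasurableSpace Ω} {U1 U2 : ℝ → Ω → ℝ} {T : ℝ}
    (h : PBM μ G U1 U2 T) {τ : ℕ → ℝ} {N : ℕ} (hτ : Monotone τ) (h0 : 0 ≤ τ 0) (hN : τ N ≤ T) :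
    Inc (fun k => G (τ k)) μ (fun k ω => U1 (τ (k+1)) ω - U1 (τ k) ω) (fun k ω => U2 (τ (k+1)) ω - U2 (τ k) ω)
      (fun k => τ (k+1) - τ k) N := by
  have p : ∀ k, 0 ≤ τ k := fun k => h0.trans (hτ (Nat.zero_le k))
  have q : ∀ k < N, τ (k+1) ≤ T := fun k hk => (hτ hk).trans hN
  have r : ∀ k, τ k ≤ τ (k+1) := fun k => hτ (Nat.le_succ k)
  refine ⟨fun k => h.le _, fun i j hij => h.mono (hτ hij), fun k => sub_nonneg.2 (r k), fun k hk => ?_, fun k hk => ?_,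
    fun k hk => h.cl _ _ (p k) (r k) (q k hk)⟩
  · exact (h.m1 _ (p _) (q k hk)).sub ((h.m1 _ (p _) ((r k).trans (q k hk))).mono (h.mono (r k)) le_rfl)
  · exact (h.m2 _ (p _) (q k hk)).sub ((h.m2 _ (p _) ((r k).trans (q k hk))).mono (h.mono (r k)) le_rfl)

/-- ordering a finite set of times -/
structure Grid (S : Finset ℝ) (T : ℝ) (τ : ℕ → ℝ) (N : ℕ) : Prop where
  mono : Monotone τ
  strict : ∀ k < N, τ k < τ (k+1)
  zero : τ 0 = 0
  last : τ N = T
  mem : ∀ k, τ k ∈ S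
  ex : ∀ s ∈ S, ∃ k ≤ N, τ k = s
  next : ∀ s ∈ S, ∀ k, τ k < s → τ (k+1) ≤ s

lemma exists_grid (S : Finset ℝ) {T : ℝ} (h0 : (0:ℝ) ∈ S) (hT : T ∈ S) (hS : ∀ s ∈ S, 0 ≤ s ∧ s ≤ T) :
    ∃ τ N, Grid S T τ N := by
  have hc : 0 < S.card := Finset.card_pos.2 ⟨0, h0⟩
  obtain ⟨n, hn⟩ : ∃ n, S.card = n + 1 := ⟨S.card - 1, by omega⟩
  let e := S.orderEmbOfFin hn
  let τ : ℕ → ℝ := fun k => e ⟨min k n, by omega⟩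
  have hex : ∀ s ∈ S, ∃ k ≤ n, τ k = s := by
    intro s hs
    have : s ∈ Set.range e := by rw [Finset.range_orderEmbOfFin]; exact hs
    obtain ⟨i, hi⟩ := this
    refine ⟨i, by omega, ?_⟩
    rw [← hi]
    change e _ = e i
    congr 1
    ext; simp; omega
  have hmono : Monotone τ := fun i j hij => e.monotone (by simp only [Fin.mk_le_mk]; omega)
  have hmem : ∀ k, τ k ∈ S := fun k => Finset.orderEmbOfFin_mem _ _ _
  refine ⟨τ, n, hmono, fun k hk => e.strictMono (by simp only [Fin.mk_lt_mk]; omega), ?_, ?_, hmem, hex, ?_⟩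
  · obtain ⟨k, -, hk⟩ := hex 0 h0
    exact le_antisymm (hk ▸ hmono (Nat.zero_le k)) (hS _ (hmem 0)).1
  · obtain ⟨k, hkn, hk⟩ := hex T hT
    exact le_antisymm (hS _ (hmem n)).2 (hk ▸ hmono hkn)
  · intro s hs k hk
    obtain ⟨j, -, rfl⟩ := hex s hs
    apply hmono
    by_contra hcon
    exact absurd (hmono (by omega : j ≤ k)) (not_le.2 hk)
end

section
/-! ### The Euler scheme -/

/-- integral of a step function `p` (constant on `[i d, (i+1) d)`) against a path -/
def eS (p : ℕ → ℝ) (d : ℝ) (V : ℝ → ℝ) (s : ℝ) : ℝ :=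
  ∑ i ∈ Finset.range ⌊s / d⌋₊, p i * (V ((i + 1 : ℕ) * d) - V (i * d)) +
    p ⌊s / d⌋₊ * (V s - V (⌊s / d⌋₊ * d))

lemma eS_eq (p : ℕ → ℝ) {d : ℝ} (hd : 0 < d) (V : ℝ → ℝ) {q : ℕ} {s : ℝ} (h1 : q * d ≤ s) (h2 : s ≤ (q + 1) * d) :
    eS p d V s = ∑ i ∈ Finset.range q, p i * (V ((i + 1 : ℕ) * d) - V (i * d)) + p q * (V s - V (q * d)) := by
  rcases h2.lt_or_eq with h | h
  · have : ⌊s / d⌋₊ = q := by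
      rw [Nat.floor_eq_iff (by have : 0 ≤ (q:ℝ) * d := by positivity
                               have : 0 ≤ s := this.trans h1
                               positivity), le_div_iff₀ hd, div_lt_iff₀ hd]
      exact ⟨h1, h⟩
    rw [eS, this]
  · have : ⌊s / d⌋₊ = q + 1 := by
      rw [h, mul_div_assoc, div_self hd.ne', mul_one]
      exact_mod_cast Nat.floor_natCast (R := ℝ) (q + 1)
    rw [eS, this, Finset.sum_range_succ]
    have e : ((q + 1 : ℕ) : ℝ) * d = s := by rw [h]; push_cast; ring
    rw [e]; ring

lemma floor_le_mul {d s : ℝ} (hd : 0 < d) (hs : 0 ≤ s) : (⌊s / d⌋₊ : ℝ) * d ≤ s := by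
  rw [← le_div_iff₀ hd]; exact Nat.floor_le (by positivity)

lemma lt_floor_mul {d s : ℝ} (hd : 0 < d) : s < ((⌊s / d⌋₊ : ℝ) + 1) * d := by
  rw [← div_lt_iff₀ hd]; exact Nat.lt_floor_add_one _

lemma eS_incr (p : ℕ → ℝ) {d : ℝ} (hd : 0 < d) (V : ℝ → ℝ) {q : ℕ} {s s' : ℝ} (h1 : q * d ≤ s) (hs : s ≤ s')
    (h2 : s' ≤ (q + 1) * d) : eS p d V s' - eS p d V s = p q * (V s' - V s) := by
  rw [eS_eq p hd V h1 (hs.trans h2), eS_eq p hd V (h1.trans hs) h2]; ring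

lemma eS_zero (p : ℕ → ℝ) (d : ℝ) (V : ℝ → ℝ) : eS p d V 0 = 0 := by simp [eS]

/-- a grid of `[0,T]` containing all multiples of `d` -/
structure Fine (d : ℝ) (τ : ℕ → ℝ) (N : ℕ) : Prop where
  mono : Monotone τ
  zero : τ 0 = 0
  strict : ∀ k < N, τ k < τ (k+1)
  next : ∀ k < N, τ (k+1) ≤ ((⌊τ k / d⌋₊ : ℝ) + 1) * d
  ex : ∀ k < N, ∃ j ≤ k, τ j = ⌊τ k / d⌋₊ * d

lemma Fine.nn {d : ℝ} {τ : ℕ → ℝ} {N : ℕ} (h : Fine d τ N) (k : ℕ) : 0 ≤ τ k := h.zero ▸ h.mono (Nat.zero_le k)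

lemma eS_step {d : ℝ} {τ : ℕ → ℝ} {N : ℕ} (h : Fine d τ N) (hd : 0 < d) (p : ℕ → ℝ) (V : ℝ → ℝ) {k : ℕ} (hk : k < N) :
    eS p d V (τ (k+1)) - eS p d V (τ k) = p ⌊τ k / d⌋₊ * (V (τ (k+1)) - V (τ k)) :=
  eS_incr p hd V (floor_le_mul hd (h.nn k)) (h.mono (Nat.le_succ k)) (h.next k hk)

lemma eS_sum {d : ℝ} {τ : ℕ → ℝ} {N : ℕ} (h : Fine d τ N) (hd : 0 < d) (p : ℕ → ℝ) (V : ℝ → ℝ) (j l : ℕ) (hK : j + l ≤ N) :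
    eS p d V (τ (j + l)) - eS p d V (τ j) = ∑ k ∈ Finset.range l, p ⌊τ (j + k) / d⌋₊ * (V (τ (j + k + 1)) - V (τ (j + k))) := by
  induction l with
  | zero => simp
  | succ l ih =>
    rw [Finset.sum_range_succ, ← ih (by omega), ← eS_step h hd p V (by omega : j + l < N)]
    ring_nf

lemma eS_sum0 {d : ℝ} {τ : ℕ → ℝ} {N : ℕ} (h : Fine d τ N) (hd : 0 < d) (p : ℕ → ℝ) (V : ℝ → ℝ) {K : ℕ} (hK : K ≤ N) :
    eS p d V (τ K) = ∑ k ∈ Finset.range K, p ⌊τ k / d⌋₊ * (V (τ (k + 1)) - V (τ k)) := by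
  have := eS_sum h hd p V 0 K (by omega)
  simpa [h.zero, eS_zero] using this

def mults (d s : ℝ) : Finset ℝ := (Finset.range (⌊s / d⌋₊ + 1)).image fun i : ℕ => (i : ℝ) * d

lemma mults_mem {d s : ℝ} (hd : 0 < d) (hs : 0 ≤ s) {x : ℝ} (hx : x ∈ mults d s) : 0 ≤ x ∧ x ≤ s := by
  simp only [mults, Finset.mem_image, Finset.mem_range] at hx
  obtain ⟨i, hi, rfl⟩ := hx
  refine ⟨by positivity, le_trans ?_ (floor_le_mul hd hs)⟩
  have : (i : ℝ) ≤ ⌊s / d⌋₊ := by exact_mod_cast Nat.lt_succ_iff.1 hi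
  gcongr

lemma mem_mults {d s : ℝ} (hd : 0 < d) {q : ℕ} (hq : q * d ≤ s) : (q : ℝ) * d ∈ mults d s := by
  simp only [mults, Finset.mem_image, Finset.mem_range]
  exact ⟨q, Nat.lt_succ_of_le (Nat.le_floor ((le_div_iff₀ hd).2 hq)), rfl⟩

lemma Grid.fine {S : Finset ℝ} {T : ℝ} {τ : ℕ → ℝ} {N : ℕ} (h : Grid S T τ N) {d : ℝ} (hd : 0 < d)
    (hS : mults d T ⊆ S) : Fine d τ N := by
  have nn : ∀ k, 0 ≤ τ k := fun k => h.zero ▸ h.mono (Nat.zero_le k)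
  have hle : ∀ k ≤ N, τ k ≤ T := fun k hk => h.last ▸ h.mono hk
  refine ⟨h.mono, h.zero, h.strict, fun k hk => ?_, fun k hk => ?_⟩
  · by_cases hc : ((⌊τ k / d⌋₊ + 1 : ℕ) : ℝ) * d ≤ T
    · have := h.next _ (hS (mem_mults hd hc)) k (by push_cast; exact lt_floor_mul hd)
      exact_mod_cast this
    · push Not at hc
      push_cast at hc
      exact (hle _ hk).trans hc.le
  · have hq : (⌊τ k / d⌋₊ : ℝ) * d ≤ τ k := floor_le_mul hd (nn k)
    obtain ⟨j, hj, e⟩ := h.ex _ (hS (mem_mults hd (hq.trans (hle k hk.le))))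
    rcases le_or_gt j k with hjk | hjk
    · exact ⟨j, hjk, e⟩
    · exact ⟨k, le_rfl, le_antisymm (e ▸ h.mono hjk.le) hq⟩

lemma fine_unif {d : ℝ} (hd : 0 < d) (N : ℕ) : Fine d (fun k => k * d) N := by
  have e : ∀ k : ℕ, ⌊(k : ℝ) * d / d⌋₊ = k := fun k => by rw [mul_div_assoc, div_self hd.ne', mul_one, Nat.floor_natCast]
  refine ⟨fun i j hij => by have : (i:ℝ) ≤ j := by exact_mod_cast hij
                            show (i:ℝ) * d ≤ j * d; gcongr, by simp, fun k _ => ?_, fun k _ => ?_, fun k _ => ⟨k, le_rfl, by simp only [e]⟩⟩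
  · push_cast; nlinarith
  · simp only [e]; push_cast; exact le_rfl

/-- merged grid -/
lemma exists_merge {d d' s t : ℝ} (hd : 0 < d) (hd' : 0 < d') (hs : 0 ≤ s) (hst : s ≤ t) :
    ∃ τ N j, Fine d τ N ∧ Fine d' τ N ∧ j ≤ N ∧ τ j = s ∧ τ N = t := by
  classical
  have ht := hs.trans hst
  obtain ⟨τ, N, h⟩ := exists_grid (mults d t ∪ mults d' t ∪ {0, s, t}) (T := t) (by simp) (by simp) (by
    intro x hx
    simp only [Finset.mem_union, Finset.mem_insert, Finset.mem_singleton] at hx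
    rcases hx with (hx | hx) | rfl | rfl | rfl
    · exact mults_mem hd ht hx
    · exact mults_mem hd' ht hx
    · exact ⟨le_rfl, ht⟩
    · exact ⟨hs, hst⟩
    · exact ⟨ht, le_rfl⟩)
  obtain ⟨j, hj, e⟩ := h.ex s (by simp)
  refine ⟨τ, N, j, h.fine hd ?_, h.fine hd' ?_, hj, e, h.last⟩
  · intro x hx; simp [hx]
  · intro x hx; simp [hx]

/-- data of the scalar equation -/
structure Dat (Ω : Type*) where
  (y lam α1 α2 β1 β2 : ℝ)
  (U1 U2 : ℝ → Ω → ℝ)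

namespace Dat
variable {Ω : Type*} (D : Dat Ω)

def P : Prop := Par D.lam D.α1 D.α2 D.β1 D.β2

def ez (d : ℝ) : ℕ → Ω → ℝ
  | 0, _ => D.y
  | k+1, ω => ez d k ω + (-D.lam * psgn (ez d k ω) * ((k+1 : ℕ) * d - k * d) +
      ((D.α1 + D.β1 * psgn (ez d k ω)) * (D.U1 ((k+1 : ℕ) * d) ω - D.U1 (k * d) ω) +
       (D.α2 + D.β2 * psgn (ez d k ω)) * (D.U2 ((k+1 : ℕ) * d) ω - D.U2 (k * d) ω)))

def ep (d : ℝ) (k : ℕ) (ω : Ω) : ℝ := psgn (D.ez d k ω)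

def eK (d s : ℝ) (ω : Ω) : ℝ := eS (fun k => D.ep d k ω) d id s
def eJ1 (d s : ℝ) (ω : Ω) : ℝ := eS (fun k => D.ep d k ω) d (fun r => D.U1 r ω) s
def eJ2 (d s : ℝ) (ω : Ω) : ℝ := eS (fun k => D.ep d k ω) d (fun r => D.U2 r ω) s
def eZ (d s : ℝ) (ω : Ω) : ℝ :=
  D.y - D.lam * D.eK d s ω + D.α1 * (D.U1 s ω - D.U1 0 ω) + D.α2 * (D.U2 s ω - D.U2 0 ω)
    + D.β1 * D.eJ1 d s ω + D.β2 * D.eJ2 d s ω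

def gp (d : ℝ) (τ : ℕ → ℝ) (k : ℕ) (ω : Ω) : ℝ := D.ep d ⌊τ k / d⌋₊ ω
def gx1 (τ : ℕ → ℝ) (k : ℕ) (ω : Ω) : ℝ := D.U1 (τ (k+1)) ω - D.U1 (τ k) ω
def gx2 (τ : ℕ → ℝ) (k : ℕ) (ω : Ω) : ℝ := D.U2 (τ (k+1)) ω - D.U2 (τ k) ω

def gz (d : ℝ) (τ : ℕ → ℝ) (k : ℕ) (ω : Ω) : ℝ :=
  zw D.y D.lam D.α1 D.α2 D.β1 D.β2 (D.gp d τ) (D.gx1 τ) (D.gx2 τ) (fun k => τ (k+1) - τ k) k ω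

lemma eZ_grid {d : ℝ} {τ : ℕ → ℝ} {N : ℕ} (h : Fine d τ N) (hd : 0 < d) {K : ℕ} (hK : K ≤ N) (ω : Ω) :
    D.gz d τ K ω = D.eZ d (τ K) ω := by
  unfold eZ eK eJ1 eJ2 gz zw walk
  rw [eS_sum0 h hd _ _ hK, eS_sum0 h hd _ _ hK, eS_sum0 h hd _ _ hK]
  have t1 : D.U1 (τ K) ω - D.U1 0 ω = ∑ k ∈ Finset.range K, D.gx1 τ k ω := by
    simp only [gx1]; rw [Finset.sum_range_sub (fun k => D.U1 (τ k) ω), h.zero]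
  have t2 : D.U2 (τ K) ω - D.U2 0 ω = ∑ k ∈ Finset.range K, D.gx2 τ k ω := by
    simp only [gx2]; rw [Finset.sum_range_sub (fun k => D.U2 (τ k) ω), h.zero]
  rw [t1, t2]
  simp only [sub_eq_add_neg D.y, add_assoc, Finset.mul_sum, ← Finset.sum_add_distrib, ← Finset.sum_neg_distrib]
  congr 1
  refine Finset.sum_congr rfl fun i _ => ?_
  simp only [gp, gx1, gx2, id]
  ring

lemma ez_eq {d : ℝ} (hd : 0 < d) (k : ℕ) (ω : Ω) : D.ez d k ω = D.eZ d (k * d) ω := by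
  have h := fine_unif hd k
  rw [← D.eZ_grid h hd le_rfl]
  suffices ∀ j, D.ez d j ω = D.gz d (fun k => (k:ℝ) * d) j ω from this k
  intro j
  have e : ∀ k : ℕ, ⌊(k : ℝ) * d / d⌋₊ = k := fun k => by rw [mul_div_assoc, div_self hd.ne', mul_one, Nat.floor_natCast]
  induction j with
  | zero => simp [ez, gz, zw, walk]
  | succ j ih =>
    unfold gz zw walk at ih ⊢
    rw [Finset.sum_range_succ, ← add_assoc, ← ih, ez]
    simp only [gp, gx1, gx2, ep, e]

section
variable {D} [m : MeasurableSpace Ω] {μ : Measure Ω} [IsProbabilityMeasure μ] {G : ℝ → MeasurableSpace Ω} {T : ℝ}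

lemma ez_meas (hB : PBM μ G D.U1 D.U2 T) {d : ℝ} (hd : 0 < d) (k : ℕ) (hk : k * d ≤ T) : Measurable[G (k * d)] (D.ez d k) := by
  induction k with
  | zero => exact measurable_const
  | succ k ih =>
    have hle : (k:ℝ) * d ≤ (k + 1 : ℕ) * d := by push_cast; nlinarith
    have ih' := (ih (hle.trans hk)).mono (hB.mono hle) le_rfl
    have a1 := hB.m1 _ (by positivity) hk
    have a2 := hB.m2 _ (by positivity) hk
    have b1 := (hB.m1 (k*d) (by positivity) (hle.trans hk)).mono (hB.mono hle) le_rfl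
    have b2 := (hB.m2 (k*d) (by positivity) (hle.trans hk)).mono (hB.mono hle) le_rfl
    have c := psgn_meas.comp ih'
    exact ih'.add (((measurable_const.mul c).mul measurable_const).add
      (((measurable_const.add (measurable_const.mul c)).mul (a1.sub b1)).add
        ((measurable_const.add (measurable_const.mul c)).mul (a2.sub b2))))

lemma gp_sgn (hB : PBM μ G D.U1 D.U2 T) {d : ℝ} (hd : 0 < d) {τ : ℕ → ℝ} {N : ℕ} (h : Fine d τ N) (hT : τ N ≤ T) :
    Sgn (fun k => G (τ k)) (D.gp d τ) N := by
  refine ⟨fun k hk => ?_, fun k hk ω => psgn_pm _⟩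
  have hq := floor_le_mul hd (h.nn k)
  exact (psgn_meas.comp (ez_meas hB hd _ (hq.trans ((h.mono hk.le).trans hT)))).mono (hB.mono hq) le_rfl

lemma ginc (hB : PBM μ G D.U1 D.U2 T) {d : ℝ} {τ : ℕ → ℝ} {N : ℕ} (h : Fine d τ N) (hT : τ N ≤ T) :
    Inc (fun k => G (τ k)) μ (D.gx1 τ) (D.gx2 τ) (fun k => τ (k+1) - τ k) N :=
  hB.inc h.mono h.zero.ge hT

lemma gtot {d : ℝ} {τ : ℕ → ℝ} {N : ℕ} (h : Fine d τ N) (K : ℕ) : ∑ k ∈ Finset.range K, (τ (k+1) - τ k) = τ K := by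
  rw [Finset.sum_range_sub, h.zero, sub_zero]

lemma ges (hB : PBM μ G D.U1 D.U2 T) {d : ℝ} (hd : 0 < d) {τ : ℕ → ℝ} {N : ℕ} (h : Fine d τ N) (hT : τ N ≤ T) :
    Es μ (fun k => G (τ k)) (D.gx1 τ) (D.gx2 τ) (fun k => τ (k+1) - τ k) N (D.gp d τ)
      D.y D.lam D.α1 D.α2 D.β1 D.β2 d T := by
  refine ⟨ginc hB h hT, gp_sgn hB hd h hT, fun k hk => sub_pos.2 (h.strict k hk), fun k hk => ?_, ?_, ?_⟩
  · have := h.next k hk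
    have := floor_le_mul hd (h.nn k)
    linarith
  · rw [gtot h]; exact hT
  · choose! κ hκ using h.ex
    refine ⟨κ, fun k hk => ⟨(hκ k hk).1, ?_, fun ω => ?_⟩⟩
    · rw [Finset.sum_Ico_eq_sub _ (hκ k hk).1, gtot h, gtot h, (hκ k hk).2]
      have := lt_floor_mul (s := τ k) hd
      linarith
    · have := D.eZ_grid h hd ((hκ k hk).1.trans hk.le) ω
      unfold gz at this
      rw [this, (hκ k hk).2, ← D.ez_eq hd]
      rfl

end
end Dat
end

section
/-! ### Estimates for the Euler scheme -/
namespace Dat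
section
variable {Ω : Type*} {D : Dat Ω} [m : MeasurableSpace Ω] {μ : Measure Ω} [IsProbabilityMeasure μ] {G : ℝ → MeasurableSpace Ω} {T : ℝ}

lemma exists_fine {d s t : ℝ} (hd : 0 < d) (hs : 0 ≤ s) (hst : s ≤ t) :
    ∃ τ N j, Fine d τ N ∧ j ≤ N ∧ τ j = s ∧ τ N = t := by
  obtain ⟨τ, N, j, h, -, h1, h2, h3⟩ := exists_merge hd hd hs hst
  exact ⟨τ, N, j, h, h1, h2, h3⟩

lemma eJ_cl (hB : PBM μ G D.U1 D.U2 T) {d s t : ℝ} (hd : 0 < d) (hs : 0 ≤ s) (hst : s ≤ t) (ht : t ≤ T) :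
    CL (G s) μ (fun ω => (D.eJ1 d t ω - D.eJ1 d s ω, D.eJ2 d t ω - D.eJ2 d s ω)) (gam2 (t - s)) := by
  obtain ⟨τ, N, j, h, hj, rfl, rfl⟩ := exists_fine hd hs hst
  have hi := ginc hB h ht
  have hp := gp_sgn hB hd h ht
  have h2 : ∀ k < N, ∀ ω, D.gp d τ k ω ^ 2 = 1 := fun k hk ω => by rcases hp.pm k hk ω with e | e <;> simp [e]
  have ho := hi.orth (a := D.gp d τ) (b := fun _ _ => 0) (c := fun _ _ => 0) (d := D.gp d τ) hp.meas
    (fun _ _ => measurable_const) (fun _ _ => measurable_const) hp.meas (fun k hk ω => by simp [h2 k hk ω])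
    (fun k hk ω => by simp [h2 k hk ω]) (fun k hk ω => by simp)
  obtain ⟨l, rfl⟩ := Nat.exists_eq_add_of_le hj
  have hl := ho.sumLaw j l le_rfl
  have e : ∑ k ∈ Finset.range l, (τ (j + k + 1) - τ (j + k)) = τ (j + l) - τ j := by
    have := Finset.sum_range_sub (fun k => τ (j + k)) l
    simpa [add_assoc] using this
  rw [e] at hl
  convert hl using 2 with ω
  unfold eJ1 eJ2
  rw [eS_sum h hd _ _ j l le_rfl, eS_sum h hd _ _ j l le_rfl]
  congr 1 <;> exact Finset.sum_congr rfl fun k _ => by simp [gp, gx1, gx2]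

lemma eK_lip {d s t : ℝ} (hd : 0 < d) (hs : 0 ≤ s) (hst : s ≤ t) (ω : Ω) : |D.eK d t ω - D.eK d s ω| ≤ t - s := by
  obtain ⟨τ, N, j, h, hj, rfl, rfl⟩ := exists_fine hd hs hst
  obtain ⟨l, rfl⟩ := Nat.exists_eq_add_of_le hj
  unfold eK
  rw [eS_sum h hd _ _ j l le_rfl]
  refine (Finset.abs_sum_le_sum_abs _ _).trans ?_
  have e : ∑ k ∈ Finset.range l, (τ (j + k + 1) - τ (j + k)) = τ (j + l) - τ j := by
    have := Finset.sum_range_sub (fun k => τ (j + k)) l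
    simpa [add_assoc] using this
  rw [← e]
  refine Finset.sum_le_sum fun k _ => ?_
  rw [abs_mul]
  have h1 : |D.ep d ⌊τ (j+k) / d⌋₊ ω| = 1 := by unfold ep; rcases psgn_pm (D.ez d ⌊τ (j+k) / d⌋₊ ω) with e | e <;> simp [e]
  rw [h1, one_mul, id, id, abs_of_nonneg (sub_nonneg.2 (h.mono (Nat.le_succ _)))]

lemma eS_meas (hB : PBM μ G D.U1 D.U2 T) {d s : ℝ} (hd : 0 < d) (hs : 0 ≤ s) (hT : s ≤ T) {V : ℝ → Ω → ℝ}
    (hV : ∀ r, 0 ≤ r → r ≤ T → Measurable[G r] (V r)) :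
    Measurable[G s] (fun ω => eS (fun k => D.ep d k ω) d (fun r => V r ω) s) := by
  obtain ⟨τ, N, j, h, hj, -, rfl⟩ := exists_fine hd le_rfl hs
  have hp := gp_sgn hB hd h hT
  have : (fun ω => eS (fun k => D.ep d k ω) d (fun r => V r ω) (τ N)) =
      fun ω => ∑ k ∈ Finset.range N, D.gp d τ k ω * (V (τ (k+1)) ω - V (τ k) ω) := by
    ext ω; rw [eS_sum0 h hd _ _ le_rfl]; rfl
  rw [this]
  refine Finset.measurable_sum _ fun k hk => ?_
  have hk := Finset.mem_range.1 hk
  have l1 : τ k ≤ τ N := h.mono hk.le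
  have l2 : τ (k+1) ≤ τ N := h.mono hk
  exact ((hp.meas k hk).mono (hB.mono l1) le_rfl).mul (((hV _ (h.nn _) (l2.trans hT)).mono (hB.mono l2) le_rfl).sub
    ((hV _ (h.nn _) (l1.trans hT)).mono (hB.mono l1) le_rfl))

lemma eK_meas (hB : PBM μ G D.U1 D.U2 T) {d s : ℝ} (hd : 0 < d) (hs : 0 ≤ s) (hT : s ≤ T) : Measurable[G s] (D.eK d s) :=
  eS_meas hB hd hs hT (V := fun r _ => r) fun _ _ _ => measurable_const

lemma eJ1_meas (hB : PBM μ G D.U1 D.U2 T) {d s : ℝ} (hd : 0 < d) (hs : 0 ≤ s) (hT : s ≤ T) : Measurable[G s] (D.eJ1 d s) :=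
  eS_meas hB hd hs hT hB.m1

lemma eJ2_meas (hB : PBM μ G D.U1 D.U2 T) {d s : ℝ} (hd : 0 < d) (hs : 0 ≤ s) (hT : s ≤ T) : Measurable[G s] (D.eJ2 d s) :=
  eS_meas hB hd hs hT hB.m2

lemma eJ_zero (d : ℝ) (ω : Ω) : D.eJ1 d 0 ω = 0 ∧ D.eJ2 d 0 ω = 0 ∧ D.eK d 0 ω = 0 :=
  ⟨eS_zero _ _ _, eS_zero _ _ _, eS_zero _ _ _⟩

lemma cl_memLp {𝒢 : Unit → MeasurableSpace Ω} {X Y : Ω → ℝ} {v : ℝ} (h : CL (𝒢 ()) μ (fun ω => (X ω, Y ω)) (gam2 v)) (hv : 0 ≤ v) :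
    MemLp X 2 μ ∧ MemLp Y 2 μ := by
  have := h.meas
  have h1 : Measurable X := measurable_fst.comp this
  have h2 : Measurable Y := measurable_snd.comp this
  constructor
  · rw [memLp_two_iff_integrable_sq h1.aestronglyMeasurable]
    exact h.integrable' (f := fun p => p.1 ^ 2) (by fun_prop) (gam2_integrable_fst v 2)
  · rw [memLp_two_iff_integrable_sq h2.aestronglyMeasurable]
    exact h.integrable' (f := fun p => p.2 ^ 2) (by fun_prop) (gam2_integrable_snd v 2)

lemma eJ_memLp (hB : PBM μ G D.U1 D.U2 T) {d s : ℝ} (hd : 0 < d) (hs : 0 ≤ s) (hT : s ≤ T) :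
    MemLp (D.eJ1 d s) 2 μ ∧ MemLp (D.eJ2 d s) 2 μ ∧ MemLp (D.eK d s) 2 μ := by
  have := cl_memLp (𝒢 := fun _ => G 0) (eJ_cl hB hd le_rfl hs hT) (by linarith)
  simp only [(eJ_zero d _).1, (eJ_zero d _).2.1, sub_zero] at this
  refine ⟨this.1, this.2, ?_⟩
  refine MemLp.of_bound ((eK_meas hB hd hs hT).mono (hB.le s) le_rfl).aestronglyMeasurable s (ae_of_all _ fun ω => ?_)
  have := eK_lip (D := D) hd le_rfl hs ω
  simpa [(eJ_zero d _).2.2] using this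

lemma eZ_meas (hB : PBM μ G D.U1 D.U2 T) {d s : ℝ} (hd : 0 < d) (hs : 0 ≤ s) (hT : s ≤ T) : Measurable[G s] (D.eZ d s) := by
  have a := eK_meas hB hd hs hT
  have b := eJ1_meas hB hd hs hT
  have c := eJ2_meas hB hd hs hT
  have u1 := hB.m1 s hs hT
  have u2 := hB.m2 s hs hT
  have v1 := (hB.m1 0 le_rfl (hs.trans hT)).mono (hB.mono hs) le_rfl
  have v2 := (hB.m2 0 le_rfl (hs.trans hT)).mono (hB.mono hs) le_rfl
  exact ((((measurable_const.sub (measurable_const.mul a)).add (measurable_const.mul (u1.sub v1))).add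
    (measurable_const.mul (u2.sub v2))).add (measurable_const.mul b)).add (measurable_const.mul c)

end

universe v
variable {Ω : Type v} {D : Dat Ω} [m : MeasurableSpace Ω] {μ : Measure Ω} [IsProbabilityMeasure μ] {G : ℝ → MeasurableSpace Ω} {T : ℝ}

lemma sq_ne_int {p q : Ω → ℝ} (hp : Measurable p) (hq : Measurable q) (h1 : ∀ ω, p ω = 1 ∨ p ω = -1) (h2 : ∀ ω, q ω = 1 ∨ q ω = -1) :
    ∫ ω, (p ω - q ω) ^ 2 ∂μ = 4 * μ.real {ω | p ω ≠ q ω} ∧ ∫ ω, |p ω - q ω| ∂μ = 2 * μ.real {ω | p ω ≠ q ω} := by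
  have hm : MeasurableSet {ω | p ω ≠ q ω} := (measurableSet_eq_fun hp hq).compl
  constructor
  · have : (fun ω => (p ω - q ω) ^ 2) = {ω | p ω ≠ q ω}.indicator (fun _ => (4:ℝ)) := by
      ext ω
      rcases h1 ω with e | e <;> rcases h2 ω with e' | e' <;> simp [Set.indicator, e, e'] <;> norm_num
    rw [this, integral_indicator_const _ hm]; simp [mul_comm]
  · have : (fun ω => |p ω - q ω|) = {ω | p ω ≠ q ω}.indicator (fun _ => (2:ℝ)) := by
      ext ω
      rcases h1 ω with e | e <;> rcases h2 ω with e' | e' <;> simp [Set.indicator, e, e'] <;> norm_num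
    rw [this, integral_indicator_const _ hm]; simp [mul_comm]

lemma cauchy (P : D.P) (hB : PBM μ G D.U1 D.U2 T) (hT : 0 ≤ T) {ε : ℝ} (hε : 0 < ε) :
    ∃ d0 : ℝ, 0 < d0 ∧ d0 ≤ 1 ∧ ∀ d d' s : ℝ, 0 < d → d ≤ d0 → 0 < d' → d' ≤ d0 → 0 ≤ s → s ≤ T →
      ∫ ω, |D.eZ d s ω - D.eZ d' s ω| ∂μ ≤ ε ∧ ∫ ω, (D.eJ1 d s ω - D.eJ1 d' s ω) ^ 2 ∂μ ≤ ε ∧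
      ∫ ω, (D.eJ2 d s ω - D.eJ2 d' s ω) ^ 2 ∂μ ≤ ε ∧ ∫ ω, (D.eK d s ω - D.eK d' s ω) ^ 2 ∂μ ≤ ε := by
  set ε' := ε / (4 * (1 + T)) with hε'
  have hε0 : 0 < ε' := by positivity
  have hε1 : 4 * (1 + T) * ε' = ε := by rw [hε']; field_simp
  obtain ⟨d0, h0, h1, hpair⟩ := pair_final.{v} (y := D.y) P hT hε0
  refine ⟨d0, h0, h1, fun d d' s hd hd0 hd' hd0' hs hsT => ?_⟩
  obtain ⟨τ, N, j, h, h', -, -, rfl⟩ := exists_merge hd hd' le_rfl hs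
  have i1 := ginc hB h hsT
  have s1 := gp_sgn hB hd h hsT
  have s2 := gp_sgn hB hd' h' hsT
  obtain ⟨q1, q2⟩ := hpair ((ges hB hd h hsT).mono hd0) ((ges hB hd' h' hsT).mono hd0')
  have bd : ∀ k < N, ∀ ω, |D.gp d τ k ω - D.gp d' τ k ω| ≤ 2 := fun k hk ω => by
    rcases s1.pm k hk ω with e | e <;> rcases s2.pm k hk ω with e' | e' <;> simp [e, e'] <;> norm_num
  have mm : ∀ k < N, Measurable[G (τ k)] (fun ω => D.gp d τ k ω - D.gp d' τ k ω) := fun k hk => (s1.meas k hk).sub (s2.meas k hk)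
  have sq : ∀ k < N, _ := fun k hk => sq_ne_int (μ := μ) ((s1.meas k hk).mono (hB.le _) le_rfl) ((s2.meas k hk).mono (hB.le _) le_rfl) (s1.pm k hk) (s2.pm k hk)
  have tot4 : ∑ k ∈ Finset.range N, (τ (k+1) - τ k) * (4 * μ.real {ω | D.gp d τ k ω ≠ D.gp d' τ k ω}) ≤ ε := by
    have : ∑ k ∈ Finset.range N, (τ (k+1) - τ k) * (4 * μ.real {ω | D.gp d τ k ω ≠ D.gp d' τ k ω}) =
        4 * ∑ k ∈ Finset.range N, (τ (k+1) - τ k) * μ.real {ω | D.gp d τ k ω ≠ D.gp d' τ k ω} := by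
      rw [Finset.mul_sum]; exact Finset.sum_congr rfl fun _ _ => by ring
    rw [this]; nlinarith
  refine ⟨?_, ?_, ?_, ?_⟩
  · have := q1 N le_rfl
    have e : ∀ ω, D.eZ d (τ N) ω - D.eZ d' (τ N) ω = D.gz d τ N ω - D.gz d' τ N ω := fun ω => by
      rw [D.eZ_grid h hd le_rfl, D.eZ_grid h' hd' le_rfl]
    simp only [e]
    refine this.trans ?_
    nlinarith
  · have := i1.isometry (a := fun k ω => D.gp d τ k ω - D.gp d' τ k ω) (b := fun _ _ => 0) mm (fun _ _ => measurable_const) bd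
      (fun k hk ω => by simp) le_rfl
    have e : ∀ ω, D.eJ1 d (τ N) ω - D.eJ1 d' (τ N) ω = ∑ k ∈ Finset.range N, ((D.gp d τ k ω - D.gp d' τ k ω) * D.gx1 τ k ω + 0 * D.gx2 τ k ω) := fun ω => by
      unfold eJ1; rw [eS_sum0 h hd _ _ le_rfl, eS_sum0 h' hd' _ _ le_rfl, ← Finset.sum_sub_distrib]
      exact Finset.sum_congr rfl fun k _ => by simp only [gp, gx1]; ring
    simp only [e]
    rw [this]
    refine le_trans (le_of_eq ?_) tot4
    refine Finset.sum_congr rfl fun k hk => ?_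
    rw [← (sq k (Finset.mem_range.1 hk)).1]; simp
  · have := i1.isometry (b := fun k ω => D.gp d τ k ω - D.gp d' τ k ω) (a := fun _ _ => 0) (fun _ _ => measurable_const) mm
      (fun k hk ω => by simp) bd le_rfl
    have e : ∀ ω, D.eJ2 d (τ N) ω - D.eJ2 d' (τ N) ω = ∑ k ∈ Finset.range N, (0 * D.gx1 τ k ω + (D.gp d τ k ω - D.gp d' τ k ω) * D.gx2 τ k ω) := fun ω => by
      unfold eJ2; rw [eS_sum0 h hd _ _ le_rfl, eS_sum0 h' hd' _ _ le_rfl, ← Finset.sum_sub_distrib]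
      exact Finset.sum_congr rfl fun k _ => by simp only [gp, gx2]; ring
    simp only [e]
    rw [this]
    refine le_trans (le_of_eq ?_) tot4
    refine Finset.sum_congr rfl fun k hk => ?_
    rw [← (sq k (Finset.mem_range.1 hk)).1]; simp
  · have e : ∀ ω, D.eK d (τ N) ω - D.eK d' (τ N) ω = ∑ k ∈ Finset.range N, (τ (k+1) - τ k) * (D.gp d τ k ω - D.gp d' τ k ω) := fun ω => by
      unfold eK; rw [eS_sum0 h hd _ _ le_rfl, eS_sum0 h' hd' _ _ le_rfl, ← Finset.sum_sub_distrib]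
      exact Finset.sum_congr rfl fun k _ => by simp only [gp, id]; ring
    have gi : ∀ k ∈ Finset.range N, Integrable (fun ω => (τ (k+1) - τ k) * |D.gp d τ k ω - D.gp d' τ k ω|) μ := fun k hk => by
      have hk := Finset.mem_range.1 hk
      exact (integrable_of_bdd (C := 2) (((mm k hk).mono (hB.le _) le_rfl).abs) (fun ω => by rw [abs_abs]; exact bd k hk ω)).const_mul _
    have pt : ∀ ω, (D.eK d (τ N) ω - D.eK d' (τ N) ω) ^ 2 ≤ 2 * T * ∑ k ∈ Finset.range N, (τ (k+1) - τ k) * |D.gp d τ k ω - D.gp d' τ k ω| := fun ω => by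
      have b1 : |D.eK d (τ N) ω - D.eK d' (τ N) ω| ≤ ∑ k ∈ Finset.range N, (τ (k+1) - τ k) * |D.gp d τ k ω - D.gp d' τ k ω| := by
        rw [e]
        refine (Finset.abs_sum_le_sum_abs _ _).trans (Finset.sum_le_sum fun k _ => ?_)
        rw [abs_mul, abs_of_nonneg (i1.pos k)]
      have b2 : |D.eK d (τ N) ω - D.eK d' (τ N) ω| ≤ 2 * T := by
        refine b1.trans ?_
        have : ∑ k ∈ Finset.range N, (τ (k+1) - τ k) * |D.gp d τ k ω - D.gp d' τ k ω| ≤ ∑ k ∈ Finset.range N, (τ (k+1) - τ k) * 2 :=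
          Finset.sum_le_sum fun k hk => mul_le_mul_of_nonneg_left (bd k (Finset.mem_range.1 hk) ω) (i1.pos k)
        rw [← Finset.sum_mul, gtot h] at this
        linarith
      rw [← sq_abs, pow_two]
      exact mul_le_mul b2 b1 (abs_nonneg _) (by linarith)
    refine (integral_mono_of_nonneg (ae_of_all _ fun ω => sq_nonneg _) ((integrable_finset_sum _ gi).const_mul _) (ae_of_all _ pt)).trans ?_
    rw [integral_const_mul, integral_finset_sum _ gi]
    have : ∑ k ∈ Finset.range N, ∫ ω, (τ (k+1) - τ k) * |D.gp d τ k ω - D.gp d' τ k ω| ∂μ =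
        2 * ∑ k ∈ Finset.range N, (τ (k+1) - τ k) * μ.real {ω | D.gp d τ k ω ≠ D.gp d' τ k ω} := by
      rw [Finset.mul_sum]
      refine Finset.sum_congr rfl fun k hk => ?_
      rw [integral_const_mul, (sq k (Finset.mem_range.1 hk)).2]; ring
    rw [this]
    nlinarith
end Dat
end

section
/-! ### Continuous modifications -/

lemma floor_two (x : ℝ) : ⌊x * 2⌋₊ = 2 * ⌊x⌋₊ ∨ ⌊x * 2⌋₊ = 2 * ⌊x⌋₊ + 1 := by
  rcases le_or_gt 0 x with hx | hx
  · have h1 := Nat.floor_le hx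
    have h2 := Nat.lt_floor_add_one x
    have h3 : 2 * ⌊x⌋₊ ≤ ⌊x * 2⌋₊ := Nat.le_floor (by push_cast; linarith)
    have h4 : ⌊x * 2⌋₊ < 2 * ⌊x⌋₊ + 2 := (Nat.floor_lt (by positivity)).2 (by push_cast; linarith)
    omega
  · left; rw [Nat.floor_of_nonpos hx.le, Nat.floor_of_nonpos (by linarith)]

lemma floor_near {x y : ℝ} (h : x ≤ y) (h1 : y < x + 1) : ⌊y⌋₊ = ⌊x⌋₊ ∨ ⌊y⌋₊ = ⌊x⌋₊ + 1 := by
  have h2 := Nat.floor_mono h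
  have h3 := Nat.lt_floor_add_one x
  have h4 : ⌊y⌋₊ < ⌊x⌋₊ + 2 := by
    rcases le_or_gt 0 y with hy | hy
    · rw [Nat.floor_lt hy]; push_cast; linarith
    · rw [Nat.floor_of_nonpos hy.le]; omega
  omega

lemma kc_path (f : ℝ → ℝ) {r : ℝ} (r0 : 0 < r) (r1 : r < 1)
    (hf : ∀ N : ℕ, ∀ᶠ n : ℕ in atTop, ∀ i < N * 2 ^ n, |f ((i + 1 : ℕ) / 2 ^ n) - f (i / 2 ^ n)| ≤ r ^ n) :
    ∃ g : ℝ → ℝ, Continuous g ∧ ∀ t, Tendsto (fun n : ℕ => f (⌊t * 2 ^ n⌋₊ / 2 ^ n)) atTop (nhds (g t)) := by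
  set a : ℕ → ℝ → ℝ := fun n t => f (⌊t * 2 ^ n⌋₊ / 2 ^ n) with ha
  have hlt : ∀ (N : ℕ) (t : ℝ), t < N → ∀ n, 0 < N → ⌊t * 2 ^ n⌋₊ < N * 2 ^ n := by
    intro N t ht n hN
    rcases le_or_gt 0 t with h | h
    · rw [Nat.floor_lt (by positivity)]; push_cast; gcongr
    · rw [Nat.floor_of_nonpos (by nlinarith [pow_pos (two_pos : (0:ℝ) < 2) n])]; positivity
  have step : ∀ (N n : ℕ) (t : ℝ), 0 < N → t < N →
      (∀ i < N * 2 ^ (n+1), |f ((i + 1 : ℕ) / 2 ^ (n+1)) - f (i / 2 ^ (n+1))| ≤ r ^ (n+1)) → |a (n+1) t - a n t| ≤ r ^ (n+1) := by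
    intro N n t hN ht h
    have e : t * 2 ^ (n+1) = t * 2 ^ n * 2 := by ring
    have e2 : f (⌊t * 2 ^ n⌋₊ / 2 ^ n) = f ((2 * ⌊t * 2 ^ n⌋₊ : ℕ) / 2 ^ (n+1)) := by
      congr 1; push_cast; rw [pow_succ]; field_simp
    have hlt' := hlt N t ht (n+1) hN
    simp only [ha, e2]
    rw [e] at hlt' ⊢
    rcases floor_two (t * 2 ^ n) with h' | h'
    · rw [h']; simp; positivity
    · rw [h'] at hlt' ⊢; exact h _ (by omega)
  have key : ∀ N : ℕ, 0 < N → ∃ n0, ∀ n ≥ n0, (∀ i < N * 2 ^ n, |f ((i + 1 : ℕ) / 2 ^ n) - f (i / 2 ^ n)| ≤ r ^ n) ∧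
      ∀ k, ∀ t < (N:ℝ), |a (n + k) t - a n t| ≤ r ^ n / (1 - r) := by
    intro N hN
    obtain ⟨n0, h0⟩ := eventually_atTop.1 (hf N)
    refine ⟨n0, fun n hn => ⟨h0 n hn, fun k t ht => ?_⟩⟩
    have h1r : 0 < 1 - r := by linarith
    have : |a (n + k) t - a n t| ≤ ∑ j ∈ Finset.range k, r ^ n * r ^ j := by
      induction k with
      | zero => simp
      | succ k ih =>
        rw [Finset.sum_range_succ]
        have s := step N (n + k) t hN ht (h0 _ (by omega))
        have s' : r ^ (n + k + 1) ≤ r ^ n * r ^ k := by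
          rw [← pow_add]; exact pow_le_pow_of_le_one r0.le r1.le (by omega)
        calc |a (n + (k + 1)) t - a n t| ≤ |a (n + k + 1) t - a (n+k) t| + |a (n+k) t - a n t| := abs_sub_le _ _ _
          _ ≤ _ := by linarith
    refine this.trans ?_
    rw [← Finset.mul_sum, geom_sum_eq r1.ne, div_eq_mul_inv (r ^ n)]
    gcongr
    rw [← neg_div_neg_eq, neg_sub, neg_sub, inv_eq_one_div]
    gcongr
    have := pow_pos r0 k
    linarith
  have lim0 : ∀ c : ℝ, Tendsto (fun n : ℕ => c * r ^ n) atTop (nhds 0) := fun c => by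
    simpa using (tendsto_pow_atTop_nhds_zero_of_lt_one r0.le r1).const_mul c
  have hN : ∀ t : ℝ, ∃ N : ℕ, 0 < N ∧ t + 1 < N := fun t => by
    obtain ⟨N, hN⟩ := exists_nat_gt (max (t + 1) 0)
    exact ⟨N, by exact_mod_cast (le_max_right _ _).trans_lt hN, (le_max_left _ _).trans_lt hN⟩
  have hcau : ∀ t, CauchySeq fun n => a n t := by
    intro t
    obtain ⟨N, hN0, hNt⟩ := hN t
    obtain ⟨n0, h0⟩ := key N hN0
    rw [Metric.cauchySeq_iff']
    intro ε hε
    obtain ⟨n1, h1⟩ := eventually_atTop.1 ((lim0 (1 / (1 - r))).eventually_lt_const hε)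
    refine ⟨max n0 n1, fun n hn => ?_⟩
    obtain ⟨k, rfl⟩ := Nat.exists_eq_add_of_le hn
    rw [Real.dist_eq]
    refine ((h0 _ (le_max_left _ _)).2 k t (by linarith)).trans_lt ?_
    have := h1 _ (le_max_right n0 n1)
    calc _ = _ := by ring
      _ < ε := this
  choose g hg using fun t => cauchySeq_tendsto_of_complete (hcau t)
  refine ⟨g, ?_, hg⟩
  rw [continuous_iff_continuousAt]
  intro t
  obtain ⟨N, hN0, hNt⟩ := hN t
  obtain ⟨n0, h0⟩ := key N hN0
  have hgb : ∀ n ≥ n0, ∀ s < (N:ℝ), |g s - a n s| ≤ r ^ n / (1 - r) := by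
    intro n hn s hs
    have h1 : Tendsto (fun k => a (n + k) s) atTop (nhds (g s)) := by
      have := (tendsto_add_atTop_iff_nat n).2 (hg s)
      simpa [add_comm] using this
    exact le_of_tendsto ((h1.sub_const _).abs) (Eventually.of_forall fun k => (h0 n hn).2 k s hs)
  rw [Metric.continuousAt_iff]
  intro ε hε
  obtain ⟨n1, h1⟩ := eventually_atTop.1 ((lim0 (1 / (1 - r) + 1 / (1 - r) + 1)).eventually_lt_const hε)
  set n := max n0 n1 with hn
  have h2 := h1 n (le_max_right _ _)
  have adj : ∀ s s' : ℝ, s ≤ s' → s' < s + 1 / 2 ^ n → s' < N → |a n s' - a n s| ≤ r ^ n := by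
    intro s s' hs hs' hsN
    have p2 : (0:ℝ) < 2 ^ n := by positivity
    have : s' * 2 ^ n < s * 2 ^ n + 1 := by
      have := mul_lt_mul_of_pos_right hs' p2
      rwa [add_mul, one_div, inv_mul_cancel₀ p2.ne'] at this
    have hl := hlt N s' hsN n hN0
    simp only [ha]
    rcases floor_near (by gcongr : s * 2 ^ n ≤ s' * 2 ^ n) this with h | h
    · rw [h]; simp; positivity
    · rw [h] at hl ⊢; exact (h0 n (le_max_left _ _)).1 _ (by omega)
  refine ⟨min 1 (1 / 2 ^ n), by positivity, fun {s} hs => ?_⟩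
  rw [Real.dist_eq, lt_min_iff, abs_lt, abs_lt] at hs
  have hsN : s < N := by linarith [hs.1.2]
  have b : |a n s - a n t| ≤ r ^ n := by
    rcases le_total s t with h | h
    · rw [abs_sub_comm]; exact adj s t h (by linarith [hs.2.1]) (by linarith)
    · exact adj t s h (by linarith [hs.2.2]) hsN
  have c1 := hgb n (le_max_left _ _) s hsN
  have c2 := hgb n (le_max_left _ _) t (by linarith)
  rw [Real.dist_eq]
  have e : g s - g t = (g s - a n s) - (g t - a n t) + (a n s - a n t) := by ring
  rw [e]
  calc _ ≤ |(g s - a n s) - (g t - a n t)| + |a n s - a n t| := abs_add_le _ _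
    _ ≤ |g s - a n s| + |g t - a n t| + |a n s - a n t| := by gcongr; exact abs_sub _ _
    _ ≤ r ^ n / (1 - r) + r ^ n / (1 - r) + r ^ n := by gcongr
    _ = (1 / (1 - r) + 1 / (1 - r) + 1) * r ^ n := by ring
    _ < ε := h2

lemma markov4 {μ : Measure Ω} [IsProbabilityMeasure μ] {X : Ω → ℝ} (hX : Integrable (fun ω => X ω ^ 4) μ) {r c : ℝ} (hr : 0 < r)
    (hc : ∫ ω, X ω ^ 4 ∂μ ≤ c) : μ {ω | r < |X ω|} ≤ ENNReal.ofReal (c / r ^ 4) := by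
  have h := mul_meas_ge_le_integral_of_nonneg (μ := μ) (f := fun ω => X ω ^ 4) (ae_of_all _ fun ω => by positivity) hX (r ^ 4)
  have hsub : {ω | r < |X ω|} ⊆ {ω | r ^ 4 ≤ X ω ^ 4} := by
    intro ω hω
    have : X ω ^ 4 = |X ω| ^ 4 := by rw [← abs_pow, abs_of_nonneg (by positivity)]
    simp only [mem_setOf_eq] at hω ⊢
    rw [this]; gcongr
  refine (measure_mono hsub).trans ?_
  rw [← ofReal_measureReal]
  apply ENNReal.ofReal_le_ofReal
  rw [le_div_iff₀ (by positivity)]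
  linarith

lemma kc_cts {μ : Measure Ω} [IsProbabilityMeasure μ] (V : ℝ → Ω → ℝ) (hm : ∀ t, 0 ≤ t → Measurable (V t))
    (h4 : ∀ T : ℝ, 0 ≤ T → ∃ C : ℝ, 0 ≤ C ∧ ∀ s t, 0 ≤ s → s ≤ t → t ≤ T → Integrable (fun ω => (V t ω - V s ω) ^ 4) μ ∧
      ∫ ω, (V t ω - V s ω) ^ 4 ∂μ ≤ C * (t - s) ^ 2) :
    ∃ V' : ℝ → Ω → ℝ, (∀ ω, Continuous fun t => V' t ω) ∧ (∀ t, Measurable (V' t)) ∧ ∀ t, 0 ≤ t → V' t =ᵐ[μ] V t := by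
  have hgood : ∀ᵐ ω ∂μ, ∀ N : ℕ, ∀ᶠ n : ℕ in atTop, ∀ i < N * 2 ^ n,
      |V ((i + 1 : ℕ) / 2 ^ n) ω - V (i / 2 ^ n) ω| ≤ (7 / 8 : ℝ) ^ n := by
    rw [ae_all_iff]
    intro N
    obtain ⟨C, hC0, hC⟩ := h4 N (by positivity)
    have hs : ∑' n, μ {ω | ∃ i < N * 2 ^ n, (7 / 8 : ℝ) ^ n < |V ((i + 1 : ℕ) / 2 ^ n) ω - V (i / 2 ^ n) ω|} ≠ ⊤ := by
      have hb : ∀ n, μ {ω | ∃ i < N * 2 ^ n, (7 / 8 : ℝ) ^ n < |V ((i + 1 : ℕ) / 2 ^ n) ω - V (i / 2 ^ n) ω|} ≤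
          ENNReal.ofReal (N * C * (2048 / 2401) ^ n) := by
        intro n
        have : {ω | ∃ i < N * 2 ^ n, (7 / 8 : ℝ) ^ n < |V ((i + 1 : ℕ) / 2 ^ n) ω - V (i / 2 ^ n) ω|} =
            ⋃ i ∈ Finset.range (N * 2 ^ n), {ω | (7 / 8 : ℝ) ^ n < |V ((i + 1 : ℕ) / 2 ^ n) ω - V (i / 2 ^ n) ω|} := by
          ext ω; simp
        rw [this]
        refine (measure_biUnion_finset_le _ _).trans ?_
        have hi : ∀ i ∈ Finset.range (N * 2 ^ n), μ {ω | (7 / 8 : ℝ) ^ n < |V ((i + 1 : ℕ) / 2 ^ n) ω - V (i / 2 ^ n) ω|} ≤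
            ENNReal.ofReal (C * (1 / 2 ^ n) ^ 2 / ((7 / 8) ^ n) ^ 4) := by
          intro i hi
          have hi := Finset.mem_range.1 hi
          have hle : ((i + 1 : ℕ) : ℝ) / 2 ^ n ≤ N := by
            rw [div_le_iff₀ (by positivity)]
            exact_mod_cast hi
          have hle' : (i : ℝ) / 2 ^ n ≤ ((i + 1 : ℕ) : ℝ) / 2 ^ n := by push_cast; gcongr; linarith
          obtain ⟨c1, c2⟩ := hC (i / 2 ^ n) ((i + 1 : ℕ) / 2 ^ n) (by positivity) hle' hle
          refine markov4 c1 (by positivity) (c2.trans (le_of_eq ?_))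
          push_cast; ring
        refine (Finset.sum_le_sum hi).trans ?_
        rw [Finset.sum_const, Finset.card_range, nsmul_eq_mul, ← ENNReal.ofReal_natCast, ← ENNReal.ofReal_mul (by positivity)]
        apply ENNReal.ofReal_le_ofReal
        apply le_of_eq
        have e : (2048 / 2401 : ℝ) ^ n = (2:ℝ) ^ n * (1 / 2 ^ n) ^ 2 / ((7 / 8) ^ n) ^ 4 := by
          rw [← pow_mul, mul_comm n 4, pow_mul, one_div, ← inv_pow, ← pow_mul, mul_comm n 2, pow_mul, ← mul_pow, ← div_pow]
          norm_num
        rw [e]; push_cast; ring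
      refine ne_top_of_le_ne_top ?_ (ENNReal.tsum_le_tsum hb)
      rw [← ENNReal.ofReal_tsum_of_nonneg (fun n => by positivity)]
      · exact ENNReal.ofReal_ne_top
      · exact (summable_geometric_of_lt_one (by norm_num) (by norm_num)).mul_left _
    filter_upwards [ae_eventually_notMem hs] with ω hω
    filter_upwards [hω] with n hn i hi
    simp only [mem_setOf_eq, not_exists, not_and, not_lt] at hn
    exact hn i hi
  obtain ⟨S, hSg, hSm, hS0⟩ : ∃ S : Set Ω, (∀ ω ∈ S, ∀ N : ℕ, ∀ᶠ n : ℕ in atTop, ∀ i < N * 2 ^ n,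
      |V ((i + 1 : ℕ) / 2 ^ n) ω - V (i / 2 ^ n) ω| ≤ (7 / 8 : ℝ) ^ n) ∧ MeasurableSet S ∧ ∀ᵐ ω ∂μ, ω ∈ S := by
    refine ⟨(toMeasurable μ {ω | ¬ ∀ N : ℕ, ∀ᶠ n : ℕ in atTop, ∀ i < N * 2 ^ n,
      |V ((i + 1 : ℕ) / 2 ^ n) ω - V (i / 2 ^ n) ω| ≤ (7 / 8 : ℝ) ^ n})ᶜ, fun ω hω => ?_, (measurableSet_toMeasurable _ _).compl, ?_⟩
    · by_contra hc
      exact hω (subset_toMeasurable _ _ hc)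
    · rw [ae_iff]
      simp only [mem_compl_iff, not_not, setOf_mem_eq]
      rw [measure_toMeasurable]; exact hgood
  have hp : ∀ ω, ∃ g : ℝ → ℝ, Continuous g ∧ ∀ t, Tendsto (fun n : ℕ => S.indicator (V (⌊t * 2 ^ n⌋₊ / 2 ^ n)) ω) atTop (nhds (g t)) := by
    intro ω
    by_cases hω : ω ∈ S
    · simp only [indicator_of_mem hω]
      exact kc_path (fun t => V t ω) (by norm_num) (by norm_num) (hSg ω hω)
    · simp only [indicator_of_notMem hω]
      exact ⟨fun _ => 0, continuous_const, fun t => tendsto_const_nhds⟩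
  choose g hg1 hg2 using hp
  refine ⟨fun t ω => g ω t, hg1, fun t => ?_, fun t ht => ?_⟩
  · refine measurable_of_tendsto_metrizable (f := fun n => S.indicator (V (⌊t * 2 ^ n⌋₊ / 2 ^ n))) (fun n => ?_) (tendsto_pi_nhds.2 fun ω => hg2 ω t)
    exact (hm _ (by positivity)).indicator hSm
  · obtain ⟨C, hC0, hC⟩ := h4 t ht
    have hs : ∑' n : ℕ, μ {ω | (7 / 8 : ℝ) ^ n < |V t ω - V (⌊t * 2 ^ n⌋₊ / 2 ^ n) ω|} ≠ ⊤ := by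
      have hb : ∀ n : ℕ, μ {ω | (7 / 8 : ℝ) ^ n < |V t ω - V (⌊t * 2 ^ n⌋₊ / 2 ^ n) ω|} ≤
          ENNReal.ofReal (C * (2048 / 2401) ^ n) := by
        intro n
        have p2 : (0:ℝ) < 2 ^ n := by positivity
        have l1 : (⌊t * 2 ^ n⌋₊ : ℝ) / 2 ^ n ≤ t := by rw [div_le_iff₀ p2]; exact Nat.floor_le (by positivity)
        have l2 : t - (⌊t * 2 ^ n⌋₊ : ℝ) / 2 ^ n ≤ 1 / 2 ^ n := by
          rw [sub_le_iff_le_add, ← add_div, le_div_iff₀ p2]; linarith [Nat.lt_floor_add_one (t * 2 ^ n)]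
        obtain ⟨c1, c2⟩ := hC _ _ (by positivity) l1 le_rfl
        refine markov4 c1 (by positivity) (c2.trans (c := C * (1 / 2 ^ n) ^ 2) ?_) |>.trans ?_
        · have := sub_nonneg.2 l1; gcongr
        · apply ENNReal.ofReal_le_ofReal
          rw [mul_div_assoc]
          refine mul_le_mul_of_nonneg_left ?_ hC0
          rw [← pow_mul, mul_comm n 4, pow_mul, one_div, ← inv_pow, ← pow_mul, mul_comm n 2, pow_mul, ← div_pow]
          exact pow_le_pow_left₀ (by norm_num) (by norm_num) _
      refine ne_top_of_le_ne_top ?_ (ENNReal.tsum_le_tsum hb)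
      rw [← ENNReal.ofReal_tsum_of_nonneg (fun n => by positivity)]
      · exact ENNReal.ofReal_ne_top
      · exact (summable_geometric_of_lt_one (by norm_num) (by norm_num)).mul_left _
    filter_upwards [ae_eventually_notMem hs, hS0] with ω hω hωS
    have t1 := hg2 ω t
    simp only [indicator_of_mem hωS] at t1
    have t2 : Tendsto (fun n : ℕ => V (⌊t * 2 ^ n⌋₊ / 2 ^ n) ω) atTop (nhds (V t ω)) := by
      rw [tendsto_iff_dist_tendsto_zero]
      refine squeeze_zero' (Eventually.of_forall fun _ => dist_nonneg) ?_ (tendsto_pow_atTop_nhds_zero_of_lt_one (r := (7/8:ℝ)) (by norm_num) (by norm_num))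
      filter_upwards [hω] with n hn
      rw [dist_comm, Real.dist_eq]
      exact not_lt.1 hn
    exact tendsto_nhds_unique t1 t2
end

section
section
variable {μ : Measure Ω} [IsProbabilityMeasure μ]

lemma l2norm {f : Ω → ℝ} (hf : MemLp f 2 μ) : ‖hf.toLp f‖ ^ 2 = ∫ ω, f ω ^ 2 ∂μ := by
  rw [← real_inner_self_eq_norm_sq, L2.inner_def]
  refine integral_congr_ae ?_
  filter_upwards [hf.coeFn_toLp] with ω hω
  rw [hω]; simp [sq]

lemma l2dist {f g : Ω → ℝ} (hf : MemLp f 2 μ) (hg : MemLp g 2 μ) :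
    ‖hf.toLp f - hg.toLp g‖ ^ 2 = ∫ ω, (f ω - g ω) ^ 2 ∂μ := by
  rw [← MemLp.toLp_sub, l2norm]; rfl

/-- L2 implies in measure -/
lemma tim_of_l2 {f : ℕ → Ω → ℝ} {g : Ω → ℝ} (hf : ∀ n, MemLp (f n) 2 μ) (hg : MemLp g 2 μ)
    (h : Tendsto (fun n => ∫ ω, (f n ω - g ω) ^ 2 ∂μ) atTop (nhds 0)) : TendstoInMeasure μ f atTop g := by
  refine tendstoInMeasure_of_tendsto_eLpNorm (p := 2) (by norm_num) (fun n => (hf n).1) hg.1 ?_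
  have h1 : Tendsto (fun n => ‖(hf n).toLp (f n) - hg.toLp g‖) atTop (nhds 0) := by
    have := (Real.continuous_sqrt.tendsto 0).comp h
    simp only [Real.sqrt_zero] at this
    refine this.congr fun n => ?_
    simp only [Function.comp]
    rw [← l2dist (hf n) hg, Real.sqrt_sq (norm_nonneg _)]
  have h2 := ENNReal.tendsto_ofReal h1
  simp only [ENNReal.ofReal_zero] at h2
  refine h2.congr fun n => ?_
  rw [← MemLp.toLp_sub, Lp.norm_toLp, ENNReal.ofReal_toReal ((hf n).sub hg).2.ne]

end

section
variable {𝒢 : Unit → MeasurableSpace Ω} {μ : Measure Ω} [IsProbabilityMeasure μ]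

lemma l2lim (h𝒢 : 𝒢 () ≤ m) {V : ℝ → Ω → ℝ} (hm : ∀ d, 0 < d → Measurable[𝒢 ()] (V d)) (h2 : ∀ d, 0 < d → MemLp (V d) 2 μ)
    (hC : ∀ ε : ℝ, 0 < ε → ∃ d0 : ℝ, 0 < d0 ∧ ∀ d d' : ℝ, 0 < d → d ≤ d0 → 0 < d' → d' ≤ d0 → ∫ ω, (V d ω - V d' ω) ^ 2 ∂μ ≤ ε) :
    ∃ L : Ω → ℝ, Measurable[𝒢 ()] L ∧ MemLp L 2 μ ∧
      ∀ ε d0 : ℝ, 0 < d0 → (∀ d d' : ℝ, 0 < d → d ≤ d0 → 0 < d' → d' ≤ d0 → ∫ ω, (V d ω - V d' ω) ^ 2 ∂μ ≤ ε) →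
        ∀ d : ℝ, 0 < d → d ≤ d0 → ∫ ω, (V d ω - L ω) ^ 2 ∂μ ≤ ε := by
  have dp : ∀ n : ℕ, (0:ℝ) < (1/2) ^ n := fun n => by positivity
  have d0 : Tendsto (fun n : ℕ => ((1:ℝ)/2) ^ n) atTop (nhds 0) := tendsto_pow_atTop_nhds_zero_of_lt_one (by norm_num) (by norm_num)
  set f : ℕ → Lp ℝ 2 μ := fun n => (h2 _ (dp n)).toLp _ with hf
  have hc : CauchySeq f := by
    rw [Metric.cauchySeq_iff]
    intro ε hε
    obtain ⟨d1, hd1, H⟩ := hC ((ε/2)^2) (by positivity)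
    obtain ⟨N, hN⟩ := (d0.eventually (gt_mem_nhds hd1)).exists_forall_of_atTop
    refine ⟨N, fun a ha b hb => ?_⟩
    rw [dist_eq_norm]
    have := H _ _ (dp a) (hN a ha).le (dp b) (hN b hb).le
    rw [← l2dist (h2 _ (dp a)) (h2 _ (dp b))] at this
    have := abs_le_of_sq_le_sq' this (by positivity)
    exact lt_of_le_of_lt this.2 (by linarith)
  obtain ⟨F, hF⟩ := cauchySeq_tendsto_of_complete hc
  have ht : TendstoInMeasure μ (fun n => V ((1/2)^n)) atTop F := by
    refine tim_of_l2 (fun n => h2 _ (dp n)) (Lp.memLp F) ?_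
    have := ((hF.sub_const F).norm).pow 2
    simp only [sub_self, norm_zero, ne_eq, OfNat.ofNat_ne_zero, not_false_eq_true, zero_pow] at this
    refine this.congr fun n => ?_
    have h := l2dist (h2 _ (dp n)) (Lp.memLp F)
    rw [Lp.toLp_coeFn] at h
    exact h
  obtain ⟨ns, hns, hae⟩ := ht.exists_seq_tendsto_ae
  set L : Ω → ℝ := fun ω => limsup (fun k => V ((1/2)^(ns k)) ω) atTop with hL
  have hLm : Measurable[𝒢 ()] L := Measurable.limsup (fun k => hm _ (dp (ns k)))
  have hLF : L =ᵐ[μ] F := by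
    filter_upwards [hae] with ω hω
    exact hω.limsup_eq
  have hL2 : MemLp L 2 μ := (memLp_congr_ae hLF).2 (Lp.memLp F)
  refine ⟨L, hLm, hL2, fun ε d1 hd1 H d hd hdd => ?_⟩
  have e : hL2.toLp L = F := by
    rw [← Lp.toLp_coeFn F (Lp.memLp F)]
    exact (MemLp.toLp_eq_toLp_iff _ _).2 hLF
  rw [← l2dist (h2 d hd) hL2, e]
  have t := ((tendsto_const_nhds (x := (h2 d hd).toLp _)).sub hF).norm.pow 2
  refine le_of_tendsto t ?_
  filter_upwards [d0.eventually (gt_mem_nhds hd1)] with n hn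
  have := H d _ hd hdd (dp n) hn.le
  rwa [← l2dist (h2 d hd) (h2 _ (dp n))] at this

end

section
variable {μ : Measure Ω} [IsProbabilityMeasure μ]

lemma fatou_int {f : ℕ → Ω → ℝ} {g : Ω → ℝ} {C : ℝ} (hf : ∀ n, Integrable (f n) μ) (h0 : ∀ n ω, 0 ≤ f n ω)
    (hC : ∀ n, ∫ ω, f n ω ∂μ ≤ C) (hg : AEStronglyMeasurable g μ) (h : ∀ᵐ ω ∂μ, Tendsto (fun n => f n ω) atTop (nhds (g ω))) :
    Integrable g μ ∧ ∫ ω, g ω ∂μ ≤ C := by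
  have hC0 : 0 ≤ C := (integral_nonneg (h0 0)).trans (hC 0)
  have g0 : 0 ≤ᵐ[μ] g := by
    filter_upwards [h] with ω hω
    exact ge_of_tendsto' hω fun n => h0 n ω
  have key : ∫⁻ ω, ENNReal.ofReal (g ω) ∂μ ≤ ENNReal.ofReal C := by
    calc ∫⁻ ω, ENNReal.ofReal (g ω) ∂μ = ∫⁻ ω, liminf (fun n => ENNReal.ofReal (f n ω)) atTop ∂μ := by
          refine lintegral_congr_ae ?_
          filter_upwards [h] with ω hω
          exact (ENNReal.tendsto_ofReal hω).liminf_eq.symm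
      _ ≤ liminf (fun n => ∫⁻ ω, ENNReal.ofReal (f n ω) ∂μ) atTop :=
          lintegral_liminf_le' fun n => (hf n).1.aemeasurable.ennreal_ofReal
      _ ≤ liminf (fun _ => ENNReal.ofReal C) atTop := by
          refine liminf_le_liminf (Eventually.of_forall fun n => ?_)
          rw [← ofReal_integral_eq_lintegral_ofReal (hf n) (ae_of_all _ (h0 n))]
          exact ENNReal.ofReal_le_ofReal (hC n)
      _ = ENNReal.ofReal C := by simp
  have hi : Integrable g μ := ⟨hg, by
    rw [hasFiniteIntegral_iff_ofReal g0]; exact key.trans_lt ENNReal.ofReal_lt_top⟩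
  refine ⟨hi, ?_⟩
  rw [← ofReal_integral_eq_lintegral_ofReal hi g0] at key
  exact (ENNReal.ofReal_le_ofReal_iff hC0).1 key

end

section
universe v
variable {Ω : Type v} [m : MeasurableSpace Ω] {μ : Measure Ω} [IsProbabilityMeasure μ] {U1 U2 : ℝ → Ω → ℝ}

lemma proc_lim {V : ℝ → ℝ → Ω → ℝ} (hm : ∀ d s, 0 < d → 0 ≤ s → Measurable[GG μ U1 U2 s] (V d s))
    (h2 : ∀ d s, 0 < d → 0 ≤ s → MemLp (V d s) 2 μ)
    (hC : ∀ T ε : ℝ, 0 ≤ T → 0 < ε → ∃ d0 : ℝ, 0 < d0 ∧ ∀ d d' s : ℝ, 0 < d → d ≤ d0 → 0 < d' → d' ≤ d0 → 0 ≤ s → s ≤ T →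
      ∫ ω, (V d s ω - V d' s ω) ^ 2 ∂μ ≤ ε)
    (h4 : ∀ T : ℝ, 0 ≤ T → ∃ C : ℝ, 0 ≤ C ∧ ∀ d s t, 0 < d → 0 ≤ s → s ≤ t → t ≤ T →
      Integrable (fun ω => (V d t ω - V d s ω) ^ 4) μ ∧ ∫ ω, (V d t ω - V d s ω) ^ 4 ∂μ ≤ C * (t - s) ^ 2) :
    ∃ L : ℝ → Ω → ℝ, (∀ ω, Continuous fun t => L t ω) ∧ (∀ t, 0 ≤ t → Measurable[GG μ U1 U2 t] (L t)) ∧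
      (∀ t, 0 ≤ t → MemLp (L t) 2 μ) ∧
      ∀ T ε : ℝ, 0 ≤ T → 0 < ε → ∃ d0 : ℝ, 0 < d0 ∧ ∀ d s : ℝ, 0 < d → d ≤ d0 → 0 ≤ s → s ≤ T →
        ∫ ω, (V d s ω - L s ω) ^ 2 ∂μ ≤ ε := by
  have H : ∀ s : ℝ, ∃ L : Ω → ℝ, 0 ≤ s → Measurable[GG μ U1 U2 s] L ∧ MemLp L 2 μ ∧
      ∀ ε d0 : ℝ, 0 < d0 → (∀ d d' : ℝ, 0 < d → d ≤ d0 → 0 < d' → d' ≤ d0 → ∫ ω, (V d s ω - V d' s ω) ^ 2 ∂μ ≤ ε) →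
        ∀ d : ℝ, 0 < d → d ≤ d0 → ∫ ω, (V d s ω - L ω) ^ 2 ∂μ ≤ ε := by
    intro s
    by_cases hs : 0 ≤ s
    · obtain ⟨L, hL⟩ := l2lim (𝒢 := fun _ => GG μ U1 U2 s) (V := fun d => V d s) (GG_le μ U1 U2 s) (fun d hd => hm d s hd hs) (fun d hd => h2 d s hd hs) (fun ε hε => by
        obtain ⟨d0, h0, H⟩ := hC s ε hs hε
        exact ⟨d0, h0, fun d d' a b a' b' => H d d' s a b a' b' hs le_rfl⟩)
      exact ⟨L, fun _ => hL⟩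
    · exact ⟨0, fun h => absurd h hs⟩
  choose L hL using H
  have conv : ∀ T ε : ℝ, 0 ≤ T → 0 < ε → ∃ d0 : ℝ, 0 < d0 ∧ ∀ d s : ℝ, 0 < d → d ≤ d0 → 0 ≤ s → s ≤ T →
        ∫ ω, (V d s ω - L s ω) ^ 2 ∂μ ≤ ε := by
    intro T ε hT hε
    obtain ⟨d0, h0, H⟩ := hC T ε hT hε
    exact ⟨d0, h0, fun d s hd hdd hs hsT => (hL s hs).2.2 ε d0 h0 (fun d d' a b a' b' => H d d' s a b a' b' hs hsT) d hd hdd⟩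
  have dp : ∀ n : ℕ, (0:ℝ) < (1/2) ^ n := fun n => by positivity
  have d0 : Tendsto (fun n : ℕ => ((1:ℝ)/2) ^ n) atTop (nhds 0) := tendsto_pow_atTop_nhds_zero_of_lt_one (by norm_num) (by norm_num)
  have tim : ∀ s, 0 ≤ s → TendstoInMeasure μ (fun n : ℕ => V ((1/2)^n) s) atTop (L s) := by
    intro s hs
    refine tim_of_l2 (fun n => h2 _ _ (dp n) hs) (hL s hs).2.1 ?_
    rw [Metric.tendsto_atTop]
    intro ε hε
    obtain ⟨d1, h1, H⟩ := conv s (ε/2) hs (by positivity)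
    obtain ⟨N, hN⟩ := (d0.eventually (gt_mem_nhds h1)).exists_forall_of_atTop
    refine ⟨N, fun n hn => ?_⟩
    rw [Real.dist_eq, sub_zero, abs_of_nonneg (integral_nonneg fun ω => sq_nonneg _)]
    have := H _ s (dp n) (hN n hn).le hs le_rfl
    linarith
  obtain ⟨L', c, ml, hae⟩ := kc_cts (μ := μ) L (fun t ht => (hL t ht).1.mono (GG_le _ _ _ _) le_rfl) (fun T hT => by
    obtain ⟨C, hC0, H⟩ := h4 T hT
    refine ⟨C, hC0, fun s t hs hst ht => ?_⟩
    obtain ⟨ns, hns, a⟩ := (tim s hs).exists_seq_tendsto_ae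
    have tt := (tim t (hs.trans hst)).comp hns.tendsto_atTop
    obtain ⟨ns', hns', b⟩ := tt.exists_seq_tendsto_ae
    refine fatou_int (f := fun n ω => (V ((1/2)^(ns (ns' n))) t ω - V ((1/2)^(ns (ns' n))) s ω) ^ 4)
      (fun n => (H _ _ _ (dp _) hs hst ht).1) (fun n ω => by positivity) (fun n => (H _ _ _ (dp _) hs hst ht).2)
      (((((hL t (hs.trans hst)).1.mono (GG_le _ _ _ _) le_rfl).sub ((hL s hs).1.mono (GG_le _ _ _ _) le_rfl)).pow_const 4).aestronglyMeasurable) ?_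
    filter_upwards [a, b] with ω ha hb
    exact ((hb.sub (ha.comp hns'.tendsto_atTop)).pow 4))
  refine ⟨L', c, fun t ht => GG_congr (hL t ht).1 (ml t) (hae t ht).symm, fun t ht => (memLp_congr_ae (hae t ht)).2 (hL t ht).2.1, fun T ε hT hε => ?_⟩
  obtain ⟨d0, h0, H⟩ := conv T ε hT hε
  refine ⟨d0, h0, fun d s hd hdd hs hsT => ?_⟩
  rw [integral_congr_ae (g := fun ω => (V d s ω - L s ω) ^ 2)]
  · exact H d s hd hdd hs hsT
  · filter_upwards [hae s hs] with ω hω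
    rw [hω]

namespace Dat
variable {D : Dat Ω}

def Yl (D : Dat Ω) (K J1 J2 : ℝ → Ω → ℝ) (s : ℝ) (ω : Ω) : ℝ :=
  D.y - D.lam * K s ω + D.α1 * (D.U1 s ω - D.U1 0 ω) + D.α2 * (D.U2 s ω - D.U2 0 ω)
    + D.β1 * J1 s ω + D.β2 * J2 s ω

theorem limit (P : D.P) (hB : ∀ T, 0 ≤ T → PBM μ (GG μ D.U1 D.U2) D.U1 D.U2 T) :
    ∃ K J1 J2 : ℝ → Ω → ℝ, (∀ ω, Continuous (fun t => K t ω) ∧ Continuous (fun t => J1 t ω) ∧ Continuous (fun t => J2 t ω)) ∧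
      (∀ t, 0 ≤ t → Measurable[GG μ D.U1 D.U2 t] (K t) ∧ Measurable[GG μ D.U1 D.U2 t] (J1 t) ∧ Measurable[GG μ D.U1 D.U2 t] (J2 t)) ∧
      (∀ t, 0 ≤ t → MemLp (K t) 2 μ ∧ MemLp (J1 t) 2 μ ∧ MemLp (J2 t) 2 μ) ∧
      ∀ T ε : ℝ, 0 ≤ T → 0 < ε → ∃ d0 : ℝ, 0 < d0 ∧ ∀ d s : ℝ, 0 < d → d ≤ d0 → 0 ≤ s → s ≤ T →
        ∫ ω, (D.eK d s ω - K s ω) ^ 2 ∂μ ≤ ε ∧ ∫ ω, (D.eJ1 d s ω - J1 s ω) ^ 2 ∂μ ≤ ε ∧ ∫ ω, (D.eJ2 d s ω - J2 s ω) ^ 2 ∂μ ≤ ε := by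
  have hC := fun T ε (hT : (0:ℝ) ≤ T) (hε : (0:ℝ) < ε) => cauchy P (hB T hT) hT hε
  obtain ⟨K, cK, mK, lK, HK⟩ := proc_lim (μ := μ) (U1 := D.U1) (U2 := D.U2) (V := D.eK) (fun d s hd hs => eK_meas (hB s hs) hd hs le_rfl)
    (fun d s hd hs => (eJ_memLp (hB s hs) hd hs le_rfl).2.2)
    (fun T ε hT hε => by
      obtain ⟨d0, h0, -, H⟩ := hC T ε hT hε
      exact ⟨d0, h0, fun d d' s a b a' b' hs hsT => (H d d' s a b a' b' hs hsT).2.2.2⟩)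
    (fun T hT => ⟨T ^ 2, by positivity, fun d s t hd hs hst ht => by
      have mm := (((eK_meas (hB t (hs.trans hst)) hd (hs.trans hst) le_rfl).mono (GG_le _ _ _ _) le_rfl).sub ((eK_meas (hB s hs) hd hs le_rfl).mono (GG_le _ _ _ _) le_rfl)).pow_const 4
      have bd : ∀ ω, (D.eK d t ω - D.eK d s ω) ^ 4 ≤ T ^ 2 * (t - s) ^ 2 := fun ω => by
        have h := eK_lip (D := D) hd hs hst ω
        have h' : (D.eK d t ω - D.eK d s ω) ^ 4 ≤ (t - s) ^ 4 := by
          rw [← Even.pow_abs (by decide : Even 4)]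
          exact pow_le_pow_left₀ (abs_nonneg _) h 4
        have h'' : (t - s) ^ 2 ≤ T ^ 2 := pow_le_pow_left₀ (by linarith) (by linarith) 2
        nlinarith [sq_nonneg (t - s)]
      have hi : Integrable (fun ω => (D.eK d t ω - D.eK d s ω) ^ 4) μ :=
        Integrable.of_bound mm.aestronglyMeasurable _ (ae_of_all _ fun ω => by
          rw [Real.norm_eq_abs, abs_of_nonneg (by positivity)]; exact bd ω)
      refine ⟨hi, ?_⟩
      have := integral_mono hi (integrable_const (T ^ 2 * (t - s) ^ 2)) bd
      simpa using this⟩)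
  obtain ⟨J1, c1, m1, l1, H1⟩ := proc_lim (μ := μ) (U1 := D.U1) (U2 := D.U2) (V := D.eJ1) (fun d s hd hs => eJ1_meas (hB s hs) hd hs le_rfl)
    (fun d s hd hs => (eJ_memLp (hB s hs) hd hs le_rfl).1)
    (fun T ε hT hε => by
      obtain ⟨d0, h0, -, H⟩ := hC T ε hT hε
      exact ⟨d0, h0, fun d d' s a b a' b' hs hsT => (H d d' s a b a' b' hs hsT).2.1⟩)
    (fun T hT => ⟨c4, c4_nonneg, fun d s t hd hs hst ht => by
      have := (eJ_cl (D := D) (hB T hT) hd hs hst ht)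
      have hv : 0 ≤ t - s := by linarith
      have i1 := gam2_int_fst (v := t - s) (f := fun x => x ^ 4) (by fun_prop)
      have := CL.integral' this (f := fun p : ℝ × ℝ => p.1 ^ 4) (by fun_prop)
      have := CL.integrable' (eJ_cl (D := D) (hB T hT) hd hs hst ht) (f := fun p : ℝ × ℝ => p.1 ^ 4) (by fun_prop) (gam2_integrable_fst (t - s) 4)
      refine ⟨this, ?_⟩
      simp_all [gam_integral_four hv]⟩)
  obtain ⟨J2, c2, m2, l2, H2⟩ := proc_lim (μ := μ) (U1 := D.U1) (U2 := D.U2) (V := D.eJ2) (fun d s hd hs => eJ2_meas (hB s hs) hd hs le_rfl)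
    (fun d s hd hs => (eJ_memLp (hB s hs) hd hs le_rfl).2.1)
    (fun T ε hT hε => by
      obtain ⟨d0, h0, -, H⟩ := hC T ε hT hε
      exact ⟨d0, h0, fun d d' s a b a' b' hs hsT => (H d d' s a b a' b' hs hsT).2.2.1⟩)
    (fun T hT => ⟨c4, c4_nonneg, fun d s t hd hs hst ht => by
      have := (eJ_cl (D := D) (hB T hT) hd hs hst ht)
      have hv : 0 ≤ t - s := by linarith
      have i1 := gam2_int_snd (v := t - s) (f := fun x => x ^ 4) (by fun_prop)
      have := CL.integral' this (f := fun p : ℝ × ℝ => p.2 ^ 4) (by fun_prop)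
      have := CL.integrable' (eJ_cl (D := D) (hB T hT) hd hs hst ht) (f := fun p : ℝ × ℝ => p.2 ^ 4) (by fun_prop) (gam2_integrable_snd (t - s) 4)
      refine ⟨this, ?_⟩
      simp_all [gam_integral_four hv]⟩)
  refine ⟨K, J1, J2, fun ω => ⟨cK ω, c1 ω, c2 ω⟩, fun t ht => ⟨mK t ht, m1 t ht, m2 t ht⟩, fun t ht => ⟨lK t ht, l1 t ht, l2 t ht⟩, fun T ε hT hε => ?_⟩
  obtain ⟨a, ha, A⟩ := HK T ε hT hε
  obtain ⟨b, hb, B⟩ := H1 T ε hT hε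
  obtain ⟨c, hc, C⟩ := H2 T ε hT hε
  exact ⟨min a (min b c), by positivity, fun d s hd hdd hs hsT => ⟨A d s hd (hdd.trans (min_le_left _ _)) hs hsT,
    B d s hd (hdd.trans ((min_le_right _ _).trans (min_le_left _ _))) hs hsT, C d s hd (hdd.trans ((min_le_right _ _).trans (min_le_right _ _))) hs hsT⟩⟩

end Dat
end
end

section
section
variable {μ : Measure Ω} [IsProbabilityMeasure μ]

def GA (f : Lp ℝ 2 μ) : Prop := ∀ t : ℝ, ∫ ω, Complex.exp (t * f ω * Complex.I) ∂μ = Complex.exp (-(t ^ 2 * ‖f‖ ^ 2 / 2 : ℝ))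

lemma GA.closed : IsClosed {f : Lp ℝ 2 μ | GA f} := by
  rw [← isSeqClosed_iff_isClosed]
  intro f g hf hg t
  have tim : TendstoInMeasure μ (fun n => (f n : Ω → ℝ)) atTop g := tendstoInMeasure_of_tendsto_Lp hg
  obtain ⟨ns, hns, hae⟩ := tim.exists_seq_tendsto_ae
  have h1 : Tendsto (fun k => ∫ ω, Complex.exp (t * f (ns k) ω * Complex.I) ∂μ) atTop (nhds (∫ ω, Complex.exp (t * g ω * Complex.I) ∂μ)) := by
    refine tendsto_integral_of_dominated_convergence (fun _ => 1) (fun k => ?_) (integrable_const _) (fun k => ae_of_all _ fun ω => ?_) ?_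
    · have := (Lp.stronglyMeasurable (f (ns k))).measurable
      exact Measurable.aestronglyMeasurable (by fun_prop)
    · rw [← Complex.ofReal_mul, Complex.norm_exp_ofReal_mul_I]
    · filter_upwards [hae] with ω hω
      have c : Continuous fun x : ℝ => Complex.exp (t * x * Complex.I) := by fun_prop
      exact (c.tendsto _).comp hω
  have h2 : Tendsto (fun k => ∫ ω, Complex.exp (t * f (ns k) ω * Complex.I) ∂μ) atTop (nhds (Complex.exp (-(t ^ 2 * ‖g‖ ^ 2 / 2 : ℝ)))) := by
    simp_rw [fun k => hf (ns k) t]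
    have c : Continuous fun x : ℝ => Complex.exp (-(t ^ 2 * x ^ 2 / 2 : ℝ)) := by fun_prop
    exact (c.tendsto _).comp (hg.norm.comp hns.tendsto_atTop)
  exact tendsto_nhds_unique h1 h2

lemma GA.law {f : Lp ℝ 2 μ} (hf : GA f) : μ.map f = gaussianReal 0 (‖f‖ ^ 2).toNNReal := by
  have mf : Measurable f := (Lp.stronglyMeasurable f).measurable
  have : IsProbabilityMeasure (μ.map f) := Measure.isProbabilityMeasure_map mf.aemeasurable
  refine Measure.ext_of_charFun ?_
  ext t
  rw [charFun_gaussianReal, charFun_apply_real, integral_map mf.aemeasurable (Measurable.aestronglyMeasurable (by fun_prop)), hf t]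
  congr 1
  rw [Real.coe_toNNReal _ (by positivity)]
  push_cast; ring

lemma GA.of_gauss {f : Lp ℝ 2 μ} (hf : HasGaussianLaw f μ) (h0 : ∫ ω, f ω ∂μ = 0) : GA f := by
  intro t
  have mf : Measurable f := (Lp.stronglyMeasurable f).measurable
  have h := hf.map_eq_gaussianReal
  have v : Var[f; μ] = ‖f‖ ^ 2 := by
    rw [variance_of_integral_eq_zero mf.aemeasurable h0, ← l2norm (Lp.memLp f), Lp.toLp_coeFn]
  rw [v, h0] at h
  have e := charFun_apply_real (μ := μ.map f) t
  rw [integral_map mf.aemeasurable (Measurable.aestronglyMeasurable (by fun_prop))] at e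
  rw [← e, h, charFun_gaussianReal, Real.coe_toNNReal _ (by positivity)]
  congr 1
  push_cast; ring

end

lemma isonormal (H : Type) [NormedAddCommGroup H] [InnerProductSpace ℝ H] [CompleteSpace H] :
    ∃ (Ω : Type) (_ : MeasurableSpace Ω) (μ : Measure Ω) (_ : IsProbabilityMeasure μ) (I : H →ₗᵢ[ℝ] Lp ℝ 2 μ), ∀ v, GA (I v) := by
  classical
  obtain ⟨w, b, -⟩ := exists_hilbertBasis ℝ H
  set μ : Measure (w → ℝ) := Measure.infinitePi fun _ => gaussianReal 0 1 with hμ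
  refine ⟨w → ℝ, inferInstance, μ, inferInstance, ?_⟩
  have ev : ∀ i : w, μ.map (fun ω : w → ℝ => ω i) = gaussianReal 0 1 := fun i => Measure.infinitePi_map_eval _ i
  have hl : ∀ i : w, HasLaw (fun ω : w → ℝ => ω i) (gaussianReal 0 1) μ := fun i => ⟨(measurable_pi_apply i).aemeasurable, ev i⟩
  have ind : iIndepFun (fun (i : w) (ω : w → ℝ) => ω i) μ := by
    rw [iIndepFun_iff_map_fun_eq_infinitePi_map (fun i => by fun_prop)]
    simp_rw [ev]
    exact Measure.map_id
  have mem : ∀ i : w, MemLp (fun ω : w → ℝ => ω i) 2 μ := fun i => (hl i).hasGaussianLaw.memLp_two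
  have mean : ∀ i : w, ∫ ω : w → ℝ, ω i ∂μ = 0 := fun i => by
    rw [(hl i).integral_eq]; simp
  set ξ : w → Lp ℝ 2 μ := fun i => (mem i).toLp _ with hξ
  have on : Orthonormal ℝ ξ := by
    rw [orthonormal_iff_ite]
    intro i j
    have e : inner ℝ (ξ i) (ξ j) = ∫ ω : w → ℝ, ω i * ω j ∂μ := by
      rw [L2.inner_def]
      refine integral_congr_ae ?_
      filter_upwards [(mem i).coeFn_toLp, (mem j).coeFn_toLp] with ω hi hj
      simp only [hξ]
      rw [hi, hj]; simp [mul_comm]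
    rw [e]
    split_ifs with h
    · subst h
      have := variance_of_integral_eq_zero (μ := μ) (X := fun ω : w → ℝ => ω i) (measurable_pi_apply i).aemeasurable (mean i)
      rw [(hl i).variance_eq] at this
      simp only [variance_id_gaussianReal] at this
      simp only [← sq]; rw [← this]; simp
    · have := (ind.indepFun h).integral_fun_mul_eq_mul_integral (mem i).1 (mem j).1
      rw [this, mean]; simp
  refine ⟨(on.orthogonalFamily.linearIsometry).comp b.repr.toLinearIsometry, fun v => ?_⟩
  have hs := on.orthogonalFamily.hasSum_linearIsometry (b.repr v)
  refine GA.closed.mem_of_tendsto hs (Eventually.of_forall fun s => ?_)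
  set f : Lp ℝ 2 μ := ∑ i ∈ s, (LinearIsometry.toSpanSingleton ℝ (Lp ℝ 2 μ) (on.1 i)) (b.repr v i) with hf
  have fe : f =ᵐ[μ] fun ω => ∑ i : s, b.repr v i * ω i := by
    have h1 : f = ∑ i ∈ s, (b.repr v i) • ξ i := by
      rw [hf]; refine Finset.sum_congr rfl fun i _ => ?_
      simp
    rw [h1]
    refine (Lp.coeFn_finsetSum _ _).trans ?_
    have : ∀ᵐ ω ∂μ, ∀ i : s, (((b.repr v i) • ξ i : Lp ℝ 2 μ) : (w → ℝ) → ℝ) ω = b.repr v i * ω i := by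
      rw [ae_all_iff]
      intro i
      filter_upwards [Lp.coeFn_smul (b.repr v i) (ξ i), (mem i).coeFn_toLp] with ω h1 h2
      rw [h1]; simp only [hξ, Pi.smul_apply, smul_eq_mul]; rw [h2]
    filter_upwards [this] with ω hω
    rw [Finset.sum_apply, ← Finset.sum_coe_sort]
    exact Finset.sum_congr rfl fun i _ => hω i
  have g : HasGaussianLaw (fun ω : w → ℝ => ∑ i : s, b.repr v i * ω i) μ := by
    refine iIndepFun.hasGaussianLaw_fun_sum (X := fun (i : s) (ω : w → ℝ) => b.repr v i * ω i) (fun i => ?_) ?_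
    · exact ((hl i).hasGaussianLaw.fun_smul (b.repr v i))
    · have i2 : iIndepFun (fun (i : s) (ω : w → ℝ) => ω i) μ := ind.precomp (g := fun i : s => (i : w)) Subtype.val_injective
      exact i2.comp (fun i x => b.repr v i * x) (fun i => by fun_prop)
  refine GA.of_gauss (g.congr fe.symm) ?_
  rw [integral_congr_ae fe, integral_finset_sum]
  · simp only [integral_const_mul, mean]; simp
  · intro i _
    exact ((mem i).integrable (by norm_num)).const_mul _
end

section
lemma exists_preBM : ∃ (Ω : Type) (_ : MeasurableSpace Ω) (μ : Measure Ω) (_ : IsProbabilityMeasure μ) (B : NNReal → Ω → ℝ),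
    (∀ t, Measurable (B t)) ∧ IsPreBrownianReal B μ := by
  obtain ⟨Ω, mΩ, μ, hμ, I, hI⟩ := isonormal (Lp ℝ 2 (volume : Measure ℝ))
  let v : NNReal → Lp ℝ 2 (volume : Measure ℝ) := fun t => indicatorConstLp 2 (measurableSet_Ioc (a := (0:ℝ)) (b := t)) (by simp) (1:ℝ)
  have mB : ∀ t, Measurable (I (v t)) := fun t => (Lp.stronglyMeasurable _).measurable
  have mean : ∀ u, ∫ ω, I u ω ∂μ = 0 := fun u => by
    have := (hI u).law
    have mm : Measurable (I u) := (Lp.stronglyMeasurable _).measurable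
    have e := integral_map (μ := μ) (φ := I u) mm.aemeasurable (f := fun x : ℝ => x) (by fun_prop)
    rw [← e, this]; simp
  refine ⟨Ω, mΩ, μ, hμ, fun t => I (v t), mB, IsGaussianProcess.isPreBrownianReal_of_covariance ⟨fun S => ⟨?_⟩⟩ (fun t => mean _) ?_⟩
  · refine isGaussian_of_map_eq_gaussianReal fun L => ?_
    have mr : Measurable (fun ω => S.restrict (fun t => I (v t) ω)) := measurable_pi_lambda _ fun i => mB _
    set u : Lp ℝ 2 (volume : Measure ℝ) := ∑ i : S, (L (Pi.single i 1)) • v i with hu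
    refine ⟨0, (‖I u‖ ^ 2).toNNReal, ?_⟩
    rw [Measure.map_map L.continuous.measurable mr, ← (hI u).law]
    refine Measure.map_congr ?_
    have h1 : I u = ∑ i : S, (L (Pi.single i 1)) • I (v i) := by rw [hu, map_sum]; simp
    have h2 : (I u : Ω → ℝ) =ᵐ[μ] ∑ i : S, (((L (Pi.single i 1)) • I (v i) : Lp ℝ 2 μ) : Ω → ℝ) := by
      rw [h1]; exact Lp.coeFn_finsetSum _ _
    have h3 : ∀ᵐ ω ∂μ, ∀ i : S, (((L (Pi.single i 1)) • I (v i) : Lp ℝ 2 μ) : Ω → ℝ) ω = L (Pi.single i 1) * I (v i) ω := by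
      rw [ae_all_iff]
      intro i
      filter_upwards [Lp.coeFn_smul (L (Pi.single i 1)) (I (v i))] with ω h
      rw [h]; rfl
    filter_upwards [h2, h3] with ω e2 e3
    rw [e2, Finset.sum_apply]
    simp_rw [e3]
    have e4 : (S.restrict fun t => I (v t) ω) = ∑ i : S, (I (v i) ω) • (Pi.single i (1:ℝ) : S → ℝ) := by
      ext j
      simp [Finset.sum_apply, Pi.single_apply]
    simp only [Function.comp]
    rw [e4, map_sum]
    refine Finset.sum_congr rfl fun i _ => ?_
    rw [map_smul, smul_eq_mul, mul_comm]
  · intro s t hst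
    rw [covariance_eq_sub (Lp.memLp _) (Lp.memLp _), mean, mean]
    have e' : μ[(I (v s) : Ω → ℝ) * (I (v t) : Ω → ℝ)] = inner ℝ (I (v s)) (I (v t)) := by
      rw [L2.inner_def]
      refine integral_congr_ae (ae_of_all _ fun ω => ?_)
      exact mul_comm _ _
    rw [e', LinearIsometry.inner_map_map, L2.inner_indicatorConstLp_indicatorConstLp _ _ (by simp) (by simp)]
    rw [Ioc_inter_Ioc]
    have : (min s t : ℝ) = s := min_eq_left (by exact_mod_cast hst)
    simp [this]

lemma natSA_comp {Ω' : Type*} [MeasurableSpace Ω'] (W : ℝ → Ω → ℝ) (f : Ω' → Ω) (s : ℝ) :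
    natSA (fun t ω => W t (f ω)) s ≤ MeasurableSpace.comap f (natSA W s) := by
  refine iSup₂_le fun r hr => ?_
  rw [← measurable_iff_comap_le]
  have h1 : Measurable[natSA W s] (W r) := natSA_meas W hr.1 hr.2
  have h2 : Measurable[MeasurableSpace.comap f (natSA W s), natSA W s] f := comap_measurable f
  exact h1.comp h2

lemma exists_BM : ∃ (Ω : Type) (_ : MeasurableSpace Ω) (μ : Measure Ω) (_ : IsProbabilityMeasure μ) (W : ℝ → Ω → ℝ),
    (∀ ω, Continuous fun t => W t ω) ∧ (∀ t, Measurable (W t)) ∧ (∀ᵐ ω ∂μ, W 0 ω = 0) ∧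
    ∀ s t, 0 ≤ s → s ≤ t → CL (natSA W s) μ (fun ω => W t ω - W s ω) (gam (t - s)) := by
  obtain ⟨Ω, mΩ, μ, hμ, B, mB, hB⟩ := exists_preBM
  have lawB : ∀ s t : ℝ, 0 ≤ s → s ≤ t → μ.map (fun ω => B t.toNNReal ω - B s.toNNReal ω) = gam (t - s) := by
    intro s t hs hst
    have := (hB.hasLaw_sub t.toNNReal s.toNNReal).map_eq
    unfold gam
    rw [show (fun ω => B t.toNNReal ω - B s.toNNReal ω) = B t.toNNReal - B s.toNNReal from rfl, this]
    congr 1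
    ext
    rw [coe_nndist, Real.dist_eq]
    simp only [NNReal.val_eq_coe, Real.coe_toNNReal _ hs, Real.coe_toNNReal _ (hs.trans hst), Real.coe_toNNReal _ (sub_nonneg.2 hst)]
    exact abs_of_nonneg (sub_nonneg.2 hst)
  obtain ⟨W, cW, mW, hae⟩ := kc_cts (μ := μ) (fun t => B t.toNNReal) (fun t _ => mB _) (fun T hT => ⟨c4, c4_nonneg, fun s t hs hst ht => by
    have hl := lawB s t hs hst
    have mm : Measurable (fun ω => B t.toNNReal ω - B s.toNNReal ω) := (mB _).sub (mB _)
    have i := gam_integrable_pow (t - s) 4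
    have j := gam_integral_four (sub_nonneg.2 hst)
    rw [← hl] at i j
    rw [integral_map mm.aemeasurable (by fun_prop)] at j
    exact ⟨(integrable_map_measure (by fun_prop) mm.aemeasurable).1 i, j.le⟩⟩)
  have hB' : IsPreBrownianReal (fun (t : NNReal) ω => W t ω) μ := hB.congr fun t => by
    have := hae t t.2
    simp only [Real.toNNReal_coe] at this
    exact this.symm
  refine ⟨Ω, mΩ, μ, hμ, W, cW, mW, ?_, fun s t hs hst => ?_⟩
  · have := hB'.eval_zero_ae_eq_zero
    simpa using this
  · have ind := hB'.indepFun_shift s.toNNReal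
    have mm : Measurable (fun ω => W t ω - W s ω) := (mW _).sub (mW _)
    refine ⟨mm, fun A hA S hS => ?_⟩
    have hle : natSA W s ≤ MeasurableSpace.comap (fun ω (r : Set.Iic s.toNNReal) => W (r : NNReal) ω) inferInstance := by
      refine iSup₂_le fun r hr => ?_
      rw [← measurable_iff_comap_le]
      have h1 : Measurable (fun p : (Set.Iic s.toNNReal → ℝ) => p ⟨r.toNNReal, Real.toNNReal_le_toNNReal hr.2⟩) := measurable_pi_apply _
      have h2 : W r = (fun p : (Set.Iic s.toNNReal → ℝ) => p ⟨r.toNNReal, Real.toNNReal_le_toNNReal hr.2⟩) ∘ (fun ω (r : Set.Iic s.toNNReal) => W (r : NNReal) ω) := by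
        ext ω
        simp [Real.coe_toNNReal _ hr.1]
      rw [h2]
      exact h1.comp (comap_measurable _)
    obtain ⟨A', hA', rfl⟩ := hle _ hA
    have hS' : MeasurableSet ((fun p : NNReal → ℝ => p (t - s).toNNReal) ⁻¹' S) := measurable_pi_apply _ hS
    have := (indepFun_iff_measure_inter_preimage_eq_mul.1 ind) _ _ hS' hA'
    have e : (fun ω (r : NNReal) => W (s.toNNReal + r : NNReal) ω - W s.toNNReal ω) ⁻¹' ((fun p : NNReal → ℝ => p (t - s).toNNReal) ⁻¹' S) = (fun ω => W t ω - W s ω) ⁻¹' S := by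
      ext ω
      simp only [mem_preimage, NNReal.coe_add, Real.coe_toNNReal _ hs, Real.coe_toNNReal _ (sub_nonneg.2 hst)]
      rw [show s + (t - s) = t by ring]
    rw [e] at this
    have hl := lawB s t hs hst
    have hl' : μ.map (fun ω => W t ω - W s ω) = gam (t - s) := by
      rw [← hl]
      refine Measure.map_congr ?_
      filter_upwards [hae s hs, hae t (hs.trans hst)] with ω h1 h2
      rw [h1, h2]
    rw [inter_comm, this, mul_comm, ← hl', Measure.map_apply mm hS]

theorem exists_planar : ∃ (Ω : Type) (_ : MeasurableSpace Ω) (μ : Measure Ω) (_ : IsProbabilityMeasure μ) (U1 U2 : ℝ → Ω → ℝ),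
    (∀ ω, Continuous (fun t => U1 t ω) ∧ Continuous (fun t => U2 t ω)) ∧ (∀ t, Measurable (U1 t) ∧ Measurable (U2 t)) ∧
    IsPlanarBM μ (GG μ U1 U2) U1 U2 ∧ ∀ T, PBM μ (GG μ U1 U2) U1 U2 T := by
  obtain ⟨Ω, mΩ, μ, hμ, W, cW, mW, W0, cl⟩ := exists_BM
  let U1 : ℝ → Ω × Ω → ℝ := fun t ω => W t ω.1
  let U2 : ℝ → Ω × Ω → ℝ := fun t ω => W t ω.2
  have m1 : ∀ t, Measurable (U1 t) := fun t => (mW t).comp measurable_fst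
  have m2 : ∀ t, Measurable (U2 t) := fun t => (mW t).comp measurable_snd
  have p1 : MeasurePreserving (Prod.fst : Ω × Ω → Ω) (μ.prod μ) μ := measurePreserving_fst
  have p2 : MeasurePreserving (Prod.snd : Ω × Ω → Ω) (μ.prod μ) μ := measurePreserving_snd
  have nle : ∀ s, natSA W s ≤ mΩ := fun s => iSup₂_le fun r hr => (mW r).comap_le
  have tr : ∀ f : Ω × Ω → Ω, MeasurePreserving f (μ.prod μ) μ → ∀ s t, 0 ≤ s → s ≤ t →
      CL (natSA (fun t ω => W t (f ω)) s) (μ.prod μ) (fun ω => W t (f ω) - W s (f ω)) (gam (t - s)) := by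
    intro f hf s t hs hst
    refine ⟨((mW t).comp hf.measurable).sub ((mW s).comp hf.measurable), fun A hA B hB => ?_⟩
    obtain ⟨A', hA', rfl⟩ := natSA_comp W f s _ hA
    have h := (cl s t hs hst).rect A' hA' B hB
    have hA'' : MeasurableSet A' := nle s _ hA'
    have hms : MeasurableSet (A' ∩ (fun ω => W t ω - W s ω) ⁻¹' B) := hA''.inter (((mW t).sub (mW s)) hB)
    rw [hf.measure_preimage hA''.nullMeasurableSet, ← h, ← hf.measure_preimage hms.nullMeasurableSet]
    rfl
  have c1 := tr Prod.fst p1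
  have c2 := tr Prod.snd p2
  have path : Measurable (fun ω : Ω => (fun t => W t ω)) := measurable_pi_lambda _ mW
  have ind : IndepFun (fun ω => (fun t => U1 t ω)) (fun ω => (fun t => U2 t ω)) (μ.prod μ) :=
    indepFun_prod path path
  have pb := pbm_of_indep (μ := μ.prod μ) (U1 := U1) (U2 := U2) (fun t _ => m1 t) (fun t _ => m2 t) ind c1 c2
  have bm : ∀ U : ℝ → Ω × Ω → ℝ, (∀ t, 0 ≤ t → Measurable[GG (μ.prod μ) U1 U2 t] (U t)) → (∀ᵐ ω ∂(μ.prod μ), U 0 ω = 0) → (∀ ω, Continuous fun t => U t ω) →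
      (∀ s t, 0 ≤ s → s ≤ t → CL (GG (μ.prod μ) U1 U2 s) (μ.prod μ) (fun ω => U t ω - U s ω) (gam (t - s))) →
      IsBM (μ.prod μ) (GG (μ.prod μ) U1 U2) U := by
    intro U mU U0 cU clU
    refine ⟨GG_le _ _ _, GG_mono _ _ _, fun t ht => (mU t ht).comap_le, U0, ae_of_all _ cU, fun s t hs hst => (clU s t hs hst).law, fun s t hs hst => ?_⟩
    rw [Indep_iff]
    rintro _ A ⟨B, hB, rfl⟩ hA
    have := (clU s t hs hst).rect A hA B hB
    rw [inter_comm, this, mul_comm, ← (clU s t hs hst).law, Measure.map_apply (clU s t hs hst).meas hB]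
  refine ⟨Ω × Ω, inferInstance, μ.prod μ, inferInstance, U1, U2, fun ω => ⟨cW _, cW _⟩, fun t => ⟨m1 t, m2 t⟩, ⟨?_, ?_, ind⟩, pb⟩
  · refine bm U1 (fun t ht => (pb t).m1 t ht le_rfl) (p1.quasiMeasurePreserving.ae W0) (fun ω => cW _) (fun s t hs hst => ?_)
    have := ((pb t).cl s t hs hst le_rfl).comp' (GG_le _ _ _ s) (f := Prod.fst) measurable_fst
    rwa [gam2_fst] at this
  · refine bm U2 (fun t ht => (pb t).m2 t ht le_rfl) (p2.quasiMeasurePreserving.ae W0) (fun ω => cW _) (fun s t hs hst => ?_)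
    have := ((pb t).cl s t hs hst le_rfl).comp' (GG_le _ _ _ s) (f := Prod.snd) measurable_snd
    rwa [gam2_snd] at this
end

section

/-- left dyadic grid point -/
def gr (t : ℝ) (n : ℕ) (s : ℝ) : ℝ := t * (⌊s * 2 ^ n / t⌋₊ : ℝ) / 2 ^ n

lemma gr_eq {t : ℝ} (ht : 0 < t) (n i : ℕ) {s : ℝ} (h1 : t * i / 2 ^ n ≤ s) (h2 : s < t * (i + 1) / 2 ^ n) :
    gr t n s = t * i / 2 ^ n := by
  have hp : (0:ℝ) < 2 ^ n := by positivity
  have : ⌊s * 2 ^ n / t⌋₊ = i := by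
    rw [div_le_iff₀ hp] at h1
    rw [lt_div_iff₀ hp] at h2
    have h0 : 0 ≤ s := by
      by_contra hc; push Not at hc
      have : s * 2 ^ n < 0 := mul_neg_of_neg_of_pos hc hp
      have : (0:ℝ) ≤ t * i := by positivity
      linarith
    rw [Nat.floor_eq_iff (by positivity), le_div_iff₀ ht, div_lt_iff₀ ht]
    constructor <;> linarith
  rw [gr, this]

lemma gr_le {t : ℝ} (ht : 0 < t) (n : ℕ) {s : ℝ} (hs : 0 ≤ s) : gr t n s ≤ s := by
  have hp : (0:ℝ) < 2 ^ n := by positivity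
  rw [gr, div_le_iff₀ hp]
  have := Nat.floor_le (show 0 ≤ s * 2 ^ n / t by positivity)
  rw [le_div_iff₀ ht] at this; linarith

lemma gr_lt {t : ℝ} (ht : 0 < t) (n : ℕ) (s : ℝ) : s < gr t n s + t / 2 ^ n := by
  have hp : (0:ℝ) < 2 ^ n := by positivity
  rw [gr, ← add_div, lt_div_iff₀ hp]
  have := Nat.lt_floor_add_one (s * 2 ^ n / t)
  rw [div_lt_iff₀ ht] at this; linarith

lemma gr_nonneg {t : ℝ} (ht : 0 < t) (n : ℕ) (s : ℝ) : 0 ≤ gr t n s := by unfold gr; positivity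

lemma half_tendsto (t : ℝ) : Tendsto (fun n : ℕ => t / 2 ^ n) atTop (𝓝 0) := by
  have := (tendsto_pow_atTop_nhds_zero_of_lt_one (r := (1/2:ℝ)) (by norm_num) (by norm_num)).const_mul t
  simp only [mul_zero] at this
  refine this.congr fun n => ?_
  rw [one_div, inv_pow, div_eq_mul_inv]

lemma gr_tendsto {t : ℝ} (ht : 0 < t) {s : ℝ} (hs : 0 ≤ s) : Tendsto (fun n => gr t n s) atTop (𝓝 s) := by
  have h1 : Tendsto (fun n : ℕ => s - t / 2 ^ n) atTop (𝓝 s) := by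
    simpa using (half_tendsto t).const_sub s
  exact tendsto_of_tendsto_of_tendsto_of_le_of_le h1 tendsto_const_nhds (fun n => by
    have := gr_lt ht n s; simp only; linarith) (fun n => gr_le ht n hs)

lemma gr_meas {β : Type*} [MeasurableSpace β] (t : ℝ) (n : ℕ) (F : ℝ → β) : Measurable (fun s => F (gr t n s)) := by
  have h1 : Measurable (fun s : ℝ => ⌊s * 2 ^ n / t⌋₊) := Nat.measurable_floor.comp (by fun_prop)
  have h2 : Measurable (fun i : ℕ => F (t * (i:ℝ) / 2 ^ n)) := measurable_from_nat
  exact h2.comp h1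

lemma step_int {t : ℝ} (ht : 0 < t) (n : ℕ) (F : ℝ → ℝ) :
    ∫ s in (0:ℝ)..t, F (gr t n s) = ∑ i ∈ Finset.range (2 ^ n), (t / 2 ^ n) * F (t * i / 2 ^ n) := by
  have hp : (0:ℝ) < 2 ^ n := by positivity
  have hle : ∀ i : ℕ, t * i / 2 ^ n ≤ t * ((i + 1 : ℕ)) / 2 ^ n := fun i => by push_cast; gcongr; linarith
  have key : ∀ i : ℕ, Set.EqOn (fun s => F (gr t n s)) (fun _ => F (t * i / 2 ^ n)) (Set.Ioo (t * i / 2 ^ n) (t * ((i+1 : ℕ)) / 2 ^ n)) := by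
    intro i s hs
    simp only [gr_eq ht n i hs.1.le (by have := hs.2; push_cast at this; exact this)]
  have hae : ∀ i : ℕ, (fun s => F (gr t n s)) =ᵐ[volume.restrict (Set.Ioc (t * i / 2 ^ n) (t * ((i+1 : ℕ)) / 2 ^ n))] (fun _ => F (t * i / 2 ^ n)) := by
    intro i
    rw [← restrict_Ioo_eq_restrict_Ioc]
    exact (ae_restrict_mem measurableSet_Ioo).mono fun s hs => key i hs
  have hnn : ∀ i : ℕ, IntervalIntegrable (fun s => F (gr t n s)) volume (t * i / 2 ^ n) (t * ((i+1 : ℕ)) / 2 ^ n) := by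
    intro i
    rw [intervalIntegrable_iff_integrableOn_Ioc_of_le (hle i)]
    exact (integrableOn_const (by simp) (C := F (t * i / 2 ^ n))).congr (hae i).symm
  have := intervalIntegral.sum_integral_adjacent_intervals (μ := volume) (f := fun s => F (gr t n s)) (a := fun i : ℕ => t * i / 2 ^ n) (n := 2 ^ n) (fun k _ => hnn k)
  simp only [Nat.cast_zero, mul_zero, zero_div, Nat.cast_pow, Nat.cast_ofNat, mul_div_assoc, div_self hp.ne', mul_one] at this
  rw [← this]
  refine Finset.sum_congr rfl fun i _ => ?_
  have e : ∫ s in (t * i / 2 ^ n)..(t * ((i+1 : ℕ)) / 2 ^ n), F (gr t n s) = (t / 2 ^ n) * F (t * i / 2 ^ n) := by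
    rw [intervalIntegral.integral_of_le (hle i), integral_congr_ae (hae i)]
    rw [setIntegral_const, smul_eq_mul]
    congr 1
    rw [Measure.real, Real.volume_Ioc, ENNReal.toReal_ofReal (by have := hle i; linarith)]
    push_cast; ring
  simpa [mul_div_assoc] using e

section
variable {μ : Measure Ω} [IsProbabilityMeasure μ]

/-- small ball estimate passing to a limit in measure -/
lemma small_ball {Ω : Type*} {𝒢 : MeasurableSpace Ω} [m : MeasurableSpace Ω] {μ : Measure Ω} [IsProbabilityMeasure μ]
    (h𝒢 : 𝒢 ≤ m) {B C : ℕ → Ω → ℝ} {Z : Ω → ℝ} {v r : ℝ} (hv : 0 < v) (hr : 0 < r)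
    (hB : ∀ n, CL 𝒢 μ (B n) (gam v)) (hC : ∀ n, Measurable[𝒢] (C n))
    (hlim : TendstoInMeasure μ (fun n ω => C n ω + B n ω) atTop Z) :
    μ {ω | |Z ω| ≤ r} ≤ ENNReal.ofReal (2 * r / √v) := by
  have h1 : ∀ n, μ {ω | |C n ω + B n ω| ≤ 2 * r} ≤ ENNReal.ofReal (2 * r / √v) := by
    intro n
    have hm := (hB n).map_prod h𝒢 (hC n)
    have hS : MeasurableSet {p : ℝ × ℝ | |p.1 + p.2| ≤ 2 * r} := measurableSet_le (by fun_prop) (by fun_prop)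
    have hmm : Measurable (fun ω => (C n ω, B n ω)) := ((hC n).mono h𝒢 le_rfl).prodMk (hB n).meas
    have : μ {ω | |C n ω + B n ω| ≤ 2 * r} = (μ.map (fun ω => (C n ω, B n ω))) {p : ℝ × ℝ | |p.1 + p.2| ≤ 2 * r} := by
      rw [Measure.map_apply hmm hS]; rfl
    have hpr : IsProbabilityMeasure (gam v) := by unfold gam; infer_instance
    have hpc : IsProbabilityMeasure (μ.map (C n)) := Measure.isProbabilityMeasure_map ((hC n).mono h𝒢 le_rfl).aemeasurable
    rw [this, hm, Measure.prod_apply hS]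
    calc _ ≤ ∫⁻ x, ENNReal.ofReal (2 * r / √v) ∂(μ.map (C n)) := by
          refine lintegral_mono fun x => ?_
          refine le_trans (measure_mono ?_) (gam_small hv (-x) (r := 2 * r) (by positivity))
          intro z hz
          simp only [Set.mem_preimage, Set.mem_setOf_eq, abs_le] at hz
          exact ⟨by linarith, by linarith⟩
      _ = _ := by simp
  have h2 := hlim (ENNReal.ofReal r) (by simpa using hr)
  have h3 : ∀ n, μ {ω | |Z ω| ≤ r} ≤ ENNReal.ofReal (2 * r / √v) + μ {ω | ENNReal.ofReal r ≤ edist (C n ω + B n ω) (Z ω)} := by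
    intro n
    refine le_trans (measure_mono (t := {ω | |C n ω + B n ω| ≤ 2 * r} ∪ {ω | ENNReal.ofReal r ≤ edist (C n ω + B n ω) (Z ω)}) ?_) ((measure_union_le _ _).trans (add_le_add (h1 n) le_rfl))
    intro ω hω
    by_cases hc : ENNReal.ofReal r ≤ edist (C n ω + B n ω) (Z ω)
    · exact Or.inr hc
    · left
      rw [edist_dist, ENNReal.ofReal_le_ofReal_iff dist_nonneg, Real.dist_eq] at hc
      push Not at hc
      simp only [Set.mem_setOf_eq] at hω ⊢
      have := abs_add_le (C n ω + B n ω - Z ω) (Z ω)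
      simp only [sub_add_cancel] at this
      linarith
  have h4 := ge_of_tendsto' (tendsto_const_nhds.add h2) h3
  simpa using h4

lemma zero_of_small {A : Set Ω} {lam t : ℝ} (hlam : 0 ≤ lam) (ht : 0 < t) (h : ∀ v, 0 < v → v ≤ t → (∃ k : ℕ, v = t / 2 ^ k) → μ A ≤ ENNReal.ofReal (2 * ((lam + 1) * v) / √v)) : μ A = 0 := by
  have h1 : ∀ k : ℕ, μ A ≤ ENNReal.ofReal (2 * (lam + 1) * √(t / 2 ^ k)) := by
    intro k
    have hp : (0:ℝ) < t / 2 ^ k := by positivity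
    refine (h _ hp (div_le_self ht.le (one_le_pow₀ (by norm_num))) ⟨k, rfl⟩).trans (ENNReal.ofReal_le_ofReal (le_of_eq ?_))
    have := Real.sq_sqrt hp.le
    have hs := Real.sqrt_pos.2 hp
    rw [div_eq_iff hs.ne']
    nlinarith
  have h2 : Tendsto (fun k : ℕ => ENNReal.ofReal (2 * (lam + 1) * √(t / 2 ^ k))) atTop (𝓝 0) := by
    have := ((Real.continuous_sqrt.tendsto 0).comp (half_tendsto t)).const_mul (2 * (lam + 1))
    have := (ENNReal.continuous_ofReal.tendsto _).comp this
    simpa [Function.comp_def] using this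
  exact le_antisymm (ge_of_tendsto' h2 h1) zero_le

lemma psgn_conv {Z : ℕ → Ω → ℝ} {Y : Ω → ℝ} (hY : Measurable Y) (hlim : TendstoInMeasure μ Z atTop Y) (h0 : μ {ω | Y ω = 0} = 0) :
    Tendsto (fun n => μ.real {ω | psgn (Z n ω) ≠ psgn (Y ω)}) atTop (𝓝 0) := by
  have hd : Tendsto (fun k : ℕ => μ {ω | |Y ω| ≤ 1 / ((k:ℝ) + 1)}) atTop (𝓝 0) := by
    rw [← h0]
    have e : {ω | Y ω = 0} = ⋂ k : ℕ, {ω | |Y ω| ≤ 1 / ((k:ℝ) + 1)} := by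
      ext ω
      simp only [Set.mem_setOf_eq, Set.mem_iInter]
      constructor
      · intro h k; rw [h, abs_zero]; positivity
      · intro h
        have := ge_of_tendsto' tendsto_one_div_add_atTop_nhds_zero_nat h
        exact abs_eq_zero.1 (le_antisymm this (abs_nonneg _))
    rw [e]
    refine tendsto_measure_iInter_atTop (fun k => (measurableSet_le hY.abs measurable_const).nullMeasurableSet) ?_ ⟨0, measure_ne_top _ _⟩
    intro i j hij ω hω
    simp only [Set.mem_setOf_eq] at hω ⊢
    refine hω.trans ?_
    have : (i:ℝ) ≤ j := by exact_mod_cast hij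
    gcongr
  have main : Tendsto (fun n => μ {ω | psgn (Z n ω) ≠ psgn (Y ω)}) atTop (𝓝 0) := by
    rw [ENNReal.tendsto_nhds_zero]
    intro ε hε
    have hε2 : 0 < ε / 2 := ENNReal.half_pos hε.ne'
    obtain ⟨k, hk⟩ := ((ENNReal.tendsto_nhds_zero.1 hd) (ε / 2) hε2).exists
    have hdp : (0:ℝ) < 1 / ((k:ℝ) + 1) := by positivity
    have h2 := hlim (ENNReal.ofReal (1 / ((k:ℝ) + 1))) (by simpa using hdp)
    filter_upwards [(ENNReal.tendsto_nhds_zero.1 h2) (ε / 2) hε2] with n hn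
    refine le_trans (measure_mono (t := {ω | |Y ω| ≤ 1 / ((k:ℝ) + 1)} ∪ {ω | ENNReal.ofReal (1 / ((k:ℝ) + 1)) ≤ edist (Z n ω) (Y ω)}) ?_) ((measure_union_le _ _).trans ((add_le_add hk hn).trans (by rw [ENNReal.add_halves])))
    intro ω hω
    by_contra hc
    simp only [Set.mem_union, Set.mem_setOf_eq, not_or, edist_dist, ENNReal.ofReal_le_ofReal_iff dist_nonneg, Real.dist_eq] at hc hω
    obtain ⟨h3, h4⟩ := hc
    push Not at h3 h4
    apply hω
    rw [ENNReal.ofReal_lt_ofReal_iff hdp, abs_lt] at h4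
    unfold psgn
    rcases le_or_gt (Y ω) 0 with hy | hy
    · rw [abs_of_nonpos hy] at h3
      rw [if_neg (not_lt.2 hy), if_neg (by linarith)]
    · rw [abs_of_pos hy] at h3
      rw [if_pos hy, if_pos (by linarith)]
  have := (ENNReal.tendsto_toReal ENNReal.zero_ne_top).comp main
  simpa [Measure.real, Function.comp_def] using this

lemma ne_tri {a b c : Ω → ℝ} : μ.real {ω | a ω ≠ b ω} ≤ μ.real {ω | a ω ≠ c ω} + μ.real {ω | b ω ≠ c ω} := by
  refine le_trans (measureReal_mono (s₂ := {ω | a ω ≠ c ω} ∪ {ω | b ω ≠ c ω}) ?_) (measureReal_union_le _ _)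
  intro ω hω
  by_contra hc
  simp only [Set.mem_union, Set.mem_setOf_eq, not_or, not_not] at hc hω
  exact hω (hc.1.trans hc.2.symm)

lemma dct01 {t : ℝ} (ht : 0 ≤ t) {f : ℕ → ℝ → ℝ} (hm : ∀ n, AEStronglyMeasurable (f n) (volume.restrict (Set.uIoc 0 t))) (hb : ∀ n s, |f n s| ≤ 1)
    (hl : ∀ s, 0 < s → s < t → Tendsto (fun n => f n s) atTop (𝓝 0)) : Tendsto (fun n => ∫ s in (0:ℝ)..t, f n s) atTop (𝓝 0) := by
  have := intervalIntegral.tendsto_integral_filter_of_dominated_convergence (μ := volume) (a := 0) (b := t) (F := f) (f := fun _ => 0) (l := atTop) (fun _ => 1)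
    (Eventually.of_forall hm) (Eventually.of_forall fun n => ae_of_all _ fun s _ => by simpa using hb n s) (by simp) (by
      have : ∀ᵐ s : ℝ, s ≠ t := by simp [ae_iff]
      filter_upwards [this] with s hs hs'
      rw [Set.uIoc_of_le ht] at hs'
      exact hl s hs'.1 (lt_of_le_of_ne hs'.2 hs))
  simpa using this
end
end

section
section
variable {μ : Measure Ω} [IsProbabilityMeasure μ]

lemma tim_add {f f' : ℕ → Ω → ℝ} {g g' : Ω → ℝ} (h : TendstoInMeasure μ f atTop g) (h' : TendstoInMeasure μ f' atTop g') :
    TendstoInMeasure μ (fun n ω => f n ω + f' n ω) atTop (fun ω => g ω + g' ω) := by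
  intro ε hε
  have hε2 : 0 < ε / 2 := ENNReal.half_pos hε.ne'
  have h3 := (h _ hε2).add (h' _ hε2)
  rw [add_zero] at h3
  refine tendsto_of_tendsto_of_tendsto_of_le_of_le tendsto_const_nhds h3 (fun _ => zero_le) fun n => ?_
  refine le_trans (measure_mono (t := {x | ε / 2 ≤ edist (f n x) (g x)} ∪ {x | ε / 2 ≤ edist (f' n x) (g' x)}) ?_) (measure_union_le _ _)
  intro ω hω
  by_contra hc
  simp only [Set.mem_union, Set.mem_setOf_eq, not_or, not_le] at hc hω
  have := ENNReal.add_lt_add hc.1 hc.2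
  rw [ENNReal.add_halves] at this
  exact absurd (hω.trans (edist_add_add_le _ _ _ _)) (not_le.2 this)

lemma tim_cmul {f : ℕ → Ω → ℝ} {g : Ω → ℝ} (c : ℝ) (h : TendstoInMeasure μ f atTop g) :
    TendstoInMeasure μ (fun n ω => c * f n ω) atTop (fun ω => c * g ω) := by
  rw [tendstoInMeasure_iff_dist] at h ⊢
  intro ε hε
  have h3 := h (ε / (|c| + 1)) (by positivity)
  refine tendsto_of_tendsto_of_tendsto_of_le_of_le tendsto_const_nhds h3 (fun _ => zero_le) fun n => measure_mono ?_
  intro ω hω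
  simp only [Set.mem_setOf_eq, Real.dist_eq] at hω ⊢
  rw [← mul_sub, abs_mul] at hω
  rw [div_le_iff₀ (by positivity)]
  nlinarith [abs_nonneg (f n ω - g ω)]

lemma tim_const (g : Ω → ℝ) : TendstoInMeasure μ (fun _ : ℕ => g) atTop g := by
  intro ε hε
  have : {x : Ω | ε ≤ edist (g x) (g x)} = ∅ := by
    ext x; simp [hε.ne']
  simp only [this, measure_empty]; exact tendsto_const_nhds

lemma tim_bound {f : ℕ → Ω → ℝ} {g : Ω → ℝ} {c : ℝ} (h : TendstoInMeasure μ f atTop g) (hb : ∀ᶠ n in atTop, ∀ᵐ ω ∂μ, |f n ω| ≤ c) :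
    ∀ᵐ ω ∂μ, |g ω| ≤ c := by
  obtain ⟨N, hN⟩ := eventually_atTop.1 hb
  obtain ⟨ns, hns, hl⟩ := h.exists_seq_tendsto_ae
  have hall : ∀ᵐ ω ∂μ, ∀ n, N ≤ n → |f n ω| ≤ c := by
    rw [ae_all_iff]; intro n
    by_cases hn : N ≤ n
    · filter_upwards [hN n hn] with ω h _ using h
    · exact ae_of_all _ fun ω h => absurd h hn
  filter_upwards [hl, hall] with ω hω ha
  refine le_of_tendsto hω.abs ?_
  filter_upwards [hns.tendsto_atTop.eventually_ge_atTop N] with k hk using ha _ hk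

/-- L2 smallness gives convergence in measure of a difference -/
lemma tim_diff {f f' : ℕ → Ω → ℝ} {g : Ω → ℝ} (h : TendstoInMeasure μ f' atTop g) (hm : ∀ n, MemLp (fun ω => f n ω - f' n ω) 2 μ)
    (h2 : Tendsto (fun n => ∫ ω, (f n ω - f' n ω) ^ 2 ∂μ) atTop (𝓝 0)) : TendstoInMeasure μ f atTop g := by
  have h3 := tim_of_l2 (μ := μ) (f := fun n ω => f n ω - f' n ω) (g := fun _ => 0) hm (memLp_const 0) (by simpa using h2)
  have := tim_add h3 h
  simpa using this

lemma ae_eq_all {A B : ℝ → Ω → ℝ} (hA : ∀ ω, Continuous fun t => A t ω) (hB : ∀ ω, Continuous fun t => B t ω)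
    (h : ∀ t, 0 ≤ t → ∀ᵐ ω ∂μ, A t ω = B t ω) : ∀ᵐ ω ∂μ, ∀ t, 0 ≤ t → A t ω = B t ω := by
  have h1 : ∀ᵐ ω ∂μ, ∀ q : ℚ, A |(q:ℝ)| ω = B |(q:ℝ)| ω := ae_all_iff.2 fun q => h _ (abs_nonneg _)
  filter_upwards [h1] with ω hω t ht
  have := Continuous.ext_on (f := fun t : ℝ => A |t| ω) (g := fun t : ℝ => B |t| ω) (s := Set.range ((↑) : ℚ → ℝ)) Rat.denseRange_cast
    ((hA ω).comp continuous_abs) ((hB ω).comp continuous_abs) (by rintro _ ⟨q, rfl⟩; exact hω q)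
  have := congrFun this t
  simpa [abs_of_nonneg ht] using this

lemma joint_meas {Y : ℝ → Ω → ℝ} (hc : ∀ ω, Continuous fun t => Y t ω) (hm : ∀ t, 0 ≤ t → Measurable (Y t)) :
    Measurable (fun p : ℝ × Ω => Y (max p.1 0) p.2) := by
  refine measurable_uncurry_of_continuous_of_measurable (u := fun (s : ℝ) ω => Y (max s 0) ω) (fun ω => ?_) (fun s => hm _ (le_max_right _ _))
  exact (hc ω).comp (continuous_id.max continuous_const)

lemma ae_ne_zero {Y : ℝ → Ω → ℝ} (hc : ∀ ω, Continuous fun t => Y t ω) (hm : ∀ t, 0 ≤ t → Measurable (Y t))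
    (h0 : ∀ t, 0 < t → μ {ω | Y t ω = 0} = 0) (t : ℝ) : ∀ᵐ ω ∂μ, ∀ᵐ s ∂(volume.restrict (Set.Ioc 0 t)), Y s ω ≠ 0 := by
  have hj := joint_meas hc hm
  have hS : MeasurableSet {p : Ω × ℝ | Y (max p.2 0) p.1 ≠ 0} := by
    have : Measurable (fun p : Ω × ℝ => Y (max p.2 0) p.1) := hj.comp measurable_swap
    exact (measurableSet_eq_fun this measurable_const).compl
  have h1 : ∀ᵐ p ∂((volume.restrict (Set.Ioc 0 t)).prod μ), Y (max p.1 0) p.2 ≠ 0 := by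
    rw [Measure.ae_prod_iff_ae_ae]
    · filter_upwards [ae_restrict_mem measurableSet_Ioc] with s hs
      rw [max_eq_left hs.1.le, ae_iff]
      simpa using h0 s hs.1
    · exact (measurableSet_eq_fun hj measurable_const).compl
  have h2 : ∀ᵐ p ∂(μ.prod (volume.restrict (Set.Ioc 0 t))), Y (max p.2 0) p.1 ≠ 0 := by
    rw [← Measure.prod_swap]
    rw [ae_map_iff measurable_swap.aemeasurable hS]
    exact h1
  have h3 := Measure.ae_ae_of_ae_prod h2
  filter_upwards [h3] with ω hω
  filter_upwards [hω, ae_restrict_mem measurableSet_Ioc] with s h1 hs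
  rwa [max_eq_left hs.1.le] at h1

lemma psgn_tendsto {x : ℝ} (hx : x ≠ 0) : ∀ᶠ z in 𝓝 x, psgn z = psgn x := by
  rcases lt_or_gt_of_ne hx with h | h
  · filter_upwards [Iio_mem_nhds h] with z hz
    unfold psgn; rw [if_neg (not_lt.2 (le_of_lt hz)), if_neg (not_lt.2 h.le)]
  · filter_upwards [Ioi_mem_nhds h] with z hz
    unfold psgn; rw [if_pos (Set.mem_Ioi.1 hz), if_pos h]

/-- Riemann sums of the sign converge almost surely -/
lemma riem {Y : ℝ → Ω → ℝ} (hc : ∀ ω, Continuous fun t => Y t ω) (hm : ∀ t, 0 ≤ t → Measurable (Y t))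
    (h0 : ∀ t, 0 < t → μ {ω | Y t ω = 0} = 0) {t : ℝ} (ht : 0 < t) :
    ∀ᵐ ω ∂μ, Tendsto (fun n : ℕ => ∑ i ∈ Finset.range (2 ^ n), (t / 2 ^ n) * psgn (Y (t * i / 2 ^ n) ω)) atTop
      (𝓝 (∫ s in (0:ℝ)..t, psgn (Y s ω))) := by
  filter_upwards [ae_ne_zero hc hm h0 t] with ω hω
  have e : ∀ n : ℕ, ∑ i ∈ Finset.range (2 ^ n), (t / 2 ^ n) * psgn (Y (t * i / 2 ^ n) ω) = ∫ s in (0:ℝ)..t, psgn (Y (gr t n s) ω) :=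
    fun n => (step_int ht n (fun s => psgn (Y s ω))).symm
  simp only [e]
  refine intervalIntegral.tendsto_integral_filter_of_dominated_convergence (fun _ => 1) ?_ ?_ (by simp) ?_
  · exact Eventually.of_forall fun n => (gr_meas t n (fun s => psgn (Y s ω))).aestronglyMeasurable
  · refine Eventually.of_forall fun n => ae_of_all _ fun s _ => ?_
    rcases psgn_pm (Y (gr t n s) ω) with e | e <;> simp [e]
  · rw [ae_restrict_iff' measurableSet_Ioc] at hω
    filter_upwards [hω] with s hs hs'
    rw [Set.uIoc_of_le ht.le] at hs'
    have h1 := ((hc ω).tendsto s).comp (gr_tendsto ht hs'.1.le)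
    exact (tendsto_const_nhds.congr' ((h1.eventually (psgn_tendsto (hs hs'))).mono fun n hn => hn.symm))
end

namespace Dat
variable {μ : Measure Ω} [IsProbabilityMeasure μ] {D : Dat Ω} {G : ℝ → MeasurableSpace Ω} {T : ℝ}

lemma eM_cl (P : D.P) (hB : PBM μ G D.U1 D.U2 T) {d s t : ℝ} (hd : 0 < d) (hs : 0 ≤ s) (hst : s ≤ t) (ht : t ≤ T) :
    CL (G s) μ (fun ω => D.α1 * (D.U1 t ω - D.U1 s ω) + D.α2 * (D.U2 t ω - D.U2 s ω) + D.β1 * (D.eJ1 d t ω - D.eJ1 d s ω) + D.β2 * (D.eJ2 d t ω - D.eJ2 d s ω)) (gam (t - s)) := by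
  obtain ⟨τ, N, j, h, hj, rfl, rfl⟩ := exists_fine hd hs hst
  have hi := ginc hB h ht
  have hp := gp_sgn hB hd h ht
  have h2 : ∀ k < N, ∀ ω, (D.α1 + D.β1 * D.gp d τ k ω) ^ 2 + (D.α2 + D.β2 * D.gp d τ k ω) ^ 2 = 1 := fun k hk ω => by
    have := P.ab; have := P.nrm
    rcases hp.pm k hk ω with e | e <;> rw [e] <;> nlinarith
  have m1 : ∀ a b : ℝ, ∀ k < N, Measurable[G (τ k)] (fun ω => a + b * D.gp d τ k ω) := fun a b k hk => ((hp.meas k hk).const_mul b).const_add a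
  have ho := hi.orth (a := fun k ω => D.α1 + D.β1 * D.gp d τ k ω) (b := fun k ω => D.α2 + D.β2 * D.gp d τ k ω)
    (c := fun k ω => -(D.α2 + D.β2 * D.gp d τ k ω)) (d := fun k ω => D.α1 + D.β1 * D.gp d τ k ω)
    (m1 _ _) (m1 _ _) (fun k hk => (m1 _ _ k hk).neg) (m1 _ _) h2
    (fun k hk ω => by rw [← h2 k hk ω]; ring) (fun k hk ω => by ring)
  obtain ⟨l, rfl⟩ := Nat.exists_eq_add_of_le hj
  have hl := (ho.sumLaw j l le_rfl).comp' (hB.le _) (f := Prod.fst) measurable_fst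
  have e : ∀ τ : ℕ → ℝ, ∑ k ∈ Finset.range l, (τ (j + k + 1) - τ (j + k)) = τ (j + l) - τ j := fun τ => by
    have := Finset.sum_range_sub (fun k => τ (j + k)) l
    simpa [add_assoc] using this
  rw [e τ, gam2_fst] at hl
  convert hl using 2 with ω
  unfold eJ1 eJ2
  rw [eS_sum h hd _ _ j l le_rfl, eS_sum h hd _ _ j l le_rfl, ← e (fun k => D.U1 (τ k) ω), ← e (fun k => D.U2 (τ k) ω)]
  simp only [Finset.mul_sum, ← Finset.sum_add_distrib]
  exact Finset.sum_congr rfl fun k _ => by simp only [gp, gx1, gx2]; ring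
end Dat
end

section
namespace Dat
variable {μ : Measure Ω} [IsProbabilityMeasure μ] {D : Dat Ω} {K J1 J2 : ℝ → Ω → ℝ}

structure Lim (D : Dat Ω) (μ : Measure Ω) (K J1 J2 : ℝ → Ω → ℝ) : Prop where
  P : D.P
  hB : ∀ T, PBM μ (GG μ D.U1 D.U2) D.U1 D.U2 T
  cU1 : ∀ ω, Continuous (fun t => D.U1 t ω)
  cU2 : ∀ ω, Continuous (fun t => D.U2 t ω)
  cont : ∀ ω, Continuous (fun t => K t ω) ∧ Continuous (fun t => J1 t ω) ∧ Continuous (fun t => J2 t ω)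
  meas : ∀ t, 0 ≤ t → Measurable[GG μ D.U1 D.U2 t] (K t) ∧ Measurable[GG μ D.U1 D.U2 t] (J1 t) ∧ Measurable[GG μ D.U1 D.U2 t] (J2 t)
  mem : ∀ t, 0 ≤ t → MemLp (K t) 2 μ ∧ MemLp (J1 t) 2 μ ∧ MemLp (J2 t) 2 μ
  lim : ∀ T ε : ℝ, 0 ≤ T → 0 < ε → ∃ d0 : ℝ, 0 < d0 ∧ ∀ d s : ℝ, 0 < d → d ≤ d0 → 0 ≤ s → s ≤ T →
        ∫ ω, (D.eK d s ω - K s ω) ^ 2 ∂μ ≤ ε ∧ ∫ ω, (D.eJ1 d s ω - J1 s ω) ^ 2 ∂μ ≤ ε ∧ ∫ ω, (D.eJ2 d s ω - J2 s ω) ^ 2 ∂μ ≤ ε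

lemma Lim.Ymeas (L : Lim D μ K J1 J2) {t : ℝ} (ht : 0 ≤ t) : Measurable[GG μ D.U1 D.U2 t] (D.Yl K J1 J2 t) := by
  obtain ⟨a, b, c⟩ := L.meas t ht
  have u1 := (L.hB t).m1 t ht le_rfl
  have u2 := (L.hB t).m2 t ht le_rfl
  have v1 := ((L.hB t).m1 0 le_rfl ht).mono ((L.hB t).mono ht) le_rfl
  have v2 := ((L.hB t).m2 0 le_rfl ht).mono ((L.hB t).mono ht) le_rfl
  exact ((((measurable_const.sub (a.const_mul _)).add ((u1.sub v1).const_mul _)).add ((u2.sub v2).const_mul _)).add (b.const_mul _)).add (c.const_mul _)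

lemma Lim.Ycont (L : Lim D μ K J1 J2) (ω : Ω) : Continuous (fun t => D.Yl K J1 J2 t ω) := by
  obtain ⟨a, b, c⟩ := L.cont ω
  have := L.cU1 ω; have := L.cU2 ω
  unfold Yl; fun_prop

lemma seq_lim {f : ℕ → ℝ} {t : ℝ} (ht : 0 < t) (h0 : ∀ n, 0 ≤ f n) {C : ℝ} (hC : 0 < C)
    (h : ∀ ε, 0 < ε → ∃ d0 : ℝ, 0 < d0 ∧ ∀ n : ℕ, t / 2 ^ n ≤ d0 → f n ≤ C * ε) : Tendsto f atTop (𝓝 0) := by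
  rw [Metric.tendsto_atTop]
  intro ε hε
  obtain ⟨d0, hd0, H⟩ := h (ε / (2 * C)) (by positivity)
  obtain ⟨N, hN⟩ := eventually_atTop.1 ((half_tendsto t).eventually (Iio_mem_nhds hd0))
  refine ⟨N, fun n hn => ?_⟩
  have h1 := H n (hN n hn).le
  rw [Real.dist_eq, sub_zero, abs_of_nonneg (h0 n)]
  have : C * (ε / (2 * C)) = ε / 2 := by field_simp
  linarith

lemma Lim.seq (L : Lim D μ K J1 J2) {t : ℝ} (ht : 0 < t) {r : ℕ → ℝ} (hr : ∀ n, 0 ≤ r n) {T : ℝ} (hrT : ∀ n, r n ≤ T) :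
    Tendsto (fun n : ℕ => ∫ ω, (D.eK (t / 2 ^ n) (r n) ω - K (r n) ω) ^ 2 ∂μ) atTop (𝓝 0) ∧
    Tendsto (fun n : ℕ => ∫ ω, (D.eJ1 (t / 2 ^ n) (r n) ω - J1 (r n) ω) ^ 2 ∂μ) atTop (𝓝 0) ∧
    Tendsto (fun n : ℕ => ∫ ω, (D.eJ2 (t / 2 ^ n) (r n) ω - J2 (r n) ω) ^ 2 ∂μ) atTop (𝓝 0) := by
  have hT : 0 ≤ T := (hr 0).trans (hrT 0)
  refine ⟨?_, ?_, ?_⟩ <;> refine seq_lim ht (fun n => integral_nonneg fun ω => sq_nonneg _) one_pos fun ε hε => ?_ <;>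
    obtain ⟨d0, h0, H⟩ := L.lim T ε hT hε <;> refine ⟨d0, h0, fun n hn => ?_⟩ <;> rw [one_mul] <;>
    have := H (t / 2 ^ n) (r n) (by positivity) hn (hr n) (hrT n)
  exacts [this.1, this.2.1, this.2.2]

lemma Lim.mems (L : Lim D μ K J1 J2) {d s : ℝ} (hd : 0 < d) (hs : 0 ≤ s) : MemLp (fun ω => D.eK d s ω - K s ω) 2 μ ∧
    MemLp (fun ω => D.eJ1 d s ω - J1 s ω) 2 μ ∧ MemLp (fun ω => D.eJ2 d s ω - J2 s ω) 2 μ := by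
  obtain ⟨a, b, c⟩ := eJ_memLp (D := D) (L.hB s) hd hs le_rfl
  obtain ⟨a', b', c'⟩ := L.mem s hs
  exact ⟨c.sub a', a.sub b', b.sub c'⟩

lemma Lim.diff (L : Lim D μ K J1 J2) {t : ℝ} (ht : 0 < t) {r : ℕ → ℝ} (hr : ∀ n, 0 ≤ r n) {T : ℝ} (hrT : ∀ n, r n ≤ T) :
    TendstoInMeasure μ (fun n ω => D.eK (t / 2 ^ n) (r n) ω - K (r n) ω) atTop (fun _ => 0) ∧
    TendstoInMeasure μ (fun n ω => D.eJ1 (t / 2 ^ n) (r n) ω - J1 (r n) ω) atTop (fun _ => 0) ∧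
    TendstoInMeasure μ (fun n ω => D.eJ2 (t / 2 ^ n) (r n) ω - J2 (r n) ω) atTop (fun _ => 0) := by
  obtain ⟨a, b, c⟩ := L.seq ht hr hrT
  have hm := fun n : ℕ => L.mems (d := t / 2 ^ n) (by positivity) (hr n)
  exact ⟨tim_of_l2 (fun n => (hm n).1) (memLp_const 0) (by simpa using a),
    tim_of_l2 (fun n => (hm n).2.1) (memLp_const 0) (by simpa using b),
    tim_of_l2 (fun n => (hm n).2.2) (memLp_const 0) (by simpa using c)⟩

lemma Lim.tims (L : Lim D μ K J1 J2) {t : ℝ} (ht : 0 < t) {s : ℝ} (hs : 0 ≤ s) :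
    TendstoInMeasure μ (fun n ω => D.eK (t / 2 ^ n) s ω) atTop (K s) ∧
    TendstoInMeasure μ (fun n ω => D.eJ1 (t / 2 ^ n) s ω) atTop (J1 s) ∧
    TendstoInMeasure μ (fun n ω => D.eJ2 (t / 2 ^ n) s ω) atTop (J2 s) := by
  obtain ⟨a, b, c⟩ := L.diff ht (r := fun _ => s) (fun _ => hs) (T := s) (fun _ => le_rfl)
  have a := tim_add a (tim_const (K s))
  have b := tim_add b (tim_const (J1 s))
  have c := tim_add c (tim_const (J2 s))
  simp only [sub_add_cancel, zero_add] at a b c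
  exact ⟨a, b, c⟩

lemma Lim.start (L : Lim D μ K J1 J2) : ∀ᵐ ω ∂μ, K 0 ω = 0 ∧ J1 0 ω = 0 ∧ J2 0 ω = 0 := by
  obtain ⟨a, b, c⟩ := L.tims one_pos le_rfl
  have a := tim_bound a (c := 0) (Eventually.of_forall fun n => ae_of_all _ fun ω => by rw [(eJ_zero _ ω).2.2]; simp)
  have b := tim_bound b (c := 0) (Eventually.of_forall fun n => ae_of_all _ fun ω => by rw [(eJ_zero _ ω).1]; simp)
  have c := tim_bound c (c := 0) (Eventually.of_forall fun n => ae_of_all _ fun ω => by rw [(eJ_zero _ ω).2.1]; simp)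
  filter_upwards [a, b, c] with ω a b c
  exact ⟨abs_nonpos_iff.1 a, abs_nonpos_iff.1 b, abs_nonpos_iff.1 c⟩

lemma Lim.Klip (L : Lim D μ K J1 J2) {s t : ℝ} (hs : 0 ≤ s) (hst : s ≤ t) : ∀ᵐ ω ∂μ, |K t ω - K s ω| ≤ t - s := by
  have a := (L.tims one_pos (hs.trans hst)).1
  have b := tim_cmul (-1) (L.tims one_pos hs).1
  have c := tim_add a b
  have := tim_bound c (c := t - s) (Eventually.of_forall fun n => ae_of_all _ fun ω => by
    have := eK_lip (D := D) (d := 1 / 2 ^ n) (by positivity) hs hst ω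
    simpa [sub_eq_add_neg] using this)
  simpa [sub_eq_add_neg] using this

lemma Lim.zero (L : Lim D μ K J1 J2) {t : ℝ} (ht : 0 < t) : μ {ω | D.Yl K J1 J2 t ω = 0} = 0 := by
  refine zero_of_small L.P.lam0 ht fun v hv hvt _ => ?_
  obtain ⟨s, rfl⟩ : ∃ s, v = t - s := ⟨t - v, by ring⟩
  have hs : 0 ≤ s := by linarith
  have hst : s ≤ t := by linarith
  have key := small_ball (𝒢 := GG μ D.U1 D.U2 s) (μ := μ) (GG_le _ _ _ s) (v := t - s) (r := (D.lam + 1) * (t - s)) hv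
    (by have := L.P.lam0; positivity)
    (B := fun n ω => D.α1 * (D.U1 t ω - D.U1 s ω) + D.α2 * (D.U2 t ω - D.U2 s ω) + D.β1 * (D.eJ1 (1 / 2 ^ n) t ω - D.eJ1 (1 / 2 ^ n) s ω) + D.β2 * (D.eJ2 (1 / 2 ^ n) t ω - D.eJ2 (1 / 2 ^ n) s ω))
    (C := fun _ => D.Yl K J1 J2 s) (Z := fun ω => D.Yl K J1 J2 t ω + D.lam * (K t ω - K s ω))
    (fun n => eM_cl L.P (L.hB t) (by positivity) hs hst le_rfl) (fun _ => L.Ymeas hs) (by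
      obtain ⟨-, b, c⟩ := L.tims one_pos (hs.trans hst)
      obtain ⟨-, b', c'⟩ := L.tims one_pos hs
      have := tim_add (tim_const (fun ω => D.Yl K J1 J2 s ω + (D.α1 * (D.U1 t ω - D.U1 s ω) + D.α2 * (D.U2 t ω - D.U2 s ω))))
        (tim_add (tim_cmul D.β1 (tim_add b (tim_cmul (-1) b'))) (tim_cmul D.β2 (tim_add c (tim_cmul (-1) c'))))
      refine this.congr (fun n => ae_of_all _ fun ω => ?_) (ae_of_all _ fun ω => ?_)
      · simp only; ring
      · simp only [Yl]; ring)
  refine le_trans (measure_mono_ae ?_) key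
  filter_upwards [L.Klip hs hst] with ω h1 h2
  change D.Yl K J1 J2 t ω = 0 at h2
  change |D.Yl K J1 J2 t ω + D.lam * (K t ω - K s ω)| ≤ _
  rw [h2, zero_add, abs_mul, abs_of_nonneg L.P.lam0]
  have := L.P.lam0
  nlinarith [mul_le_mul_of_nonneg_left h1 L.P.lam0]

lemma Lim.eZ_tim (L : Lim D μ K J1 J2) {t : ℝ} (ht : 0 < t) {s : ℝ} (hs : 0 ≤ s) :
    TendstoInMeasure μ (fun n ω => D.eZ (t / 2 ^ n) (gr t n s) ω) atTop (D.Yl K J1 J2 s) := by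
  obtain ⟨a, b, c⟩ := L.diff ht (r := fun n => gr t n s) (fun n => gr_nonneg ht n s) (T := s) (fun n => gr_le ht n hs)
  have hY : TendstoInMeasure μ (fun n => D.Yl K J1 J2 (gr t n s)) atTop (D.Yl K J1 J2 s) :=
    tendstoInMeasure_of_tendsto_ae (fun n => ((L.Ymeas (gr_nonneg ht n s)).mono (GG_le _ _ _ _) le_rfl).aestronglyMeasurable)
      (ae_of_all _ fun ω => ((L.Ycont ω).tendsto s).comp (gr_tendsto ht hs))
  have := tim_add hY (tim_add (tim_cmul (-D.lam) a) (tim_add (tim_cmul D.β1 b) (tim_cmul D.β2 c)))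
  refine this.congr (fun n => ae_of_all _ fun ω => ?_) (ae_of_all _ fun ω => ?_)
  · simp only [Yl, eZ]; ring
  · simp

lemma Lim.Y_tim (L : Lim D μ K J1 J2) {t : ℝ} (ht : 0 < t) {s : ℝ} (hs : 0 ≤ s) :
    TendstoInMeasure μ (fun n ω => D.Yl K J1 J2 (gr t n s) ω) atTop (D.Yl K J1 J2 s) :=
  tendstoInMeasure_of_tendsto_ae (fun n => ((L.Ymeas (gr_nonneg ht n s)).mono (GG_le _ _ _ _) le_rfl).aestronglyMeasurable)
      (ae_of_all _ fun ω => ((L.Ycont ω).tendsto s).comp (gr_tendsto ht hs))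

lemma Lim.mism (L : Lim D μ K J1 J2) {t : ℝ} (ht : 0 < t) :
    Tendsto (fun n : ℕ => ∑ i ∈ Finset.range (2 ^ n), (t / 2 ^ n) * μ.real {ω | psgn (D.Yl K J1 J2 (t * i / 2 ^ n) ω) ≠ psgn (D.eZ (t / 2 ^ n) (t * i / 2 ^ n) ω)}) atTop (𝓝 0) := by
  have e := fun n : ℕ => step_int ht n (fun s => μ.real {ω | psgn (D.Yl K J1 J2 s ω) ≠ psgn (D.eZ (t / 2 ^ n) s ω)})
  simp only [← e]
  refine dct01 ht.le (fun n => (gr_meas t n (fun s => μ.real {ω | psgn (D.Yl K J1 J2 s ω) ≠ psgn (D.eZ (t / 2 ^ n) s ω)})).aestronglyMeasurable) (fun n s => ?_) fun s hs hst => ?_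
  · rw [abs_of_nonneg measureReal_nonneg]; exact measureReal_le_one
  · have h1 := psgn_conv ((L.Ymeas hs.le).mono (GG_le _ _ _ _) le_rfl) (L.eZ_tim ht hs.le) (L.zero hs)
    have h2 := psgn_conv ((L.Ymeas hs.le).mono (GG_le _ _ _ _) le_rfl) (L.Y_tim ht hs.le) (L.zero hs)
    have h3 := h2.add h1
    rw [add_zero] at h3
    exact tendsto_of_tendsto_of_tendsto_of_le_of_le tendsto_const_nhds h3 (fun _ => measureReal_nonneg) (fun n => ne_tri)
end Dat
end

section
namespace Dat
variable {μ : Measure Ω} [IsProbabilityMeasure μ] {D : Dat Ω} {K J1 J2 : ℝ → Ω → ℝ}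

lemma grid_pt (t : ℝ) (n k : ℕ) : (k : ℝ) * (t / 2 ^ n) = t * k / 2 ^ n := by ring

lemma eS_dy {t : ℝ} (ht : 0 < t) (n : ℕ) (p : ℕ → ℝ) (V : ℝ → ℝ) :
    eS p (t / 2 ^ n) V t = ∑ i ∈ Finset.range (2 ^ n), p i * (V (t * (i + 1) / 2 ^ n) - V (t * i / 2 ^ n)) := by
  have hd : 0 < t / 2 ^ n := by positivity
  have := eS_sum0 (fine_unif hd (2 ^ n)) hd p V (le_refl (2 ^ n))
  have e : ∀ k : ℕ, ⌊(k : ℝ) * (t / 2 ^ n) / (t / 2 ^ n)⌋₊ = k := fun k => by rw [mul_div_assoc, div_self hd.ne', mul_one, Nat.floor_natCast]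
  simp only [e] at this
  simp only [grid_pt] at this
  push_cast at this
  rw [mul_div_assoc t, div_self (by positivity : (2:ℝ) ^ n ≠ 0), mul_one] at this
  rw [this]

lemma ep_dy {t : ℝ} (ht : 0 < t) (n k : ℕ) (ω : Ω) : D.ep (t / 2 ^ n) k ω = psgn (D.eZ (t / 2 ^ n) (t * k / 2 ^ n) ω) := by
  rw [ep, ez_eq D (by positivity), grid_pt]

lemma Lim.si (L : Lim D μ K J1 J2) {t : ℝ} (ht : 0 < t) :
    TendstoInMeasure μ (fun n => rsum (fun s ω => psgn (D.Yl K J1 J2 s ω)) D.U1 t n) atTop (J1 t) ∧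
    TendstoInMeasure μ (fun n => rsum (fun s ω => psgn (D.Yl K J1 J2 s ω)) D.U2 t n) atTop (J2 t) := by
  have hd : ∀ n : ℕ, 0 < t / 2 ^ n := fun n => by positivity
  have hk : ∀ n k : ℕ, k < 2 ^ n → t * k / 2 ^ n ≤ t := fun n k h => by
    rw [div_le_iff₀ (by positivity)]
    have : (k:ℝ) ≤ 2 ^ n := by exact_mod_cast h.le
    gcongr
  have hN : ∀ n : ℕ, ((2 ^ n : ℕ) : ℝ) * (t / 2 ^ n) ≤ t := fun n => by push_cast; exact le_of_eq (by field_simp)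
  have hi := fun n : ℕ => ginc (D := D) (L.hB t) (fine_unif (hd n) (2 ^ n)) (hN n)
  simp only [grid_pt] at hi
  have hΔ : ∀ n k : ℕ, t * (k + 1 : ℕ) / 2 ^ n - t * k / 2 ^ n = t / 2 ^ n := fun n k => by push_cast; ring
  simp only [hΔ] at hi
  let a : ℕ → ℕ → Ω → ℝ := fun n k ω => psgn (D.Yl K J1 J2 (t * k / 2 ^ n) ω) - psgn (D.eZ (t / 2 ^ n) (t * k / 2 ^ n) ω)
  have nn : ∀ n k : ℕ, 0 ≤ t * k / 2 ^ n := fun n k => by positivity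
  have mY : ∀ n k : ℕ, Measurable[GG μ D.U1 D.U2 (t * k / 2 ^ n)] (fun ω => psgn (D.Yl K J1 J2 (t * k / 2 ^ n) ω)) := fun n k =>
    psgn_meas.comp (L.Ymeas (nn n k))
  have mZ : ∀ n k : ℕ, Measurable[GG μ D.U1 D.U2 (t * k / 2 ^ n)] (fun ω => psgn (D.eZ (t / 2 ^ n) (t * k / 2 ^ n) ω)) := fun n k =>
    psgn_meas.comp (eZ_meas (L.hB _) (hd n) (nn n k) le_rfl)
  have ma : ∀ n k : ℕ, Measurable[GG μ D.U1 D.U2 (t * k / 2 ^ n)] (a n k) := fun n k => (mY n k).sub (mZ n k)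
  have ba : ∀ n k ω, |a n k ω| ≤ 2 := fun n k ω => by
    rcases psgn_pm (D.Yl K J1 J2 (t * k / 2 ^ n) ω) with e | e <;> rcases psgn_pm (D.eZ (t / 2 ^ n) (t * k / 2 ^ n) ω) with e' | e' <;> simp only [a, e, e'] <;> norm_num
  have sq : ∀ n k : ℕ, ∫ ω, a n k ω ^ 2 ∂μ = 4 * μ.real {ω | psgn (D.Yl K J1 J2 (t * k / 2 ^ n) ω) ≠ psgn (D.eZ (t / 2 ^ n) (t * k / 2 ^ n) ω)} := fun n k =>
    (sq_ne_int ((mY n k).mono (GG_le _ _ _ _) le_rfl) ((mZ n k).mono (GG_le _ _ _ _) le_rfl) (fun ω => psgn_pm _) (fun ω => psgn_pm _)).1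
  have hlim : Tendsto (fun n : ℕ => ∑ i ∈ Finset.range (2 ^ n), (t / 2 ^ n) * ∫ ω, a n i ω ^ 2 ∂μ) atTop (𝓝 0) := by
    have := (L.mism ht).const_mul 4
    rw [mul_zero] at this
    refine this.congr fun n => ?_
    rw [Finset.mul_sum]
    exact Finset.sum_congr rfl fun i _ => by rw [sq]; ring
  obtain ⟨-, b1, b2⟩ := L.tims ht ht.le
  have z1 : ∀ n : ℕ, ∀ k < 2 ^ n, ∀ ω : Ω, |(0:ℝ)| ≤ 2 := fun _ _ _ _ => by simp
  have e1 : ∀ n ω, rsum (fun s ω => psgn (D.Yl K J1 J2 s ω)) D.U1 t n ω - D.eJ1 (t / 2 ^ n) t ω =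
      ∑ k ∈ Finset.range (2 ^ n), (a n k ω * D.gx1 (fun k => t * k / 2 ^ n) k ω + 0 * D.gx2 (fun k => t * k / 2 ^ n) k ω) := fun n ω => by
    rw [eJ1, eS_dy ht, rsum, ← Finset.sum_sub_distrib]
    refine Finset.sum_congr rfl fun i _ => ?_
    simp only [ep_dy ht, a, gx1]; push_cast; ring
  have e2 : ∀ n ω, rsum (fun s ω => psgn (D.Yl K J1 J2 s ω)) D.U2 t n ω - D.eJ2 (t / 2 ^ n) t ω =
      ∑ k ∈ Finset.range (2 ^ n), (0 * D.gx1 (fun k => t * k / 2 ^ n) k ω + a n k ω * D.gx2 (fun k => t * k / 2 ^ n) k ω) := fun n ω => by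
    rw [eJ2, eS_dy ht, rsum, ← Finset.sum_sub_distrib]
    refine Finset.sum_congr rfl fun i _ => ?_
    simp only [ep_dy ht, a, gx2]; push_cast; ring
  constructor
  · refine tim_diff b1 (fun n => ?_) ?_
    · simp only [e1]
      exact (hi n).memLpSum (a := a n) (b := fun _ _ => 0) (fun k _ => ma n k) (fun _ _ => measurable_const) (fun k _ => ba n k) (z1 n) le_rfl
    · refine hlim.congr fun n => ?_
      simp only [e1]
      rw [(hi n).isometry (a := a n) (b := fun _ _ => 0) (fun k _ => ma n k) (fun _ _ => measurable_const) (fun k _ => ba n k) (z1 n) le_rfl]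
      simp
  · refine tim_diff b2 (fun n => ?_) ?_
    · simp only [e2]
      exact (hi n).memLpSum (a := fun _ _ => 0) (b := a n) (fun _ _ => measurable_const) (fun k _ => ma n k) (z1 n) (fun k _ => ba n k) le_rfl
    · refine hlim.congr fun n => ?_
      simp only [e2]
      rw [(hi n).isometry (a := fun _ _ => 0) (b := a n) (fun _ _ => measurable_const) (fun k _ => ma n k) (z1 n) (fun k _ => ba n k) le_rfl]
      simp

lemma Lim.K_eq (L : Lim D μ K J1 J2) {t : ℝ} (ht : 0 < t) : ∀ᵐ ω ∂μ, K t ω = ∫ s in (0:ℝ)..t, psgn (D.Yl K J1 J2 s ω) := by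
  have hd : ∀ n : ℕ, 0 < t / 2 ^ n := fun n => by positivity
  have nn : ∀ n k : ℕ, 0 ≤ t * k / 2 ^ n := fun n k => by positivity
  have mY : ∀ n k : ℕ, Measurable (fun ω => psgn (D.Yl K J1 J2 (t * k / 2 ^ n) ω)) := fun n k =>
    (psgn_meas.comp (L.Ymeas (nn n k))).mono (GG_le _ _ _ _) le_rfl
  have mZ : ∀ n k : ℕ, Measurable (fun ω => psgn (D.eZ (t / 2 ^ n) (t * k / 2 ^ n) ω)) := fun n k =>
    (psgn_meas.comp (eZ_meas (L.hB _) (hd n) (nn n k) le_rfl)).mono (GG_le _ _ _ _) le_rfl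
  have h1 : TendstoInMeasure μ (fun (n : ℕ) ω => ∑ i ∈ Finset.range (2 ^ n), (t / 2 ^ n) * psgn (D.Yl K J1 J2 (t * i / 2 ^ n) ω)) atTop
      (fun ω => ∫ s in (0:ℝ)..t, psgn (D.Yl K J1 J2 s ω)) :=
    tendstoInMeasure_of_tendsto_ae (fun n => (Finset.measurable_fun_sum _ fun i _ => (mY n i).const_mul _).aestronglyMeasurable)
      (riem L.Ycont (fun s hs => (L.Ymeas hs).mono (GG_le _ _ _ _) le_rfl) (fun s hs => L.zero hs) ht)
  have h2 : TendstoInMeasure μ (fun (n : ℕ) ω => ∑ i ∈ Finset.range (2 ^ n), (t / 2 ^ n) * (psgn (D.Yl K J1 J2 (t * i / 2 ^ n) ω) - psgn (D.eZ (t / 2 ^ n) (t * i / 2 ^ n) ω))) atTop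
      (fun ω => 0) := by
    refine tendstoInMeasure_of_tendsto_eLpNorm (p := 1) (by norm_num) (fun n => (Finset.measurable_fun_sum _ fun i _ => ((mY n i).sub (mZ n i)).const_mul _).aestronglyMeasurable) aestronglyMeasurable_const ?_
    have hl := ENNReal.tendsto_ofReal ((L.mism ht).const_mul 2)
    simp only [mul_zero, ENNReal.ofReal_zero] at hl
    refine tendsto_of_tendsto_of_tendsto_of_le_of_le tendsto_const_nhds hl (fun _ => zero_le) fun n => ?_
    have bd : ∀ i ω, |psgn (D.Yl K J1 J2 (t * (i:ℕ) / 2 ^ n) ω) - psgn (D.eZ (t / 2 ^ n) (t * i / 2 ^ n) ω)| ≤ 2 := fun k ω => by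
      rcases psgn_pm (D.Yl K J1 J2 (t * k / 2 ^ n) ω) with e | e <;> rcases psgn_pm (D.eZ (t / 2 ^ n) (t * k / 2 ^ n) ω) with e' | e' <;> simp only [e, e'] <;> norm_num
    have ii : ∀ i : ℕ, Integrable (fun ω => |psgn (D.Yl K J1 J2 (t * i / 2 ^ n) ω) - psgn (D.eZ (t / 2 ^ n) (t * i / 2 ^ n) ω)|) μ := fun i =>
      Integrable.of_bound ((mY n i).sub (mZ n i)).abs.aestronglyMeasurable 2 (ae_of_all _ fun ω => by
        rw [Real.norm_eq_abs, abs_abs]; exact bd i ω)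
    have si : Integrable (fun ω => ∑ i ∈ Finset.range (2 ^ n), (t / 2 ^ n) * |psgn (D.Yl K J1 J2 (t * i / 2 ^ n) ω) - psgn (D.eZ (t / 2 ^ n) (t * i / 2 ^ n) ω)|) μ :=
      integrable_finset_sum _ fun i _ => (ii i).const_mul _
    have e : ∫ ω, ∑ i ∈ Finset.range (2 ^ n), (t / 2 ^ n) * |psgn (D.Yl K J1 J2 (t * i / 2 ^ n) ω) - psgn (D.eZ (t / 2 ^ n) (t * i / 2 ^ n) ω)| ∂μ =
        2 * ∑ i ∈ Finset.range (2 ^ n), (t / 2 ^ n) * μ.real {ω | psgn (D.Yl K J1 J2 (t * i / 2 ^ n) ω) ≠ psgn (D.eZ (t / 2 ^ n) (t * i / 2 ^ n) ω)} := by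
      rw [integral_finset_sum _ fun i _ => (ii i).const_mul _, Finset.mul_sum]
      refine Finset.sum_congr rfl fun i _ => ?_
      rw [integral_const_mul, (sq_ne_int (mY n i) (mZ n i) (fun ω => psgn_pm _) (fun ω => psgn_pm _)).2]; ring
    rw [← e, eLpNorm_one_eq_lintegral_enorm, ofReal_integral_eq_lintegral_ofReal si (ae_of_all _ fun ω => Finset.sum_nonneg fun i _ => by have := hd n; positivity)]
    refine lintegral_mono fun ω => ?_
    simp only [Pi.sub_apply, sub_zero]
    rw [← ofReal_norm_eq_enorm, Real.norm_eq_abs]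
    refine ENNReal.ofReal_le_ofReal ((Finset.abs_sum_le_sum_abs _ _).trans (Finset.sum_le_sum fun i _ => ?_))
    rw [abs_mul, abs_of_pos (hd n)]
  have h3 := tim_add h1 (tim_cmul (-1) h2)
  have h4 : TendstoInMeasure μ (fun (n : ℕ) ω => D.eK (t / 2 ^ n) t ω) atTop (fun ω => ∫ s in (0:ℝ)..t, psgn (D.Yl K J1 J2 s ω)) := by
    refine h3.congr (fun n => ae_of_all _ fun ω => ?_) (ae_of_all _ fun ω => by simp)
    simp only
    rw [eK, eS_dy ht, Finset.mul_sum, ← Finset.sum_add_distrib]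
    refine Finset.sum_congr rfl fun i _ => ?_
    simp only [ep_dy ht, id]; ring
  exact tendstoInMeasure_ae_unique (L.tims ht ht.le).1 h4

lemma Lim.K_all (L : Lim D μ K J1 J2) : ∀ᵐ ω ∂μ, ∀ t, 0 ≤ t → K t ω = ∫ s in (0:ℝ)..t, psgn (D.Yl K J1 J2 s ω) := by
  refine ae_eq_all (fun ω => (L.cont ω).1) (fun ω => ?_) fun t ht => ?_
  · refine intervalIntegral.continuous_primitive (fun a b => ?_) 0
    refine (intervalIntegrable_const (c := (1:ℝ))).mono_fun ?_ (ae_of_all _ fun s => ?_)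
    · exact (psgn_meas.comp (L.Ycont ω).measurable).aestronglyMeasurable
    · rcases psgn_pm (D.Yl K J1 J2 s ω) with e | e <;> simp [e]
  · rcases ht.eq_or_lt with rfl | h
    · filter_upwards [L.start] with ω h; simp [h.1]
    · exact L.K_eq h
end Dat
end

section

lemma if_psgn (a b p q : ℝ) : (if a ≤ b then q else p) = (p + q) / 2 + (p - q) / 2 * psgn (a - b) := by
  unfold psgn
  by_cases h : a ≤ b
  · rw [if_pos h, if_neg (by linarith)]; ring
  · rw [if_neg h, if_pos (by linarith [not_le.1 h])]; ring

lemma rsum_aff (a b : ℝ) (ψ U : ℝ → Ω → ℝ) (t : ℝ) (n : ℕ) (ω : Ω) :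
    rsum (fun s ω => a + b * ψ s ω) U t n ω = a * (U t ω - U 0 ω) + b * rsum ψ U t n ω := by
  unfold rsum
  have h := Finset.sum_range_sub (fun k : ℕ => U (t * k / 2 ^ n) ω) (2 ^ n)
  push_cast at h
  rw [mul_div_assoc t, div_self (by positivity : (2:ℝ) ^ n ≠ 0), mul_one, mul_zero, zero_div] at h
  rw [← h, Finset.mul_sum, Finset.mul_sum, ← Finset.sum_add_distrib]
  exact Finset.sum_congr rfl fun i _ => by ring

lemma rsum_zero (H U : ℝ → Ω → ℝ) (n : ℕ) (ω : Ω) : rsum H U 0 n ω = 0 := by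
  unfold rsum; simp

/-- entries of a square root -/
lemma sq_entries {a b : ℝ} {S : Matrix (Fin 2) (Fin 2) ℝ} (h : S * S.transpose = Matrix.diagonal ![a, b]) :
    S 0 0 ^ 2 + S 0 1 ^ 2 = a ∧ S 1 0 ^ 2 + S 1 1 ^ 2 = b ∧ S 0 0 * S 1 0 + S 0 1 * S 1 1 = 0 := by
  have h00 := congrFun (congrFun h 0) 0
  have h11 := congrFun (congrFun h 1) 1
  have h01 := congrFun (congrFun h 0) 1
  simp [Matrix.mul_apply, Fin.sum_univ_two, Matrix.diagonal] at h00 h11 h01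
  exact ⟨by linarith, by linarith, h01⟩

lemma Dat.Lim.row {μ : Measure Ω} [IsProbabilityMeasure μ] {D : Dat Ω} {K J1 J2 : ℝ → Ω → ℝ} (L : Dat.Lim D μ K J1 J2)
    (a1 b1 a2 b2 : ℝ) {H1 H2 I : ℝ → Ω → ℝ} (h1 : H1 = fun s ω => a1 + b1 * psgn (D.Yl K J1 J2 s ω))
    (h2 : H2 = fun s ω => a2 + b2 * psgn (D.Yl K J1 J2 s ω))
    (hI : I = fun t ω => a1 * (D.U1 t ω - D.U1 0 ω) + a2 * (D.U2 t ω - D.U2 0 ω) + b1 * J1 t ω + b2 * J2 t ω) :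
    IsSI2 μ H1 D.U1 H2 D.U2 I := by
  have hi : ∀ᵐ ω ∂μ, I 0 ω = 0 := by
    filter_upwards [L.start] with ω h
    subst hI; simp [h.2.1, h.2.2]
  refine ⟨hi, fun t ht => ?_⟩
  rcases ht.eq_or_lt with rfl | ht
  · refine (tim_const (μ := μ) (fun _ => (0:ℝ))).congr (fun n => ae_of_all _ fun ω => by simp [rsum_zero]) ?_
    filter_upwards [hi] with ω h; exact h.symm
  · obtain ⟨s1, s2⟩ := L.si ht
    have := tim_add (tim_const (μ := μ) (fun ω => a1 * (D.U1 t ω - D.U1 0 ω) + a2 * (D.U2 t ω - D.U2 0 ω))) (tim_add (tim_cmul b1 s1) (tim_cmul b2 s2))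
    subst h1 h2 hI
    refine this.congr (fun n => ae_of_all _ fun ω => ?_) (ae_of_all _ fun ω => ?_)
    · simp only [rsum_aff]; ring
    · simp only; ring

theorem partB (g h ρ σ : ℝ) (hnorm : ρ ^ 2 + σ ^ 2 = 1) (hgh : 0 < g + h) (x₁ x₂ : ℝ)
    (Sp Sm : Matrix (Fin 2) (Fin 2) ℝ)
    (hSp : Sp * Sp.transpose = Matrix.diagonal ![ρ ^ 2, σ ^ 2])
    (hSm : Sm * Sm.transpose = Matrix.diagonal ![σ ^ 2, ρ ^ 2])
    (hne : ¬ ∀ j : Fin 2, Sm 0 j - Sm 1 j = -(Sp 0 j - Sp 1 j)) :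
    ∃ (Ω : Type) (mΩ : MeasurableSpace Ω) (μ : Measure Ω) (_ : IsProbabilityMeasure μ)
        (F : ℝ → MeasurableSpace Ω) (U₁ U₂ : ℝ → Ω → ℝ),
      IsPlanarBM μ F U₁ U₂ ∧
        ∃ X₁ X₂ : ℝ → Ω → ℝ, SolvesGen μ F g h Sp Sm x₁ x₂ U₁ U₂ X₁ X₂ ∧
            ∀ t : ℝ, 0 ≤ t →
              natFilt μ (fun s ω => (X₁ s ω, X₂ s ω)) t ≤
                natFilt μ (fun s ω => (U₁ s ω, U₂ s ω)) t := by
  obtain ⟨p0, p1, p01⟩ := sq_entries hSp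
  obtain ⟨q0, q1, q01⟩ := sq_entries hSm
  obtain ⟨Ω, mΩ, μ, hμ, U1, U2, cU, mU, hP, hB⟩ := exists_planar
  let D : Dat Ω := ⟨x₁ - x₂, g + h,
    (Sp 0 0 + Sm 0 0) / 2 - (Sp 1 0 + Sm 1 0) / 2, (Sp 0 1 + Sm 0 1) / 2 - (Sp 1 1 + Sm 1 1) / 2,
    (Sp 0 0 - Sm 0 0) / 2 - (Sp 1 0 - Sm 1 0) / 2, (Sp 0 1 - Sm 0 1) / 2 - (Sp 1 1 - Sm 1 1) / 2,
    U1, U2⟩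
  have DP : D.P := by
    refine ⟨hgh.le, ?_, ?_, ?_⟩ <;> simp only [D]
    · linarith
    · linarith
    · by_contra hc
      refine hne fun j => ?_
      have c1 : (Sp 0 0 + Sm 0 0) / 2 - (Sp 1 0 + Sm 1 0) / 2 = 0 := by nlinarith
      have c2 : (Sp 0 1 + Sm 0 1) / 2 - (Sp 1 1 + Sm 1 1) / 2 = 0 := by nlinarith
      fin_cases j
      · simp only [Fin.zero_eta]; linarith
      · simp only [Fin.mk_one]; linarith
  obtain ⟨K, J1, J2, hc, hm, hmem, hl⟩ := Dat.limit (D := D) (μ := μ) DP (fun T _ => hB T)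
  have L : Dat.Lim D μ K J1 J2 := ⟨DP, hB, fun ω => (cU ω).1, fun ω => (cU ω).2, hc, hm, hmem, hl⟩
  let I : Fin 2 → ℝ → Ω → ℝ := fun i t ω => (Sp i 0 + Sm i 0) / 2 * (U1 t ω - U1 0 ω) + (Sp i 1 + Sm i 1) / 2 * (U2 t ω - U2 0 ω)
    + (Sp i 0 - Sm i 0) / 2 * J1 t ω + (Sp i 1 - Sm i 1) / 2 * J2 t ω
  let X1 : ℝ → Ω → ℝ := fun t ω => x₁ + ((g - h) / 2 * t - (g + h) / 2 * K t ω) + I 0 t ω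
  let X2 : ℝ → Ω → ℝ := fun t ω => x₂ + ((g - h) / 2 * t + (g + h) / 2 * K t ω) + I 1 t ω
  have hY : ∀ t ω, X1 t ω - X2 t ω = D.Yl K J1 J2 t ω := fun t ω => by
    simp only [X1, X2, I, Dat.Yl, D]; ring
  have mI : ∀ i t, 0 ≤ t → Measurable[GG μ U1 U2 t] (I i t) := fun i t ht => by
    obtain ⟨a, b, c⟩ := hm t ht
    have u1 := (hB t).m1 t ht le_rfl
    have u2 := (hB t).m2 t ht le_rfl
    have v1 := ((hB t).m1 0 le_rfl ht).mono ((hB t).mono ht) le_rfl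
    have v2 := ((hB t).m2 0 le_rfl ht).mono ((hB t).mono ht) le_rfl
    exact ((((u1.sub v1).const_mul _).add ((u2.sub v2).const_mul _)).add (b.const_mul _)).add (c.const_mul _)
  have mX : ∀ t, 0 ≤ t → Measurable[GG μ U1 U2 t] (fun ω => (X1 t ω, X2 t ω)) := fun t ht => by
    obtain ⟨a, -, -⟩ := hm t ht
    have h1 : Measurable[GG μ U1 U2 t] (X1 t) := (measurable_const.add (measurable_const.sub (a.const_mul _))).add (mI 0 t ht)
    have h2 : Measurable[GG μ U1 U2 t] (X2 t) := (measurable_const.add (measurable_const.add (a.const_mul _))).add (mI 1 t ht)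
    exact h1.prodMk h2
  have cI : ∀ i ω, Continuous fun t => I i t ω := fun i ω => by
    obtain ⟨a, b, c⟩ := hc ω
    obtain ⟨d, e⟩ := cU ω
    simp only [I]; fun_prop
  have cif : ∀ p q : ℝ, (fun s ω => if X1 s ω ≤ X2 s ω then q else p) = fun s ω => (p + q) / 2 + (p - q) / 2 * psgn (D.Yl K J1 J2 s ω) := fun p q => by
    funext s ω; rw [if_psgn, hY]
  refine ⟨Ω, mΩ, μ, hμ, GG μ U1 U2, U1, U2, hP, X1, X2, ⟨fun t ht => (mX t ht).comap_le, ae_of_all _ fun ω => ?_, I 0, I 1, ?_, ?_, ?_⟩, fun t ht => ?_⟩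
  · have := (hc ω).1
    have i0 := cI 0 ω
    have i1 := cI 1 ω
    constructor
    · simp only [X1]; fun_prop
    · simp only [X2]; fun_prop
  · exact L.row _ _ _ _ (cif _ _) (cif _ _) rfl
  · exact L.row _ _ _ _ (cif _ _) (cif _ _) rfl
  · filter_upwards [L.K_all] with ω hK t ht
    have ci : ∀ p q : ℝ, ∫ s in (0:ℝ)..t, (if X1 s ω ≤ X2 s ω then q else p) = (p + q) / 2 * t + (p - q) / 2 * K t ω := fun p q => by
      have e : ∀ s, (if X1 s ω ≤ X2 s ω then q else p) = (p + q) / 2 + (p - q) / 2 * psgn (D.Yl K J1 J2 s ω) := fun s => congrFun (congrFun (cif p q) s) ω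
      simp only [e]
      have ii : IntervalIntegrable (fun s => psgn (D.Yl K J1 J2 s ω)) volume 0 t := by
        refine (intervalIntegrable_const (c := (1:ℝ))).mono_fun (psgn_meas.comp (L.Ycont ω).measurable).aestronglyMeasurable (ae_of_all _ fun s => ?_)
        rcases psgn_pm (D.Yl K J1 J2 s ω) with e | e <;> simp [e]
      rw [intervalIntegral.integral_add intervalIntegrable_const (ii.const_mul _), intervalIntegral.integral_const_mul, ← hK t ht]
      simp; ring
    rw [ci, ci]
    simp only [X1, X2]
    constructor <;> ring
  · refine sup_le (iSup₂_le fun s hs => ?_) le_sup_right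
    exact (mX s hs.1).comap_le.trans ((GG_mono μ U1 U2 hs.2).trans inf_le_left)
end

section

lemma block_sum {j : ℕ} (hj : 0 < j) (f g : ℕ → ℝ) (M : ℕ) :
    ∑ i ∈ Finset.range (j * M), f (i / j) * (g (i + 1) - g i) = ∑ q ∈ Finset.range M, f q * (g (j * (q + 1)) - g (j * q)) := by
  induction M with
  | zero => simp
  | succ M ih =>
    rw [Nat.mul_succ, Finset.sum_range_add, ih, Finset.sum_range_succ]
    congr 1
    have e : ∀ x ∈ Finset.range j, f ((j * M + x) / j) * (g (j * M + x + 1) - g (j * M + x)) = f M * (g (j * M + (x + 1)) - g (j * M + x)) := fun x hx => by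
      rw [Nat.mul_add_div hj, Nat.div_eq_of_lt (Finset.mem_range.1 hx), add_zero, add_assoc]
    rw [Finset.sum_congr rfl e, ← Finset.mul_sum, Finset.sum_range_sub (fun x => g (j * M + x))]
    rw [Nat.mul_succ, add_zero]

lemma Inc.diffsq {H : ℕ → MeasurableSpace Ω} {μ : Measure Ω} [IsProbabilityMeasure μ] {ξ η : ℕ → Ω → ℝ} {δ : ℝ} {N : ℕ}
    (h : Inc H μ ξ η (fun _ => δ) N) {p q : ℕ → Ω → ℝ} (hp : ∀ k < N, Measurable[H k] (p k)) (hq : ∀ k < N, Measurable[H k] (q k))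
    (p1 : ∀ k ω, p k ω = 1 ∨ p k ω = -1) (q1 : ∀ k ω, q k ω = 1 ∨ q k ω = -1) {K : ℕ} (hK : K ≤ N) :
    MemLp (fun ω => ∑ k ∈ Finset.range K, (p k ω - q k ω) * ξ k ω) 2 μ ∧
    ∫ ω, (∑ k ∈ Finset.range K, (p k ω - q k ω) * ξ k ω) ^ 2 ∂μ ≤ 4 * ∑ k ∈ Finset.range N, δ * μ.real {ω | p k ω ≠ q k ω} := by
  have ba : ∀ k < N, ∀ ω, |p k ω - q k ω| ≤ 2 := fun k _ ω => by
    rcases p1 k ω with e | e <;> rcases q1 k ω with e' | e' <;> rw [e, e'] <;> norm_num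
  have ma : ∀ k < N, Measurable[H k] (fun ω => p k ω - q k ω) := fun k hk => (hp k hk).sub (hq k hk)
  have e : ∀ ω, ∑ k ∈ Finset.range K, (p k ω - q k ω) * ξ k ω = ∑ k ∈ Finset.range K, ((p k ω - q k ω) * ξ k ω + 0 * η k ω) := fun ω => by simp
  simp only [e]
  refine ⟨h.memLpSum (a := fun k ω => p k ω - q k ω) (b := fun _ _ => 0) ma (fun _ _ => measurable_const) ba (fun _ _ _ => by simp) hK, ?_⟩
  rw [h.isometry (a := fun k ω => p k ω - q k ω) (b := fun _ _ => 0) ma (fun _ _ => measurable_const) ba (fun _ _ _ => by simp) hK, Finset.mul_sum]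
  have nn : ∀ k, 0 ≤ 4 * (δ * μ.real {ω | p k ω ≠ q k ω}) := fun k => by have := h.pos 0; positivity
  refine le_trans (le_of_eq (Finset.sum_congr rfl fun k hk => ?_)) (Finset.sum_le_sum_of_subset_of_nonneg (Finset.range_mono hK) fun k _ _ => nn k)
  have hk' : k < N := (Finset.mem_range.1 hk).trans_le hK
  have := (Dat.sq_ne_int (μ := μ) ((hp k hk').mono (h.le k) le_rfl) ((hq k hk').mono (h.le k) le_rfl) (p1 k) (q1 k)).1
  simp only [ne_eq, OfNat.ofNat_ne_zero, not_false_eq_true, zero_pow, add_zero]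
  rw [this]; ring

def pt (n k : ℕ) : ℝ := (k : ℝ) / 2 ^ n
def dd (W : ℝ → Ω → ℝ) (n k : ℕ) (ω : Ω) : ℝ := W (pt n (k + 1)) ω - W (pt n k) ω

lemma pt_nonneg (n k : ℕ) : 0 ≤ pt n k := by unfold pt; positivity
lemma pt_mono (n : ℕ) : Monotone (pt n) := fun a b h => by
  unfold pt; have : (a:ℝ) ≤ b := by exact_mod_cast h
  gcongr
lemma pt_top (n : ℕ) : pt n (2 ^ n) = 1 := by unfold pt; push_cast; exact div_self (by positivity)
lemma pt_le {n k : ℕ} (h : k ≤ 2 ^ n) : pt n k ≤ 1 := (pt_mono n h).trans_eq (pt_top n)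
lemma pt_zero (n : ℕ) : pt n 0 = 0 := by simp [pt]
lemma pt_step (n k : ℕ) : pt n (k + 1) - pt n k = 1 / 2 ^ n := by unfold pt; push_cast; ring
lemma pt_ref (n k p : ℕ) : pt (n + p) (2 ^ p * k) = pt n k := by
  unfold pt; push_cast; rw [pow_add]; field_simp

structure Tan (μ : Measure Ω) (G : ℝ → MeasurableSpace Ω) (Y W V : ℝ → Ω → ℝ) (y : ℝ) : Prop where
  hB : PBM μ G W V 1
  mY : ∀ t, 0 ≤ t → Measurable[G t] (Y t)
  cY : ∀ ω, Continuous fun t => Y t ω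
  z : ∀ t, 0 < t → μ {ω | Y t ω = 0} = 0
  y0 : ∀ᵐ ω ∂μ, Y 0 ω = y
  sol : ∀ t, 0 ≤ t → t ≤ 1 → TendstoInMeasure μ (fun n => rsum (fun s ω => psgn (Y s ω)) W t n) atTop (fun ω => Y t ω - y)

namespace Tan
variable {μ : Measure Ω} [IsProbabilityMeasure μ] {G : ℝ → MeasurableSpace Ω} {Y W V : ℝ → Ω → ℝ} {y : ℝ}

lemma incW (T : Tan μ G Y W V y) (n : ℕ) : Inc (fun k => G (pt n k)) μ (dd W n) (dd V n) (fun _ => 1 / 2 ^ n) (2 ^ n) := by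
  have := T.hB.inc (τ := pt n) (N := 2 ^ n) (pt_mono n) (pt_nonneg n 0) (pt_top n).le
  simp only [pt_step] at this
  exact this

lemma mYm (T : Tan μ G Y W V y) {t : ℝ} (ht : 0 ≤ t) : Measurable (Y t) := (T.mY t ht).mono (T.hB.le t) le_rfl

lemma mism0 (T : Tan μ G Y W V y) {N : ℕ → ℕ} (Z : ℕ → ℝ → Ω → ℝ) (hN : Tendsto N atTop atTop)
    (hZ : ∀ s, 0 < s → s < 1 → TendstoInMeasure μ (fun n => Z n (gr 1 (N n) s)) atTop (Y s)) :
    Tendsto (fun n : ℕ => ∑ i ∈ Finset.range (2 ^ N n), (1 / 2 ^ N n) * μ.real {ω | psgn (Z n (pt (N n) i) ω) ≠ psgn (Y (pt (N n) i) ω)}) atTop (𝓝 0) := by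
  have e := fun n : ℕ => step_int one_pos (N n) (fun s => μ.real {ω | psgn (Z n s ω) ≠ psgn (Y s ω)})
  simp only [one_mul] at e
  simp only [pt, ← e]
  refine dct01 zero_le_one (fun n => (gr_meas 1 (N n) (fun s => μ.real {ω | psgn (Z n s ω) ≠ psgn (Y s ω)})).aestronglyMeasurable) (fun n s => ?_) fun s hs hst => ?_
  · rw [abs_of_nonneg measureReal_nonneg]; exact measureReal_le_one
  · have hY : TendstoInMeasure μ (fun n => Y (gr 1 (N n) s)) atTop (Y s) :=
      tendstoInMeasure_of_tendsto_ae (fun n => (T.mYm (gr_nonneg one_pos _ _)).aestronglyMeasurable) (ae_of_all _ fun ω =>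
        ((T.cY ω).tendsto s).comp ((gr_tendsto one_pos hs.le).comp hN))
    have h1 := psgn_conv (T.mYm hs.le) (hZ s hs hst) (T.z s hs)
    have h2 := psgn_conv (T.mYm hs.le) hY (T.z s hs)
    have h3 := h1.add h2
    rw [add_zero] at h3
    exact tendsto_of_tendsto_of_tendsto_of_le_of_le tendsto_const_nhds h3 (fun _ => measureReal_nonneg) (fun n => ne_tri)

lemma mism1 (T : Tan μ G Y W V y) {N : ℕ → ℕ} (u : ℕ → ℕ → ℝ) (hN : Tendsto N atTop atTop) {c : ℕ → ℝ} (hc : Tendsto c atTop (𝓝 0))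
    (hu0 : ∀ n i, 0 ≤ u n i) (hu : ∀ n i, |u n i - pt (N n) i| ≤ c n) :
    Tendsto (fun n : ℕ => ∑ i ∈ Finset.range (2 ^ N n), (1 / 2 ^ N n) * μ.real {ω | psgn (Y (u n i) ω) ≠ psgn (Y (pt (N n) i) ω)}) atTop (𝓝 0) := by
  have := T.mism0 (N := N) (fun n s => Y (u n ⌊s * 2 ^ N n⌋₊)) hN (fun s hs hst => ?_)
  · refine this.congr fun n => Finset.sum_congr rfl fun i _ => ?_
    have : ⌊pt (N n) i * 2 ^ N n⌋₊ = i := by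
      rw [pt, div_mul_cancel₀ _ (by positivity), Nat.floor_natCast]
    rw [this]
  · refine tendstoInMeasure_of_tendsto_ae (fun n => (T.mYm (hu0 _ _)).aestronglyMeasurable) (ae_of_all _ fun ω => ((T.cY ω).tendsto s).comp ?_)
    have hg := (gr_tendsto one_pos hs.le).comp hN
    have e : ∀ n, pt (N n) ⌊gr 1 (N n) s * 2 ^ N n⌋₊ = gr 1 (N n) s := fun n => by
      have : gr 1 (N n) s * 2 ^ N n = ⌊s * 2 ^ N n / 1⌋₊ := by rw [gr]; field_simp
      rw [this, Nat.floor_natCast, pt, gr, one_mul]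
    have h2 : Tendsto (fun n => u n ⌊gr 1 (N n) s * 2 ^ N n⌋₊ - gr 1 (N n) s) atTop (𝓝 0) := by
      rw [tendsto_zero_iff_abs_tendsto_zero]
      refine tendsto_of_tendsto_of_tendsto_of_le_of_le tendsto_const_nhds hc (fun _ => abs_nonneg _) (fun n => ?_)
      have := hu n ⌊gr 1 (N n) s * 2 ^ N n⌋₊
      rwa [e] at this
    have h3 := h2.add hg
    rw [zero_add] at h3
    refine h3.congr fun n => ?_
    simp

lemma psY (T : Tan μ G Y W V y) {s : ℝ} (hs : 0 ≤ s) {t : ℝ} (hst : s ≤ t) : Measurable[G t] (fun ω => psgn (Y s ω)) :=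
  psgn_meas.comp ((T.mY s hs).mono (T.hB.mono hst) le_rfl)

lemma sol1 (T : Tan μ G Y W V y) (k j : ℕ) (hj : j ≤ 2 ^ k) :
    TendstoInMeasure μ (fun (n : ℕ) ω => ∑ i ∈ Finset.range (j * 2 ^ n), psgn (Y (pt (n + k) i) ω) * dd W (n + k) i ω) atTop (fun ω => Y (pt k j) ω - y) := by
  rcases Nat.eq_zero_or_pos j with rfl | hj0
  · refine (tim_const (μ := μ) (fun _ => (0:ℝ))).congr (fun n => ae_of_all _ fun ω => by simp) ?_
    filter_upwards [T.y0] with ω h; simp [pt_zero, h]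
  have hjn : ∀ n, j * 2 ^ n ≤ 2 ^ (n + k) := fun n => by
    rw [pow_add, mul_comm]; exact Nat.mul_le_mul_left _ hj
  have er : ∀ n ω, rsum (fun s ω => psgn (Y s ω)) W (pt k j) n ω = ∑ i ∈ Finset.range (j * 2 ^ n), psgn (Y (pt (n + k) (j * (i / j))) ω) * dd W (n + k) i ω := fun n ω => by
    have hb := block_sum hj0 (fun q => psgn (Y (pt (n + k) (j * q)) ω)) (fun i => W (pt (n + k) i) ω) (2 ^ n)
    have e1 : ∀ q : ℕ, pt (n + k) (j * q) = pt k j * q / 2 ^ n := fun q => by unfold pt; push_cast; rw [pow_add]; field_simp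
    simp only [dd]
    rw [hb, rsum]
    refine Finset.sum_congr rfl fun q _ => ?_
    rw [e1, e1]; push_cast; rfl
  have hd : ∀ n ω, ∑ i ∈ Finset.range (j * 2 ^ n), psgn (Y (pt (n + k) i) ω) * dd W (n + k) i ω - rsum (fun s ω => psgn (Y s ω)) W (pt k j) n ω =
      ∑ i ∈ Finset.range (j * 2 ^ n), (psgn (Y (pt (n + k) i) ω) - psgn (Y (pt (n + k) (j * (i / j))) ω)) * dd W (n + k) i ω := fun n ω => by
    rw [er, ← Finset.sum_sub_distrib]
    exact Finset.sum_congr rfl fun i _ => by ring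
  have key := fun n => (T.incW (n + k)).diffsq (p := fun i ω => psgn (Y (pt (n + k) i) ω)) (q := fun i ω => psgn (Y (pt (n + k) (j * (i / j))) ω))
    (fun i _ => T.psY (pt_nonneg _ _) le_rfl) (fun i _ => T.psY (pt_nonneg _ _) (pt_mono _ (Nat.mul_div_le _ _))) (fun _ _ => psgn_pm _) (fun _ _ => psgn_pm _) (hjn n)
  have hm := T.mism1 (N := fun n => n + k) (fun n i => pt (n + k) (j * (i / j))) (tendsto_add_atTop_nat k) (c := fun n => (j:ℝ) / 2 ^ n) (half_tendsto _) (fun _ _ => pt_nonneg _ _)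
    (fun n i => by
      have h1 := Nat.mul_div_le i j
      have h2 := Nat.lt_mul_div_succ i hj0
      have h1' : ((j * (i / j) : ℕ) : ℝ) ≤ i := by exact_mod_cast h1
      have h2' : (i : ℝ) ≤ ((j * (i / j) : ℕ) : ℝ) + j := by
        have : i ≤ j * (i / j) + j := by rw [Nat.mul_add] at h2; omega
        exact_mod_cast this
      rw [pt, pt, ← sub_div, abs_div, abs_of_pos (by positivity : (0:ℝ) < 2 ^ (n + k)), abs_sub_comm, abs_of_nonneg (by linarith)]
      have : (2:ℝ) ^ n ≤ 2 ^ (n + k) := pow_le_pow_right₀ one_le_two (by omega)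
      apply div_le_div₀ <;> first | positivity | linarith)
  refine tim_diff (T.sol _ (pt_nonneg _ _) (pt_le hj)) (fun n => ?_) ?_
  · simp only [hd]; exact (key n).1
  · simp only [hd]
    have h4 := hm.const_mul 4
    rw [mul_zero] at h4
    refine tendsto_of_tendsto_of_tendsto_of_le_of_le tendsto_const_nhds h4 (fun _ => integral_nonneg fun _ => sq_nonneg _) (fun n => (key n).2.trans_eq ?_)
    congr 1
    refine Finset.sum_congr rfl fun i _ => ?_
    simp only [ne_comm]
end Tan
end

section

section
variable {μ : Measure Ω}

lemma tim_prod {E E' : Type*} [PseudoEMetricSpace E] [PseudoEMetricSpace E'] {f : ℕ → Ω → E} {g : Ω → E} {f' : ℕ → Ω → E'} {g' : Ω → E'}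
    (h : TendstoInMeasure μ f atTop g) (h' : TendstoInMeasure μ f' atTop g') :
    TendstoInMeasure μ (fun n ω => (f n ω, f' n ω)) atTop (fun ω => (g ω, g' ω)) := by
  intro ε hε
  have h1 := (h ε hε).add (h' ε hε)
  rw [add_zero] at h1
  refine tendsto_of_tendsto_of_tendsto_of_le_of_le tendsto_const_nhds h1 (fun _ => zero_le) fun n => ?_
  refine le_trans (measure_mono ?_) (measure_union_le _ _)
  intro ω hω
  simp only [Set.mem_setOf_eq, Prod.edist_eq, le_sup_iff] at hω
  exact hω

lemma tim_pi {ι E : Type*} [Fintype ι] [PseudoEMetricSpace E] [Nonempty ι] {f : ℕ → Ω → ι → E} {g : Ω → ι → E}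
    (h : ∀ i, TendstoInMeasure μ (fun n ω => f n ω i) atTop (fun ω => g ω i)) : TendstoInMeasure μ f atTop g := by
  intro ε hε
  have h1 := tendsto_finset_sum (Finset.univ : Finset ι) (fun i _ => h i ε hε)
  rw [Finset.sum_const_zero] at h1
  refine tendsto_of_tendsto_of_tendsto_of_le_of_le tendsto_const_nhds h1 (fun _ => zero_le) fun n => ?_
  refine le_trans (measure_mono ?_) (measure_biUnion_finset_le _ _)
  intro ω hω
  simp only [Set.mem_setOf_eq, edist_pi_def] at hω
  by_contra hc
  simp only [Set.mem_iUnion, Set.mem_setOf_eq, not_exists, not_le, Finset.mem_univ, exists_prop, true_and] at hc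
  exact absurd hω (not_le.2 ((Finset.sup_lt_iff hε).2 fun i _ => hc i))

lemma tim_bmul {f : ℕ → Ω → ℝ} {g b : Ω → ℝ} (hb : ∀ ω, |b ω| ≤ 1) (h : TendstoInMeasure μ f atTop g) :
    TendstoInMeasure μ (fun n ω => b ω * f n ω) atTop (fun ω => b ω * g ω) := by
  intro ε hε
  refine tendsto_of_tendsto_of_tendsto_of_le_of_le tendsto_const_nhds (h ε hε) (fun _ => zero_le) fun n => measure_mono fun ω hω => ?_
  simp only [Set.mem_setOf_eq] at hω ⊢
  refine hω.trans ?_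
  rw [edist_dist, edist_dist, Real.dist_eq, Real.dist_eq, ← mul_sub, abs_mul]
  exact ENNReal.ofReal_le_ofReal (mul_le_of_le_one_left (abs_nonneg _) (hb ω))

lemma tim_sum [IsProbabilityMeasure μ] (K : ℕ) {f : ℕ → ℕ → Ω → ℝ} {g : ℕ → Ω → ℝ} (h : ∀ i < K, TendstoInMeasure μ (f i) atTop (g i)) :
    TendstoInMeasure μ (fun n ω => ∑ i ∈ Finset.range K, f i n ω) atTop (fun ω => ∑ i ∈ Finset.range K, g i ω) := by
  induction K with
  | zero => simpa using tim_const (μ := μ) (fun _ => (0:ℝ))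
  | succ K ih =>
    simp only [Finset.sum_range_succ]
    exact tim_add (ih fun i hi => h i (by omega)) (h K (by omega))

lemma tim_fatou [IsProbabilityMeasure μ] {f : ℕ → Ω → ℝ} {g : Ω → ℝ} {C : ℝ} (h : TendstoInMeasure μ f atTop g) (hf : ∀ n, MemLp (f n) 2 μ)
    (hC : ∀ n, ∫ ω, f n ω ^ 2 ∂μ ≤ C) (hg : AEStronglyMeasurable g μ) : MemLp g 2 μ ∧ ∫ ω, g ω ^ 2 ∂μ ≤ C := by
  obtain ⟨ns, -, hns⟩ := h.exists_seq_tendsto_ae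
  have := fatou_int (μ := μ) (f := fun n ω => f (ns n) ω ^ 2) (g := fun ω => g ω ^ 2) (C := C) (fun n => (hf _).integrable_sq) (fun _ _ => sq_nonneg _) (fun n => hC _)
    (hg.pow 2) (by filter_upwards [hns] with ω hω; exact hω.pow 2)
  exact ⟨(memLp_two_iff_integrable_sq hg).2 this.1, this.2⟩
end

namespace Tan
variable {μ : Measure Ω} [IsProbabilityMeasure μ] {G : ℝ → MeasurableSpace Ω} {Y W V : ℝ → Ω → ℝ} {y : ℝ}

lemma solInc (T : Tan μ G Y W V y) (k j : ℕ) (hj : j < 2 ^ k) :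
    TendstoInMeasure μ (fun (n : ℕ) ω => ∑ i ∈ Finset.range (2 ^ n), psgn (Y (pt (n + k) (2 ^ n * j + i)) ω) * dd W (n + k) (2 ^ n * j + i) ω) atTop (dd Y k j) := by
  have h := tim_add (T.sol1 k (j + 1) hj) (tim_cmul (-1) (T.sol1 k j hj.le))
  refine h.congr (fun n => ae_of_all _ fun ω => ?_) (ae_of_all _ fun ω => by simp only [dd]; ring)
  simp only [Nat.add_mul, one_mul]
  rw [Finset.sum_range_add]
  simp only [mul_comm j]; ring

lemma incY (T : Tan μ G Y W V y) (k : ℕ) : Inc (fun j => G (pt k j)) μ (dd Y k) (dd V k) (fun _ => 1 / 2 ^ k) (2 ^ k) := by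
  have hY : ∀ j, Measurable (dd Y k j) := fun j => (T.mYm (pt_nonneg _ _)).sub (T.mYm (pt_nonneg _ _))
  have iW := T.incW k
  refine ⟨iW.le, iW.mono, iW.pos, fun j _ => (T.mY _ (pt_nonneg _ _)).sub ((T.mY _ (pt_nonneg _ _)).mono (T.hB.mono (pt_mono _ (Nat.le_succ _))) le_rfl), iW.m2, fun j hj => ?_⟩
  have hV : Measurable (dd V k j) := (iW.m2 j hj).mono (iW.le _) le_rfl
  have hlim := tim_prod (T.solInc k j hj) (tim_const (μ := μ) (dd V k j))
  refine CL.of_tendsto (iW.le j) (fun n => ?_) ((hY j).prodMk hV) hlim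
  have h1 := (T.incW (n + k)).sign (a := fun i ω => psgn (Y (pt (n + k) i) ω)) (fun i _ => T.psY (pt_nonneg _ _) le_rfl)
    (fun i _ ω => by rcases psgn_pm (Y (pt (n + k) i) ω) with e | e <;> rw [e] <;> norm_num)
  have h2 := h1.sumLaw (2 ^ n * j) (2 ^ n) (by
    rw [← Nat.mul_succ, pow_add]; exact Nat.mul_le_mul_left _ hj)
  have e1 : pt (n + k) (2 ^ n * j) = pt k j := by rw [add_comm, pt_ref]
  have e2 : ∀ ω, ∑ i ∈ Finset.range (2 ^ n), dd V (n + k) (2 ^ n * j + i) ω = dd V k j ω := fun ω => by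
    have := Finset.sum_range_sub (fun i => V (pt (n + k) (2 ^ n * j + i)) ω) (2 ^ n)
    simp only [dd, add_assoc] at this ⊢
    rw [this, add_zero, e1, ← Nat.mul_succ, add_comm n k, pt_ref]
  have e3 : ∑ i ∈ Finset.range (2 ^ n), (fun _ : ℕ => (1:ℝ) / 2 ^ (n + k)) (2 ^ n * j + i) = 1 / 2 ^ k := by
    simp only [Finset.sum_const, Finset.card_range, nsmul_eq_mul]; push_cast; rw [pow_add]; field_simp
  rw [e3] at h2
  simp only [e2, e1] at h2
  exact h2

lemma tW (T : Tan μ G Y W V y) (k j : ℕ) (hj : j ≤ 2 ^ k) :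
    TendstoInMeasure μ (fun (n : ℕ) ω => ∑ i ∈ Finset.range (j * 2 ^ n), psgn (Y (pt (n + k) i) ω) * dd Y (n + k) i ω) atTop (fun ω => W (pt k j) ω - W 0 ω) := by
  have hjn : ∀ n, j * 2 ^ n ≤ 2 ^ (n + k) := fun n => by
    rw [pow_add, mul_comm]; exact Nat.mul_le_mul_left _ hj
  have hjn2 : ∀ n p, 2 ^ p * (j * 2 ^ n) ≤ 2 ^ (n + k + p) := fun n p => by
    rw [pow_add 2 (n + k), mul_comm]; exact Nat.mul_le_mul_right _ (hjn n)
  let S : ℕ → ℕ → Ω → ℝ := fun n p ω => ∑ l ∈ Finset.range (2 ^ p * (j * 2 ^ n)), (psgn (Y (pt (n + k) (l / 2 ^ p)) ω) * psgn (Y (pt (n + k + p) l) ω)) * dd W (n + k + p) l ω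
  let Tn : ℕ → Ω → ℝ := fun n ω => ∑ i ∈ Finset.range (j * 2 ^ n), psgn (Y (pt (n + k) i) ω) * dd Y (n + k) i ω
  let A : Ω → ℝ := fun ω => W (pt k j) ω - W 0 ω
  let e : ℕ → ℕ → ℝ := fun n p => ∑ l ∈ Finset.range (2 ^ (n + k + p)), (1 / 2 ^ (n + k + p)) * μ.real {ω | psgn (Y (pt (n + k) (l / 2 ^ p)) ω) ≠ psgn (Y (pt (n + k + p) l) ω)}
  have mm : ∀ n p l, pt (n + k) (l / 2 ^ p) ≤ pt (n + k + p) l := fun n p l => by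
    rw [← pt_ref (n + k) (l / 2 ^ p) p]; exact pt_mono _ (Nat.mul_div_le _ _)
  have hS : ∀ n, TendstoInMeasure μ (S n) atTop (Tn n) := fun n => by
    have h := tim_sum (μ := μ) (j * 2 ^ n) (fun i hi => tim_bmul (b := fun ω => psgn (Y (pt (n + k) i) ω))
      (fun ω => by rcases psgn_pm (Y (pt (n + k) i) ω) with e | e <;> rw [e] <;> simp) (T.solInc (n + k) i (hi.trans_le (hjn n))))
    refine h.congr (fun p => ae_of_all _ fun ω => ?_) (ae_of_all _ fun ω => rfl)
    have gen : ∀ M : ℕ, ∑ i ∈ Finset.range M, psgn (Y (pt (n + k) i) ω) * ∑ l ∈ Finset.range (2 ^ p), psgn (Y (pt (p + (n + k)) (2 ^ p * i + l)) ω) * dd W (p + (n + k)) (2 ^ p * i + l) ω =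
        ∑ l ∈ Finset.range (2 ^ p * M), (psgn (Y (pt (n + k) (l / 2 ^ p)) ω) * psgn (Y (pt (n + k + p) l) ω)) * dd W (n + k + p) l ω := fun M => by
      induction M with
      | zero => simp
      | succ M ih =>
        rw [Finset.sum_range_succ, ih, Nat.mul_succ, Finset.sum_range_add, Finset.mul_sum]
        congr 1
        refine Finset.sum_congr rfl fun x hx => ?_
        rw [Nat.mul_add_div (by positivity), Nat.div_eq_of_lt (Finset.mem_range.1 hx), add_zero, add_comm p (n + k)]; ring
    exact gen _
  have hA : ∀ n p ω, A ω - S n p ω = ∑ l ∈ Finset.range (2 ^ p * (j * 2 ^ n)), ((fun _ _ => (1:ℝ)) l ω - psgn (Y (pt (n + k) (l / 2 ^ p)) ω) * psgn (Y (pt (n + k + p) l) ω)) * dd W (n + k + p) l ω := fun n p ω => by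
    have h1 := Finset.sum_range_sub (fun l => W (pt (n + k + p) l) ω) (2 ^ p * (j * 2 ^ n))
    have h2 : pt (n + k + p) (2 ^ p * (j * 2 ^ n)) = pt k j := by rw [pt_ref, mul_comm j, add_comm n k, pt_ref]
    rw [h2, pt_zero] at h1
    simp only [A, S, sub_mul, one_mul, Finset.sum_sub_distrib, ← h1, dd]
  have pm : ∀ a b : ℝ, (psgn a * psgn b = 1 ∨ psgn a * psgn b = -1) := fun a b => by
    rcases psgn_pm a with e | e <;> rcases psgn_pm b with e' | e' <;> rw [e, e'] <;> norm_num
  have key := fun n p => (T.incW (n + k + p)).diffsq (p := fun _ _ => 1) (q := fun l ω => psgn (Y (pt (n + k) (l / 2 ^ p)) ω) * psgn (Y (pt (n + k + p) l) ω))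
    (fun l _ => measurable_const) (fun l _ => (T.psY (pt_nonneg _ _) (mm n p l)).mul (T.psY (pt_nonneg _ _) le_rfl)) (fun _ _ => Or.inl rfl) (fun _ _ => pm _ _) (hjn2 n p)
  simp only [← hA] at key
  have hle : ∀ n p, ∫ ω, (A ω - S n p ω) ^ 2 ∂μ ≤ 4 * e n p := fun n p => by
    refine (key n p).2.trans_eq ?_
    congr 1
    refine Finset.sum_congr rfl fun l _ => ?_
    congr 2
    ext ω
    simp only [Set.mem_setOf_eq]
    rcases psgn_pm (Y (pt (n + k) (l / 2 ^ p)) ω) with e | e <;> rcases psgn_pm (Y (pt (n + k + p) l) ω) with e' | e' <;> rw [e, e'] <;> norm_num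
  have e0 : ∀ n p, 0 ≤ e n p := fun n p => Finset.sum_nonneg fun l _ => by positivity
  have mA : Measurable A := ((T.hB.m1 _ (pt_nonneg _ _) (pt_le hj)).mono (T.hB.le _) le_rfl).sub ((T.hB.m1 _ le_rfl zero_le_one).mono (T.hB.le _) le_rfl)
  have mT : ∀ n, Measurable (Tn n) := fun n => Finset.measurable_fun_sum _ fun i _ => ((psgn_meas.comp (T.mYm (pt_nonneg _ _))).mul ((T.mYm (pt_nonneg _ _)).sub (T.mYm (pt_nonneg _ _))))
  have fat : ∀ n C, (∀ p, ∫ ω, (A ω - S n p ω) ^ 2 ∂μ ≤ C) → MemLp (fun ω => A ω - Tn n ω) 2 μ ∧ ∫ ω, (A ω - Tn n ω) ^ 2 ∂μ ≤ C := fun n C hC => by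
    have h := tim_add (tim_const (μ := μ) A) (tim_cmul (-1) (hS n))
    refine tim_fatou (f := fun p ω => A ω - S n p ω) (h.congr (fun p => ae_of_all _ fun ω => by ring) (ae_of_all _ fun ω => by ring)) (fun p => (key n p).1) hC (mA.sub (mT n)).aestronglyMeasurable
  have e4 : ∀ n p, e n p ≤ 1 := fun n p => by
    refine (Finset.sum_le_sum (g := fun _ => 1 / 2 ^ (n + k + p)) fun l _ => mul_le_of_le_one_right (by positivity) measureReal_le_one).trans_eq ?_
    rw [Finset.sum_const, Finset.card_range, nsmul_eq_mul]; push_cast; field_simp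
  have mem : ∀ n, MemLp (fun ω => A ω - Tn n ω) 2 μ := fun n => (fat n 4 fun p => (hle n p).trans (by linarith [e4 n p])).1
  have ch : ∀ n, ∃ p, ∫ ω, (A ω - Tn n ω) ^ 2 ∂μ ≤ 8 * e n p := fun n => by
    by_contra hc
    push Not at hc
    have h1 := (fat n ((∫ ω, (A ω - Tn n ω) ^ 2 ∂μ) / 2) fun p => (hle n p).trans (by linarith [hc p])).2
    linarith [hc 0, e0 n 0]
  choose P hP using ch
  have hm := T.mism1 (N := fun n => n + k + P n) (fun n i => pt (n + k) (i / 2 ^ P n))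
    (tendsto_atTop_mono (fun n => (by omega : n ≤ n + k + P n)) tendsto_id) (c := fun n => (1:ℝ) / 2 ^ n) (half_tendsto _) (fun _ _ => pt_nonneg _ _)
    (fun n i => by
      have h1 := Nat.mul_div_le i (2 ^ P n)
      have h2 := Nat.lt_mul_div_succ i (by positivity : 0 < 2 ^ P n)
      have h1' : ((2 ^ P n * (i / 2 ^ P n) : ℕ) : ℝ) ≤ i := by exact_mod_cast h1
      have h2' : (i : ℝ) ≤ ((2 ^ P n * (i / 2 ^ P n) : ℕ) : ℝ) + 2 ^ P n := by
        have : i ≤ 2 ^ P n * (i / 2 ^ P n) + 2 ^ P n := by rw [Nat.mul_add] at h2; omega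
        exact_mod_cast this
      rw [← pt_ref (n + k) (i / 2 ^ P n) (P n), pt, pt, ← sub_div, abs_div, abs_of_pos (by positivity : (0:ℝ) < 2 ^ (n + k + P n)), abs_sub_comm, abs_of_nonneg (by linarith),
        div_le_div_iff₀ (by positivity) (by positivity), pow_add, pow_add]
      have h3 : (1:ℝ) ≤ 2 ^ k := one_le_pow₀ one_le_two
      have h4 : (i:ℝ) - ((2 ^ P n * (i / 2 ^ P n) : ℕ) : ℝ) ≤ 2 ^ P n := by linarith
      calc _ ≤ (2:ℝ) ^ P n * 2 ^ n := by gcongr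
        _ = 1 * (2 ^ n * 1 * 2 ^ P n) := by ring
        _ ≤ _ := by gcongr)
  have h8 := hm.const_mul 8
  rw [mul_zero] at h8
  refine tim_diff (f' := fun _ => A) (tim_const A) (fun n => ?_) ?_
  · have := (mem n).neg
    refine this.congr_norm (by exact ((mT n).sub mA).aestronglyMeasurable) (ae_of_all _ fun ω => ?_)
    simp only [Pi.neg_apply, norm_neg]; rw [norm_sub_rev]
  · refine tendsto_of_tendsto_of_tendsto_of_le_of_le tendsto_const_nhds h8 (fun _ => integral_nonneg fun _ => sq_nonneg _) (fun n => le_trans (le_of_eq ?_) (hP n))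
    refine integral_congr_ae (ae_of_all _ fun ω => ?_)
    simp only [Tn]; ring
end Tan
end

section

open Classical in
def chi (s0 : ℝ) (a : ℕ → ℝ) (i : ℕ) : ℝ := if ∀ l ≤ i, 0 < s0 * a l then 1 else -1

def rfl1 (s0 : ℝ) (a : ℕ → ℝ) (j : ℕ) : ℝ := a 0 + ∑ i ∈ Finset.range j, chi s0 a i * (a (i + 1) - a i)

lemma chi_pm (s0 : ℝ) (a : ℕ → ℝ) (i : ℕ) : chi s0 a i = 1 ∨ chi s0 a i = -1 := by
  unfold chi; split_ifs <;> simp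

lemma psgn_mul_self (x : ℝ) : psgn x * x = |x| := by
  unfold psgn; split_ifs with h
  · rw [abs_of_pos h, one_mul]
  · rw [abs_of_nonpos (not_lt.1 h)]; ring

lemma rfl1_inv {s0 : ℝ} {a : ℕ → ℝ} (hs : s0 = psgn (a 0)) {ε : ℝ} (hε : 0 ≤ ε) {N : ℕ} (ha : ∀ i < N, |a (i + 1) - a i| ≤ ε) (j : ℕ) (hj : j ≤ N) :
    ((∀ l ≤ j, 0 < s0 * a l) → rfl1 s0 a j = a j) ∧ ((¬ ∀ l ≤ j, 0 < s0 * a l) → |rfl1 s0 a j + a j| ≤ 2 * ε) := by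
  induction j with
  | zero =>
    refine ⟨fun _ => by simp [rfl1], fun h => ?_⟩
    have h0 : ¬ 0 < s0 * a 0 := fun h' => h fun l hl => by rwa [Nat.le_zero.1 hl]
    rw [hs, psgn_mul_self, abs_pos, not_not] at h0
    simp [rfl1, h0, hε]
  | succ j ih =>
    have ih := ih (by omega)
    have er : rfl1 s0 a (j + 1) = rfl1 s0 a j + chi s0 a j * (a (j + 1) - a j) := by
      simp only [rfl1, Finset.sum_range_succ]; ring
    by_cases hj' : ∀ l ≤ j, 0 < s0 * a l
    · have hc : chi s0 a j = 1 := if_pos hj'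
      have e : rfl1 s0 a (j + 1) = a (j + 1) := by rw [er, ih.1 hj', hc]; ring
      refine ⟨fun _ => e, fun h => ?_⟩
      have h1 : ¬ 0 < s0 * a (j + 1) := fun h' => h fun l hl => by
        rcases Nat.lt_or_ge j l with hl' | hl'
        · rwa [show l = j + 1 by omega]
        · exact hj' l hl'
      have h2 := hj' j le_rfl
      have h3 := abs_le.1 (ha j (by omega))
      rw [e, abs_le]
      rcases psgn_pm (a 0) with e0 | e0 <;> rw [hs, e0] at h1 h2 <;> constructor <;> linarith [h3.1, h3.2]
    · have hc : chi s0 a j = -1 := if_neg hj'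
      refine ⟨fun h => absurd (fun l hl => h l (by omega)) hj', fun _ => ?_⟩
      have := ih.2 hj'
      rw [er, hc]
      convert this using 2; ring

lemma chi_rfl1 {s0 : ℝ} {a : ℕ → ℝ} (hs : s0 = psgn (a 0)) {ε : ℝ} (hε : 0 ≤ ε) {N : ℕ} (ha : ∀ i < N, |a (i + 1) - a i| ≤ ε) (j : ℕ) (hj : j ≤ N) :
    |chi s0 a j * rfl1 s0 a j - a j| ≤ 2 * ε := by
  have h := rfl1_inv hs hε ha j hj
  by_cases hj' : ∀ l ≤ j, 0 < s0 * a l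
  · rw [h.1 hj', show chi s0 a j = 1 from if_pos hj']; simpa using hε
  · rw [show chi s0 a j = -1 from if_neg hj']
    have := h.2 hj'
    rw [← abs_neg]
    convert this using 2; ring

lemma psgn_pert {c r d : ℝ} (hc : c = 1 ∨ c = -1) (hd : 0 < d) : psgn (c * r + psgn r * c * d) = psgn r * c := by
  have h : c * r + psgn r * c * d = (psgn r * c) * (|r| + d) := by
    rw [← psgn_mul_self]
    rcases psgn_pm r with e | e <;> rw [e] <;> ring
  have hp : 0 < |r| + d := by positivity
  rw [h]
  rcases psgn_pm r with e | e <;> rcases hc with e' | e' <;> rw [e, e'] <;> norm_num [psgn] <;> first | linarith | positivity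

lemma osc {f : ℝ → ℝ} (hf : Continuous f) {ε : ℝ} (hε : 0 < ε) : ∀ᶠ n : ℕ in atTop, ∀ i < 2 ^ n, |f (pt n (i + 1)) - f (pt n i)| ≤ ε := by
  have hu := (isCompact_Icc (a := (0:ℝ)) (b := 1)).uniformContinuousOn_of_continuous hf.continuousOn
  rw [Metric.uniformContinuousOn_iff] at hu
  obtain ⟨δ, hδ, h⟩ := hu ε hε
  filter_upwards [(half_tendsto 1).eventually (gt_mem_nhds hδ)] with n hn i hi
  have := h (pt n (i + 1)) ⟨pt_nonneg _ _, pt_le hi⟩ (pt n i) ⟨pt_nonneg _ _, pt_le hi.le⟩ (by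
    rw [Real.dist_eq, pt_step, abs_of_nonneg (by positivity)]; exact hn)
  exact this.le

lemma law_lim {E : Type*} [PseudoEMetricSpace E] [MeasurableSpace E] [BorelSpace E] {μ : Measure Ω} [IsProbabilityMeasure μ]
    {A B : ℕ → Ω → E} {a b : Ω → E} (hA : ∀ n, AEMeasurable (A n) μ) (hB : ∀ n, AEMeasurable (B n) μ) (h : ∀ n, μ.map (A n) = μ.map (B n))
    (la : TendstoInMeasure μ A atTop a) (lb : TendstoInMeasure μ B atTop b) : μ.map a = μ.map b := by
  have h1 := la.tendstoInDistribution hA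
  have h2 := lb.tendstoInDistribution hB
  refine tendstoInDistribution_unique A h1 ⟨hA, h2.aemeasurable_limit, ?_⟩
  refine h2.tendsto.congr fun n => Subtype.ext (h n).symm

def pS (y : ℝ) (z : ℕ → ℝ × ℝ) (i : ℕ) : ℝ := y + ∑ l ∈ Finset.range i, (z l).1
def Phi (y : ℝ) (n k : ℕ) (z : ℕ → ℝ × ℝ) : ℝ × (Fin (2 ^ k + 1) → ℝ × ℝ) :=
  (pS y z (2 ^ (n + k)), fun j => (∑ i ∈ Finset.range (j.1 * 2 ^ n), psgn (pS y z i) * (z i).1, ∑ i ∈ Finset.range (j.1 * 2 ^ n), (z i).2))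

lemma pS_meas (y : ℝ) (i : ℕ) : Measurable fun z : ℕ → ℝ × ℝ => pS y z i := by
  unfold pS
  exact measurable_const.add (Finset.measurable_fun_sum _ fun l _ => (measurable_pi_apply l).fst)

lemma Phi_meas (y : ℝ) (n k : ℕ) : Measurable (Phi y n k) := by
  unfold Phi
  refine (pS_meas y _).prodMk (measurable_pi_lambda _ fun j => Measurable.prodMk ?_ ?_)
  · exact Finset.measurable_fun_sum _ fun l _ => (psgn_meas.comp (pS_meas y l)).mul (measurable_pi_apply l).fst
  · exact Finset.measurable_fun_sum _ fun l _ => (measurable_pi_apply l).snd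

lemma jn {k j : ℕ} (n : ℕ) (hj : j ≤ 2 ^ k) : j * 2 ^ n ≤ 2 ^ (n + k) := by
  rw [pow_add, mul_comm]; exact Nat.mul_le_mul_left _ hj

lemma Phi_trunc (y : ℝ) (n k : ℕ) (z : ℕ → ℝ × ℝ) : Phi y n k (fun i => if i < 2 ^ (n + k) then z i else 0) = Phi y n k z := by
  have hS : ∀ i ≤ 2 ^ (n + k), pS y (fun i => if i < 2 ^ (n + k) then z i else 0) i = pS y z i := fun i hi => by
    unfold pS
    congr 1
    refine Finset.sum_congr rfl fun l hl => ?_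
    beta_reduce
    rw [if_pos (by have := Finset.mem_range.1 hl; omega)]
  unfold Phi
  rw [hS _ le_rfl]
  congr 1
  funext j
  have hj := jn n (Nat.lt_succ_iff.1 j.2)
  congr 1
  · refine Finset.sum_congr rfl fun i hi => ?_
    have := Finset.mem_range.1 hi
    rw [hS i (by omega)]
    beta_reduce
    rw [if_pos (by omega)]
  · refine Finset.sum_congr rfl fun i hi => ?_
    have := Finset.mem_range.1 hi
    beta_reduce
    rw [if_pos (by omega)]
end

section

namespace Tan
variable {μ : Measure Ω} [IsProbabilityMeasure μ] {G : ℝ → MeasurableSpace Ω} {Y W V : ℝ → Ω → ℝ} {y : ℝ}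

lemma chiM (T : Tan μ G Y W V y) (s0 : ℝ) (N i : ℕ) : Measurable[G (pt N i)] (fun ω => chi s0 (fun l => Y (pt N l) ω) i) := by
  unfold chi
  refine Measurable.ite ?_ measurable_const measurable_const
  have : {ω | ∀ l ≤ i, 0 < s0 * Y (pt N l) ω} = ⋂ l ∈ Finset.range (i + 1), {ω | 0 < s0 * Y (pt N l) ω} := by
    ext ω; simp [Nat.lt_succ_iff]
  rw [this]
  refine Finset.measurableSet_biInter (m := G (pt N i)) _ fun l hl => ?_
  have h1 : Measurable[G (pt N i)] (fun ω => s0 * Y (pt N l) ω) :=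
    ((T.mY _ (pt_nonneg N l)).mono (T.hB.mono (pt_mono N (Nat.lt_succ_iff.1 (Finset.mem_range.1 hl)))) le_rfl).const_mul s0
  exact h1 measurableSet_Ioi

lemma chiS (_ : Tan μ G Y W V y) (s0 : ℝ) (N i : ℕ) (ω : Ω) : chi s0 (fun l => Y (pt N l) ω) i ^ 2 = 1 := by
  rcases chi_pm s0 (fun l => Y (pt N l) ω) i with e | e <;> rw [e] <;> norm_num

lemma incR (T : Tan μ G Y W V y) (s0 : ℝ) (N : ℕ) :
    Inc (fun j => G (pt N j)) μ (fun i ω => chi s0 (fun l => Y (pt N l) ω) i * dd Y N i ω) (dd V N) (fun _ => 1 / 2 ^ N) (2 ^ N) :=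
  (T.incY N).sign (fun i _ => T.chiM s0 N i) (fun i _ ω => T.chiS s0 N i ω)

lemma law_n (T : Tan μ G Y W V y) (s0 : ℝ) (n k : ℕ) :
    μ.map (fun ω => Phi y n k (fun i => (dd Y (n + k) i ω, dd V (n + k) i ω))) =
    μ.map (fun ω => Phi y n k (fun i => (chi s0 (fun l => Y (pt (n + k) l) ω) i * dd Y (n + k) i ω, dd V (n + k) i ω))) := by
  have i1 := T.incY (n + k)
  have i2 := T.incR s0 (n + k)
  have h := CL.seq_law (E := ℝ × ℝ) i1.mono i1.le (2 ^ (n + k)) (fun j hj => i1.cl j hj) (fun j hj => i2.cl j hj)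
    (fun j hj => (i1.m1 j hj).prodMk (i1.m2 j hj)) (fun j hj => (i2.m1 j hj).prodMk (i2.m2 j hj))
  have h' := congrArg (fun ν => ν.map (Phi y n k)) h
  have mz : ∀ {Z : ℕ → Ω → ℝ × ℝ}, (∀ j < 2 ^ (n + k), Measurable (Z j)) → Measurable (fun ω => fun i : ℕ => if i < 2 ^ (n + k) then Z i ω else 0) := fun {Z} hZ =>
    measurable_pi_lambda _ fun i => by
      by_cases hi : i < 2 ^ (n + k)
      · simpa [hi] using hZ i hi
      · simpa [hi] using measurable_const
  beta_reduce at h'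
  rw [Measure.map_map (Phi_meas y n k) (mz fun j hj => (i1.cl j hj).meas), Measure.map_map (Phi_meas y n k) (mz fun j hj => (i2.cl j hj).meas)] at h'
  simpa only [Function.comp_def, Phi_trunc] using h'

lemma pSY (_ : Tan μ G Y W V y) {ω : Ω} (h : Y 0 ω = y) (N i : ℕ) (c : ℕ → ℝ) : pS y (fun i => (dd Y N i ω, c i)) i = Y (pt N i) ω := by
  unfold pS dd
  simp only
  rw [Finset.sum_range_sub (fun l => Y (pt N l) ω), pt_zero, h]; ring

lemma pSR (_ : Tan μ G Y W V y) {ω : Ω} (h : Y 0 ω = y) (N i : ℕ) (c : ℕ → ℝ) (s0 : ℝ) :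
    pS y (fun i => (chi s0 (fun l => Y (pt N l) ω) i * dd Y N i ω, c i)) i = rfl1 s0 (fun l => Y (pt N l) ω) i := by
  unfold pS rfl1 dd
  beta_reduce
  rw [pt_zero, h]

lemma vsum (V : ℝ → Ω → ℝ) (n k j : ℕ) (ω : Ω) : ∑ i ∈ Finset.range (j * 2 ^ n), dd V (n + k) i ω = V (pt k j) ω - V 0 ω := by
  unfold dd
  rw [Finset.sum_range_sub (fun l => V (pt (n + k) l) ω), pt_zero, mul_comm, add_comm n k, pt_ref]

lemma limA (T : Tan μ G Y W V y) (k : ℕ) :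
    TendstoInMeasure μ (fun n ω => Phi y n k (fun i => (dd Y (n + k) i ω, dd V (n + k) i ω))) atTop
      (fun ω => (Y 1 ω, fun j : Fin (2 ^ k + 1) => (W (pt k j.1) ω - W 0 ω, V (pt k j.1) ω - V 0 ω))) := by
  refine tim_prod ?_ (tim_pi fun j => tim_prod ?_ ?_)
  · refine (tim_const (μ := μ) (Y 1)).congr (fun n => ?_) (ae_of_all _ fun _ => rfl)
    filter_upwards [T.y0] with ω hω
    rw [T.pSY hω, pt_top]
  · refine (T.tW k j.1 (Nat.lt_succ_iff.1 j.2)).congr (fun n => ?_) (ae_of_all _ fun _ => rfl)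
    filter_upwards [T.y0] with ω hω
    simp only [T.pSY hω]
  · exact (tim_const (μ := μ) (fun ω => V (pt k j.1) ω - V 0 ω)).congr (fun n => ae_of_all _ fun ω => (vsum V n k j.1 ω).symm) (ae_of_all _ fun _ => rfl)

/-- hitting event on dyadics -/
def hit (Y : ℝ → Ω → ℝ) (s0 : ℝ) : Set Ω := {ω | ∃ n : ℕ, ∃ l ≤ 2 ^ n, ¬ 0 < s0 * Y (pt n l) ω}

open Classical in
def Yr (Y : ℝ → Ω → ℝ) (s0 : ℝ) (ω : Ω) : ℝ := if ω ∈ hit Y s0 then - Y 1 ω else Y 1 ω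

lemma limR1 (T : Tan μ G Y W V y) {ω : Ω} (h : Y 0 ω = y) (k : ℕ) :
    Tendsto (fun n => rfl1 (psgn y) (fun l => Y (pt (n + k) l) ω) (2 ^ (n + k))) atTop (𝓝 (Yr Y (psgn y) ω)) := by
  have hs : ∀ N, psgn y = psgn ((fun l => Y (pt N l) ω) 0) := fun N => by simp only [pt_zero, h]
  unfold Yr
  split_ifs with hh
  · obtain ⟨n0, l, hl, hneg⟩ := hh
    rw [Metric.tendsto_atTop']
    intro ε hε
    have ho := (tendsto_add_atTop_nat k).eventually (osc (T.cY ω) (show 0 < ε / 3 by positivity))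
    obtain ⟨M, hM⟩ := eventually_atTop.1 ho
    refine ⟨max M n0, fun n hn => ?_⟩
    have := (rfl1_inv (a := fun l => Y (pt (n + k) l) ω) (hs (n + k)) (show 0 ≤ ε / 3 by positivity) (hM n (le_of_lt (lt_of_le_of_lt (le_max_left _ _) hn))) (2 ^ (n + k)) le_rfl).2 (fun hall => hneg ?_)
    · rw [pt_top] at this
      rw [Real.dist_eq, sub_neg_eq_add]; linarith
    · have hn0 : n0 ≤ n + k := by have := (le_max_right M n0).trans_lt hn; omega
      obtain ⟨p, hp⟩ := Nat.exists_eq_add_of_le hn0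
      have := hall (2 ^ p * l) (by rw [hp, pow_add, mul_comm]; exact Nat.mul_le_mul_right _ hl)
      rwa [hp, pt_ref] at this
  · refine tendsto_const_nhds.congr fun n => ?_
    have := (rfl1_inv (a := fun l => Y (pt (n + k) l) ω) (N := 2 ^ (n + k)) (hs (n + k)) (ε := ∑ i ∈ Finset.range (2 ^ (n + k)), |Y (pt (n + k) (i + 1)) ω - Y (pt (n + k) i) ω|) (Finset.sum_nonneg fun _ _ => abs_nonneg _)
      (fun i hi => Finset.single_le_sum (f := fun i => |Y (pt (n + k) (i + 1)) ω - Y (pt (n + k) i) ω|) (fun _ _ => abs_nonneg _) (Finset.mem_range.2 hi)) (2 ^ (n + k)) le_rfl).1 (fun l hl => ?_)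
    · rw [this, pt_top]
    · by_contra hc
      exact hh ⟨n + k, l, hl, hc⟩

lemma mR (T : Tan μ G Y W V y) (s0 : ℝ) (N i : ℕ) (c : ℕ → Ω → ℝ) : Measurable[G (pt N i)] (fun ω => pS y (fun i => (chi s0 (fun l => Y (pt N l) ω) i * dd Y N i ω, c i ω)) i) := by
  unfold pS
  refine measurable_const.add (Finset.measurable_fun_sum _ fun l hl => ?_)
  have hl := Finset.mem_range.1 hl
  exact ((T.chiM s0 N l).mono (T.hB.mono (pt_mono N hl.le)) le_rfl).mul
    (((T.mY _ (pt_nonneg _ _)).mono (T.hB.mono (pt_mono N hl)) le_rfl).sub ((T.mY _ (pt_nonneg _ _)).mono (T.hB.mono (pt_mono N hl.le)) le_rfl))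

lemma misR (T : Tan μ G Y W V y) (k : ℕ) :
    Tendsto (fun n : ℕ => ∑ i ∈ Finset.range (2 ^ (n + k)), (1 / 2 ^ (n + k)) * μ.real {ω |
      psgn (pS y (fun i => (chi (psgn y) (fun l => Y (pt (n + k) l) ω) i * dd Y (n + k) i ω, dd V (n + k) i ω)) i) * chi (psgn y) (fun l => Y (pt (n + k) l) ω) i ≠ psgn (Y (pt (n + k) i) ω)}) atTop (𝓝 0) := by
  let R : ℕ → ℕ → Ω → ℝ := fun n i ω => pS y (fun i => (chi (psgn y) (fun l => Y (pt (n + k) l) ω) i * dd Y (n + k) i ω, dd V (n + k) i ω)) i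
  let c : ℕ → ℕ → Ω → ℝ := fun n i ω => chi (psgn y) (fun l => Y (pt (n + k) l) ω) i
  let Z : ℕ → ℕ → Ω → ℝ := fun n i ω => c n i ω * R n i ω + psgn (R n i ω) * c n i ω * (1 / 2 ^ n)
  have mRm : ∀ n i, Measurable (R n i) := fun n i => (T.mR _ _ _ _).mono (T.hB.le _) le_rfl
  have mc : ∀ n i, Measurable (c n i) := fun n i => (T.chiM _ _ _).mono (T.hB.le _) le_rfl
  have := T.mism0 (N := fun n => n + k) (fun n s => Z n ⌊s * 2 ^ (n + k)⌋₊) (tendsto_add_atTop_nat k) (fun s hs hst => ?_)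
  · refine this.congr fun n => Finset.sum_congr rfl fun i _ => ?_
    have : ⌊pt (n + k) i * 2 ^ (n + k)⌋₊ = i := by
      rw [pt, div_mul_cancel₀ _ (by positivity), Nat.floor_natCast]
    rw [this]
    congr 2
    ext ω
    simp only [Set.mem_setOf_eq, Z]
    rw [psgn_pert (chi_pm _ _ _) (by positivity)]
  · refine tendstoInMeasure_of_tendsto_ae (fun n => (((mc _ _).mul (mRm _ _)).add (((psgn_meas.comp (mRm _ _)).mul (mc _ _)).mul_const _)).aestronglyMeasurable) ?_
    filter_upwards [T.y0] with ω hω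
    have hY := ((T.cY ω).tendsto s).comp ((gr_tendsto one_pos hs.le).comp (tendsto_add_atTop_nat k))
    have e : ∀ N, pt N ⌊gr 1 N s * 2 ^ N⌋₊ = gr 1 N s := fun N => by
      have : gr 1 N s * 2 ^ N = ⌊s * 2 ^ N / 1⌋₊ := by rw [gr]; field_simp
      rw [this, Nat.floor_natCast, pt, gr, one_mul]
    have hi : ∀ N, ⌊gr 1 N s * 2 ^ N⌋₊ ≤ 2 ^ N := fun N => by
      have h1 : gr 1 N s * 2 ^ N = ⌊s * 2 ^ N / 1⌋₊ := by rw [gr]; field_simp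
      rw [h1, Nat.floor_natCast, div_one]
      refine Nat.floor_le_of_le ?_
      push_cast
      exact mul_le_of_le_one_left (by positivity) hst.le
    have hR : ∀ n i, R n i ω = rfl1 (psgn y) (fun l => Y (pt (n + k) l) ω) i := fun n i => T.pSR hω _ _ _ _
    have hd : Tendsto (fun n => c n ⌊gr 1 (n + k) s * 2 ^ (n + k)⌋₊ ω * R n ⌊gr 1 (n + k) s * 2 ^ (n + k)⌋₊ ω - Y (gr 1 (n + k) s) ω) atTop (𝓝 0) := by
      rw [Metric.tendsto_atTop']
      intro ε hε
      have ho := (tendsto_add_atTop_nat k).eventually (osc (T.cY ω) (show 0 < ε / 3 by positivity))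
      obtain ⟨M, hM⟩ := eventually_atTop.1 ho
      refine ⟨M, fun n hn => ?_⟩
      have := chi_rfl1 (a := fun l => Y (pt (n + k) l) ω) (s0 := psgn y) (by simp only [pt_zero, hω]) (show 0 ≤ ε / 3 by positivity) (hM n hn.le) _ (hi (n + k))
      rw [e, ← hR] at this
      rw [Real.dist_eq, sub_zero]
      exact this.trans_lt (by linarith)
    have hp : Tendsto (fun n => psgn (R n ⌊gr 1 (n + k) s * 2 ^ (n + k)⌋₊ ω) * c n ⌊gr 1 (n + k) s * 2 ^ (n + k)⌋₊ ω * (1 / 2 ^ n)) atTop (𝓝 0) := by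
      rw [tendsto_zero_iff_abs_tendsto_zero]
      refine (half_tendsto 1).congr fun n => ?_
      simp only [Function.comp]
      rcases psgn_pm (R n ⌊gr 1 (n + k) s * 2 ^ (n + k)⌋₊ ω) with e | e <;> rcases chi_pm (psgn y) (fun l => Y (pt (n + k) l) ω) ⌊gr 1 (n + k) s * 2 ^ (n + k)⌋₊ with e' | e' <;> simp only [c] <;> rw [e, e'] <;> simp
    have h3 := (hd.add hp).add hY
    rw [zero_add, zero_add] at h3
    refine h3.congr fun n => ?_
    simp only [Z, Function.comp]
    ring

lemma limB (T : Tan μ G Y W V y) (k : ℕ) :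
    TendstoInMeasure μ (fun n ω => Phi y n k (fun i => (chi (psgn y) (fun l => Y (pt (n + k) l) ω) i * dd Y (n + k) i ω, dd V (n + k) i ω))) atTop
      (fun ω => (Yr Y (psgn y) ω, fun j : Fin (2 ^ k + 1) => (W (pt k j.1) ω - W 0 ω, V (pt k j.1) ω - V 0 ω))) := by
  refine tim_prod ?_ (tim_pi fun j => tim_prod ?_ ?_)
  · refine tendstoInMeasure_of_tendsto_ae (fun n => ((T.mR _ _ _ _).mono (T.hB.le _) le_rfl).aestronglyMeasurable) ?_
    filter_upwards [T.y0] with ω hω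
    simp only [T.pSR hω]
    exact T.limR1 hω k
  · have hj := Nat.lt_succ_iff.1 j.2
    have key := fun n => (T.incY (n + k)).diffsq
      (p := fun i ω => psgn (pS y (fun i => (chi (psgn y) (fun l => Y (pt (n + k) l) ω) i * dd Y (n + k) i ω, dd V (n + k) i ω)) i) * chi (psgn y) (fun l => Y (pt (n + k) l) ω) i)
      (q := fun i ω => psgn (Y (pt (n + k) i) ω))
      (fun i _ => (psgn_meas.comp (T.mR _ _ _ _)).mul (T.chiM _ _ _)) (fun i _ => T.psY (pt_nonneg _ _) le_rfl)
      (fun i ω => by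
        rcases psgn_pm (pS y (fun i => (chi (psgn y) (fun l => Y (pt (n + k) l) ω) i * dd Y (n + k) i ω, dd V (n + k) i ω)) i) with e | e <;>
        rcases chi_pm (psgn y) (fun l => Y (pt (n + k) l) ω) i with e' | e' <;> rw [e, e'] <;> norm_num) (fun _ _ => psgn_pm _) (jn n hj)
    have hd : ∀ n ω, ∑ i ∈ Finset.range (j.1 * 2 ^ n), psgn (pS y (fun i => (chi (psgn y) (fun l => Y (pt (n + k) l) ω) i * dd Y (n + k) i ω, dd V (n + k) i ω)) i) * (chi (psgn y) (fun l => Y (pt (n + k) l) ω) i * dd Y (n + k) i ω)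
        - ∑ i ∈ Finset.range (j.1 * 2 ^ n), psgn (Y (pt (n + k) i) ω) * dd Y (n + k) i ω =
        ∑ i ∈ Finset.range (j.1 * 2 ^ n), (psgn (pS y (fun i => (chi (psgn y) (fun l => Y (pt (n + k) l) ω) i * dd Y (n + k) i ω, dd V (n + k) i ω)) i) * chi (psgn y) (fun l => Y (pt (n + k) l) ω) i - psgn (Y (pt (n + k) i) ω)) * dd Y (n + k) i ω := fun n ω => by
      rw [← Finset.sum_sub_distrib]
      exact Finset.sum_congr rfl fun i _ => by ring
    refine tim_diff (T.tW k j.1 hj) (fun n => ?_) ?_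
    · simp only [hd]; exact (key n).1
    · simp only [hd]
      have h4 := (T.misR k).const_mul 4
      rw [mul_zero] at h4
      exact tendsto_of_tendsto_of_tendsto_of_le_of_le tendsto_const_nhds h4 (fun _ => integral_nonneg fun _ => sq_nonneg _) (fun n => (key n).2)
  · exact (tim_const (μ := μ) (fun ω => V (pt k j.1) ω - V 0 ω)).congr (fun n => ae_of_all _ fun ω => (vsum V n k j.1 ω).symm) (ae_of_all _ fun _ => rfl)

def DD (W V : ℝ → Ω → ℝ) (k : ℕ) (ω : Ω) : Fin (2 ^ k + 1) → ℝ × ℝ := fun j => (W (pt k j.1) ω - W 0 ω, V (pt k j.1) ω - V 0 ω)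

lemma lawDD (T : Tan μ G Y W V y) (k : ℕ) : μ.map (fun ω => (Y 1 ω, DD W V k ω)) = μ.map (fun ω => (Yr Y (psgn y) ω, DD W V k ω)) := by
  have mz : ∀ n, ∀ {Z : ℕ → Ω → ℝ × ℝ}, (∀ j < 2 ^ (n + k), Measurable (Z j)) → Measurable (fun ω => Phi y n k (fun i => Z i ω)) := fun n {Z} hZ => by
    have : Measurable (fun ω => fun i : ℕ => if i < 2 ^ (n + k) then Z i ω else 0) :=
      measurable_pi_lambda _ fun i => by
        by_cases hi : i < 2 ^ (n + k)
        · simpa [hi] using hZ i hi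
        · simpa [hi] using measurable_const
    simpa only [Function.comp_def, Phi_trunc] using (Phi_meas y n k).comp this
  exact law_lim (fun n => (mz n fun j hj => ((T.incY (n + k)).cl j hj).meas).aemeasurable) (fun n => (mz n fun j hj => ((T.incR (psgn y) (n + k)).cl j hj).meas).aemeasurable)
    (fun n => T.law_n (psgn y) n k) (T.limA k) (T.limB k)
end Tan
end

section

namespace Tan
variable {μ : Measure Ω} [IsProbabilityMeasure μ] {G : ℝ → MeasurableSpace Ω} {Y W V : ℝ → Ω → ℝ} {y : ℝ}

/-- sigma-algebra of the dyadic values -/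
def sD (W V : ℝ → Ω → ℝ) (k : ℕ) : MeasurableSpace Ω := MeasurableSpace.comap (DD W V k) inferInstance

lemma sD_mono (W V : ℝ → Ω → ℝ) : Monotone (sD W V) := by
  refine monotone_nat_of_le_succ fun k => ?_
  have h : DD W V k = (fun (z : Fin (2 ^ (k + 1) + 1) → ℝ × ℝ) (j : Fin (2 ^ k + 1)) => z ⟨2 * j.1, by have := j.2; rw [pow_succ]; omega⟩) ∘ DD W V (k + 1) := by
    funext ω j
    simp only [DD, Function.comp]
    have := pt_ref k j.1 1
    rw [pow_one] at this
    rw [this]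
  rw [sD, h, ← MeasurableSpace.comap_comp]
  refine MeasurableSpace.comap_mono ?_
  refine Measurable.comap_le ?_
  exact measurable_pi_lambda _ fun j => measurable_pi_apply _

lemma DD_meas (T : Tan μ G Y W V y) (k : ℕ) : Measurable (DD W V k) := by
  refine measurable_pi_lambda _ fun j => ?_
  have hj := Nat.lt_succ_iff.1 j.2
  exact (((T.hB.m1 _ (pt_nonneg _ _) (pt_le hj)).mono (T.hB.le _) le_rfl).sub ((T.hB.m1 _ le_rfl zero_le_one).mono (T.hB.le _) le_rfl)).prodMk
    (((T.hB.m2 _ (pt_nonneg _ _) (pt_le hj)).mono (T.hB.le _) le_rfl).sub ((T.hB.m2 _ le_rfl zero_le_one).mono (T.hB.le _) le_rfl))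

lemma Yr_meas (T : Tan μ G Y W V y) (s0 : ℝ) : Measurable (Yr Y s0) := by
  unfold Yr
  refine Measurable.ite ?_ (T.mYm zero_le_one).neg (T.mYm zero_le_one)
  have : {a | a ∈ hit Y s0} = ⋃ n : ℕ, ⋃ l ∈ Finset.range (2 ^ n + 1), {ω | ¬ 0 < s0 * Y (pt n l) ω} := by
    ext ω; simp only [hit, Set.mem_setOf_eq, Set.mem_iUnion, Finset.mem_range, Nat.lt_succ_iff, exists_prop]
  rw [this]
  refine MeasurableSet.iUnion fun n => Finset.measurableSet_biUnion _ fun l _ => ?_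
  exact (measurableSet_lt measurable_const ((T.mYm (pt_nonneg _ _)).const_mul s0)).compl

lemma contra (T : Tan μ G Y W V y) {S : Set Ω} (hS : MeasurableSet[⨆ k, sD W V k] S) (hae : {ω | psgn y * Y 1 ω < 0} =ᵐ[μ] S) : False := by
  let A : Set Ω := {ω | psgn y * Y 1 ω < 0}
  let A' : Set Ω := {ω | psgn y * Yr Y (psgn y) ω < 0}
  have mA : MeasurableSet A := measurableSet_lt ((T.mYm zero_le_one).const_mul _) measurable_const
  have mA' : MeasurableSet A' := measurableSet_lt ((T.Yr_meas _).const_mul _) measurable_const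
  have hle : (⨆ k, sD W V k) ≤ m := iSup_le fun k => (T.DD_meas k).comap_le
  have hk : ∀ k, ∀ S, MeasurableSet[sD W V k] S → μ (S ∩ A) = μ (S ∩ A') := fun k S hS => by
    obtain ⟨D, hD, rfl⟩ := hS
    have mB : MeasurableSet {p : ℝ × (Fin (2 ^ k + 1) → ℝ × ℝ) | p.2 ∈ D ∧ psgn y * p.1 < 0} :=
      (measurable_snd hD).inter (measurableSet_lt (measurable_fst.const_mul _) measurable_const)
    have h := congrArg (fun ν => ν {p : ℝ × (Fin (2 ^ k + 1) → ℝ × ℝ) | p.2 ∈ D ∧ psgn y * p.1 < 0}) (T.lawDD k)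
    beta_reduce at h
    rw [Measure.map_apply ((T.mYm zero_le_one).prodMk (T.DD_meas k)) mB, Measure.map_apply ((T.Yr_meas _).prodMk (T.DD_meas k)) mB] at h
    exact h
  have hall : ∀ S, MeasurableSet[⨆ k, sD W V k] S → μ (S ∩ A) = μ (S ∩ A') := by
    have := ext_of_generate_finite (m0 := ⨆ k, sD W V k) (μ := (μ.restrict A).trim hle) (ν := (μ.restrict A').trim hle) (⋃ k, {t | MeasurableSet[sD W V k] t})
      (MeasurableSpace.generateFrom_iUnion_measurableSet _).symm
      (isPiSystem_iUnion_of_monotone _ (fun k => @MeasurableSpace.isPiSystem_measurableSet _ (sD W V k)) (fun i j hij => sD_mono W V hij)) (fun s hs => ?_) ?_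
    · intro S hS
      have h1 := congrArg (fun ν => ν S) this
      beta_reduce at h1
      rwa [trim_measurableSet_eq hle hS, trim_measurableSet_eq hle hS, Measure.restrict_apply (hle _ hS), Measure.restrict_apply (hle _ hS)] at h1
    · obtain ⟨k, hs⟩ := Set.mem_iUnion.1 hs
      have hs' : MeasurableSet[⨆ k, sD W V k] s := le_iSup (sD W V) k _ hs
      rw [trim_measurableSet_eq hle hs', trim_measurableSet_eq hle hs', Measure.restrict_apply (hle _ hs'), Measure.restrict_apply (hle _ hs')]
      exact hk k s hs
    · rw [trim_measurableSet_eq hle MeasurableSet.univ, trim_measurableSet_eq hle MeasurableSet.univ, Measure.restrict_apply MeasurableSet.univ, Measure.restrict_apply MeasurableSet.univ]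
      exact hk 0 _ (@MeasurableSet.univ _ (sD W V 0))
  have h1 := hall S hS
  have h2 : μ (S ∩ A) = μ A := measure_congr (by
    filter_upwards [hae] with ω hω
    have hω : (ω ∈ A) = (ω ∈ S) := hω
    exact propext ⟨fun h => h.2, fun h => ⟨hω ▸ h, h⟩⟩)
  have h3 : μ (S ∩ A') = 0 := by
    rw [measure_congr (t := A ∩ A') (by
      filter_upwards [hae] with ω hω
      have hω : (ω ∈ A) = (ω ∈ S) := hω
      exact propext ⟨fun h => ⟨hω ▸ h.1, h.2⟩, fun h => ⟨hω ▸ h.1, h.2⟩⟩)]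
    rw [show A ∩ A' = ∅ from ?_, measure_empty]
    ext ω
    simp only [A, A', Set.mem_inter_iff, Set.mem_setOf_eq, Set.mem_empty_iff_false, iff_false, not_and, not_lt]
    intro h
    have : ω ∈ hit Y (psgn y) := ⟨0, 1, le_rfl, by simp only [pt]; norm_num; exact h.le⟩
    rw [Yr, if_pos this]; linarith
  have h4 : 0 < μ A := by
    have i0 := ((T.incY 0).cl 0 (by norm_num))
    have l := i0.law
    have l1 : μ.map (dd Y 0 0) = gam 1 := by
      have := congrArg (fun ν => ν.map Prod.fst) l
      beta_reduce at this
      rw [Measure.map_map measurable_fst i0.meas, gam2_fst] at this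
      simpa [Function.comp_def] using this
    have md : Measurable (dd Y 0 0) := (T.mYm (pt_nonneg _ _)).sub (T.mYm (pt_nonneg _ _))
    have e : ∀ᵐ ω ∂μ, Y 1 ω = y + dd Y 0 0 ω := by
      filter_upwards [T.y0] with ω h
      simp [dd, pt, h]
    rcases psgn_pm y with hp | hp
    · have : μ A = gam 1 (Iio (-y)) := by
        rw [← l1, Measure.map_apply md measurableSet_Iio]
        refine measure_congr ?_
        filter_upwards [e] with ω h
        refine propext ⟨fun h' => ?_, fun h' => ?_⟩
        · have h' : psgn y * Y 1 ω < 0 := h'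
          rw [hp, h] at h'
          show dd Y 0 0 ω < -y
          linarith
        · have h' : dd Y 0 0 ω < -y := h'
          show psgn y * Y 1 ω < 0
          rw [hp, h]; linarith
      rw [this]; exact gam_Iio_pos one_pos _
    · have : μ A = gam 1 (Ioi (-y)) := by
        rw [← l1, Measure.map_apply md measurableSet_Ioi]
        refine measure_congr ?_
        filter_upwards [e] with ω h
        refine propext ⟨fun h' => ?_, fun h' => ?_⟩
        · have h' : psgn y * Y 1 ω < 0 := h'
          rw [hp, h] at h'
          show -y < dd Y 0 0 ω
          linarith
        · have h' : -y < dd Y 0 0 ω := h'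
          show psgn y * Y 1 ω < 0
          rw [hp, h]; linarith
      rw [this]; exact gam_Ioi_pos one_pos _
  rw [h2, h3] at h1
  exact h4.ne' h1
end Tan
end

section

lemma CL.lint {Ω E : Type*} {𝒢 : MeasurableSpace Ω} [m : MeasurableSpace Ω] [MeasurableSpace E] {μ : Measure Ω} [IsProbabilityMeasure μ] {Z : Ω → E} {ν : Measure E}
    (h : CL 𝒢 μ Z ν) (h𝒢 : 𝒢 ≤ m) {u : Ω → ENNReal} (hu : Measurable[𝒢] u) {f : E → ENNReal} (hf : Measurable f) :
    ∫⁻ ω, u ω * f (Z ω) ∂μ = (∫⁻ ω, u ω ∂μ) * ∫⁻ z, f z ∂ν := by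
  have := h.prob
  have hp := h.map_prod h𝒢 hu
  have hum : Measurable u := hu.mono h𝒢 le_rfl
  have e1 : ∫⁻ ω, u ω * f (Z ω) ∂μ = ∫⁻ p, p.1 * f p.2 ∂(μ.map (fun ω => (u ω, Z ω))) := by
    exact (lintegral_map (f := fun p : ENNReal × E => p.1 * f p.2) (measurable_fst.mul (hf.comp measurable_snd)) (hum.prodMk h.meas)).symm
  have : IsProbabilityMeasure (μ.map u) := Measure.isProbabilityMeasure_map hum.aemeasurable
  rw [e1, hp, lintegral_prod_mul (f := fun x => x) measurable_id.aemeasurable hf.aemeasurable, lintegral_map (f := fun x : ENNReal => x) measurable_id hum]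

lemma gam2_shift {v : ℝ} (hv : 0 ≤ v) (l : ℝ) {f : ℝ × ℝ → ENNReal} (hf : Measurable f) :
    ∫⁻ p, f (p.1 - l * v, p.2) * ENNReal.ofReal (Real.exp (l * p.1 - l ^ 2 * v / 2)) ∂(gam2 v) = ∫⁻ p, f p ∂(gam2 v) := by
  have me : Measurable (fun p : ℝ × ℝ => ENNReal.ofReal (Real.exp (l * p.1 - l ^ 2 * v / 2))) := by fun_prop
  unfold gam2
  rw [lintegral_prod_symm _ (by
    exact ((hf.comp ((measurable_fst.sub_const _).prodMk measurable_snd)).mul me).aemeasurable), lintegral_prod_symm _ hf.aemeasurable]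
  refine lintegral_congr fun y => ?_
  exact gam_shift hv l (f := fun x => f (x, y)) (hf.comp (measurable_id.prodMk measurable_const))

section
variable {μ : Measure Ω} [IsProbabilityMeasure μ] {G : ℝ → MeasurableSpace Ω} {W V : ℝ → Ω → ℝ}

def ge (W : ℝ → Ω → ℝ) (l s t : ℝ) (ω : Ω) : ENNReal := ENNReal.ofReal (Real.exp (l * (W t ω - W s ω) - l ^ 2 * (t - s) / 2))

lemma ge_mul (W : ℝ → Ω → ℝ) (l r s t : ℝ) (ω : Ω) : ge W l r s ω * ge W l s t ω = ge W l r t ω := by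
  unfold ge
  rw [← ENNReal.ofReal_mul (Real.exp_nonneg _), ← Real.exp_add]
  congr 2; ring

lemma ge_meas (h : PBM μ G W V 1) (l : ℝ) {s t : ℝ} (hs : 0 ≤ s) (hst : s ≤ t) (ht : t ≤ 1) : Measurable[G t] (ge W l s t) := by
  have h1 : Measurable[G t] (fun ω => W t ω - W s ω) := (h.m1 t (hs.trans hst) ht).sub ((h.m1 s hs (hst.trans ht)).mono (h.mono hst) le_rfl)
  exact ENNReal.measurable_ofReal.comp (Real.measurable_exp.comp ((h1.const_mul l).sub_const _))

def gir (μ : Measure Ω) (W : ℝ → Ω → ℝ) (l : ℝ) : Measure Ω := μ.withDensity (ge W l 0 1)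

lemma gir0 (h : PBM μ G W V 1) (l : ℝ) {s t : ℝ} (hs : 0 ≤ s) (hst : s ≤ t) (ht : t ≤ 1) {A : Set Ω} (hA : MeasurableSet[G s] A) {B : Set (ℝ × ℝ)} (hB : MeasurableSet B) :
    gir μ W l (A ∩ (fun ω => (W t ω - l * t - (W s ω - l * s), V t ω - V s ω)) ⁻¹' B) = (∫⁻ ω, A.indicator (ge W l 0 s) ω ∂μ) * gam2 (t - s) B := by
  have ht0 := hs.trans hst
  have hs1 := hst.trans ht
  have me : Measurable (fun p : ℝ × ℝ => ENNReal.ofReal (Real.exp (l * p.1 - l ^ 2 * (t - s) / 2))) := by fun_prop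
  have me' : Measurable (fun p : ℝ × ℝ => ENNReal.ofReal (Real.exp (l * p.1 - l ^ 2 * (1 - t) / 2))) := by fun_prop
  have mZ : Measurable[G t] (fun ω => (W t ω - W s ω, V t ω - V s ω)) :=
    ((h.m1 t ht0 ht).sub ((h.m1 s hs hs1).mono (h.mono hst) le_rfl)).prodMk ((h.m2 t ht0 ht).sub ((h.m2 s hs hs1).mono (h.mono hst) le_rfl))
  have eZ : (fun ω => (W t ω - l * t - (W s ω - l * s), V t ω - V s ω)) = (fun p : ℝ × ℝ => (p.1 - l * (t - s), p.2)) ∘ (fun ω => (W t ω - W s ω, V t ω - V s ω)) := by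
    funext ω; simp only [Function.comp]; congr 1; ring
  have mI : Measurable (B.indicator (fun _ => (1:ENNReal))) := measurable_const.indicator hB
  let g : ℝ × ℝ → ENNReal := fun p => B.indicator (fun _ => (1:ENNReal)) (p.1 - l * (t - s), p.2) * ENNReal.ofReal (Real.exp (l * p.1 - l ^ 2 * (t - s) / 2))
  have mg : Measurable g := (mI.comp ((measurable_fst.sub_const _).prodMk measurable_snd)).mul me
  have mu : Measurable[G s] (A.indicator (ge W l 0 s)) := (ge_meas h l le_rfl hs hs1).indicator hA
  have c1 := (h.cl s t hs hst ht).lint (h.le s) mu mg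
  have c2 := (h.cl t 1 ht0 ht le_rfl).lint (h.le t) (u := fun ω => A.indicator (ge W l 0 s) ω * g (W t ω - W s ω, V t ω - V s ω)) ((mu.mono (h.mono hst) le_rfl).mul (mg.comp mZ)) me'
  have i1 := gam2_shift (v := t - s) (by linarith) l mI
  have i2 := gam2_shift (v := 1 - t) (by linarith) l (f := fun _ => 1) measurable_const
  have : IsProbabilityMeasure (gam2 (1 - t)) := (h.cl t 1 ht0 ht le_rfl).prob
  simp only [one_mul, lintegral_const, measure_univ] at i2
  rw [lintegral_indicator_const hB, one_mul] at i1
  have hset : MeasurableSet (A ∩ (fun ω => (W t ω - l * t - (W s ω - l * s), V t ω - V s ω)) ⁻¹' B) := by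
    refine (h.le s _ hA).inter ?_
    rw [eZ]
    exact (((measurable_fst.sub_const _).prodMk measurable_snd).comp (mZ.mono (h.le t) le_rfl)) hB
  rw [gir, withDensity_apply _ hset, ← lintegral_indicator hset, ← i1, ← c1]
  rw [i2, mul_one] at c2
  rw [← c2]
  refine lintegral_congr fun ω => ?_
  have e2 : ENNReal.ofReal (Real.exp (l * (W 1 ω - W t ω) - l ^ 2 * (1 - t) / 2)) = ge W l t 1 ω := rfl
  have e3 : ENNReal.ofReal (Real.exp (l * (W t ω - W s ω) - l ^ 2 * (t - s) / 2)) = ge W l s t ω := rfl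
  have e4 : l * (t - s) = l * t - l * s := by ring
  have e5 : W t ω - l * t - (W s ω - l * s) = W t ω - W s ω - l * (t - s) := by ring
  simp only [g, e2, e3]
  by_cases hωA : ω ∈ A
  · by_cases hωB : (W t ω - W s ω - l * (t - s), V t ω - V s ω) ∈ B
    · rw [Set.indicator_of_mem (show ω ∈ A ∩ _ from ⟨hωA, by show (_, _) ∈ B; rwa [e5]⟩), Set.indicator_of_mem hωA, Set.indicator_of_mem hωB, one_mul, ge_mul, ge_mul]
    · rw [Set.indicator_of_notMem (fun hc => hωB (by have : (_, _) ∈ B := hc.2; rwa [e5] at this)), Set.indicator_of_notMem hωB]; simp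
  · rw [Set.indicator_of_notMem (fun hc => hωA hc.1), Set.indicator_of_notMem hωA]; simp

lemma gir_prob (h : PBM μ G W V 1) (l : ℝ) : IsProbabilityMeasure (gir μ W l) := by
  have := gir0 h l le_rfl le_rfl zero_le_one (@MeasurableSet.univ _ (G 0)) MeasurableSet.univ
  have : IsProbabilityMeasure (gam2 (0 - 0)) := (h.cl 0 0 le_rfl le_rfl zero_le_one).prob
  constructor
  simp_all [ge]

lemma gir_ac (μ : Measure Ω) (W : ℝ → Ω → ℝ) (l : ℝ) : gir μ W l ≪ μ := withDensity_absolutelyContinuous _ _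

lemma gir_pbm (h : PBM μ G W V 1) (l : ℝ) : PBM (gir μ W l) G (fun t ω => W t ω - l * t) V 1 := by
  refine ⟨h.le, h.mono, fun t h0 h1 => (h.m1 t h0 h1).sub_const _, h.m2, fun s t hs hst ht => ⟨?_, fun A hA B hB => ?_⟩⟩
  · have a1 : ∀ r, 0 ≤ r → r ≤ 1 → Measurable (W r) := fun r h0 h1 => (h.m1 r h0 h1).mono (h.le r) le_rfl
    have a2 : ∀ r, 0 ≤ r → r ≤ 1 → Measurable (V r) := fun r h0 h1 => (h.m2 r h0 h1).mono (h.le r) le_rfl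
    exact (((a1 t (hs.trans hst) ht).sub_const _).sub ((a1 s hs (hst.trans ht)).sub_const _)).prodMk ((a2 t (hs.trans hst) ht).sub (a2 s hs (hst.trans ht)))
  · have : IsProbabilityMeasure (gam2 (t - s)) := (h.cl s t hs hst ht).prob
    have h1 := gir0 h l hs hst ht hA MeasurableSet.univ
    rw [Set.preimage_univ, Set.inter_univ, measure_univ, mul_one] at h1
    rw [gir0 h l hs hst ht hA hB, h1]

lemma tim_ac {Q : Measure Ω} [IsProbabilityMeasure Q] (hQ : Q ≪ μ) {f : ℕ → Ω → ℝ} {g : Ω → ℝ} (hf : ∀ n, Measurable (f n)) (h : TendstoInMeasure μ f atTop g) : TendstoInMeasure Q f atTop g := by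
  have : ∀ ns : ℕ → ℕ, StrictMono ns → ∃ ns' : ℕ → ℕ, StrictMono ns' ∧ ∀ᵐ ω ∂Q, Tendsto (fun i => f (ns (ns' i)) ω) atTop (𝓝 (g ω)) := fun ns hns => by
    obtain ⟨ns', h1, h2⟩ := (h.comp hns.tendsto_atTop).exists_seq_tendsto_ae
    exact ⟨ns', h1, hQ.ae_le h2⟩
  exact (exists_seq_tendstoInMeasure_atTop_iff (fun n => (hf n).aestronglyMeasurable)).2 this
end
end

section

structure Drf (μ : Measure Ω) (G : ℝ → MeasurableSpace Ω) (Y W V I : ℝ → Ω → ℝ) (y lam : ℝ) : Prop where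
  hl : 0 ≤ lam
  hB : ∀ T, PBM μ G W V T
  mY : ∀ t, 0 ≤ t → Measurable[G t] (Y t)
  cY : ∀ ω, Continuous fun t => Y t ω
  y0 : ∀ᵐ ω ∂μ, Y 0 ω = y
  sol : ∀ t, 0 ≤ t → TendstoInMeasure μ (fun n => rsum (fun s ω => psgn (Y s ω)) W t n) atTop (I t)
  eq : ∀ᵐ ω ∂μ, ∀ t, 0 ≤ t → Y t ω = y - lam * (∫ s in (0:ℝ)..t, psgn (Y s ω)) + I t ω

namespace Drf
variable {μ : Measure Ω} [IsProbabilityMeasure μ] {G : ℝ → MeasurableSpace Ω} {Y W V I : ℝ → Ω → ℝ} {y lam : ℝ}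

lemma mYm (D : Drf μ G Y W V I y lam) {t : ℝ} (ht : 0 ≤ t) : Measurable (Y t) := (D.mY t ht).mono ((D.hB 1).le t) le_rfl

lemma grid_nn {t : ℝ} (ht : 0 ≤ t) (n i : ℕ) : 0 ≤ t * i / 2 ^ n := by positivity
lemma grid_le {t : ℝ} (ht : 0 ≤ t) {n i j : ℕ} (h : i ≤ j) : t * i / 2 ^ n ≤ t * j / 2 ^ n := by
  have : (i:ℝ) ≤ j := by exact_mod_cast h
  gcongr
lemma grid_top (t : ℝ) (n : ℕ) : t * ((2 ^ n : ℕ) : ℝ) / 2 ^ n = t := by push_cast; field_simp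

lemma mterm (D : Drf μ G Y W V I y lam) {t : ℝ} (ht : 0 ≤ t) (n i : ℕ) {r : ℝ} (hr : t * (i + 1 : ℕ) / 2 ^ n ≤ r) :
    Measurable[G r] (fun ω => psgn (Y (t * i / 2 ^ n) ω) * (W (t * (i + 1) / 2 ^ n) ω - W (t * i / 2 ^ n) ω)) := by
  have h1 : t * i / 2 ^ n ≤ r := (grid_le ht (Nat.le_succ i)).trans hr
  push_cast at hr
  have nn : 0 ≤ t * (i + 1) / 2 ^ n := by positivity
  exact (psgn_meas.comp ((D.mY _ (grid_nn ht n i)).mono ((D.hB 1).mono h1) le_rfl)).mul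
    ((((D.hB r).m1 _ nn hr).mono ((D.hB 1).mono hr) le_rfl).sub (((D.hB r).m1 _ (grid_nn ht n i) h1).mono ((D.hB 1).mono h1) le_rfl))

lemma mrsum (D : Drf μ G Y W V I y lam) {t : ℝ} (ht : 0 ≤ t) (n : ℕ) : Measurable[G t] (fun ω => rsum (fun s ω => psgn (Y s ω)) W t n ω) := by
  unfold rsum
  refine Finset.measurable_fun_sum _ fun i hi => D.mterm ht n i ?_
  exact (grid_le ht (Finset.mem_range.1 hi)).trans_eq (grid_top t n)

lemma psint (D : Drf μ G Y W V I y lam) (ω : Ω) (a b : ℝ) : IntervalIntegrable (fun s => psgn (Y s ω)) volume a b := by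
  refine (intervalIntegrable_const (c := (1:ℝ))).mono_fun (psgn_meas.comp (D.cY ω).measurable).aestronglyMeasurable (ae_of_all _ fun s => ?_)
  rcases psgn_pm (Y s ω) with e | e <;> simp [e]

lemma zero (D : Drf μ G Y W V I y lam) {t : ℝ} (ht : 0 < t) : μ {ω | Y t ω = 0} = 0 := by
  refine zero_of_small D.hl ht fun v hv hvt ⟨k, hk⟩ => ?_
  set s := t - v with hs
  have hs0 : 0 ≤ s := by linarith
  have h2k : 1 ≤ 2 ^ k := Nat.one_le_two_pow
  let i0 : ℕ → ℕ := fun n => 2 ^ n * (2 ^ k - 1)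
  have hi0 : ∀ n, i0 n + 2 ^ n = 2 ^ (n + k) := fun n => by
    simp only [i0]; rw [← Nat.mul_succ, Nat.succ_eq_add_one, Nat.sub_add_cancel h2k, pow_add]
  have gs : ∀ n, t * (i0 n : ℕ) / 2 ^ (n + k) = s := fun n => by
    have h1 : ((i0 n : ℕ) : ℝ) = 2 ^ (n + k) - 2 ^ n := by
      have := hi0 n
      have h' : ((i0 n : ℕ) : ℝ) + 2 ^ n = 2 ^ (n + k) := by exact_mod_cast this
      linarith
    rw [h1, hs, hk, pow_add]; field_simp
  let tm : ℕ → ℕ → Ω → ℝ := fun n i ω => psgn (Y (t * i / 2 ^ (n + k)) ω) * (W (t * (i + 1) / 2 ^ (n + k)) ω - W (t * i / 2 ^ (n + k)) ω)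
  let A : ℕ → Ω → ℝ := fun n ω => ∑ i ∈ Finset.range (i0 n), tm n i ω
  let B : ℕ → Ω → ℝ := fun n ω => ∑ i ∈ Finset.range (2 ^ n), tm n (i0 n + i) ω
  let C : ℕ → Ω → ℝ := fun n ω => Y s ω - rsum (fun s ω => psgn (Y s ω)) W s n ω + A n ω
  have hAB : ∀ n ω, A n ω + B n ω = rsum (fun s ω => psgn (Y s ω)) W t (n + k) ω := fun n ω => by
    simp only [A, B, rsum]
    rw [← hi0 n, Finset.sum_range_add]
  have hlim : TendstoInMeasure μ (fun n ω => C n ω + B n ω) atTop (fun ω => Y t ω + lam * ∫ r in s..t, psgn (Y r ω)) := by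
    have h := tim_add (tim_add (tim_const (μ := μ) (Y s)) (tim_cmul (-1) (D.sol s hs0))) ((D.sol t ht.le).comp (tendsto_add_atTop_nat k))
    refine h.congr (fun n => ae_of_all _ fun ω => ?_) ?_
    · have := hAB n ω
      simp only [C, Function.comp]; linarith
    · filter_upwards [D.eq] with ω hω
      have e1 := hω s hs0
      have e2 := hω t ht.le
      have e3 := intervalIntegral.integral_add_adjacent_intervals (D.psint ω 0 s) (D.psint ω s t)
      rw [← e3] at e2
      linarith
  have mC : ∀ n, Measurable[G s] (C n) := fun n => by
    refine ((D.mY s hs0).sub (D.mrsum hs0 n)).add (Finset.measurable_fun_sum _ fun i hi => D.mterm ht.le (n + k) i ?_)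
    exact (grid_le ht.le (Finset.mem_range.1 hi)).trans_eq (gs n)
  have cB : ∀ n, CL (G s) μ (B n) (gam v) := fun n => by
    have hm : Monotone (fun i : ℕ => t * i / 2 ^ (n + k)) := fun a b hab => grid_le ht.le hab
    have h1 := (D.hB t).inc (τ := fun i : ℕ => t * i / 2 ^ (n + k)) (N := 2 ^ (n + k)) hm (grid_nn ht.le _ _) (grid_top t _).le
    have h2 := h1.sign (a := fun i ω => psgn (Y (t * i / 2 ^ (n + k)) ω)) (fun i _ => psgn_meas.comp (D.mY _ (grid_nn ht.le _ _)))
      (fun i _ ω => by rcases psgn_pm (Y (t * i / 2 ^ (n + k)) ω) with e | e <;> rw [e] <;> norm_num)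
    have h3 := (h2.sumLaw (i0 n) (2 ^ n) (hi0 n).le)
    have h4 := h3.comp' ((D.hB 1).le _) measurable_fst
    rw [gam2_fst] at h4
    have e3 : ∑ i ∈ Finset.range (2 ^ n), ((fun i : ℕ => t * i / 2 ^ (n + k)) (i0 n + i + 1) - (fun i : ℕ => t * i / 2 ^ (n + k)) (i0 n + i)) = v := by
      have := Finset.sum_range_sub (fun i : ℕ => t * (i0 n + i : ℕ) / 2 ^ (n + k)) (2 ^ n)
      rw [add_zero, hi0, grid_top, gs] at this
      refine Eq.trans ?_ (this.trans (by rw [hs]; ring))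
      rfl
    rw [e3] at h4
    beta_reduce at h4
    rw [gs] at h4
    refine Eq.mp ?_ h4
    congr 1
    funext ω
    simp only [B, tm]
    push_cast
    rfl
  have hr : 0 < (lam + 1) * v := mul_pos (by linarith [D.hl]) hv
  refine (measure_mono fun ω hω => ?_).trans (small_ball ((D.hB 1).le s) hv hr cB mC hlim)
  have hω : Y t ω = 0 := hω
  show |Y t ω + lam * ∫ r in s..t, psgn (Y r ω)| ≤ _
  have h1 : ‖∫ r in s..t, psgn (Y r ω)‖ ≤ 1 * |t - s| := intervalIntegral.norm_integral_le_of_norm_le_const fun r _ => by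
    rcases psgn_pm (Y r ω) with e | e <;> simp [e]
  rw [hω, zero_add, abs_mul, abs_of_nonneg D.hl]
  have h2 : |t - s| = v := by rw [hs, sub_sub_cancel, abs_of_pos hv]
  rw [h2, one_mul, Real.norm_eq_abs] at h1
  nlinarith [D.hl]

lemma tan (D : Drf μ G Y W V I y lam) : IsProbabilityMeasure (gir μ W lam) ∧ Tan (gir μ W lam) G Y (fun t ω => W t ω - lam * t) V y := by
  have hp := gir_prob (D.hB 1) lam
  have hac := gir_ac μ W lam
  refine ⟨hp, ⟨gir_pbm (D.hB 1) lam, D.mY, D.cY, fun t ht => hac (D.zero ht), hac.ae_le D.y0, fun t h0 h1 => ?_⟩⟩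
  have mW : ∀ r, 0 ≤ r → Measurable (W r) := fun r hr => ((D.hB r).m1 r hr le_rfl).mono ((D.hB 1).le r) le_rfl
  refine tim_ac hac (fun n => ?_) ?_
  · unfold rsum
    refine Finset.measurable_fun_sum _ fun i hi => ?_
    exact (psgn_meas.comp (D.mYm (grid_nn h0 n i))).mul (((mW _ (by positivity)).sub_const _).sub ((mW _ (by positivity)).sub_const _))
  rcases h0.eq_or_lt with rfl | h0
  · refine (tim_const (μ := μ) (fun _ => (0:ℝ))).congr (fun n => ae_of_all _ fun ω => by simp [rsum]) ?_
    filter_upwards [D.y0] with ω h; simp [h]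
  · have hr : TendstoInMeasure μ (fun (n : ℕ) ω => ∑ i ∈ Finset.range (2 ^ n), (t / 2 ^ n) * psgn (Y (t * i / 2 ^ n) ω)) atTop (fun ω => ∫ s in (0:ℝ)..t, psgn (Y s ω)) :=
      tendstoInMeasure_of_tendsto_ae (fun n => (Finset.measurable_fun_sum _ fun i _ => (psgn_meas.comp (D.mYm (grid_nn h0.le n i))).const_mul _).aestronglyMeasurable)
        (riem D.cY (fun _ => D.mYm) (fun _ => D.zero) h0)
    refine (tim_add (D.sol t h0.le) (tim_cmul (-lam) hr)).congr (fun n => ae_of_all _ fun ω => ?_) ?_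
    · simp only [rsum]
      rw [Finset.mul_sum, ← Finset.sum_add_distrib]
      refine Finset.sum_congr rfl fun i _ => ?_
      ring
    · filter_upwards [D.eq] with ω hω
      have := hω t h0.le
      linarith
end Drf
end

section

lemma em_lim {μ : Measure Ω} (H : Unit → MeasurableSpace Ω) {f : ℕ → Ω → ℝ} {g : Ω → ℝ}
    (hf : ∀ n, Measurable[eventuallyMeasurableSpace (H ()) (ae μ)] (f n))
    (hl : ∀ᵐ ω ∂μ, Tendsto (fun n => f n ω) atTop (𝓝 (g ω))) :
    Measurable[eventuallyMeasurableSpace (H ()) (ae μ)] g := by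
  have h1 : EventuallyMeasurable (H ()) (ae μ) (fun ω => limsup (fun n => f n ω) atTop) := Measurable.limsup hf
  refine h1.congr ?_
  filter_upwards [hl] with ω h using h.limsup_eq.symm

lemma nat_sub {μ : Measure Ω} {U1 U2 W V : ℝ → Ω → ℝ} {a b : ℝ} (l : ℝ) (hab : a ^ 2 + b ^ 2 = 1)
    (hW : ∀ t ω, W t ω = (a * U1 t ω + b * U2 t ω) - l * t) (hV : ∀ t ω, V t ω = -b * U1 t ω + a * U2 t ω)
    (i1 : ∀ᵐ ω ∂μ, U1 0 ω = 0) (i2 : ∀ᵐ ω ∂μ, U2 0 ω = 0)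
    (c1 : ∀ᵐ ω ∂μ, Continuous fun t => U1 t ω) (c2 : ∀ᵐ ω ∂μ, Continuous fun t => U2 t ω) :
    natSA (fun s ω => (U1 s ω, U2 s ω)) 1 ≤ eventuallyMeasurableSpace
      (⨆ k, Tan.sD W V k) (ae μ) := by
  obtain ⟨H, hH⟩ : ∃ H : Unit → MeasurableSpace Ω, H () = ⨆ k, Tan.sD W
    V k := ⟨fun _ => _, rfl⟩
  rw [← hH]
  refine iSup₂_le fun s hs => Measurable.comap_le ?_
  let q : ℕ → ℕ := fun n => ⌊s * 2 ^ n⌋₊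
  have hq : ∀ n, q n ≤ 2 ^ n := fun n => by
    refine Nat.floor_le_of_le ?_
    push_cast
    exact mul_le_of_le_one_left (by positivity) hs.2
  have hlim : Tendsto (fun n => pt n (q n)) atTop (𝓝 s) := by
    have := (tendsto_nat_floor_mul_div_atTop hs.1).comp (tendsto_pow_atTop_atTop_of_one_lt (one_lt_two (α := ℝ)))
    exact this
  let D : ∀ n, Ω → ℝ × ℝ := fun n ω => Tan.DD W V n ω ⟨q n, Nat.lt_succ_of_le (hq n)⟩
  have mD : ∀ n, Measurable[eventuallyMeasurableSpace (H ()) (ae μ)] (D n) := fun n => by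
    have h0 : MeasurableSpace.comap (D n) inferInstance ≤ Tan.sD W V n := by
      unfold Tan.sD
      rintro _ ⟨B, hB, rfl⟩
      exact ⟨(fun z : Fin (2 ^ n + 1) → ℝ × ℝ => z ⟨q n, Nat.lt_succ_of_le (hq n)⟩) ⁻¹' B, measurable_pi_apply _ hB, rfl⟩
    refine (comap_measurable (D n)).mono (h0.trans (le_trans ?_ le_eventuallyMeasurableSpace)) le_rfl
    rw [hH]
    exact le_iSup (fun k => Tan.sD W V k) n
  have e : ∀ n ω, D n ω = ((a * U1 (pt n (q n)) ω + b * U2 (pt n (q n)) ω) - l * pt n (q n) - ((a * U1 0 ω + b * U2 0 ω) - l * 0),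
    (-b * U1 (pt n (q n)) ω + a * U2 (pt n (q n)) ω) - (-b * U1 0 ω + a * U2 0 ω)) := fun n ω => by
    simp only [← hW, ← hV]; rfl
  have m1 : Measurable[eventuallyMeasurableSpace (H ()) (ae μ)] (U1 s) := by
    refine em_lim H (f := fun n ω => a * ((D n ω).1 + l * pt n (q n)) - b * (D n ω).2) (fun n => ?_) ?_
    · exact (((measurable_fst.comp (mD n)).add_const _).const_mul _).sub ((measurable_snd.comp (mD n)).const_mul _)
    · filter_upwards [i1, i2, c1] with ω h1 h2 hc
      refine ((hc.tendsto s).comp hlim).congr fun n => ?_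
      simp only [e, h1, h2, Function.comp]
      linear_combination (-U1 (pt n (q n)) ω) * hab
  have m2 : Measurable[eventuallyMeasurableSpace (H ()) (ae μ)] (U2 s) := by
    refine em_lim H (f := fun n ω => b * ((D n ω).1 + l * pt n (q n)) + a * (D n ω).2) (fun n => ?_) ?_
    · exact (((measurable_fst.comp (mD n)).add_const _).const_mul _).add ((measurable_snd.comp (mD n)).const_mul _)
    · filter_upwards [i1, i2, c2] with ω h1 h2 hc
      refine ((hc.tendsto s).comp hlim).congr fun n => ?_
      simp only [e, h1, h2, Function.comp]
      linear_combination (-U2 (pt n (q n)) ω) * hab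
  exact m1.prodMk m2

lemma bm_cl {μ : Measure Ω} [IsProbabilityMeasure μ] {F : ℝ → MeasurableSpace Ω} {U : ℝ → Ω → ℝ} (h : IsBM μ F U)
    (s t : ℝ) (hs : 0 ≤ s) (hst : s ≤ t) : CL (natSA U s) μ (fun ω => U t ω - U s ω) (gam (t - s)) := by
  have mU : ∀ r, 0 ≤ r → Measurable (U r) := fun r hr => (comap_measurable (U r)).mono ((h.adapted r hr).trans (h.le r)) le_rfl
  have mZ : Measurable (fun ω => U t ω - U s ω) := (mU t (hs.trans hst)).sub (mU s hs)
  refine ⟨mZ, fun A hA B hB => ?_⟩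
  have hA' : MeasurableSet[F s] A :=
    (iSup₂_le fun r hr => (h.adapted r hr.1).trans (h.mono hr.2) : natSA U s ≤ F s) A hA
  have h1 := (Indep_iff _ _ _).1 (h.indep s t hs hst) _ A ⟨B, hB, rfl⟩ hA'
  rw [inter_comm, h1, mul_comm, gam, ← h.law s t hs hst, Measure.map_apply mZ hB]

lemma pbm_rot {μ : Measure Ω} [IsProbabilityMeasure μ] {G : ℝ → MeasurableSpace Ω} {U1 U2 : ℝ → Ω → ℝ} {a b T : ℝ} (h : PBM μ G U1 U2 T) (hab : a ^ 2 + b ^ 2 = 1) :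
    PBM μ G (fun t ω => a * U1 t ω + b * U2 t ω) (fun t ω => -b * U1 t ω + a * U2 t ω) T := by
  refine ⟨h.le, h.mono, fun t h0 h1 => ((h.m1 t h0 h1).const_mul _).add ((h.m2 t h0 h1).const_mul _),
    fun t h0 h1 => ((h.m1 t h0 h1).const_mul _).add ((h.m2 t h0 h1).const_mul _), fun s t hs hst ht => ?_⟩
  have h1 := (h.cl s t hs hst ht).comp' (h.le s) (f := fun p : ℝ × ℝ => (a * p.1 + b * p.2, -b * p.1 + a * p.2)) (by fun_prop)
  rw [gam2_orth (sub_nonneg.2 hst) hab (by linarith) (by ring)] at h1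
  convert h1 using 3
  · ring
  · ring
end

section

lemma rsum_mix (X₁ X₂ Y U₁ U₂ : ℝ → Ω → ℝ) {p q p' q' r s r' s' a b : ℝ} (t : ℝ) (n : ℕ) (ω : Ω)
    (hY : ∀ s, Y s ω = X₁ s ω - X₂ s ω) (ha : p - p' = a) (hb : r - r' = b) (ha' : q - q' = -a) (hb' : s - s' = -b) :
    (rsum (fun s ω => if X₁ s ω ≤ X₂ s ω then q else p) U₁ t n ω + rsum (fun τ ω => if X₁ τ ω ≤ X₂ τ ω then s else r) U₂ t n ω)
      + (-1) * (rsum (fun s ω => if X₁ s ω ≤ X₂ s ω then q' else p') U₁ t n ω + rsum (fun τ ω => if X₁ τ ω ≤ X₂ τ ω then s' else r') U₂ t n ω)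
      = rsum (fun s ω => psgn (Y s ω)) (fun t ω => a * U₁ t ω + b * U₂ t ω) t n ω := by
  unfold rsum
  rw [← Finset.sum_add_distrib, ← Finset.sum_add_distrib, Finset.mul_sum, ← Finset.sum_add_distrib]
  refine Finset.sum_congr rfl fun i _ => ?_
  simp only [hY, if_psgn]
  rw [show q = q' - a by linarith, show s = s' - b by linarith, show p = p' + a by linarith, show r = r' + b by linarith]
  ring

lemma partA {μ : Measure Ω} [IsProbabilityMeasure μ] {F : ℝ → MeasurableSpace Ω} {U₁ U₂ X₁ X₂ : ℝ → Ω → ℝ}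
    {g h ρ σ : ℝ} (hnorm : ρ ^ 2 + σ ^ 2 = 1) (hgh : 0 < g + h) {x₁ x₂ : ℝ}
    {Sp Sm : Matrix (Fin 2) (Fin 2) ℝ}
    (hSp : Sp * Sp.transpose = Matrix.diagonal ![ρ ^ 2, σ ^ 2])
    (hj : ∀ j : Fin 2, Sm 0 j - Sm 1 j = -(Sp 0 j - Sp 1 j))
    (hU : IsPlanarBM μ F U₁ U₂) (hX : SolvesGen μ F g h Sp Sm x₁ x₂ U₁ U₂ X₁ X₂)
    (hstr : ∀ t : ℝ, 0 ≤ t → natFilt μ (fun s ω => (X₁ s ω, X₂ s ω)) t ≤ natFilt μ (fun s ω => (U₁ s ω, U₂ s ω)) t) : False := by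
  obtain ⟨b1, b2, hind⟩ := hU
  obtain ⟨had, hc, I₁, I₂, hI₁, hI₂, heq⟩ := hX
  obtain ⟨e1, e2, e3⟩ := sq_entries hSp
  set a := Sp 0 0 - Sp 1 0 with ha
  set b := Sp 0 1 - Sp 1 1 with hb
  have hab : a ^ 2 + b ^ 2 = 1 := by rw [ha, hb]; linear_combination e1 + e2 - 2 * e3 + hnorm
  have mU : ∀ {U : ℝ → Ω → ℝ}, IsBM μ F U → ∀ r, 0 ≤ r → Measurable (U r) := fun h r hr =>
    (comap_measurable _).mono ((h.adapted r hr).trans (h.le r)) le_rfl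
  have hB : ∀ T, PBM μ (GG μ U₁ U₂) (fun t ω => a * U₁ t ω + b * U₂ t ω) (fun t ω => -b * U₁ t ω + a * U₂ t ω) T := fun T =>
    pbm_rot (pbm_of_indep (mU b1) (mU b2) hind (bm_cl b1) (bm_cl b2) T) hab
  have mX : ∀ t, 0 ≤ t → Measurable[GG μ U₁ U₂ t] (fun ω => X₁ t ω - X₂ t ω) := fun t ht => by
    have h1 : MeasurableSpace.comap (fun ω => (X₁ t ω, X₂ t ω)) inferInstance ≤ GG μ U₁ U₂ t := by
      refine le_inf (le_trans ?_ (hstr t ht)) ((had t ht).trans (b1.le t))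
      exact le_trans (natSA_meas (fun s ω => (X₁ s ω, X₂ s ω)) ht le_rfl).comap_le le_sup_left
    exact (measurable_fst.sub measurable_snd).comp ((comap_measurable (fun ω => (X₁ t ω, X₂ t ω))).mono h1 le_rfl)
  set N := toMeasurable μ {ω | ¬ (Continuous (fun t => X₁ t ω) ∧ Continuous (fun t => X₂ t ω))} with hN
  have mN : MeasurableSet N := measurableSet_toMeasurable _ _
  have N0 : μ N = 0 := by rw [hN, measure_toMeasurable]; exact hc
  classical
  let Y : ℝ → Ω → ℝ := fun t ω => if ω ∈ N then 0 else X₁ t ω - X₂ t ω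
  have hY : ∀ᵐ ω ∂μ, ∀ t, Y t ω = X₁ t ω - X₂ t ω := by
    filter_upwards [measure_eq_zero_iff_ae_notMem.1 N0] with ω hω t
    exact if_neg hω
  have cY : ∀ ω, Continuous fun t => Y t ω := fun ω => by
    by_cases hω : ω ∈ N
    · simp only [Y, if_pos hω]; exact continuous_const
    · simp only [Y, if_neg hω]
      have : Continuous (fun t => X₁ t ω) ∧ Continuous (fun t => X₂ t ω) := by
        by_contra hcon
        exact hω (subset_toMeasurable _ _ hcon)
      exact this.1.sub this.2
  have mY : ∀ t, 0 ≤ t → Measurable[GG μ U₁ U₂ t] (Y t) := fun t ht =>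
    GG_congr (mX t ht) (Measurable.ite mN measurable_const ((mX t ht).mono (GG_le _ _ _ _) le_rfl))
      (by filter_upwards [hY] with ω h using (h t).symm)
  have D : Drf μ (GG μ U₁ U₂) Y (fun t ω => a * U₁ t ω + b * U₂ t ω) (fun t ω => -b * U₁ t ω + a * U₂ t ω)
      (fun t ω => I₁ t ω + (-1) * I₂ t ω) (x₁ - x₂) (g + h) := by
    refine ⟨hgh.le, hB, mY, cY, ?_, fun t ht => ?_, ?_⟩
    · filter_upwards [hY, heq, hI₁.1, hI₂.1] with ω h1 h2 h3 h4
      obtain ⟨p, q⟩ := h2 0 le_rfl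
      rw [h1, p, q, h3, h4, intervalIntegral.integral_same, intervalIntegral.integral_same]; ring
    · refine (tim_add (hI₁.2 t ht) (tim_cmul (-1) (hI₂.2 t ht))).congr (fun n => ?_) (EventuallyEq.refl _ _)
      filter_upwards [hY] with ω h1
      exact rsum_mix X₁ X₂ Y U₁ U₂ t n ω h1 ha.symm hb.symm (hj 0) (hj 1)
    · filter_upwards [hY, heq] with ω h1 h2 t ht
      obtain ⟨p, q⟩ := h2 t ht
      have ii : IntervalIntegrable (fun s => psgn (Y s ω)) volume 0 t := by
        refine (intervalIntegrable_const (c := (1:ℝ))).mono_fun (psgn_meas.comp (cY ω).measurable).aestronglyMeasurable (ae_of_all _ fun s => ?_)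
        rcases psgn_pm (Y s ω) with e | e <;> simp [e]
      have k1 : ∀ u v : ℝ, (∫ s in (0:ℝ)..t, (if X₁ s ω ≤ X₂ s ω then v else u)) = (u + v) / 2 * t + (u - v) / 2 * ∫ s in (0:ℝ)..t, psgn (Y s ω) := fun u v => by
        simp only [if_psgn, ← h1]
        rw [intervalIntegral.integral_add intervalIntegrable_const (ii.const_mul _), intervalIntegral.integral_const, intervalIntegral.integral_const_mul]
        simp only [smul_eq_mul]; ring
      rw [h1 t, p, q, k1, k1]; ring
  obtain ⟨_, T⟩ := D.tan
  have mA : MeasurableSet[augSA μ (natSA (fun s ω => (U₁ s ω, U₂ s ω)) 1)] {ω | psgn (x₁ - x₂) * Y 1 ω < 0} := by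
    have h1 : Measurable[GG μ U₁ U₂ 1] (fun ω => psgn (x₁ - x₂) * Y 1 ω) := (mY 1 zero_le_one).const_mul _
    exact (inf_le_left : GG μ U₁ U₂ 1 ≤ _) _ (h1 measurableSet_Iio)
  obtain ⟨A', hA', hAA'⟩ := augSA_ae (𝒢 := fun _ => natSA (fun s ω => (U₁ s ω, U₂ s ω)) 1) mA
  obtain ⟨S, hS, hAS⟩ := nat_sub (g + h) hab (fun _ _ => rfl) (fun _ _ => rfl) (IsBM.init b1) (IsBM.init b2) b1.cont b2.cont A' hA'
  exact T.contra hS ((gir_ac μ _ (g + h)).ae_le (hAA'.trans hAS))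
end

/-- Theorem 5 of the paper. Let `Σ(x) = Σ₊ 1{x₁ > x₂} + Σ₋ 1{x₁ ≤ x₂}`
be any real square root of the covariance matrix `𝒜(x₁,x₂)`, i.e.
`Σ₊ Σ₊ᵀ = diag(ρ², σ²)` and `Σ₋ Σ₋ᵀ = diag(σ², ρ²)`.  Then the (unique in
distribution) weak solution of `dX = Σ(X) dU + G(X) dt` fails to be strong — i.e. on
every filtered probability space carrying a planar Brownian motion `U` there is no
solution adapted to the augmented filtration of `U` — if and only if
`(e₁ − e₂)ᵀ Σ₋ = −(e₁ − e₂)ᵀ Σ₊`. -/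
theorem general_square_root_strong_iff
    (g h ρ σ : ℝ) (hg : 0 ≤ g) (hh : 0 ≤ h) (hρ : 0 ≤ ρ) (hσ : 0 ≤ σ)
    (hnorm : ρ ^ 2 + σ ^ 2 = 1) (hgh : 0 < g + h) (x₁ x₂ : ℝ)
    (Sp Sm : Matrix (Fin 2) (Fin 2) ℝ)
    (hSp : Sp * Sp.transpose = Matrix.diagonal ![ρ ^ 2, σ ^ 2])
    (hSm : Sm * Sm.transpose = Matrix.diagonal ![σ ^ 2, ρ ^ 2]) :
    (∀ (Ω : Type) [mΩ : MeasurableSpace Ω] (μ : Measure Ω) [IsProbabilityMeasure μ]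
        (F : ℝ → MeasurableSpace Ω) (U₁ U₂ : ℝ → Ω → ℝ),
      IsPlanarBM μ F U₁ U₂ →
        ¬ ∃ X₁ X₂ : ℝ → Ω → ℝ, SolvesGen μ F g h Sp Sm x₁ x₂ U₁ U₂ X₁ X₂ ∧
            ∀ t : ℝ, 0 ≤ t →
              natFilt μ (fun s ω => (X₁ s ω, X₂ s ω)) t ≤
                natFilt μ (fun s ω => (U₁ s ω, U₂ s ω)) t) ↔
      (∀ j : Fin 2, Sm 0 j - Sm 1 j = -(Sp 0 j - Sp 1 j)) := by
  constructor
  · intro H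
    by_contra hne
    obtain ⟨Ω, mΩ, μ, hμ, F, U₁, U₂, hU, hex⟩ := partB g h ρ σ hnorm hgh x₁ x₂ Sp Sm hSp hSm hne
    exact H Ω μ F U₁ U₂ hU hex
  · rintro hj Ω mΩ μ hμ F U₁ U₂ hU ⟨X₁, X₂, hX, hstr⟩
    exact partA hnorm hgh hSp hj hU hX hstr

end SDEPaper
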